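/- There exist positive constants c₇ and c₈ and a real number X₀ such that for all X ≥ X₀, the number of primes p ≤ X for which there exist primes q and r with p < q < r and A(pqr) > 2p/3 − c₈·√p is at least c₇ · X / (log X)², where log denotes the natural logarithm. -/

import Mathlib

/-- The height `A(n)` of the `n`-th cyclotomic polynomial. -/
noncomputable def cycHeight (n : ℕ) : ℕ :=
  (Finset.range ((Polynomial.cyclotomic n ℤ).natDegree + 1)).sup
    fun k => ((Polynomial.cyclotomic n ℤ).coeff k).natAbs

section

open Polynomial

/-- Explicit form of the binary cyclotomic polynomial `Φ_{pq}`. -/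
theorem cyclotomic_mul_primes_eq {p q ρ σ : ℕ} (hp : p.Prime) (hq : q.Prime) (hpq : p ≠ q)
    (hρ : ρ ≤ q) (hσ : σ ≤ p) (h : ρ * p + σ * q = p * q + 1) :
    cyclotomic (p * q) ℤ =
      (∑ x ∈ Finset.range ρ, ∑ y ∈ Finset.range σ, (X : ℤ[X]) ^ (x * p + y * q)) -
      ∑ x ∈ Finset.Ico ρ q, ∑ y ∈ Finset.Ico σ p, (X : ℤ[X]) ^ (x * p + y * q - p * q) := by
  have := Fact.mk hp
  have := Fact.mk hq
  have hX (n : ℕ) (hn : 0 < n) : (X ^ n - 1 : ℤ[X]) ≠ 0 := X_pow_sub_C_ne_zero hn 1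
  have e1 : cyclotomic (p * q) ℤ * (X ^ p - 1) * (X ^ q - 1) = (X ^ (p * q) - 1) * (X - 1) := by
    have h1 := cyclotomic_expand_eq_cyclotomic_mul (p := q) (n := p) hq
      (fun hd => hpq ((Nat.prime_dvd_prime_iff_eq hq hp).1 hd).symm) ℤ
    have h2 := cyclotomic_prime_mul_X_sub_one ℤ p
    have h3 := congrArg (expand ℤ q) h2
    simp only [map_mul, map_sub, map_pow, expand_X, map_one] at h3
    rw [h1, ← pow_mul, mul_comm q p] at h3
    rw [← h3, ← h2]
    ring
  have g1 : (∑ x ∈ Finset.range ρ, ∑ y ∈ Finset.range σ, (X : ℤ[X]) ^ (x * p + y * q)) *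
      (X ^ p - 1) * (X ^ q - 1) = (X ^ (ρ * p) - 1) * (X ^ (σ * q) - 1) := by
    have a1 := geom_sum_mul (X ^ p : ℤ[X]) ρ
    have a2 := geom_sum_mul (X ^ q : ℤ[X]) σ
    rw [← pow_mul, mul_comm p] at a1
    rw [← pow_mul, mul_comm q] at a2
    rw [← a1, ← a2]
    have : (∑ x ∈ Finset.range ρ, ∑ y ∈ Finset.range σ, (X : ℤ[X]) ^ (x * p + y * q)) =
      (∑ x ∈ Finset.range ρ, (X ^ p : ℤ[X]) ^ x) * ∑ y ∈ Finset.range σ, (X ^ q : ℤ[X]) ^ y := by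
      rw [Finset.sum_mul_sum]
      refine Finset.sum_congr rfl fun x _ => Finset.sum_congr rfl fun y _ => ?_
      rw [pow_add, ← pow_mul, ← pow_mul, mul_comm p, mul_comm q]
    rw [this]; ring
  have g2 : X ^ (p * q) * (∑ x ∈ Finset.Ico ρ q, ∑ y ∈ Finset.Ico σ p,
      (X : ℤ[X]) ^ (x * p + y * q - p * q)) * (X ^ p - 1) * (X ^ q - 1) =
      (X ^ (p * q) - X ^ (ρ * p)) * (X ^ (p * q) - X ^ (σ * q)) := by
    have a1 := geom_sum_Ico_mul (X ^ p : ℤ[X]) hρ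
    have a2 := geom_sum_Ico_mul (X ^ q : ℤ[X]) hσ
    rw [← pow_mul, ← pow_mul, mul_comm p ρ] at a1
    rw [← pow_mul, ← pow_mul, mul_comm q p, mul_comm q σ] at a2
    rw [← a1, ← a2]
    have : X ^ (p * q) * (∑ x ∈ Finset.Ico ρ q, ∑ y ∈ Finset.Ico σ p,
        (X : ℤ[X]) ^ (x * p + y * q - p * q)) =
      (∑ x ∈ Finset.Ico ρ q, (X ^ p : ℤ[X]) ^ x) * ∑ y ∈ Finset.Ico σ p, (X ^ q : ℤ[X]) ^ y := by
      rw [Finset.sum_mul_sum, Finset.mul_sum]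
      refine Finset.sum_congr rfl fun x hx => ?_
      rw [Finset.mul_sum]
      refine Finset.sum_congr rfl fun y hy => ?_
      rw [← pow_add, ← pow_mul, ← pow_mul, ← pow_add]
      congr 1
      have b1 := (Finset.mem_Ico.1 hx).1
      have b2 := (Finset.mem_Ico.1 hy).1
      have : p * q ≤ x * p + y * q := by nlinarith
      rw [Nat.add_sub_cancel' this]; ring
    rw [this]; ring
  have hne : (X ^ (p * q) * (X ^ p - 1) * (X ^ q - 1) : ℤ[X]) ≠ 0 :=
    mul_ne_zero (mul_ne_zero (pow_ne_zero _ X_ne_zero) (hX _ hp.pos)) (hX _ hq.pos)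
  apply mul_right_cancel₀ hne
  have h' : (X : ℤ[X]) ^ (ρ * p) * X ^ (σ * q) = X ^ (p * q) * X := by
    rw [← pow_add, h, pow_succ]
  linear_combination X ^ (p * q) * e1 - X ^ (p * q) * g1 + g2 - (X ^ (p * q) - 1) * h'

/-- The indicator of a residue class, as a power series. -/
noncomputable def classSeries (N a : ℕ) : PowerSeries ℤ :=
  PowerSeries.mk fun n => if n % N = a then 1 else 0

theorem classSeries_mul {N a : ℕ} (ha : a < N) :
    classSeries N a * (1 - PowerSeries.X ^ N) = PowerSeries.X ^ a := by
  ext n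
  rw [mul_sub, mul_one, map_sub, PowerSeries.coeff_mul_X_pow', PowerSeries.coeff_X_pow,
    classSeries, PowerSeries.coeff_mk]
  by_cases hn : N ≤ n
  · rw [if_pos hn, PowerSeries.coeff_mk, ← Nat.mod_eq_sub_mod hn, sub_self, if_neg (by omega)]
  · rw [if_neg hn, Nat.mod_eq_of_lt (by omega)]
    simp

theorem cyclotomic_mul_three_primes_eq {p q r : ℕ} (hp : p.Prime) (hq : q.Prime) (hr : r.Prime)
    (hpq : p < q) (hqr : q < r) :
    ((cyclotomic (p * q * r) ℤ : ℤ[X]) : PowerSeries ℤ) =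
      ((expand ℤ r (cyclotomic (p * q) ℤ) : ℤ[X]) : PowerSeries ℤ) *
        ∑ m ∈ Finset.range p, (classSeries (p * q) m - classSeries (p * q) (m + q)) := by
  have := Fact.mk hp
  have := Fact.mk hq
  have hX (n : ℕ) (hn : 0 < n) : (X ^ n - 1 : ℤ[X]) ≠ 0 := X_pow_sub_C_ne_zero hn 1
  have e1 : cyclotomic (p * q) ℤ * (X ^ p - 1) * (X ^ q - 1) = (X ^ (p * q) - 1) * (X - 1) := by
    have h1 := cyclotomic_expand_eq_cyclotomic_mul (p := q) (n := p) hq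
      (fun hd => hpq.ne ((Nat.prime_dvd_prime_iff_eq hq hp).1 hd).symm) ℤ
    have h2 := cyclotomic_prime_mul_X_sub_one ℤ p
    have h3 := congrArg (expand ℤ q) h2
    simp only [map_mul, map_sub, map_pow, expand_X, map_one] at h3
    rw [h1, ← pow_mul, mul_comm q p] at h3
    rw [← h3, ← h2]
    ring
  have hnd : ¬ r ∣ p * q := by
    rw [hr.dvd_mul]
    rintro (h | h)
    · exact absurd (Nat.le_of_dvd hp.pos h) (by omega)
    · exact absurd (Nat.le_of_dvd hq.pos h) (by omega)
  have e2 := cyclotomic_expand_eq_cyclotomic_mul hr hnd ℤ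
  have hp2 := hp.two_le
  have e3 : cyclotomic (p * q * r) ℤ * (1 - X ^ (p * q)) =
      expand ℤ r (cyclotomic (p * q) ℤ) * ∑ m ∈ Finset.range p, (X ^ m - X ^ (m + q)) := by
    have hg : (∑ m ∈ Finset.range p, (X ^ m - X ^ (m + q)) : ℤ[X]) * (X - 1) =
        (X ^ p - 1) * (1 - X ^ q) := by
      have : (∑ m ∈ Finset.range p, (X ^ m - X ^ (m + q)) : ℤ[X]) =
          (∑ m ∈ Finset.range p, X ^ m) * (1 - X ^ q) := by
        rw [Finset.sum_mul]
        exact Finset.sum_congr rfl fun m _ => by ring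
      rw [this, ← geom_sum_mul]
      ring
    have hX1 : (X - 1 : ℤ[X]) ≠ 0 := X_sub_C_ne_zero 1
    apply mul_right_cancel₀ hX1
    rw [mul_assoc (expand _ _ _), hg, e2]
    linear_combination cyclotomic (p * q * r) ℤ * e1
  have e4 := congrArg (fun f : ℤ[X] => (f : PowerSeries ℤ)) e3
  simp only [Polynomial.coe_mul, Polynomial.coe_sub, Polynomial.coe_one, Polynomial.coe_pow,
    Polynomial.coe_X] at e4
  have hne : (1 - PowerSeries.X ^ (p * q) : PowerSeries ℤ) ≠ 0 := by
    intro h0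
    have := congrArg (PowerSeries.coeff (R := ℤ) 0) h0
    simp [hp.ne_zero, hq.ne_zero] at this
  apply mul_right_cancel₀ hne
  rw [e4, mul_assoc, Finset.sum_mul]
  congr 1
  have : ((∑ m ∈ Finset.range p, (X ^ m - X ^ (m + q)) : ℤ[X]) : PowerSeries ℤ) =
      ∑ m ∈ Finset.range p, (PowerSeries.X ^ m - PowerSeries.X ^ (m + q)) := by
    rw [← Polynomial.coeToPowerSeries.ringHom_apply, map_sum]
    simp
  rw [this]
  refine Finset.sum_congr rfl fun m hm => ?_
  have hm := Finset.mem_range.1 hm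
  rw [sub_mul, classSeries_mul, classSeries_mul]
  · nlinarith
  · nlinarith

theorem coeff_X_pow_mul_classSeries (N a e k : ℕ) :
    PowerSeries.coeff k ((PowerSeries.X : PowerSeries ℤ) ^ e * classSeries N a) =
      if e ≤ k ∧ (k - e) % N = a then 1 else 0 := by
  rw [PowerSeries.coeff_X_pow_mul', classSeries, PowerSeries.coeff_mk]
  split_ifs <;> simp_all

/-- Coefficient of `Φ_{pq}`, cut off at exponent `T`, at the residue class of `x * p + y * q`. -/
def cutCoeff (p q σ T x y : ℕ) : ℤ :=
  if x * p + σ * q ≤ p * q ∧ y < σ ∧ x * p + y * q ≤ T then 1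
  else if p * q < x * p + σ * q ∧ σ ≤ y ∧ x * p + y * q ≤ T + p * q then -1 else 0

theorem crt_unique {p q x y x' y' : ℕ} (hpq : p.Coprime q) (hx : x < q) (hx' : x' < q)
    (hy : y < p) (hy' : y' < p) (h : x * p + y * q ≡ x' * p + y' * q [MOD p * q]) :
    x = x' ∧ y = y' := by
  constructor
  · have h1 := h.of_mul_left p
    have h2 : x * p ≡ x' * p [MOD q] := by
      simpa [Nat.ModEq, Nat.add_mul_mod_self_right] using h1
    exact (Nat.ModEq.cancel_right_of_coprime hpq.symm h2).eq_of_lt_of_lt hx hx'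
  · have h1 := h.of_mul_right q
    have h2 : y * q ≡ y' * q [MOD p] := by
      simpa [Nat.ModEq, Nat.mul_add_mod_self_right] using h1
    exact (Nat.ModEq.cancel_right_of_coprime hpq h2).eq_of_lt_of_lt hy hy'

theorem sub_mod_eq_iff {N e r k a : ℕ} (ha : a < N) (hle : e * r ≤ k) :
    (k - e * r) % N = a ↔ e * r + a ≡ k [MOD N] := by
  have h1 : k = e * r + (k - e * r) := by omega
  constructor
  · intro h
    conv_rhs => rw [h1]
    exact Nat.ModEq.add_left _ (by rw [Nat.ModEq, Nat.mod_eq_of_lt ha, h])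
  · intro h
    rw [h1] at h
    have := Nat.ModEq.add_left_cancel' _ h
    rw [Nat.ModEq, Nat.mod_eq_of_lt ha] at this
    omega

theorem sum_sum_ite_eq_and (s t : Finset ℕ) (f : ℕ → ℕ → Prop) [∀ x y, Decidable (f x y)]
    (x' y' : ℕ) :
    (∑ x ∈ s, ∑ y ∈ t, if f x y ∧ x = x' ∧ y = y' then (1 : ℤ) else 0) =
      if x' ∈ s ∧ y' ∈ t ∧ f x' y' then 1 else 0 := by
  have : ∀ x y : ℕ, (if f x y ∧ x = x' ∧ y = y' then (1 : ℤ) else 0) =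
      if y = y' then (if x = x' then (if f x' y' then 1 else 0) else 0) else 0 := by
    intro x y
    split_ifs <;> simp_all
  simp only [this, Finset.sum_ite_eq']
  by_cases h1 : y' ∈ t
  · simp only [h1, if_true, Finset.sum_ite_eq']
    split_ifs <;> simp_all
  · simp [h1]

theorem sum_class_eq_cutCoeff {p q r ρ σ T k a x' y' : ℕ} (hpq : p.Coprime q)
    (hr : r.Coprime (p * q)) (hp : 0 < p)
    (hρ : ρ ≤ q) (hσ : σ ≤ p) (h : ρ * p + σ * q = p * q + 1)
    (hT : ∀ e, e * r ≤ k ↔ e ≤ T) (ha : a < p * q) (hx' : x' < q) (hy' : y' < p)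
    (hk : (x' * p + y' * q) * r + a ≡ k [MOD p * q]) :
    (∑ x ∈ Finset.range ρ, ∑ y ∈ Finset.range σ,
        (if (x * p + y * q) * r ≤ k ∧ (k - (x * p + y * q) * r) % (p * q) = a then
            (1 : ℤ) else 0)) -
      ∑ x ∈ Finset.Ico ρ q, ∑ y ∈ Finset.Ico σ p,
        (if (x * p + y * q - p * q) * r ≤ k ∧
          (k - (x * p + y * q - p * q) * r) % (p * q) = a then (1 : ℤ) else 0) =
      cutCoeff p q σ T x' y' := by
  have key {x y e : ℕ} (hx : x < q) (hy : y < p) (he : e ≡ x * p + y * q [MOD p * q]) :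
      (e * r ≤ k ∧ (k - e * r) % (p * q) = a) ↔ (e ≤ T ∧ x = x' ∧ y = y') := by
    rw [← hT]
    refine and_congr_right fun hle => ?_
    rw [sub_mod_eq_iff ha hle]
    constructor
    · intro h1
      have h2 := Nat.ModEq.add_right_cancel' _ (h1.trans hk.symm)
      have h3 := Nat.ModEq.cancel_right_of_coprime (Nat.Coprime.symm hr) h2
      exact crt_unique hpq hx hx' hy hy' (he.symm.trans h3)
    · rintro ⟨rfl, rfl⟩
      exact ((he.mul_right r).add_right a).trans hk
  have s1 : (∑ x ∈ Finset.range ρ, ∑ y ∈ Finset.range σ,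
        (if (x * p + y * q) * r ≤ k ∧ (k - (x * p + y * q) * r) % (p * q) = a then
            (1 : ℤ) else 0)) =
      if x' < ρ ∧ y' < σ ∧ x' * p + y' * q ≤ T then 1 else 0 := by
    rw [Finset.sum_congr rfl fun x hx => Finset.sum_congr rfl fun y hy => by
      rw [if_congr (key (x := x) (y := y) (by have := Finset.mem_range.1 hx; omega)
        (by have := Finset.mem_range.1 hy; omega) rfl) rfl rfl]]
    rw [sum_sum_ite_eq_and _ _ fun x y => x * p + y * q ≤ T]
    simp only [Finset.mem_range]
  have s2 : (∑ x ∈ Finset.Ico ρ q, ∑ y ∈ Finset.Ico σ p,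
        (if (x * p + y * q - p * q) * r ≤ k ∧
          (k - (x * p + y * q - p * q) * r) % (p * q) = a then (1 : ℤ) else 0)) =
      if ρ ≤ x' ∧ σ ≤ y' ∧ x' * p + y' * q ≤ T + p * q then 1 else 0 := by
    rw [Finset.sum_congr rfl fun x hx => Finset.sum_congr rfl fun y hy => by
      have hx := Finset.mem_Ico.1 hx
      have hy := Finset.mem_Ico.1 hy
      have hle : p * q ≤ x * p + y * q := by nlinarith
      rw [if_congr (key (x := x) (y := y) hx.2 hy.2 (by
        conv_rhs => rw [← Nat.sub_add_cancel hle]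
        simp [Nat.ModEq])) rfl rfl]]
    rw [sum_sum_ite_eq_and _ _ fun x y => x * p + y * q - p * q ≤ T]
    simp only [Finset.mem_Ico, hx', hy', and_true, Nat.sub_le_iff_le_add]
  rw [s1, s2, cutCoeff]
  have c1 : x' < ρ ↔ x' * p + σ * q ≤ p * q := by
    rw [← Nat.mul_lt_mul_right hp]
    omega
  have c2 : ρ ≤ x' ↔ p * q < x' * p + σ * q := by
    rw [← not_lt, c1, not_le]
  simp only [c1, c2]
  split_ifs <;> omega

theorem coeff_cyclotomic_three_primes {p q r ρ σ T k : ℕ} (hp : p.Prime) (hq : q.Prime)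
    (hr : r.Prime) (hpq : p < q) (hqr : q < r)
    (hρ : ρ ≤ q) (hσ : σ ≤ p) (h : ρ * p + σ * q = p * q + 1)
    (hT : ∀ e, e * r ≤ k ↔ e ≤ T) (x y y' : ℕ → ℕ)
    (hx : ∀ m < p, x m < q) (hy : ∀ m < p, y m < p)
    (hy' : ∀ m < p, y' m < p)
    (hk : ∀ m < p, (x m * p + y m * q) * r + m ≡ k [MOD p * q])
    (hk' : ∀ m < p, (x m * p + y' m * q) * r + (m + q) ≡ k [MOD p * q]) :
    (cyclotomic (p * q * r) ℤ).coeff k =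
      ∑ m ∈ Finset.range p, (cutCoeff p q σ T (x m) (y m) - cutCoeff p q σ T (x m) (y' m)) := by
  have hcop : p.Coprime q := (Nat.coprime_primes hp hq).2 hpq.ne
  have hrc : r.Coprime (p * q) :=
    Nat.Coprime.mul_right ((Nat.coprime_primes hr hp).2 (by omega))
      ((Nat.coprime_primes hr hq).2 (by omega))
  rw [← Polynomial.coeff_coe, cyclotomic_mul_three_primes_eq hp hq hr hpq hqr,
    cyclotomic_mul_primes_eq hp hq hpq.ne hρ hσ h, Finset.mul_sum, map_sum]
  refine Finset.sum_congr rfl fun m hm => ?_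
  have hm := Finset.mem_range.1 hm
  have hp2 := hp.two_le
  have e (a : ℕ) : PowerSeries.coeff k (((expand ℤ r
      ((∑ x ∈ Finset.range ρ, ∑ y ∈ Finset.range σ, (X : ℤ[X]) ^ (x * p + y * q)) -
      ∑ x ∈ Finset.Ico ρ q, ∑ y ∈ Finset.Ico σ p, (X : ℤ[X]) ^ (x * p + y * q - p * q)) : ℤ[X]) :
      PowerSeries ℤ) * classSeries (p * q) a) =
      (∑ x ∈ Finset.range ρ, ∑ y ∈ Finset.range σ,
        (if (x * p + y * q) * r ≤ k ∧ (k - (x * p + y * q) * r) % (p * q) = a then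
            (1 : ℤ) else 0)) -
      ∑ x ∈ Finset.Ico ρ q, ∑ y ∈ Finset.Ico σ p,
        (if (x * p + y * q - p * q) * r ≤ k ∧
          (k - (x * p + y * q - p * q) * r) % (p * q) = a then (1 : ℤ) else 0) := by
    rw [← Polynomial.coeToPowerSeries.ringHom_apply]
    simp only [map_sub, map_sum, map_pow, expand_X]
    simp only [Polynomial.coeToPowerSeries.ringHom_apply, Polynomial.coe_X, ← pow_mul]
    simp only [sub_mul, Finset.sum_mul, map_sub, map_sum, coeff_X_pow_mul_classSeries]
    simp only [mul_comm r]
  rw [mul_sub, map_sub, e, e,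
    sum_class_eq_cutCoeff hcop hrc hp.pos hρ hσ h hT (by nlinarith) (hx m hm) (hy m hm) (hk m hm),
    sum_class_eq_cutCoeff hcop hrc hp.pos hρ hσ h hT (by nlinarith) (hx m hm) (hy' m hm)
      (hk' m hm)]

theorem exists_coeff_eq_sum_cutCoeff {p q β σ x₀ y₀ T : ℕ} (hp : p.Prime) (hq : q.Prime)
    (hpq : 4 * p ^ 2 < q) (hβ : β < p) (hqβ : q ≡ β [MOD p]) (hσ0 : 0 < σ) (hσ : σ < p)
    (hβσ : β * σ ≡ 1 [MOD p]) :
    ∃ r k : ℕ, r.Prime ∧ q < r ∧ (cyclotomic (p * q * r) ℤ).coeff k =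
      ∑ m ∈ Finset.range p,
        (cutCoeff p q σ T ((x₀ + m * (q / (2 * p))) % q) ((y₀ + p - m) % p) -
          cutCoeff p q σ T ((x₀ + m * (q / (2 * p))) % q) ((y₀ + 2 * p - m - β) % p)) := by
  have hp0 := hp.two_le
  have hlt : p < q := by nlinarith
  have hcop : p.Coprime q := (Nat.coprime_primes hp hq).2 hlt.ne
  set h := q / (2 * p) with hh
  have hh0 : 0 < h := Nat.div_pos (by nlinarith) (by omega)
  have hhp : h * (2 * p) ≤ q := Nat.div_mul_le_self _ _
  have hhq : h < q := by nlinarith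
  have hhp' : h * p ≤ q := by nlinarith
  obtain ⟨ρ, hρ⟩ : p ∣ p * q + 1 - σ * q := by
    refine (Nat.modEq_iff_dvd' (by nlinarith)).1 ?_
    have h1 : σ * q ≡ 1 [MOD p] := by
      have := (hqβ.mul_left σ)
      rw [mul_comm σ β] at this
      exact this.trans hβσ
    exact h1.trans (by simp [Nat.ModEq])
  have hρ' : ρ * p + σ * q = p * q + 1 := by
    have : σ * q ≤ p * q + 1 := by nlinarith
    rw [mul_comm ρ p, ← hρ]; omega
  have hρq : ρ ≤ q := by
    have : 1 ≤ σ * q := by nlinarith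
    have : ρ * p ≤ q * p := by nlinarith
    exact Nat.le_of_mul_le_mul_right this hp.pos
  have hw : (q - h * p).Coprime (p * q) := by
    refine Nat.Coprime.mul_right ?_ ?_
    · have : (q - h * p + h * p).Coprime p := by
        rw [Nat.sub_add_cancel hhp']; exact hcop.symm
      simpa using this
    · rw [Nat.coprime_comm, Nat.coprime_self_sub_right hhp', Nat.coprime_comm]
      refine Nat.Coprime.mul_left ?_ hcop
      exact (hq.coprime_iff_not_dvd.2 fun hd => absurd (Nat.le_of_dvd hh0 hd) (by omega)).symm
  have hN : 1 < p * q := by nlinarith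
  obtain ⟨r₀, -, hr₀⟩ := Nat.exists_mul_mod_eq_one_of_coprime hw hN
  have hr₀c : r₀.Coprime (p * q) := by
    have h1 : (q - h * p) * r₀ ≡ 1 [MOD p * q] := by rw [Nat.ModEq, hr₀, Nat.mod_eq_of_lt hN]
    exact Nat.Coprime.coprime_mul_left (k := q - h * p) (by
      rw [Nat.Coprime, h1.gcd_eq]; simp)
  obtain ⟨r, hrgt, hr, hrr⟩ := Nat.forall_exists_prime_gt_and_modEq (p * q) (by omega) hr₀c
  have hwr : (q - h * p) * r ≡ 1 [MOD p * q] := by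
    refine (hrr.mul_left _).trans ?_
    rw [Nat.ModEq, hr₀, Nat.mod_eq_of_lt hN]
  set k := T * r + ((x₀ * p + y₀ * q) * r + T * r * (p * q - 1)) % (p * q) with hk
  have hkmod : k ≡ (x₀ * p + y₀ * q) * r [MOD p * q] := by
    have h1 : k ≡ T * r + ((x₀ * p + y₀ * q) * r + T * r * (p * q - 1)) [MOD p * q] :=
      Nat.ModEq.add_left _ (Nat.mod_modEq _ _)
    refine h1.trans ?_
    have : T * r + ((x₀ * p + y₀ * q) * r + T * r * (p * q - 1)) =
        (x₀ * p + y₀ * q) * r + T * r * (p * q) := by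
      obtain ⟨n, hn⟩ : ∃ n, p * q = n + 1 := ⟨p * q - 1, by omega⟩
      rw [hn, Nat.add_sub_cancel]; ring
    rw [this]
    simp [Nat.ModEq]
  have hlow : T * r ≤ k := Nat.le_add_right _ _
  have hup : k < (T + 1) * r := by
    have : ((x₀ * p + y₀ * q) * r + T * r * (p * q - 1)) % (p * q) < p * q :=
      Nat.mod_lt _ (by omega)
    rw [hk, add_mul T, one_mul]
    exact Nat.add_lt_add_left (this.trans hrgt) _
  have hqr : q < r := by nlinarith
  refine ⟨r, k, hr, hqr, ?_⟩
  have hT : ∀ e, e * r ≤ k ↔ e ≤ T := by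
    intro e
    constructor
    · intro he
      by_contra hc
      have : (T + 1) * r ≤ e * r := Nat.mul_le_mul_right _ (by omega)
      omega
    · intro he
      exact (Nat.mul_le_mul_right _ he).trans hlow
  have hmodx (a : ℕ) : a % q * p ≡ a * p [MOD p * q] := by
    rw [mul_comm p q]; exact (Nat.mod_modEq a q).mul_right' p
  have hmody (a : ℕ) : a % p * q ≡ a * q [MOD p * q] := (Nat.mod_modEq a p).mul_right' q
  refine coeff_cyclotomic_three_primes hp hq hr hlt hqr hρq hσ.le hρ' hT
    (fun m => (x₀ + m * h) % q) (fun m => (y₀ + p - m) % p) (fun m => (y₀ + 2 * p - m - β) % p)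
    (fun m _ => Nat.mod_lt _ hq.pos) (fun m _ => Nat.mod_lt _ hp.pos)
    (fun m _ => Nat.mod_lt _ hp.pos) ?_ ?_
  · intro m hm
    have h1 : (((x₀ + m * h) % q) * p + ((y₀ + p - m) % p) * q) * r + m ≡
        ((x₀ + m * h) * p + (y₀ + p - m) * q) * r + m * ((q - h * p) * r) [MOD p * q] :=
      Nat.ModEq.add (((hmodx _).add (hmody _)).mul_right r)
        (by simpa using (hwr.symm.mul_left m))
    refine h1.trans (Nat.ModEq.trans ?_ hkmod.symm)
    have h2 : ((x₀ + m * h) * p + (y₀ + p - m) * q) * r + m * ((q - h * p) * r) =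
        (x₀ * p + y₀ * q) * r + r * (p * q) := by
      zify [hhp', show m ≤ y₀ + p by omega]
      ring
    rw [h2]
    simp [Nat.ModEq]
  · intro m hm
    have h1 : (((x₀ + m * h) % q) * p + ((y₀ + 2 * p - m - β) % p) * q) * r + (m + q) ≡
        ((x₀ + m * h) * p + (y₀ + 2 * p - m - β) * q) * r + (m + q) * ((q - h * p) * r)
          [MOD p * q] :=
      Nat.ModEq.add (((hmodx _).add (hmody _)).mul_right r)
        (by simpa using (hwr.symm.mul_left (m + q)))
    refine h1.trans (Nat.ModEq.trans ?_ hkmod.symm)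
    obtain ⟨c, hc⟩ : p ∣ q - β := (Nat.modEq_iff_dvd' (by omega)).1 hqβ.symm
    have hc' : (q : ℤ) = β + p * c := by
      have : q = β + p * c := by omega
      exact_mod_cast this
    have h2 : (((((x₀ + m * h) * p + (y₀ + 2 * p - m - β) * q) * r +
        (m + q) * ((q - h * p) * r) : ℕ)) : ℤ) =
        (x₀ * p + y₀ * q) * r + (p * q : ℕ) * (r * (2 + c - h)) := by
      push_cast [Nat.cast_sub hhp', Nat.cast_sub (show m ≤ y₀ + 2 * p by omega),
        Nat.cast_sub (show β ≤ y₀ + 2 * p - m by omega)]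
      linear_combination (q * r : ℤ) * hc'
    rw [← Int.natCast_modEq_iff, h2]
    push_cast
    simp [Int.ModEq]

theorem abs_coeff_le_cycHeight (n k : ℕ) :
    |((cyclotomic n ℤ).coeff k : ℝ)| ≤ (cycHeight n : ℝ) := by
  rw [← Int.cast_abs, Int.abs_eq_natAbs, Int.cast_natCast, Nat.cast_le]
  by_cases h : k ≤ (cyclotomic n ℤ).natDegree
  · exact Finset.le_sup (f := fun k => ((cyclotomic n ℤ).coeff k).natAbs)
      (Finset.mem_range.2 (Nat.lt_succ_of_le h))
  · rw [coeff_eq_zero_of_natDegree_lt (by omega)]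
    simp

theorem abs_cutCoeff_le (p q σ T x y : ℕ) : |cutCoeff p q σ T x y| ≤ 1 := by
  rw [cutCoeff]
  split_ifs <;> simp

section
variable {p q σ T x y : ℕ} {ξ τ : ℝ}

theorem cutCoeff_eq_one (hq : (0 : ℝ) < q) (hξ : (x * p : ℝ) = ξ * q) (hτ : (T : ℝ) = τ * q)
    (h1 : ξ + σ ≤ p) (h2 : (y : ℝ) < σ) (h3 : ξ + y ≤ τ) : cutCoeff p q σ T x y = 1 := by
  rw [cutCoeff, if_pos]
  refine ⟨?_, by exact_mod_cast h2, ?_⟩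
  · have : (x * p + σ * q : ℝ) ≤ p * q := by rw [hξ, ← add_mul]; gcongr
    exact_mod_cast this
  · have : (x * p + y * q : ℝ) ≤ T := by rw [hξ, hτ, ← add_mul]; gcongr
    exact_mod_cast this

theorem cutCoeff_eq_neg_one (hq : (0 : ℝ) < q) (hξ : (x * p : ℝ) = ξ * q)
    (hτ : (T : ℝ) = τ * q) (h1 : p < ξ + σ) (h2 : (σ : ℝ) ≤ y) (h3 : ξ + y ≤ τ + p) :
    cutCoeff p q σ T x y = -1 := by
  have a1 : p * q < x * p + σ * q := by
    have : (p * q : ℝ) < x * p + σ * q := by rw [hξ, ← add_mul]; gcongr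
    exact_mod_cast this
  rw [cutCoeff, if_neg (by omega), if_pos]
  refine ⟨a1, by exact_mod_cast h2, ?_⟩
  have : (x * p + y * q : ℝ) ≤ T + p * q := by rw [hξ, hτ, ← add_mul, ← add_mul]; gcongr
  exact_mod_cast this

theorem cutCoeff_nonneg (hq : (0 : ℝ) < q) (hξ : (x * p : ℝ) = ξ * q) (hτ : (T : ℝ) = τ * q)
    (h : ξ + σ ≤ p ∨ (y : ℝ) < σ ∨ τ + p < ξ + y) : 0 ≤ cutCoeff p q σ T x y := by
  rw [cutCoeff]
  split_ifs with h1 h2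
  · simp
  · exfalso
    obtain ⟨h2, h3, h4⟩ := h2
    rcases h with h | h | h
    · have : (x * p + σ * q : ℝ) ≤ p * q := by rw [hξ, ← add_mul]; gcongr
      have : x * p + σ * q ≤ p * q := by exact_mod_cast this
      omega
    · have : y < σ := by exact_mod_cast h
      omega
    · have : (T + p * q : ℝ) < x * p + y * q := by rw [hξ, hτ, ← add_mul, ← add_mul]; gcongr
      have : T + p * q < x * p + y * q := by exact_mod_cast this
      omega
  · simp

theorem cutCoeff_nonpos (hq : (0 : ℝ) < q) (hξ : (x * p : ℝ) = ξ * q) (hτ : (T : ℝ) = τ * q)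
    (h : p < ξ + σ ∨ (σ : ℝ) ≤ y ∨ τ < ξ + y) : cutCoeff p q σ T x y ≤ 0 := by
  rw [cutCoeff]
  split_ifs with h1 h2
  · exfalso
    obtain ⟨h1, h3, h4⟩ := h1
    rcases h with h | h | h
    · have : (p * q : ℝ) < x * p + σ * q := by rw [hξ, ← add_mul]; gcongr
      have : p * q < x * p + σ * q := by exact_mod_cast this
      omega
    · have : σ ≤ y := by exact_mod_cast h
      omega
    · have : (T : ℝ) < x * p + y * q := by rw [hξ, hτ, ← add_mul]; gcongr
      have : T < x * p + y * q := by exact_mod_cast this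
      omega
  · simp
  · simp

end

/-- A sum over `m < p` whose terms are at least `1` on the outer thirds and at least `0` on the
middle third, away from the end points. -/
theorem le_sum_of_thirds {p D : ℕ} (f : ℕ → ℤ) (hf : ∀ m, -2 ≤ f m)
    (h1 : ∀ m, D < m → 3 * m + 3 * D < p → 1 ≤ f m)
    (h2 : ∀ m, p + 3 * D < 3 * m → 3 * m + 3 * D < 2 * p → 0 ≤ f m)
    (h3 : ∀ m, 2 * p + 3 * D < 3 * m → m + D < p → 1 ≤ f m) :
    2 * (p : ℝ) / 3 - (30 * D + 30) ≤ ∑ m ∈ Finset.range p, (f m : ℝ) := by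
  set s1 := Finset.range (D + 1)
  set s2 := Finset.Icc (p / 3 - D) (p / 3 + D)
  set s3 := Finset.Icc (2 * p / 3 - D) (2 * p / 3 + D)
  set s4 := Finset.Icc (p - D) p
  set s5 := Finset.Icc (p / 3) (2 * p / 3)
  set I : Finset ℕ → ℕ → ℤ := fun s m => if m ∈ s then 1 else 0 with hI
  have hI0 (s : Finset ℕ) (m : ℕ) : 0 ≤ I s m := by simp only [hI]; split_ifs <;> simp
  have key : ∀ m ∈ Finset.range p,
      1 - (3 * I s1 m + 3 * I s2 m + 3 * I s3 m + 3 * I s4 m + I s5 m) ≤ f m := by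
    intro m hm
    have hm := Finset.mem_range.1 hm
    have a1 := hI0 s1 m
    have a2 := hI0 s2 m
    have a3 := hI0 s3 m
    have a4 := hI0 s4 m
    have a5 := hI0 s5 m
    have a6 := hf m
    by_cases b1 : m ∈ s1
    · have : I s1 m = 1 := if_pos b1
      linarith
    by_cases b2 : m ∈ s2
    · have : I s2 m = 1 := if_pos b2
      linarith
    by_cases b3 : m ∈ s3
    · have : I s3 m = 1 := if_pos b3
      linarith
    by_cases b4 : m ∈ s4
    · have : I s4 m = 1 := if_pos b4
      linarith
    simp only [s1, s2, s3, s4, Finset.mem_range, Finset.mem_Icc, not_and_or, not_lt, not_le]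
      at b1 b2 b3 b4
    rcases lt_or_ge (p / 3 + D) m with c1 | c1
    · rcases lt_or_ge (2 * p / 3 + D) m with c2 | c2
      · have := h3 m (by omega) (by omega)
        linarith
      · have := h2 m (by omega) (by omega)
        have : I s5 m = 1 := if_pos (Finset.mem_Icc.2 (by omega))
        linarith
    · have := h1 m (by omega) (by omega)
      linarith
  have hsum (s : Finset ℕ) : ∑ m ∈ Finset.range p, I s m ≤ s.card := by
    simp only [hI]
    rw [← Finset.sum_filter, Finset.sum_const, nsmul_one, Nat.cast_le]
    exact Finset.card_le_card fun x hx => (Finset.mem_filter.1 hx).2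
  have htot := Finset.sum_le_sum key
  simp only [Finset.sum_sub_distrib, Finset.sum_add_distrib, ← Finset.mul_sum, Finset.sum_const,
    Finset.card_range, nsmul_one] at htot
  have e1 := hsum s1
  have e2 := hsum s2
  have e3 := hsum s3
  have e4 := hsum s4
  have e5 := hsum s5
  simp only [s1, s2, s3, s4, s5, Finset.card_range, Nat.card_Icc] at e1 e2 e3 e4 e5
  have main : 2 * (p : ℤ) - (90 * D + 90) ≤ 3 * ∑ m ∈ Finset.range p, f m := by
    simp only [s1, s2, s3, s4, s5] at htot
    omega
  have main' : 2 * (p : ℝ) - (90 * D + 90) ≤ 3 * ∑ m ∈ Finset.range p, (f m : ℝ) := by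
    exact_mod_cast main
  linarith

set_option maxHeartbeats 2000000 in
theorem exists_cycHeight_ge_of_near_third_third {p β σ E : ℕ} (hp : p.Prime) (hβ : β < p)
    (hσ : σ < p) (hσ0 : 0 < σ) (hβσ : β * σ ≡ 1 [MOD p])
    (h1 : 3 * β ≤ p + E) (h2 : p ≤ 3 * β + E) (h3 : 3 * σ ≤ p + E) (h4 : p ≤ 3 * σ + E) :
    ∃ q r : ℕ, q.Prime ∧ r.Prime ∧ p < q ∧ q < r ∧
      2 * (p : ℝ) / 3 - (30 * E + 330) ≤ cycHeight (p * q * r) := by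
  have hp2 := hp.two_le
  have hβc : β.Coprime p := by
    have := (hβσ.gcd_eq)
    exact Nat.Coprime.coprime_mul_right (k := σ) (by rw [Nat.Coprime, this]; simp)
  obtain ⟨q, hq4, hq, hqβ⟩ := Nat.forall_exists_prime_gt_and_modEq (4 * p ^ 2) hp.ne_zero hβc
  obtain ⟨r, k, hr, hqr, hk⟩ := exists_coeff_eq_sum_cutCoeff (x₀ := 2 * q / 3) (y₀ := p - 1)
    (T := p * q / 3) hp hq hq4 hβ hqβ hσ0 hσ hβσ
  refine ⟨q, r, hq, hr, by nlinarith, hqr, ?_⟩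
  refine le_trans ?_ ((le_abs_self _).trans (abs_coeff_le_cycHeight _ k))
  rw [hk]
  push_cast
  set h := q / (2 * p) with hh
  set D := E + 10 with hD
  have hq0 : (0 : ℝ) < q := by exact_mod_cast hq.pos
  have hp0 : (2 : ℝ) ≤ p := by exact_mod_cast hp2
  have hqR : 4 * (p : ℝ) ^ 2 < q := by exact_mod_cast hq4
  have hhl : (2 * p * h : ℝ) ≤ q := by exact_mod_cast Nat.mul_div_le q (2 * p)
  have hhu : (q : ℝ) < 2 * p * h + 2 * p := by
    have := Nat.lt_mul_div_succ q (show 0 < 2 * p by omega)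
    rw [mul_add, mul_one] at this
    exact_mod_cast this
  obtain ⟨θ, hθ⟩ : ∃ θ : ℝ, (h * p : ℝ) = θ * q := ⟨h * p / q, by field_simp⟩
  obtain ⟨τ, hτ⟩ : ∃ τ : ℝ, ((p * q / 3 : ℕ) : ℝ) = τ * q := ⟨(p * q / 3 : ℕ) / q, by field_simp⟩
  obtain ⟨ξ, hξ⟩ : ∃ ξ : ℝ, ((2 * q / 3 : ℕ) * p : ℝ) = ξ * q :=
    ⟨(2 * q / 3 : ℕ) * p / q, by field_simp⟩
  have hτl : p - 1 ≤ 3 * τ := by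
    have : p * q ≤ 3 * (p * q / 3) + 2 := by omega
    have : (p * q : ℝ) ≤ 3 * (p * q / 3 : ℕ) + 2 := by exact_mod_cast this
    rw [hτ] at this
    by_contra! hc
    nlinarith
  have hτu : 3 * τ ≤ p := by
    have : 3 * (p * q / 3) ≤ p * q := by omega
    have : 3 * (p * q / 3 : ℕ) ≤ (p * q : ℝ) := by exact_mod_cast this
    rw [hτ] at this
    by_contra! hc
    nlinarith
  have hξl : 2 * p - 1 ≤ 3 * ξ := by
    have : 2 * q ≤ 3 * (2 * q / 3) + 2 := by omega
    have : (2 * q : ℝ) ≤ 3 * (2 * q / 3 : ℕ) + 2 := by exact_mod_cast this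
    by_contra! hc
    nlinarith
  have hξu : 3 * ξ ≤ 2 * p := by
    have : 3 * (2 * q / 3) ≤ 2 * q := by omega
    have : 3 * (2 * q / 3 : ℕ) ≤ (2 * q : ℝ) := by exact_mod_cast this
    by_contra! hc
    nlinarith
  have hθu : 2 * θ ≤ 1 := by
    by_contra! hc
    nlinarith
  have hθl : p - 1 / 2 ≤ 2 * p * θ := by
    by_contra! hc
    nlinarith
  have hmθu (m : ℕ) : 2 * (m * θ) ≤ m := by nlinarith [(Nat.cast_nonneg m : (0 : ℝ) ≤ m)]
  have hmθl {m : ℕ} (hm : m ≤ p) : (m : ℝ) - 1 / 2 ≤ 2 * (m * θ) := by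
    have hm : (m : ℝ) ≤ p := by exact_mod_cast hm
    have : p * (1 - 2 * θ) ≤ 1 / 2 := by linarith
    nlinarith
  have h1R : 3 * (β : ℝ) ≤ p + E := by exact_mod_cast h1
  have h2R : (p : ℝ) ≤ 3 * β + E := by exact_mod_cast h2
  have h3R : 3 * (σ : ℝ) ≤ p + E := by exact_mod_cast h3
  have h4R : (p : ℝ) ≤ 3 * σ + E := by exact_mod_cast h4
  have hDR : (D : ℝ) = E + 10 := by rw [hD]; push_cast; rfl
  have hx1 {m : ℕ} (hm : 3 * m + 3 * D < 2 * p) :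
      (((2 * q / 3 + m * h) % q : ℕ) * p : ℝ) = (ξ + m * θ) * q := by
    rw [Nat.mod_eq_of_lt]
    · push_cast; linear_combination hξ + m * hθ
    · have hm' : 3 * (m : ℝ) + 3 * D < 2 * p := by exact_mod_cast hm
      have : ((2 * q / 3 + m * h : ℕ) : ℝ) * p < q * p := by
        push_cast
        rw [show (((2 * q / 3 : ℕ) : ℝ) + m * h) * p = (ξ + m * θ) * q by
          linear_combination hξ + m * hθ, mul_comm (q : ℝ)]
        gcongr
        linarith [hmθu m]
      exact_mod_cast lt_of_mul_lt_mul_right this (by positivity)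
  have hx2 {m : ℕ} (hm : 2 * p + 3 * D < 3 * m) (hmp : m + D < p) :
      (((2 * q / 3 + m * h) % q : ℕ) * p : ℝ) = (ξ + m * θ - p) * q := by
    have hm' : 2 * (p : ℝ) + 3 * D < 3 * m := by exact_mod_cast hm
    have hmp' : (m : ℝ) + D < p := by exact_mod_cast hmp
    have e1 : (((2 * q / 3 : ℕ) : ℝ) + m * h) * p = (ξ + m * θ) * q := by
      linear_combination hξ + m * hθ
    have hle : q ≤ 2 * q / 3 + m * h := by
      have : (q : ℝ) * p ≤ ((2 * q / 3 + m * h : ℕ) : ℝ) * p := by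
        push_cast
        rw [e1, mul_comm (q : ℝ)]
        gcongr
        linarith [hmθl (m := m) (by omega)]
      exact_mod_cast le_of_mul_le_mul_right this (by positivity)
    have hlt : 2 * q / 3 + m * h < 2 * q := by
      have : ((2 * q / 3 + m * h : ℕ) : ℝ) * p < (2 * q) * p := by
        push_cast
        rw [e1, mul_right_comm (2 : ℝ)]
        gcongr
        linarith [hmθu m]
      exact_mod_cast lt_of_mul_lt_mul_right this (by positivity)
    rw [Nat.mod_eq_sub_mod hle, Nat.mod_eq_of_lt (by omega), Nat.cast_sub hle]
    push_cast
    linear_combination e1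
  have hy1 {m : ℕ} (hm : m + D < p) : ((p - 1 + p - m) % p : ℕ) = p - 1 - m := by
    rw [Nat.mod_eq_sub_mod (by omega), Nat.mod_eq_of_lt (by omega)]; omega
  have hy1R {m : ℕ} (hm : m + D < p) : (((p - 1 + p - m) % p : ℕ) : ℝ) = p - 1 - m := by
    rw [hy1 hm, Nat.cast_sub (by omega), Nat.cast_sub (by omega)]; simp
  have hy2R {m : ℕ} (hm : 3 * m + 3 * D < 2 * p) :
      (((p - 1 + 2 * p - m - β) % p : ℕ) : ℝ) = p - 1 - m - β := by
    have : (p - 1 + 2 * p - m - β) % p = p - 1 - m - β := by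
      rw [Nat.mod_eq_sub_mod (by omega), Nat.mod_eq_sub_mod (by omega),
        Nat.mod_eq_of_lt (by omega)]; omega
    rw [this, Nat.cast_sub (by omega), Nat.cast_sub (by omega), Nat.cast_sub (by omega)]; simp
  have hy3R {m : ℕ} (hm : 2 * p + 3 * D < 3 * m) (hmp : m + D < p) :
      (((p - 1 + 2 * p - m - β) % p : ℕ) : ℝ) = 2 * p - 1 - m - β := by
    have : (p - 1 + 2 * p - m - β) % p = 2 * p - 1 - m - β := by
      rw [Nat.mod_eq_sub_mod (by omega), Nat.mod_eq_of_lt (by omega)]; omega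
    rw [this, Nat.cast_sub (by omega), Nat.cast_sub (by omega), Nat.cast_sub (by omega)]; simp
  have main := le_sum_of_thirds (p := p) (D := D) (fun m =>
    cutCoeff p q σ (p * q / 3) ((2 * q / 3 + m * h) % q) ((p - 1 + p - m) % p) -
      cutCoeff p q σ (p * q / 3) ((2 * q / 3 + m * h) % q) ((p - 1 + 2 * p - m - β) % p))
    (fun m => by
      have e1 := abs_le.1 (abs_cutCoeff_le p q σ (p * q / 3) ((2 * q / 3 + m * h) % q)
        ((p - 1 + p - m) % p))
      have e2 := abs_le.1 (abs_cutCoeff_le p q σ (p * q / 3) ((2 * q / 3 + m * h) % q)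
        ((p - 1 + 2 * p - m - β) % p))
      linarith [e1.1, e2.2])
    (fun m hm hm' => by
      have mR : (D : ℝ) < m := by exact_mod_cast hm
      have mR' : 3 * (m : ℝ) + 3 * D < p := by exact_mod_cast hm'
      have t1 := hmθu m
      have t2 := hmθl (m := m) (by omega)
      have e1 := cutCoeff_nonneg (p := p) (σ := σ) (y := (p - 1 + p - m) % p) hq0
        (hx1 (m := m) (by omega)) hτ (Or.inr (Or.inr (by rw [hy1R (by omega)]; linarith)))
      have e2 := cutCoeff_eq_neg_one (p := p) (σ := σ) (y := (p - 1 + 2 * p - m - β) % p) hq0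
        (hx1 (m := m) (by omega)) hτ (by linarith) (by rw [hy2R (by omega)]; linarith)
        (by rw [hy2R (by omega)]; linarith)
      linarith)
    (fun m hm hm' => by
      have mR : (p : ℝ) + 3 * D < 3 * m := by exact_mod_cast hm
      have mR' : 3 * (m : ℝ) + 3 * D < 2 * p := by exact_mod_cast hm'
      have t1 := hmθu m
      have t2 := hmθl (m := m) (by omega)
      have e1 := cutCoeff_nonneg (p := p) (σ := σ) (y := (p - 1 + p - m) % p) hq0
        (hx1 (m := m) (by omega)) hτ (Or.inr (Or.inr (by rw [hy1R (by omega)]; linarith)))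
      have e2 := cutCoeff_nonpos (p := p) (σ := σ) (y := (p - 1 + 2 * p - m - β) % p) hq0
        (hx1 (m := m) (by omega)) hτ (Or.inl (by linarith))
      linarith)
    (fun m hm hm' => by
      have mR : 2 * (p : ℝ) + 3 * D < 3 * m := by exact_mod_cast hm
      have mR' : (m : ℝ) + D < p := by exact_mod_cast hm'
      have t1 := hmθu m
      have t2 := hmθl (m := m) (by omega)
      have e1 := cutCoeff_eq_one (p := p) (σ := σ) (y := (p - 1 + p - m) % p) hq0
        (hx2 (m := m) hm hm') hτ (by linarith) (by rw [hy1R (by omega)]; linarith)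
        (by rw [hy1R (by omega)]; linarith)
      have e2 := cutCoeff_nonpos (p := p) (σ := σ) (y := (p - 1 + 2 * p - m - β) % p) hq0
        (hx2 (m := m) hm hm') hτ (Or.inr (Or.inl (by rw [hy3R hm hm']; linarith)))
      linarith)
  push_cast at main
  rw [hDR] at main
  linarith

set_option maxHeartbeats 2000000 in
theorem exists_cycHeight_ge_of_near_third_two_thirds {p β σ E : ℕ} (hp : p.Prime) (hβ : β < p)
    (hσ : σ < p) (hσ0 : 0 < σ) (hβσ : β * σ ≡ 1 [MOD p])
    (h1 : 3 * β ≤ p + E) (h2 : p ≤ 3 * β + E) (h3 : 3 * σ ≤ 2 * p + E)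
    (h4 : 2 * p ≤ 3 * σ + E) :
    ∃ q r : ℕ, q.Prime ∧ r.Prime ∧ p < q ∧ q < r ∧
      2 * (p : ℝ) / 3 - (30 * E + 330) ≤ cycHeight (p * q * r) := by
  have hp2 := hp.two_le
  have hβc : β.Coprime p := by
    have := (hβσ.gcd_eq)
    exact Nat.Coprime.coprime_mul_right (k := σ) (by rw [Nat.Coprime, this]; simp)
  obtain ⟨q, hq4, hq, hqβ⟩ := Nat.forall_exists_prime_gt_and_modEq (4 * p ^ 2) hp.ne_zero hβc
  obtain ⟨r, k, hr, hqr, hk⟩ := exists_coeff_eq_sum_cutCoeff (x₀ := 0) (y₀ := 2 * p / 3)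
    (T := p * q / 3) hp hq hq4 hβ hqβ hσ0 hσ hβσ
  refine ⟨q, r, hq, hr, by nlinarith, hqr, ?_⟩
  refine le_trans ?_ ((neg_le_abs _).trans (abs_coeff_le_cycHeight _ k))
  rw [hk]
  push_cast
  rw [← Finset.sum_neg_distrib]
  simp only [neg_sub]
  set h := q / (2 * p) with hh
  set D := E + 10 with hD
  have hq0 : (0 : ℝ) < q := by exact_mod_cast hq.pos
  have hp0 : (2 : ℝ) ≤ p := by exact_mod_cast hp2
  have hqR : 4 * (p : ℝ) ^ 2 < q := by exact_mod_cast hq4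
  have hhl : (2 * p * h : ℝ) ≤ q := by exact_mod_cast Nat.mul_div_le q (2 * p)
  have hhu : (q : ℝ) < 2 * p * h + 2 * p := by
    have := Nat.lt_mul_div_succ q (show 0 < 2 * p by omega)
    rw [mul_add, mul_one] at this
    exact_mod_cast this
  obtain ⟨θ, hθ⟩ : ∃ θ : ℝ, (h * p : ℝ) = θ * q := ⟨h * p / q, by field_simp⟩
  obtain ⟨τ, hτ⟩ : ∃ τ : ℝ, ((p * q / 3 : ℕ) : ℝ) = τ * q := ⟨(p * q / 3 : ℕ) / q, by field_simp⟩
  have hτl : p - 1 ≤ 3 * τ := by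
    have : p * q ≤ 3 * (p * q / 3) + 2 := by omega
    have : (p * q : ℝ) ≤ 3 * (p * q / 3 : ℕ) + 2 := by exact_mod_cast this
    rw [hτ] at this
    by_contra! hc
    nlinarith
  have hτu : 3 * τ ≤ p := by
    have : 3 * (p * q / 3) ≤ p * q := by omega
    have : 3 * (p * q / 3 : ℕ) ≤ (p * q : ℝ) := by exact_mod_cast this
    rw [hτ] at this
    by_contra! hc
    nlinarith
  have hθu : 2 * θ ≤ 1 := by
    by_contra! hc
    nlinarith
  have hθl : p - 1 / 2 ≤ 2 * p * θ := by
    by_contra! hc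
    nlinarith
  have hmθu (m : ℕ) : 2 * (m * θ) ≤ m := by nlinarith [(Nat.cast_nonneg m : (0 : ℝ) ≤ m)]
  have hmθl {m : ℕ} (hm : m ≤ p) : (m : ℝ) - 1 / 2 ≤ 2 * (m * θ) := by
    have hm : (m : ℝ) ≤ p := by exact_mod_cast hm
    have : p * (1 - 2 * θ) ≤ 1 / 2 := by linarith
    nlinarith
  have h1R : 3 * (β : ℝ) ≤ p + E := by exact_mod_cast h1
  have h2R : (p : ℝ) ≤ 3 * β + E := by exact_mod_cast h2
  have h3R : 3 * (σ : ℝ) ≤ 2 * p + E := by exact_mod_cast h3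
  have h4R : 2 * (p : ℝ) ≤ 3 * σ + E := by exact_mod_cast h4
  have hDR : (D : ℝ) = E + 10 := by rw [hD]; push_cast; rfl
  have hz : 3 * (2 * p / 3 : ℕ) ≤ 2 * p := by omega
  have hz' : 2 * p ≤ 3 * (2 * p / 3 : ℕ) + 2 := by omega
  have hzR : 3 * ((2 * p / 3 : ℕ) : ℝ) ≤ 2 * p := by exact_mod_cast hz
  have hzR' : 2 * (p : ℝ) ≤ 3 * ((2 * p / 3 : ℕ) : ℝ) + 2 := by exact_mod_cast hz'
  have hx {m : ℕ} (hm : m < p) :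
      (((0 + m * h) % q : ℕ) * p : ℝ) = (m * θ) * q := by
    rw [zero_add, Nat.mod_eq_of_lt]
    · push_cast; linear_combination m * hθ
    · have hm' : (m : ℝ) < p := by exact_mod_cast hm
      have : ((m * h : ℕ) : ℝ) * p < q * p := by
        push_cast
        rw [show (m : ℝ) * h * p = (m * θ) * q by linear_combination m * hθ, mul_comm (q : ℝ)]
        gcongr
        linarith [hmθu m]
      exact_mod_cast lt_of_mul_lt_mul_right this (by positivity)
  have hy1R {m : ℕ} (hm : 3 * m + 3 * D < 2 * p) :
      (((2 * p / 3 + p - m) % p : ℕ) : ℝ) = (2 * p / 3 : ℕ) - m := by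
    have : (2 * p / 3 + p - m) % p = 2 * p / 3 - m := by
      rw [Nat.mod_eq_sub_mod (by omega), Nat.mod_eq_of_lt (by omega)]; omega
    rw [this, Nat.cast_sub (by omega)]
  have hy2R {m : ℕ} (hm : 2 * p + 3 * D < 3 * m) (hmp : m < p) :
      (((2 * p / 3 + p - m) % p : ℕ) : ℝ) = (2 * p / 3 : ℕ) + p - m := by
    rw [Nat.mod_eq_of_lt (by omega), Nat.cast_sub (by omega), Nat.cast_add]
  have hy3R {m : ℕ} (hm : 3 * m + 3 * D < p) :
      (((2 * p / 3 + 2 * p - m - β) % p : ℕ) : ℝ) = (2 * p / 3 : ℕ) - m - β := by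
    have : (2 * p / 3 + 2 * p - m - β) % p = 2 * p / 3 - m - β := by
      rw [Nat.mod_eq_sub_mod (by omega), Nat.mod_eq_sub_mod (by omega),
        Nat.mod_eq_of_lt (by omega)]; omega
    rw [this, Nat.cast_sub (by omega), Nat.cast_sub (by omega)]
  have hy4R {m : ℕ} (hm : p + 3 * D < 3 * m) (hmp : m + D < p) :
      (((2 * p / 3 + 2 * p - m - β) % p : ℕ) : ℝ) = (2 * p / 3 : ℕ) + p - m - β := by
    have : (2 * p / 3 + 2 * p - m - β) % p = 2 * p / 3 + p - m - β := by
      rw [Nat.mod_eq_sub_mod (by omega), Nat.mod_eq_of_lt (by omega)]; omega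
    rw [this, Nat.cast_sub (by omega), Nat.cast_sub (by omega), Nat.cast_add]
  have main := le_sum_of_thirds (p := p) (D := D) (fun m =>
    cutCoeff p q σ (p * q / 3) ((0 + m * h) % q) ((2 * p / 3 + 2 * p - m - β) % p) -
      cutCoeff p q σ (p * q / 3) ((0 + m * h) % q) ((2 * p / 3 + p - m) % p))
    (fun m => by
      have e1 := abs_le.1 (abs_cutCoeff_le p q σ (p * q / 3) ((0 + m * h) % q)
        ((2 * p / 3 + p - m) % p))
      have e2 := abs_le.1 (abs_cutCoeff_le p q σ (p * q / 3) ((0 + m * h) % q)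
        ((2 * p / 3 + 2 * p - m - β) % p))
      linarith [e1.2, e2.1])
    (fun m hm hm' => by
      have mR : (D : ℝ) < m := by exact_mod_cast hm
      have mR' : 3 * (m : ℝ) + 3 * D < p := by exact_mod_cast hm'
      have t1 := hmθu m
      have t2 := hmθl (m := m) (by omega)
      have e1 := cutCoeff_nonpos (p := p) (σ := σ) (y := (2 * p / 3 + p - m) % p) hq0
        (hx (m := m) (by omega)) hτ (Or.inr (Or.inr (by rw [hy1R (by omega)]; linarith)))
      have e2 := cutCoeff_eq_one (p := p) (σ := σ) (y := (2 * p / 3 + 2 * p - m - β) % p) hq0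
        (hx (m := m) (by omega)) hτ (by linarith) (by rw [hy3R hm']; linarith)
        (by rw [hy3R hm']; linarith)
      linarith)
    (fun m hm hm' => by
      have mR : (p : ℝ) + 3 * D < 3 * m := by exact_mod_cast hm
      have mR' : 3 * (m : ℝ) + 3 * D < 2 * p := by exact_mod_cast hm'
      have t1 := hmθu m
      have t2 := hmθl (m := m) (by omega)
      have e1 := cutCoeff_nonpos (p := p) (σ := σ) (y := (2 * p / 3 + p - m) % p) hq0
        (hx (m := m) (by omega)) hτ (Or.inr (Or.inr (by rw [hy1R (by omega)]; linarith)))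
      have e2 := cutCoeff_nonneg (p := p) (σ := σ) (y := (2 * p / 3 + 2 * p - m - β) % p) hq0
        (hx (m := m) (by omega)) hτ (Or.inl (by linarith))
      linarith)
    (fun m hm hm' => by
      have mR : 2 * (p : ℝ) + 3 * D < 3 * m := by exact_mod_cast hm
      have mR' : (m : ℝ) + D < p := by exact_mod_cast hm'
      have t1 := hmθu m
      have t2 := hmθl (m := m) (by omega)
      have e1 := cutCoeff_eq_neg_one (p := p) (σ := σ) (y := (2 * p / 3 + p - m) % p) hq0
        (hx (m := m) (by omega)) hτ (by linarith) (by rw [hy2R hm (by omega)]; linarith)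
        (by rw [hy2R hm (by omega)]; linarith)
      have e2 := cutCoeff_nonneg (p := p) (σ := σ) (y := (2 * p / 3 + 2 * p - m - β) % p) hq0
        (hx (m := m) (by omega)) hτ
        (Or.inr (Or.inl (by rw [hy4R (by omega) hm']; linarith)))
      linarith)
  push_cast at main
  rw [hDR] at main
  linarith

end

theorem modEq_one_of_nine_mul {p x : ℕ} (hp : p.Prime) (hp9 : 9 < p)
    (h : (p : ℤ) ∣ 9 * (x : ℤ) - 9) : x ≡ 1 [MOD p] := by
  have hp' : Prime (p : ℤ) := Nat.prime_iff_prime_int.mp hp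
  have h9 : (p : ℤ) ∣ 9 * ((x : ℤ) - 1) := by
    rw [mul_sub, mul_one]; exact h
  rcases hp'.dvd_or_dvd h9 with h | h
  · have := Int.le_of_dvd (by norm_num) h
    omega
  · exact ((Nat.modEq_iff_dvd).mpr (by simpa using h)).symm

/-- A factorisation `p + 9 = a * b` with both factors at most `E` yields a ternary cyclotomic
polynomial with smallest prime `p` and height `2 * p / 3 - O(E)`. -/
theorem exists_cycHeight_ge_of_mul_eq {p a b E : ℕ} (hp : p.Prime) (hp9 : 9 < p)
    (hab : a * b = p + 9) (ha : a ≤ E) (hb : b ≤ E) (hE : E < p) :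
    ∃ q r : ℕ, q.Prime ∧ r.Prime ∧ p < q ∧ q < r ∧
      2 * (p : ℝ) / 3 - (30 * E + 330) ≤ cycHeight (p * q * r) := by
  have habz : (a : ℤ) * b = p + 9 := by exact_mod_cast hab
  have hp3 : p % 3 ≠ 0 := fun h => by
    have := (Nat.prime_dvd_prime_iff_eq Nat.prime_three hp).mp (Nat.dvd_of_mod_eq_zero h)
    omega
  have key : ∀ a b : ℕ, a * b = p + 9 → p % 3 = 2 → a % 3 = 1 → a ≤ E → b ≤ E →
      ∃ q r : ℕ, q.Prime ∧ r.Prime ∧ p < q ∧ q < r ∧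
      2 * (p : ℝ) / 3 - (30 * E + 330) ≤ cycHeight (p * q * r) := by
    intro a b hab hp2 ha1 ha hb
    have habz : (a : ℤ) * b = p + 9 := by exact_mod_cast hab
    have hb2 : b % 3 = 2 := by
      have : (a * b) % 3 = (p + 9) % 3 := by rw [hab]
      rw [Nat.mul_mod, ha1] at this
      omega
    obtain ⟨β, hβ⟩ : 3 ∣ a + p := by omega
    obtain ⟨σ, hσ⟩ : 3 ∣ b + 2 * p := by omega
    refine exists_cycHeight_ge_of_near_third_two_thirds hp (β := β) (σ := σ) (by omega) (by omega)
      (by omega) ?_ (by omega) (by omega) (by omega) (by omega)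
    refine modEq_one_of_nine_mul hp hp9 ⟨2 * a + b + 2 * p + 1, ?_⟩
    have h1 : (a : ℤ) + p = 3 * β := by exact_mod_cast hβ
    have h2 : (b : ℤ) + 2 * p = 3 * σ := by exact_mod_cast hσ
    push_cast
    linear_combination (-3 * (σ : ℤ)) * h1 + (-(a : ℤ) - p) * h2 + habz
  have h3 : p % 3 = 1 ∨ p % 3 = 2 := by omega
  have hmod : (a * b) % 3 = (p + 9) % 3 := by rw [hab]
  rw [Nat.mul_mod] at hmod
  have ha3 : a % 3 = 0 ∨ a % 3 = 1 ∨ a % 3 = 2 := by omega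
  have hb3 : b % 3 = 0 ∨ b % 3 = 1 ∨ b % 3 = 2 := by omega
  rcases h3 with h3 | h3
  · rcases ha3 with h | h | h <;> rw [h] at hmod
    · omega
    · have hb1 : b % 3 = 1 := by omega
      obtain ⟨β, hβ⟩ : 3 ∣ p - a := by omega
      obtain ⟨σ, hσ⟩ : 3 ∣ p - b := by omega
      refine exists_cycHeight_ge_of_near_third_third hp (β := β) (σ := σ) (by omega) (by omega)
        (by omega) ?_ (by omega) (by omega) (by omega) (by omega)
      have h1 : (p : ℤ) - a = 3 * β := by omega
      have h2 : (p : ℤ) - b = 3 * σ := by omega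
      refine modEq_one_of_nine_mul hp hp9 ⟨p - a - b + 1, ?_⟩
      push_cast
      linear_combination (-3 * (σ : ℤ)) * h1 + (a - (p : ℤ)) * h2 + habz
    · have hb1 : b % 3 = 2 := by rcases hb3 with h | h | h <;> rw [h] at hmod <;> omega
      obtain ⟨β, hβ⟩ : 3 ∣ p + a := by omega
      obtain ⟨σ, hσ⟩ : 3 ∣ p + b := by omega
      refine exists_cycHeight_ge_of_near_third_third hp (β := β) (σ := σ) (by omega) (by omega)
        (by omega) ?_ (by omega) (by omega) (by omega) (by omega)
      have h1 : (p : ℤ) + a = 3 * β := by omega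
      have h2 : (p : ℤ) + b = 3 * σ := by omega
      refine modEq_one_of_nine_mul hp hp9 ⟨p + a + b + 1, ?_⟩
      push_cast
      linear_combination (-3 * (σ : ℤ)) * h1 + (-a - (p : ℤ)) * h2 + habz
  · rcases ha3 with h | h | h
    · rw [h] at hmod; omega
    · exact key a b hab h3 h ha hb
    · have hb1 : b % 3 = 1 := by
        rw [h] at hmod; rcases hb3 with h | h | h <;> rw [h] at hmod <;> omega
      exact key b a (by rw [mul_comm]; exact hab) h3 hb1 hb ha

/-- The additive character `x ↦ exp (2πix)`. -/
noncomputable def addExp (x : ℝ) : ℂ := Complex.exp (Complex.I * ((2 * Real.pi * x : ℝ) : ℂ))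

theorem addExp_add (x y : ℝ) : addExp (x + y) = addExp x * addExp y := by
  unfold addExp
  rw [← Complex.exp_add]
  congr 1
  push_cast
  ring

theorem addExp_zero : addExp 0 = 1 := by simp [addExp]

theorem norm_addExp (x : ℝ) : ‖addExp x‖ = 1 := by
  unfold addExp
  rw [mul_comm]
  exact Complex.norm_exp_ofReal_mul_I _

theorem addExp_int (n : ℤ) : addExp n = 1 := by
  unfold addExp
  rw [Complex.exp_eq_one_iff]
  exact ⟨n, by push_cast; ring⟩

theorem addExp_add_int (x : ℝ) (n : ℤ) : addExp (x + n) = addExp x := by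
  rw [addExp_add, addExp_int, mul_one]

theorem addExp_neg (x : ℝ) : addExp (-x) = (starRingEnd ℂ) (addExp x) := by
  unfold addExp
  rw [← Complex.exp_conj]
  congr 1
  rw [map_mul, Complex.conj_I, Complex.conj_ofReal]
  push_cast
  ring

theorem addExp_sub (x y : ℝ) : addExp (x - y) = addExp x * (starRingEnd ℂ) (addExp y) := by
  rw [sub_eq_add_neg, addExp_add, addExp_neg]

theorem addExp_nat_mul (n : ℕ) (x : ℝ) : addExp (n * x) = addExp x ^ n := by
  unfold addExp
  rw [← Complex.exp_nat_mul]
  congr 1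
  push_cast
  ring

theorem norm_addExp_sub_one (x : ℝ) : ‖addExp x - 1‖ = 2 * |Real.sin (Real.pi * x)| := by
  unfold addExp
  rw [Complex.norm_exp_I_mul_ofReal_sub_one]
  rw [norm_mul, Real.norm_eq_abs, Real.norm_eq_abs, abs_two]
  congr 3
  ring

theorem two_mul_min_le_sin {y : ℝ} (h0 : 0 ≤ y) (h1 : y ≤ 1) :
    2 * min y (1 - y) ≤ Real.sin (Real.pi * y) := by
  have hpi := Real.pi_pos
  rcases le_total y (1 / 2) with h | h
  · have := Real.mul_le_sin (x := Real.pi * y) (by positivity) (by nlinarith)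
    have e : 2 / Real.pi * (Real.pi * y) = 2 * y := by field_simp
    rw [e] at this
    exact le_trans (by linarith [min_le_left y (1 - y)]) this
  · have := Real.mul_le_sin (x := Real.pi * (1 - y)) (by nlinarith) (by nlinarith)
    have e : 2 / Real.pi * (Real.pi * (1 - y)) = 2 * (1 - y) := by field_simp
    rw [e, show Real.pi * (1 - y) = Real.pi - Real.pi * y by ring, Real.sin_pi_sub] at this
    exact le_trans (by linarith [min_le_right y (1 - y)]) this

theorem sq_norm_geom_addExp_le {y : ℝ} (h0 : 0 < y) (h1 : y < 1) (M : ℕ) :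
    ‖∑ m ∈ Finset.range M, addExp (m * y)‖ ^ 2 ≤ 1 / 4 * (1 / y ^ 2 + 1 / (1 - y) ^ 2) := by
  have hs := two_mul_min_le_sin h0.le h1.le
  have hmin : 0 < min y (1 - y) := lt_min h0 (by linarith)
  have hgeom : (∑ m ∈ Finset.range M, addExp (m * y)) * (addExp y - 1) = addExp (M * y) - 1 := by
    simp_rw [addExp_nat_mul]
    exact geom_sum_mul _ _
  have hn : ‖∑ m ∈ Finset.range M, addExp (m * y)‖ * ‖addExp y - 1‖ ≤ 2 := by
    rw [← norm_mul, hgeom]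
    refine (norm_sub_le _ _).trans ?_
    rw [norm_addExp, norm_one]; norm_num
  rw [norm_addExp_sub_one, abs_of_nonneg (by linarith)] at hn
  set D := ‖∑ m ∈ Finset.range M, addExp (m * y)‖
  have hD : 0 ≤ D := norm_nonneg _
  have h2 : D * (2 * min y (1 - y)) ≤ 1 := by nlinarith
  have h3 : D ^ 2 ≤ 1 / 4 * (1 / (min y (1 - y)) ^ 2) := by
    have : D ≤ 1 / (2 * min y (1 - y)) := by rw [le_div_iff₀ (by positivity)]; exact h2
    calc D ^ 2 ≤ (1 / (2 * min y (1 - y))) ^ 2 := by gcongr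
      _ = _ := by field_simp; norm_num
  refine h3.trans ?_
  have h1y : 0 < 1 - y := by linarith
  rcases min_choice y (1 - y) with h | h <;> rw [h]
  · have : 0 ≤ 1 / (1 - y) ^ 2 := by positivity
    linarith
  · have : 0 ≤ 1 / y ^ 2 := by positivity
    linarith

theorem sum_inv_sq_le_of_spaced {ι : Type*} (s : Finset ι) (y : ι → ℝ) {δ : ℝ} (hδ : 0 < δ)
    (hy : ∀ i ∈ s, δ ≤ y i) (hsp : ∀ i ∈ s, ∀ j ∈ s, i ≠ j → δ ≤ |y i - y j|) :
    ∑ i ∈ s, 1 / (y i) ^ 2 ≤ 2 / δ ^ 2 := by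
  classical
  have hinj : Set.InjOn (fun i => ⌊y i / δ⌋₊) s := by
    intro i hi j hj hij
    by_contra hne
    have h := hsp i hi j hj hne
    simp only at hij
    have hi0 : 0 ≤ y i / δ := div_nonneg (hδ.le.trans (hy i hi)) hδ.le
    have hj0 : 0 ≤ y j / δ := div_nonneg (hδ.le.trans (hy j hj)) hδ.le
    have a1 := Nat.floor_le hi0
    have a2 := Nat.lt_floor_add_one (y i / δ)
    have b1 := Nat.floor_le hj0
    have b2 := Nat.lt_floor_add_one (y j / δ)
    rw [hij] at a1 a2
    have : |y i / δ - y j / δ| < 1 := by rw [abs_lt]; constructor <;> linarith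
    rw [← sub_div, abs_div, abs_of_pos hδ, div_lt_one hδ] at this
    linarith
  have hpos : ∀ i ∈ s, 1 ≤ ⌊y i / δ⌋₊ := by
    intro i hi
    rw [Nat.one_le_floor_iff, one_le_div hδ]
    exact hy i hi
  have h1 : ∀ i ∈ s, 1 / (y i) ^ 2 ≤ 1 / δ ^ 2 * (1 / ((⌊y i / δ⌋₊ : ℝ)) ^ 2) := by
    intro i hi
    have hyi := hy i hi
    have h0 : (0 : ℝ) < ⌊y i / δ⌋₊ := by exact_mod_cast hpos i hi
    have h2 : (⌊y i / δ⌋₊ : ℝ) * δ ≤ y i := by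
      rw [← le_div_iff₀ hδ]; exact Nat.floor_le (div_nonneg (hδ.le.trans hyi) hδ.le)
    rw [one_div_mul_one_div, ← mul_pow, mul_comm δ]
    gcongr
  refine (Finset.sum_le_sum h1).trans ?_
  rw [← Finset.mul_sum]
  have h3 : ∑ i ∈ s, 1 / ((⌊y i / δ⌋₊ : ℝ)) ^ 2
      = ∑ n ∈ s.image (fun i => ⌊y i / δ⌋₊), 1 / ((n : ℝ)) ^ 2 := by
    rw [Finset.sum_image hinj]
  rw [h3]
  obtain ⟨K, hK⟩ : ∃ K, s.image (fun i => ⌊y i / δ⌋₊) ⊆ Finset.Ioo 0 K := by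
    refine ⟨(s.image (fun i => ⌊y i / δ⌋₊)).sup id + 1, fun n hn => ?_⟩
    rw [Finset.mem_Ioo]
    refine ⟨?_, Nat.lt_succ_of_le (Finset.le_sup (f := id) hn)⟩
    obtain ⟨i, hi, rfl⟩ := Finset.mem_image.mp hn
    exact hpos i hi
  have h4 : ∑ n ∈ s.image (fun i => ⌊y i / δ⌋₊), 1 / ((n : ℝ)) ^ 2 ≤ 2 := by
    refine (Finset.sum_le_sum_of_subset_of_nonneg hK (fun _ _ _ => by positivity)).trans ?_
    have := sum_Ioo_inv_sq_le (α := ℝ) 0 K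
    simpa using this
  calc 1 / δ ^ 2 * _ ≤ 1 / δ ^ 2 * 2 := by gcongr
    _ = _ := by ring

/-- The Fejér kernel row sum over `δ`-spaced points modulo one. -/
theorem sum_sq_norm_geom_le_of_spaced {ι : Type*} (s : Finset ι) (x : ι → ℝ) {δ : ℝ}
    (hδ : 0 < δ) (hsp : ∀ i ∈ s, ∀ j ∈ s, i ≠ j → ∀ z : ℤ, δ ≤ |x i - x j - z|) (M : ℕ)
    {j : ι} (hj : j ∈ s) :
    ∑ i ∈ s, ‖∑ m ∈ Finset.range M, addExp (m * (x i - x j))‖ ^ 2 ≤ M ^ 2 + 1 / δ ^ 2 := by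
  classical
  rw [← Finset.add_sum_erase _ _ hj]
  have h0 : ‖∑ m ∈ Finset.range M, addExp (m * (x j - x j))‖ ^ 2 = (M : ℝ) ^ 2 := by
    simp [addExp_zero]
  rw [h0]
  gcongr
  set y : ι → ℝ := fun i => Int.fract (x i - x j)
  have hfl : ∀ i, y i = x i - x j - ⌊x i - x j⌋ := fun i => rfl
  have hy0 : ∀ i ∈ s.erase j, δ ≤ y i := by
    intro i hi
    have := hsp i (Finset.mem_of_mem_erase hi) j hj (Finset.ne_of_mem_erase hi) ⌊x i - x j⌋
    rw [← hfl, abs_of_nonneg (Int.fract_nonneg _)] at this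
    exact this
  have hy1 : ∀ i ∈ s.erase j, δ ≤ 1 - y i := by
    intro i hi
    have := hsp i (Finset.mem_of_mem_erase hi) j hj (Finset.ne_of_mem_erase hi) (⌊x i - x j⌋ + 1)
    rw [show x i - x j - ((⌊x i - x j⌋ + 1 : ℤ) : ℝ) = y i - 1 by rw [hfl]; push_cast; ring,
      abs_sub_comm, abs_of_nonneg] at this
    · exact this
    · have := Int.fract_lt_one (x i - x j)
      simp only [y]; linarith
  have hyy : ∀ i ∈ s.erase j, ∀ k ∈ s.erase j, i ≠ k → δ ≤ |y i - y k| := by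
    intro i hi k hk hik
    have := hsp i (Finset.mem_of_mem_erase hi) k (Finset.mem_of_mem_erase hk) hik
      (⌊x i - x j⌋ - ⌊x k - x j⌋)
    rw [hfl, hfl]
    push_cast at this
    convert this using 2
    ring
  have hb1 := sum_inv_sq_le_of_spaced (s.erase j) y hδ hy0 hyy
  have hb2 := sum_inv_sq_le_of_spaced (s.erase j) (fun i => 1 - y i) hδ hy1 (by
    intro i hi k hk hik
    have := hyy i hi k hk hik
    rw [abs_sub_comm] at this
    convert this using 2
    ring)
  have hterm : ∀ i ∈ s.erase j, ‖∑ m ∈ Finset.range M, addExp (m * (x i - x j))‖ ^ 2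
      ≤ 1 / 4 * (1 / y i ^ 2 + 1 / (1 - y i) ^ 2) := by
    intro i hi
    have := sq_norm_geom_addExp_le (y := y i) (by linarith [hy0 i hi]) (by linarith [hy1 i hi]) M
    convert this using 4 with m hm
    rw [hfl, show (m : ℝ) * (x i - x j - ⌊x i - x j⌋)
      = m * (x i - x j) + ((-(m * ⌊x i - x j⌋) : ℤ) : ℝ) by push_cast; ring, addExp_add_int]
  refine (Finset.sum_le_sum hterm).trans ?_
  rw [← Finset.mul_sum, Finset.sum_add_distrib]
  have : 2 / δ ^ 2 = 2 * (1 / δ ^ 2) := by ring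
  linarith

theorem sum_sq_norm_exp_sum_mul_le {ι : Type*} (s : Finset ι) (x : ι → ℝ) (c : ι → ℂ) (N : ℕ) :
    (N : ℝ) * ∑ n ∈ Finset.range N, ‖∑ j ∈ s, c j * addExp (n * x j)‖ ^ 2 ≤
      ∑ m ∈ Finset.range (2 * N), ∑ m' ∈ Finset.range (2 * N),
        ‖∑ j ∈ s, c j * addExp (((m : ℝ) - m') * x j)‖ ^ 2 := by
  have h1 : ∑ n ∈ Finset.range N, ∑ m' ∈ Finset.range N,
      ‖∑ j ∈ s, c j * addExp (((n + m' : ℕ) - (m' : ℝ)) * x j)‖ ^ 2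
      = (N : ℝ) * ∑ n ∈ Finset.range N, ‖∑ j ∈ s, c j * addExp (n * x j)‖ ^ 2 := by
    rw [Finset.mul_sum]
    refine Finset.sum_congr rfl fun n _ => ?_
    rw [Finset.sum_congr rfl (g := fun _ => ‖∑ j ∈ s, c j * addExp (n * x j)‖ ^ 2)]
    · simp
    · intro m' _
      congr 2
      refine Finset.sum_congr rfl fun j _ => ?_
      push_cast
      ring_nf
  rw [← h1, ← Finset.sum_product', ← Finset.sum_product']
  rw [← Finset.sum_image (s := Finset.range N ×ˢ Finset.range N)
    (g := fun q : ℕ × ℕ => (q.1 + q.2, q.2))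
    (f := fun q : ℕ × ℕ => ‖∑ j ∈ s, c j * addExp (((q.1 : ℝ) - (q.2 : ℝ)) * x j)‖ ^ 2)]
  · refine Finset.sum_le_sum_of_subset_of_nonneg ?_ (fun _ _ _ => by positivity)
    intro q hq
    simp only [Finset.mem_image, Finset.mem_product, Finset.mem_range, Prod.exists] at hq ⊢
    obtain ⟨a, b, ⟨ha, hb⟩, rfl⟩ := hq
    simp only
    omega
  · rintro ⟨a, b⟩ _ ⟨a', b'⟩ _ h
    simp only [Prod.mk.injEq] at h ⊢
    omega

/-- Dual additive large sieve. -/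
theorem dual_large_sieve {ι : Type*} (s : Finset ι) (x : ι → ℝ) {δ : ℝ} (hδ : 0 < δ)
    (hsp : ∀ i ∈ s, ∀ j ∈ s, i ≠ j → ∀ z : ℤ, δ ≤ |x i - x j - z|) (c : ι → ℂ) {N : ℕ}
    (hN : 1 ≤ N * δ) :
    ∑ n ∈ Finset.range N, ‖∑ j ∈ s, c j * addExp (n * x j)‖ ^ 2 ≤
      5 * N * ∑ j ∈ s, ‖c j‖ ^ 2 := by
  have hN0 : (0 : ℝ) < N := by
    rcases Nat.eq_zero_or_pos N with h | h
    · subst h; norm_num at hN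
    · exact_mod_cast h
  set M := 2 * N
  set κ : ι → ι → ℝ := fun j k => ‖∑ m ∈ Finset.range M, addExp (m * (x j - x k))‖ ^ 2 with hκ
  have hrow : ∀ k ∈ s, ∑ j ∈ s, κ j k ≤ 5 * N ^ 2 := by
    intro k hk
    refine (sum_sq_norm_geom_le_of_spaced s x hδ hsp M hk).trans ?_
    have : 1 / δ ^ 2 ≤ (N : ℝ) ^ 2 := by
      rw [div_le_iff₀ (by positivity), ← mul_pow]
      exact one_le_pow₀ hN
    simp only [M]
    push_cast
    linarith
  have hsymm : ∀ j k, κ j k = κ k j := by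
    intro j k
    simp only [hκ]
    rw [← Complex.norm_conj, map_sum]
    congr 2
    refine Finset.sum_congr rfl fun m _ => ?_
    rw [← addExp_neg]
    ring_nf
  have hexp : ((∑ m ∈ Finset.range M, ∑ m' ∈ Finset.range M,
        ‖∑ j ∈ s, c j * addExp (((m : ℝ) - m') * x j)‖ ^ 2 : ℝ) : ℂ)
      = ∑ j ∈ s, ∑ k ∈ s, c j * (starRingEnd ℂ) (c k) * (κ j k : ℂ) := by
    have h1 : ∀ m m' : ℕ, ((‖∑ j ∈ s, c j * addExp (((m : ℝ) - m') * x j)‖ ^ 2 : ℝ) : ℂ)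
        = ∑ j ∈ s, ∑ k ∈ s, c j * (starRingEnd ℂ) (c k) *
          (addExp (m * (x j - x k)) * (starRingEnd ℂ) (addExp (m' * (x j - x k)))) := by
      intro m m'
      push_cast
      rw [← Complex.mul_conj', map_sum, Finset.sum_mul_sum]
      refine Finset.sum_congr rfl fun j _ => Finset.sum_congr rfl fun k _ => ?_
      rw [map_mul, ← addExp_sub, ← addExp_neg, mul_mul_mul_comm, ← addExp_add]
      congr 2
      ring
    push_cast
    have h2 : ∀ j k, (κ j k : ℂ) = ∑ m ∈ Finset.range M, ∑ m' ∈ Finset.range M,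
        (addExp (m * (x j - x k)) * (starRingEnd ℂ) (addExp (m' * (x j - x k)))) := by
      intro j k
      simp only [hκ]
      push_cast
      rw [← Complex.mul_conj', map_sum, Finset.sum_mul_sum]
    simp_rw [h2, Finset.mul_sum]
    push_cast at h1
    rw [Finset.sum_congr rfl fun m _ => Finset.sum_congr rfl fun m' _ => h1 m m']
    calc _ = ∑ m ∈ Finset.range M, ∑ j ∈ s, ∑ k ∈ s, ∑ m' ∈ Finset.range M, _ := by
          refine Finset.sum_congr rfl fun m _ => ?_
          rw [Finset.sum_comm]
          refine Finset.sum_congr rfl fun j _ => ?_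
          rw [Finset.sum_comm]
      _ = _ := by
          rw [Finset.sum_comm]
          refine Finset.sum_congr rfl fun j _ => ?_
          rw [Finset.sum_comm]
  have hub : ∑ m ∈ Finset.range M, ∑ m' ∈ Finset.range M,
        ‖∑ j ∈ s, c j * addExp (((m : ℝ) - m') * x j)‖ ^ 2 ≤ 5 * N ^ 2 * ∑ j ∈ s, ‖c j‖ ^ 2 := by
    have hn : ∑ m ∈ Finset.range M, ∑ m' ∈ Finset.range M,
        ‖∑ j ∈ s, c j * addExp (((m : ℝ) - m') * x j)‖ ^ 2
        ≤ ∑ j ∈ s, ∑ k ∈ s, (‖c j‖ ^ 2 / 2 * κ j k + ‖c k‖ ^ 2 / 2 * κ j k) := by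
      rw [← Complex.norm_of_nonneg (r := ∑ m ∈ Finset.range M, ∑ m' ∈ Finset.range M,
        ‖∑ j ∈ s, c j * addExp (((m : ℝ) - m') * x j)‖ ^ 2) (by positivity), hexp]
      refine (norm_sum_le _ _).trans (Finset.sum_le_sum fun j _ => ?_)
      refine (norm_sum_le _ _).trans (Finset.sum_le_sum fun k _ => ?_)
      have hκ0 : 0 ≤ κ j k := by positivity
      rw [norm_mul, norm_mul, Complex.norm_conj, Complex.norm_of_nonneg hκ0, ← add_mul]
      gcongr
      nlinarith [sq_nonneg (‖c j‖ - ‖c k‖)]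
    refine hn.trans ?_
    simp_rw [Finset.sum_add_distrib]
    rw [Finset.sum_comm (f := fun j k => ‖c k‖ ^ 2 / 2 * κ j k)]
    have h7 : ∑ j ∈ s, ∑ k ∈ s, ‖c j‖ ^ 2 / 2 * κ j k = ∑ j ∈ s, ‖c j‖ ^ 2 / 2 * ∑ k ∈ s, κ k j :=
        by
      refine Finset.sum_congr rfl fun j _ => ?_
      rw [Finset.mul_sum]
      exact Finset.sum_congr rfl fun k _ => by rw [hsymm j k]
    have h8 : ∑ k ∈ s, ∑ j ∈ s, ‖c k‖ ^ 2 / 2 * κ j k = ∑ j ∈ s, ‖c j‖ ^ 2 / 2 * ∑ k ∈ s, κ k j :=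
      Finset.sum_congr rfl fun j _ => by rw [Finset.mul_sum]
    rw [h7, h8]
    have h5 : ∑ j ∈ s, ‖c j‖ ^ 2 / 2 * ∑ k ∈ s, κ k j ≤ ∑ j ∈ s, ‖c j‖ ^ 2 / 2 * (5 * N ^ 2) := by
      refine Finset.sum_le_sum fun j hj => ?_
      gcongr
      exact hrow j hj
    rw [← Finset.sum_mul, ← Finset.sum_div] at h5
    linarith
  have h := (sum_sq_norm_exp_sum_mul_le s x c N).trans hub
  have : (N : ℝ) * ∑ n ∈ Finset.range N, ‖∑ j ∈ s, c j * addExp (n * x j)‖ ^ 2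
      ≤ N * (5 * N * ∑ j ∈ s, ‖c j‖ ^ 2) := by
    refine h.trans (le_of_eq ?_)
    ring
  exact le_of_mul_le_mul_left this hN0

/-- The additive large sieve inequality. -/
theorem large_sieve {ι : Type*} (s : Finset ι) (x : ι → ℝ) {δ : ℝ} (hδ : 0 < δ)
    (hsp : ∀ i ∈ s, ∀ j ∈ s, i ≠ j → ∀ z : ℤ, δ ≤ |x i - x j - z|) (a : ℕ → ℂ) (N : ℕ) :
    ∑ j ∈ s, ‖∑ n ∈ Finset.range N, a n * addExp (n * x j)‖ ^ 2 ≤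
      5 * (N + 1 / δ + 1) * ∑ n ∈ Finset.range N, ‖a n‖ ^ 2 := by
  set S : ι → ℂ := fun j => ∑ n ∈ Finset.range N, a n * addExp (n * x j) with hS
  set N' := N + ⌈1 / δ⌉₊
  have hc1 := Nat.le_ceil (1 / δ)
  have hc2 := Nat.ceil_lt_add_one (a := 1 / δ) (by positivity)
  have hN' : (1 : ℝ) ≤ N' * δ := by
    rw [← div_le_iff₀ hδ]; simp only [N']; push_cast
    have : (0 : ℝ) ≤ N := by positivity
    linarith
  have hdual := dual_large_sieve s x hδ hsp (fun j => (starRingEnd ℂ) (S j)) hN'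
  replace hdual : ∑ n ∈ Finset.range N', ‖∑ j ∈ s, (starRingEnd ℂ) (S j) * addExp (n * x j)‖ ^ 2 ≤
      5 * N' * ∑ j ∈ s, ‖S j‖ ^ 2 := by
    refine hdual.trans (le_of_eq ?_)
    exact congrArg _ (Finset.sum_congr rfl fun j _ => by rw [Complex.norm_conj])
  set T := ∑ j ∈ s, ‖S j‖ ^ 2 with hT
  set U : ℕ → ℂ := fun n => ∑ j ∈ s, (starRingEnd ℂ) (S j) * addExp (n * x j) with hU
  have hT0 : 0 ≤ T := by positivity
  have h1 : (T : ℂ) = ∑ n ∈ Finset.range N, a n * U n := by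
    simp only [hT, hU, Finset.mul_sum]
    push_cast
    rw [Finset.sum_comm]
    refine Finset.sum_congr rfl fun j _ => ?_
    rw [← Complex.conj_mul']
    nth_rewrite 2 [hS]
    simp only
    rw [Finset.mul_sum]
    exact Finset.sum_congr rfl fun n _ => by ring
  have h2 : T ≤ ∑ n ∈ Finset.range N, ‖a n‖ * ‖U n‖ := by
    rw [← Complex.norm_of_nonneg hT0, h1]
    refine (norm_sum_le _ _).trans (le_of_eq ?_)
    simp
  have h3 := Finset.sum_mul_sq_le_sq_mul_sq (Finset.range N) (fun n => ‖a n‖) (fun n => ‖U n‖)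
  have h4 : ∑ n ∈ Finset.range N, ‖U n‖ ^ 2 ≤ 5 * N' * T :=
    (Finset.sum_le_sum_of_subset_of_nonneg
      (Finset.range_mono (Nat.le_add_right _ _)) (fun _ _ _ => by positivity)).trans hdual
  set Aa := ∑ n ∈ Finset.range N, ‖a n‖ ^ 2
  have hA : 0 ≤ Aa := by positivity
  have h5 : T ^ 2 ≤ Aa * (5 * N' * T) := by
    calc T ^ 2 ≤ (∑ n ∈ Finset.range N, ‖a n‖ * ‖U n‖) ^ 2 := by gcongr
      _ ≤ _ := h3
      _ ≤ _ := by gcongr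
  have h6 : T ≤ 5 * N' * Aa := by
    rcases hT0.eq_or_lt with h | h
    · rw [← h]; positivity
    · nlinarith
  refine h6.trans ?_
  gcongr
  simp only [N']
  push_cast
  linarith

theorem sum_addExp_div (q : ℕ) (hq : 0 < q) (t : ℤ) :
    ∑ c ∈ Finset.range q, addExp (t * ((c : ℝ) / q)) = if (q : ℤ) ∣ t then (q : ℂ) else 0 := by
  have hq' : (q : ℝ) ≠ 0 := by positivity
  split_ifs with h
  · obtain ⟨k, rfl⟩ := h
    rw [Finset.sum_congr rfl (g := fun _ => 1)]
    · simp
    · intro c _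
      rw [show (((q : ℤ) * k : ℤ) : ℝ) * ((c : ℝ) / q) = ((k * c : ℤ) : ℝ) by
        push_cast; field_simp, addExp_int]
  · have hne : addExp ((t : ℝ) / q) ≠ 1 := by
      intro h1
      unfold addExp at h1
      rw [Complex.exp_eq_one_iff] at h1
      obtain ⟨n, hn⟩ := h1
      apply h
      have h2 : (t : ℝ) / q = n := by
        have hpi : (Real.pi : ℂ) ≠ 0 := by exact_mod_cast Real.pi_ne_zero
        have : (((t : ℝ) / q : ℝ) : ℂ) = n := by
          have h3 : (2 * Real.pi * Complex.I) * (((t : ℝ) / q : ℝ) : ℂ)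
              = (2 * Real.pi * Complex.I) * n := by
            push_cast at hn ⊢
            linear_combination hn
          exact mul_left_cancel₀ (by simp [hpi]) h3
        exact_mod_cast this
      rw [div_eq_iff hq'] at h2
      exact ⟨n, by rw [mul_comm]; exact_mod_cast h2⟩
    have hg := geom_sum_mul (addExp ((t : ℝ) / q)) q
    have h1 : addExp ((t : ℝ) / q) ^ q = 1 := by
      rw [← addExp_nat_mul, show (q : ℝ) * (t / q) = (t : ℤ) by field_simp, addExp_int]
    rw [h1, sub_self] at hg
    rcases mul_eq_zero.mp hg with h2 | h2
    · rw [← h2]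
      refine Finset.sum_congr rfl fun c _ => ?_
      rw [← addExp_nat_mul]
      congr 1
      ring
    · exact absurd (sub_eq_zero.mp h2) hne

/-- Parseval for residue classes modulo `q`. -/
theorem sum_sq_norm_exp_sum_eq (s : Finset ℕ) (b : ℕ → ℂ) (q : ℕ) (hq : 0 < q) :
    ∑ c ∈ Finset.range q, ‖∑ n ∈ s, b n * addExp (n * ((c : ℝ) / q))‖ ^ 2 =
      q * ∑ ρ ∈ Finset.range q, ‖∑ n ∈ s with n % q = ρ, b n‖ ^ 2 := by
  have key : ((∑ c ∈ Finset.range q, ‖∑ n ∈ s, b n * addExp (n * ((c : ℝ) / q))‖ ^ 2 : ℝ) : ℂ) =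
      ((q * ∑ ρ ∈ Finset.range q, ‖∑ n ∈ s with n % q = ρ, b n‖ ^ 2 : ℝ) : ℂ) := by
    push_cast
    simp_rw [← Complex.mul_conj', map_sum, Finset.sum_mul_sum]
    rw [Finset.sum_comm]
    simp_rw [Finset.sum_filter, Finset.mul_sum]
    rw [Finset.sum_comm (s := Finset.range q)]
    refine Finset.sum_congr rfl fun n _ => ?_
    rw [Finset.sum_comm]
    have hL : ∀ m, ∑ c ∈ Finset.range q, b n * addExp (n * ((c : ℝ) / q)) *
        (starRingEnd ℂ) (b m * addExp (m * ((c : ℝ) / q)))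
        = b n * (starRingEnd ℂ) (b m) * if (q : ℤ) ∣ (n : ℤ) - m then (q : ℂ) else 0 := by
      intro m
      rw [← sum_addExp_div q hq, Finset.mul_sum]
      refine Finset.sum_congr rfl fun c _ => ?_
      rw [show (((n : ℤ) - m : ℤ) : ℝ) * ((c : ℝ) / q) = n * ((c : ℝ) / q) - m * ((c : ℝ) / q) by
        push_cast; ring, addExp_sub, map_mul]
      ring
    have hdvd : ∀ m : ℕ, (q : ℤ) ∣ (n : ℤ) - m ↔ m % q = n % q := by
      intro m
      exact (Nat.modEq_iff_dvd (n := q) (a := m) (b := n)).symm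
    rw [Finset.sum_congr rfl fun m _ => hL m]
    rw [Finset.sum_eq_single (s := Finset.range q) (n % q)]
    · rw [if_pos rfl, Finset.mul_sum]
      refine Finset.sum_congr rfl fun m _ => ?_
      simp only [hdvd]
      split_ifs <;> simp [mul_comm]
    · intro ρ _ hρ
      rw [if_neg (fun h => hρ h.symm), mul_zero]
    · intro h
      exact absurd (Finset.mem_range.mpr (Nat.mod_lt _ hq)) h
  exact_mod_cast key

/-- If `a` is supported on at most `q - w` residue classes modulo `q`, its exponential sum at
non-trivial fractions with denominator `q` is large. -/
theorem mul_sq_norm_sum_le_of_support {q w : ℕ} (hq : 0 < q) (a : ℕ → ℂ) (N : ℕ)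
    (R : Finset ℕ) (hR : R ⊆ Finset.range q) (hcard : R.card + w ≤ q)
    (ha : ∀ n, a n ≠ 0 → n % q ∈ R) :
    (w : ℝ) * ‖∑ n ∈ Finset.range N, a n‖ ^ 2 ≤ ((q : ℝ) - w) *
      ∑ c ∈ Finset.Ico 1 q, ‖∑ n ∈ Finset.range N, a n * addExp (n * ((c : ℝ) / q))‖ ^ 2 := by
  have hP := sum_sq_norm_exp_sum_eq (Finset.range N) a q hq
  set B : ℕ → ℂ := fun ρ => ∑ n ∈ Finset.range N with n % q = ρ, a n with hB
  have h0 : ∑ n ∈ Finset.range N, a n = ∑ ρ ∈ R, B ρ := by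
    rw [← Finset.sum_fiberwise_of_maps_to (s := Finset.range N) (t := Finset.range q)
      (g := fun n => n % q) (fun n _ => Finset.mem_range.mpr (Nat.mod_lt _ hq))]
    symm
    refine Finset.sum_subset hR fun ρ _ hρ => ?_
    refine Finset.sum_eq_zero fun n hn => ?_
    by_contra hne
    have := ha n hne
    rw [(Finset.mem_filter.mp hn).2] at this
    exact hρ this
  have h1 : ‖∑ n ∈ Finset.range N, a n‖ ^ 2 ≤ ((q : ℝ) - w) * ∑ ρ ∈ Finset.range q, ‖B ρ‖ ^ 2 := by
    have hc : (R.card : ℝ) ≤ q - w := by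
      have : ((R.card + w : ℕ) : ℝ) ≤ q := by exact_mod_cast hcard
      push_cast at this
      linarith
    calc ‖∑ n ∈ Finset.range N, a n‖ ^ 2 ≤ (∑ ρ ∈ R, ‖B ρ‖) ^ 2 := by
          rw [h0]; gcongr; exact norm_sum_le _ _
      _ ≤ R.card * ∑ ρ ∈ R, ‖B ρ‖ ^ 2 := sq_sum_le_card_mul_sum_sq
      _ ≤ ((q : ℝ) - w) * ∑ ρ ∈ Finset.range q, ‖B ρ‖ ^ 2 := by
          refine mul_le_mul hc (Finset.sum_le_sum_of_subset_of_nonneg hR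
            (fun _ _ _ => by positivity)) (by positivity) (le_trans (by positivity) hc)
  rw [← Finset.sum_range_add_sum_Ico _ (show 1 ≤ q from hq)] at hP
  simp only [Finset.range_one, Finset.sum_singleton, Nat.cast_zero, zero_div, mul_zero, addExp_zero,
    mul_one] at hP
  have hq0 : (0 : ℝ) ≤ q := by positivity
  nlinarith [mul_le_mul_of_nonneg_left h1 hq0]

/-- Reduced residues modulo `D`. -/
def reducedResidues (D : ℕ) : Finset ℕ := (Finset.range D).filter fun b => b.Coprime D

theorem farey_spacing {D D' b b' : ℕ} {z : ℝ} (hD : 0 < D) (hD' : 0 < D') (hz : (D : ℝ) ≤ z)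
    (hz' : (D' : ℝ) ≤ z) (hb : b ∈ reducedResidues D) (hb' : b' ∈ reducedResidues D')
    (hne : ¬(D = D' ∧ b = b')) (k : ℤ) :
    1 / z ^ 2 ≤ |(b : ℝ) / D - (b' : ℝ) / D' - k| := by
  simp only [reducedResidues, Finset.mem_filter, Finset.mem_range] at hb hb'
  have hDr : (0 : ℝ) < D := by exact_mod_cast hD
  have hDr' : (0 : ℝ) < D' := by exact_mod_cast hD'
  set M : ℤ := b * D' - b' * D - k * D * D' with hM
  have e : (b : ℝ) / D - (b' : ℝ) / D' - k = (M : ℝ) / (D * D') := by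
    rw [hM]; push_cast; field_simp
  rw [e, abs_div, abs_of_pos (by positivity : (0 : ℝ) < D * D')]
  have hM0 : M ≠ 0 := by
    intro h0
    apply hne
    have h1 : (b : ℤ) * D' = D * (b' + k * D') := by linarith
    have h2 : (b' : ℤ) * D = D' * (b - k * D) := by linarith
    have d1 : D ∣ D' := by
      have : (D : ℤ) ∣ b * D' := ⟨_, h1⟩
      have := Int.natCast_dvd_natCast.mp (by push_cast; exact this : (D : ℤ) ∣ ((b * D' : ℕ) : ℤ))
      exact (Nat.Coprime.symm hb.2).dvd_of_dvd_mul_left this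
    have d2 : D' ∣ D := by
      have : (D' : ℤ) ∣ b' * D := ⟨_, h2⟩
      have := Int.natCast_dvd_natCast.mp (by push_cast; exact this : (D' : ℤ) ∣ ((b' * D : ℕ) : ℤ))
      exact (Nat.Coprime.symm hb'.2).dvd_of_dvd_mul_left this
    have hDD := Nat.dvd_antisymm d1 d2
    subst hDD
    refine ⟨rfl, ?_⟩
    have h3 : (b : ℤ) = b' + k * D := by
      have hDz : (D : ℤ) ≠ 0 := by exact_mod_cast hD.ne'
      exact mul_right_cancel₀ hDz (by linarith)
    have h4 : (D : ℤ) ∣ b - b' := ⟨k, by linarith⟩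
    have h5 := Int.eq_zero_of_abs_lt_dvd h4 (by rw [abs_lt]; omega)
    omega
  have h1 : (1 : ℝ) ≤ |(M : ℝ)| := by exact_mod_cast Int.one_le_abs hM0
  have hz0 : 0 ≤ z := hDr.le.trans hz
  gcongr
  rw [sq]
  gcongr

/-- The large sieve over fractions with denominators in a set `T`. -/
theorem large_sieve_farey (T : Finset ℕ) {z : ℝ} (hT : ∀ D ∈ T, 0 < D ∧ (D : ℝ) ≤ z) (hz : 0 < z)
    (a : ℕ → ℂ) (N : ℕ) :
    ∑ D ∈ T, ∑ b ∈ reducedResidues D, ‖∑ n ∈ Finset.range N, a n * addExp (n * ((b : ℝ) / D))‖ ^ 2 ≤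
      5 * (N + z ^ 2 + 1) * ∑ n ∈ Finset.range N, ‖a n‖ ^ 2 := by
  have h := large_sieve (T.sigma reducedResidues) (fun y : Σ _ : ℕ, ℕ => (y.2 : ℝ) / y.1)
    (δ := 1 / z ^ 2) (by positivity) (by
      rintro ⟨D, b⟩ hi ⟨D', b'⟩ hj hne k
      rw [Finset.mem_sigma] at hi hj
      refine farey_spacing (hT D hi.1).1 (hT D' hj.1).1 (hT D hi.1).2 (hT D' hj.1).2 hi.2 hj.2 ?_ k
      rintro ⟨rfl, rfl⟩
      exact hne rfl) a N
  rw [Finset.sum_sigma, one_div_one_div] at h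
  exact h

theorem sum_reducedResidues_mul_ge {q w D : ℕ} (hq : q.Prime) (hD : 0 < D) (hqD : q.Coprime D)
    (hw : w < q) (a : ℕ → ℂ) (N : ℕ) (R : Finset ℕ) (hR : R ⊆ Finset.range q)
    (hcard : R.card + w ≤ q) (ha : ∀ n, a n ≠ 0 → n % q ∈ R) :
    (w : ℝ) / ((q : ℝ) - w) *
      ∑ b ∈ reducedResidues D, ‖∑ n ∈ Finset.range N, a n * addExp (n * ((b : ℝ) / D))‖ ^ 2 ≤
    ∑ b ∈ reducedResidues (q * D),
      ‖∑ n ∈ Finset.range N, a n * addExp (n * ((b : ℝ) / (q * D : ℕ)))‖ ^ 2 := by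
  have hqw : (0 : ℝ) < (q : ℝ) - w := by
    have : (w : ℝ) < q := by exact_mod_cast hw
    linarith
  have hD' : (0 : ℝ) < D := by exact_mod_cast hD
  have hq' : (0 : ℝ) < q := by exact_mod_cast hq.pos
  set f : ℕ × ℕ → ℕ := fun y => (y.1 * q + y.2 * D) % (q * D) with hf
  have hstep : ∀ b : ℕ, (w : ℝ) / ((q : ℝ) - w) *
      ‖∑ n ∈ Finset.range N, a n * addExp (n * ((b : ℝ) / D))‖ ^ 2 ≤
      ∑ c ∈ Finset.Ico 1 q, ‖∑ n ∈ Finset.range N, a n *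
        addExp (n * ((f (b, c) : ℝ) / (q * D : ℕ)))‖ ^ 2 := by
    intro b
    have h := mul_sq_norm_sum_le_of_support hq.pos (fun n => a n * addExp
        (n * ((b : ℝ) / D))) N R hR
      hcard (fun n hn => ha n (left_ne_zero_of_mul hn))
    rw [div_mul_eq_mul_div, div_le_iff₀ hqw, mul_comm _ ((q : ℝ) - w)]
    refine h.trans (le_of_eq ?_)
    congr 1
    refine Finset.sum_congr rfl fun c _ => ?_
    congr 2
    refine Finset.sum_congr rfl fun n _ => ?_
    rw [mul_assoc, ← addExp_add]
    congr 1
    have hdm := Nat.div_add_mod (b * q + c * D) (q * D)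
    have hdm' : ((q * D : ℕ) : ℝ) * ((b * q + c * D) / (q * D) : ℕ) + f (b, c)
        = b * q + c * D := by exact_mod_cast hdm
    set K := (b * q + c * D) / (q * D)
    have e : (n : ℝ) * ((b : ℝ) / D) + n * ((c : ℝ) / q)
        = n * ((f (b, c) : ℝ) / (q * D : ℕ)) + ((n * K : ℕ) : ℤ) := by
      have : (f (b, c) : ℝ) = b * q + c * D - ((q * D : ℕ) : ℝ) * K := by linarith
      rw [this]
      push_cast
      field_simp
      ring
    rw [e, addExp_add_int]
  rw [Finset.mul_sum]
  refine (Finset.sum_le_sum fun b _ => hstep b).trans ?_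
  rw [← Finset.sum_product', ← Finset.sum_image (f := fun y : ℕ => ‖∑ n ∈ Finset.range N, a n *
        addExp (n * ((y : ℝ) / (q * D : ℕ)))‖ ^ 2) (g := f)]
  · refine Finset.sum_le_sum_of_subset_of_nonneg ?_ (fun _ _ _ => by positivity)
    intro y hy
    obtain ⟨⟨b, c⟩, hbc, rfl⟩ := Finset.mem_image.mp hy
    simp only [Finset.mem_product, reducedResidues, Finset.mem_filter, Finset.mem_range,
      Finset.mem_Ico] at hbc ⊢
    refine ⟨Nat.mod_lt _ (Nat.mul_pos hq.pos hD), ?_⟩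
    simp only [hf]
    rw [Nat.Coprime, ← Nat.gcd_rec, Nat.gcd_comm, ← Nat.Coprime]
    refine Nat.Coprime.mul_right ?_ ?_
    · rw [add_comm, mul_comm b q]
      refine (Nat.coprime_add_mul_left_left _ _ _).mpr ?_
      refine Nat.Coprime.mul_left ?_ hqD.symm
      exact (Nat.coprime_of_lt_prime (by omega) hbc.2.2 hq).symm
    · rw [mul_comm c D]
      refine (Nat.coprime_add_mul_left_left _ _ _).mpr ?_
      exact Nat.Coprime.mul_left hbc.1.2 hqD
  · rintro ⟨b, c⟩ hbc ⟨b', c'⟩ hbc' h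
    simp only [Finset.coe_product, Set.mem_prod, Finset.mem_coe, reducedResidues, Finset.mem_filter,
      Finset.mem_range, Finset.mem_Ico] at hbc hbc'
    have h' : b * q + c * D ≡ b' * q + c' * D [MOD q * D] := h
    have h1 : c * D ≡ c' * D [MOD q] := by
      have := h'.of_mul_right D
      have e1 : b * q + c * D ≡ c * D [MOD q] := by
        simp [Nat.ModEq, Nat.add_mod]
      have e2 : b' * q + c' * D ≡ c' * D [MOD q] := by
        simp [Nat.ModEq, Nat.add_mod]
      exact e1.symm.trans (this.trans e2)
    have h2 : b * q ≡ b' * q [MOD D] := by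
      have := h'.of_mul_left q
      have e1 : b * q + c * D ≡ b * q [MOD D] := by
        simp [Nat.ModEq, Nat.add_mod]
      have e2 : b' * q + c' * D ≡ b' * q [MOD D] := by
        simp [Nat.ModEq, Nat.add_mod]
      exact e1.symm.trans (this.trans e2)
    have h3 : c ≡ c' [MOD q] := Nat.ModEq.cancel_right_of_coprime hqD h1
    have h4 : b ≡ b' [MOD D] := Nat.ModEq.cancel_right_of_coprime hqD.symm h2
    have h5 := Nat.ModEq.eq_of_lt_of_lt h3 hbc.2.2 hbc'.2.2
    have h6 := Nat.ModEq.eq_of_lt_of_lt h4 hbc.1.1 hbc'.1.1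
    rw [h5, h6]

/-- Montgomery's arithmetic large sieve. -/
theorem arithmetic_large_sieve (P : Finset ℕ) (hP : ∀ q ∈ P, q.Prime) (w : ℕ → ℕ)
    (hw : ∀ q ∈ P, w q < q) (S : Finset ℕ) (N : ℕ) (hS : S ⊆ Finset.range N)
    (R : ℕ → Finset ℕ) (hR : ∀ q ∈ P, R q ⊆ Finset.range q)
    (hcard : ∀ q ∈ P, (R q).card + w q ≤ q) (hSR : ∀ q ∈ P, ∀ n ∈ S, n % q ∈ R q)
    {z : ℝ} (hz : 0 < z) :
    (S.card : ℝ) * ∑ Q ∈ P.powerset with (((∏ q ∈ Q, q : ℕ) : ℝ) ≤ z),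
      ∏ q ∈ Q, (w q : ℝ) / ((q : ℝ) - w q) ≤ 5 * (N + z ^ 2 + 1) := by
  classical
  set a : ℕ → ℂ := fun n => if n ∈ S then 1 else 0 with ha
  have ha0 : ∀ n, a n ≠ 0 → n ∈ S := by
    intro n hn
    by_contra h
    simp [ha, h] at hn
  have hpw : ∀ Q ∈ P.powerset, (∏ q ∈ Q, (w q : ℝ) / ((q : ℝ) - w q)) * (S.card : ℝ) ^ 2 ≤
      ∑ b ∈ reducedResidues (∏ q ∈ Q, q), ‖∑ n ∈ Finset.range N, a n *
        addExp (n * ((b : ℝ) / (∏ q ∈ Q, q : ℕ)))‖ ^ 2 := by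
    intro Q hQ
    rw [Finset.mem_powerset] at hQ
    induction Q using Finset.induction_on with
    | empty =>
      have : reducedResidues 1 = {0} := by
        ext b; simp [reducedResidues]
      simp only [Finset.prod_empty, this, Finset.sum_singleton, one_mul]
      have h1 : ∑ n ∈ Finset.range N, a n * addExp (n * (((0 : ℕ) : ℝ) / ((1 : ℕ) : ℝ))) =
          S.card := by
        simp only [Nat.cast_zero, zero_div, mul_zero, addExp_zero, mul_one, ha]
        rw [Finset.sum_ite_mem, Finset.inter_eq_right.mpr hS]
        simp
      rw [h1]
      simp
    | insert q Q hqQ ih =>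
      have hqP : q ∈ P := hQ (Finset.mem_insert_self _ _)
      have hQP : Q ⊆ P := fun x hx => hQ (Finset.mem_insert_of_mem hx)
      have hD : 0 < ∏ q ∈ Q, q := Finset.prod_pos fun x hx => (hP x (hQP hx)).pos
      have hcop : q.Coprime (∏ q ∈ Q, q) := by
        refine Nat.Coprime.prod_right fun x hx => ?_
        rw [Nat.coprime_primes (hP q hqP) (hP x (hQP hx))]
        rintro rfl
        exact hqQ hx
      have h := sum_reducedResidues_mul_ge (hP q hqP) hD hcop (hw q hqP) a N (R q) (hR q hqP)
        (hcard q hqP) (fun n hn => hSR q hqP n (ha0 n hn))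
      rw [Finset.prod_insert hqQ, Finset.prod_insert hqQ]
      refine le_trans ?_ h
      rw [mul_assoc]
      refine mul_le_mul_of_nonneg_left (ih hQP) (div_nonneg (by positivity) ?_)
      have : (w q : ℝ) < q := by exact_mod_cast hw q hqP
      linarith
  set T := P.powerset.filter (fun Q => ((∏ q ∈ Q, q : ℕ) : ℝ) ≤ z) with hT
  have hinj : Set.InjOn (fun Q : Finset ℕ => ∏ q ∈ Q, q) T := by
    intro Q hQ Q' hQ' h
    have hsub : ∀ Q Q' : Finset ℕ, Q ⊆ P → Q' ⊆ P → ∏ q ∈ Q, q = ∏ q ∈ Q', q → Q ⊆ Q' := by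
      intro Q Q' hQ hQ' h q hq
      have h1 : q ∣ ∏ q ∈ Q', q := h ▸ Finset.dvd_prod_of_mem _ hq
      obtain ⟨y, hy, hqy⟩ := (hP q (hQ hq)).prime.exists_mem_finset_dvd h1
      rwa [(Nat.prime_dvd_prime_iff_eq (hP q (hQ hq)) (hP y (hQ' hy))).mp hqy]
    simp only [hT, Finset.coe_filter, Finset.mem_powerset, Set.mem_ofPred_eq] at hQ hQ'
    exact Finset.Subset.antisymm (hsub Q Q' hQ.1 hQ'.1 h) (hsub Q' Q hQ'.1 hQ.1 h.symm)
  have hls := large_sieve_farey (T.image fun Q => ∏ q ∈ Q, q) (z := z) (by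
    intro D hD
    obtain ⟨Q, hQ, rfl⟩ := Finset.mem_image.mp hD
    rw [hT, Finset.mem_filter, Finset.mem_powerset] at hQ
    exact ⟨Finset.prod_pos fun x hx => (hP x (hQ.1 hx)).pos, hQ.2⟩) hz a N
  rw [Finset.sum_image hinj] at hls
  have hnorm : ∑ n ∈ Finset.range N, ‖a n‖ ^ 2 = S.card := by
    have : ∀ n, ‖a n‖ ^ 2 = if n ∈ S then (1 : ℝ) else 0 := by
      intro n; simp only [ha]; split_ifs <;> simp
    simp_rw [this]
    rw [Finset.sum_ite_mem, Finset.inter_eq_right.mpr hS]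
    simp
  rw [hnorm] at hls
  have h1 : (∑ Q ∈ T, ∏ q ∈ Q, (w q : ℝ) / ((q : ℝ) - w q)) * (S.card : ℝ) ^ 2 ≤
      5 * (N + z ^ 2 + 1) * S.card := by
    rw [Finset.sum_mul]
    refine le_trans (Finset.sum_le_sum fun Q hQ => hpw Q (Finset.mem_filter.mp hQ).1) hls
  rcases Nat.eq_zero_or_pos S.card with h0 | h0
  · rw [h0]; simp only [Nat.cast_zero, zero_mul]; positivity
  · have h0' : (0 : ℝ) < S.card := by exact_mod_cast h0
    refine le_of_mul_le_mul_right ?_ h0'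
    calc _ = (∑ Q ∈ T, ∏ q ∈ Q, (w q : ℝ) / ((q : ℝ) - w q)) * (S.card : ℝ) ^ 2 := by ring
      _ ≤ _ := h1

theorem sum_inv_le_prod_of_primeFactors_eq (Q : Finset ℕ) (hQ : ∀ q ∈ Q, q.Prime) (S : Finset ℕ)
    (hS : ∀ n ∈ S, n ≠ 0 ∧ n.primeFactors = Q) :
    ∑ n ∈ S, 1 / (n : ℝ) ≤ ∏ q ∈ Q, 1 / ((q : ℝ) - 1) := by
  classical
  set f : ℕ →* ℝ :=
    { toFun := fun n => (n : ℝ)⁻¹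
      map_one' := by simp
      map_mul' := fun x y => by push_cast; rw [mul_inv] } with hf
  have hlt : ∀ {p : ℕ}, p.Prime → ‖f p‖ < 1 := by
    intro p hp
    have : (1 : ℝ) < p := by exact_mod_cast hp.one_lt
    simp only [hf, MonoidHom.coe_mk, OneHom.coe_mk, norm_inv, Real.norm_natCast]
    exact inv_lt_one_of_one_lt₀ this
  obtain ⟨-, hsum⟩ := EulerProduct.summable_and_hasSum_factoredNumbers_prod_filter_prime_geometric
    (f := f) hlt Q
  rw [Finset.filter_true_of_mem hQ] at hsum
  set D := ∏ q ∈ Q, q with hD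
  have hD0 : 0 < D := Finset.prod_pos fun q hq => (hQ q hq).pos
  have hdiv : ∀ n ∈ S, D ∣ n := fun n hn => by
    rw [hD, ← (hS n hn).2]; exact Nat.prod_primeFactors_dvd n
  have hmem : ∀ n ∈ S, n / D ∈ Nat.factoredNumbers Q := by
    intro n hn
    rw [Nat.mem_factoredNumbers_iff_primeFactors_subset]
    have h0 : n / D ≠ 0 := (Nat.div_pos (Nat.le_of_dvd (Nat.pos_of_ne_zero (hS n hn).1)
        (hdiv n hn)) hD0).ne'
    refine ⟨h0, ?_⟩
    rw [← (hS n hn).2]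
    exact Nat.primeFactors_mono (Nat.div_dvd_of_dvd (hdiv n hn)) (hS n hn).1
  have h1 : ∑ n ∈ S.attach, f (n.1 / D) ≤ ∏ q ∈ Q, (1 - f q)⁻¹ := by
    have hinj : Function.Injective (fun n : S => (⟨n.1 / D,
        hmem n.1 n.2⟩ : Nat.factoredNumbers Q)) := by
      rintro ⟨a, ha⟩ ⟨b, hb⟩ h
      simp only [Subtype.mk.injEq] at h ⊢
      rw [← Nat.div_mul_cancel (hdiv a ha), h, Nat.div_mul_cancel (hdiv b hb)]
    have := sum_le_hasSum (S.attach.map ⟨_, hinj⟩) (fun i _ => by simp [hf]) hsum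
    rw [Finset.sum_map] at this
    exact this
  rw [Finset.sum_attach S (fun n => f (n / D))] at h1
  have h2 : ∑ n ∈ S, 1 / (n : ℝ) = (D : ℝ)⁻¹ * ∑ n ∈ S, f (n / D) := by
    rw [Finset.mul_sum]
    refine Finset.sum_congr rfl fun n hn => ?_
    have : (n : ℝ) = (n / D : ℕ) * D := by exact_mod_cast (Nat.div_mul_cancel (hdiv n hn)).symm
    rw [this]
    simp only [hf, MonoidHom.coe_mk, OneHom.coe_mk, one_div, mul_inv]
    ring
  have h3 : ∏ q ∈ Q, 1 / ((q : ℝ) - 1) = (D : ℝ)⁻¹ * ∏ q ∈ Q, (1 - f q)⁻¹ := by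
    rw [hD]
    push_cast
    rw [← Finset.prod_inv_distrib, ← Finset.prod_mul_distrib]
    refine Finset.prod_congr rfl fun q hq => ?_
    have h1 : (1 : ℝ) < q := by exact_mod_cast (hQ q hq).one_lt
    simp only [hf, MonoidHom.coe_mk, OneHom.coe_mk]
    have : (q : ℝ) - 1 ≠ 0 := by linarith
    field_simp
  rw [h2, h3]
  gcongr

/-- Sum of `1/φ` over squarefree products of admissible primes bounded by `y`. -/
theorem half_log_le_sum_prod (P : Finset ℕ) (y m : ℕ) (hm : m ≠ 0)
    (hP : ∀ q, q ∈ P → q.Prime) (hP' : ∀ q, q.Prime → q ≤ y → ¬ q ∣ m → q ∈ P)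
    (hr : ∑ r ∈ m.primeFactors, 1 / (r : ℝ) ≤ 1 / 2) :
    1 / 2 * Real.log (y + 1) ≤
      ∑ Q ∈ P.powerset with ∏ q ∈ Q, q ≤ y, ∏ q ∈ Q, 1 / ((q : ℝ) - 1) := by
  classical
  set H := ∑ n ∈ Finset.Icc 1 y, 1 / (n : ℝ) with hH
  have hHlog : Real.log (y + 1) ≤ H := by
    have := log_add_one_le_harmonic y
    rw [harmonic_eq_sum_Icc] at this
    push_cast at this
    simpa [hH] using this
  have hdiv : ∀ r, r.Prime → ∑ n ∈ Finset.Icc 1 y with r ∣ n, 1 / (n : ℝ) ≤ 1 / r * H := by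
    intro r hr
    have hsub : (Finset.Icc 1 y).filter (r ∣ ·) ⊆ (Finset.Icc 1 y).image (r * ·) := by
      intro n hn
      obtain ⟨hn, k, rfl⟩ := Finset.mem_filter.mp hn
      rw [Finset.mem_Icc] at hn
      refine Finset.mem_image.mpr ⟨k, Finset.mem_Icc.mpr ⟨?_, ?_⟩, rfl⟩
      · rcases Nat.eq_zero_or_pos k with h | h
        · subst h; omega
        · exact h
      · exact (Nat.le_mul_of_pos_left k hr.pos).trans hn.2
    refine (Finset.sum_le_sum_of_subset_of_nonneg hsub (fun _ _ _ => by positivity)).trans ?_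
    rw [Finset.sum_image (fun a _ b _ h => Nat.eq_of_mul_eq_mul_left hr.pos h), hH, Finset.mul_sum]
    refine Finset.sum_le_sum fun n _ => ?_
    push_cast
    rw [one_div_mul_one_div]
  have hcop : 1 / 2 * H ≤ ∑ n ∈ Finset.Icc 1 y with n.Coprime m, 1 / (n : ℝ) := by
    have h1 : H ≤ ∑ n ∈ Finset.Icc 1 y with n.Coprime m, 1 / (n : ℝ) +
        ∑ r ∈ m.primeFactors, ∑ n ∈ Finset.Icc 1 y with r ∣ n, 1 / (n : ℝ) := by
      rw [hH, ← Finset.sum_filter_add_sum_filter_not (Finset.Icc 1 y) (fun n => n.Coprime m)]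
      gcongr
      simp_rw [Finset.sum_filter]
      rw [Finset.sum_comm]
      refine Finset.sum_le_sum fun n _ => ?_
      split_ifs with h
      · exact Finset.sum_nonneg fun _ _ => by split_ifs <;> positivity
      · obtain ⟨p, hp, hpn, hpm⟩ := Nat.Prime.not_coprime_iff_dvd.mp h
        refine le_trans (le_of_eq ?_) (Finset.single_le_sum (fun _ _ => by split_ifs <;> positivity)
          (Nat.mem_primeFactors.mpr ⟨hp, hpm, hm⟩))
        rw [if_pos hpn]
    have h2 : ∑ r ∈ m.primeFactors, ∑ n ∈ Finset.Icc 1 y with r ∣ n, 1 / (n : ℝ) ≤ 1 / 2 * H := by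
      calc _ ≤ ∑ r ∈ m.primeFactors, 1 / (r : ℝ) * H :=
            Finset.sum_le_sum fun r hr => hdiv r (Nat.prime_of_mem_primeFactors hr)
        _ = (∑ r ∈ m.primeFactors, 1 / (r : ℝ)) * H := by rw [Finset.sum_mul]
        _ ≤ _ := by gcongr
    linarith
  calc 1 / 2 * Real.log (y + 1) ≤ 1 / 2 * H := by gcongr
    _ ≤ _ := hcop
    _ = ∑ Q ∈ P.powerset with ∏ q ∈ Q, q ≤ y,
        ∑ n ∈ (Finset.Icc 1 y).filter (fun n => n.Coprime m) with n.primeFactors = Q, 1 /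
            (n : ℝ) := by
        rw [Finset.sum_fiberwise_of_maps_to]
        intro n hn
        rw [Finset.mem_filter, Finset.mem_Icc] at hn
        rw [Finset.mem_filter, Finset.mem_powerset]
        refine ⟨fun q hq => ?_, (Nat.le_of_dvd (by omega)
            (Nat.prod_primeFactors_dvd n)).trans hn.1.2⟩
        have hq' := Nat.prime_of_mem_primeFactors hq
        have hqn := Nat.dvd_of_mem_primeFactors hq
        refine hP' q hq' ((Nat.le_of_dvd (by omega) hqn).trans hn.1.2) fun hqm => ?_
        exact Nat.Prime.not_coprime_iff_dvd.mpr ⟨q, hq', hqn, hqm⟩ hn.2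
    _ ≤ _ := by
        refine Finset.sum_le_sum fun Q hQ => ?_
        rw [Finset.mem_filter, Finset.mem_powerset] at hQ
        refine sum_inv_le_prod_of_primeFactors_eq Q (fun q hq => hP q (hQ.1 hq)) _ fun n hn => ?_
        simp only [Finset.mem_filter, Finset.mem_Icc] at hn
        exact ⟨by omega, hn.2⟩

theorem sum_insert_powerset_ge {P : Finset ℕ} (hP : ∀ q ∈ P, q.Prime) {g z : ℕ} (hg : g ∈ P) :
    1 / ((g : ℝ) - 1) * ∑ Q ∈ (P.erase g).powerset with ∏ q ∈ Q, q ≤ z / g,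
      ∏ q ∈ Q, 1 / ((q : ℝ) - 1) ≤
    ∑ Q ∈ P.powerset with ∏ q ∈ Q, q ≤ z, if g ∈ Q then ∏ q ∈ Q, 1 / ((q : ℝ) - 1) else 0 := by
  classical
  have hnn : ∀ Q ⊆ P, 0 ≤ ∏ q ∈ Q, 1 / ((q : ℝ) - 1) := fun Q hQ =>
    Finset.prod_nonneg fun q hq => by
      have : (1 : ℝ) < q := by exact_mod_cast (hP q (hQ hq)).one_lt
      exact div_nonneg zero_le_one (by linarith)
  rw [Finset.mul_sum, ← Finset.sum_filter]
  have hnot : ∀ Q ∈ (P.erase g).powerset, g ∉ Q := fun Q hQ h => by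
    have := Finset.mem_powerset.mp hQ h
    simp at this
  have h1 : ∑ Q ∈ (P.erase g).powerset with ∏ q ∈ Q, q ≤ z / g,
      1 / ((g : ℝ) - 1) * ∏ q ∈ Q, 1 / ((q : ℝ) - 1) =
      ∑ Q ∈ ((P.erase g).powerset.filter (fun Q => ∏ q ∈ Q, q ≤ z / g)).image (insert g),
        ∏ q ∈ Q, 1 / ((q : ℝ) - 1) := by
    rw [Finset.sum_image]
    · refine Finset.sum_congr rfl fun Q hQ => ?_
      rw [Finset.prod_insert (hnot Q (Finset.mem_filter.mp hQ).1)]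
    · intro Q hQ Q' hQ' h
      have h1 := hnot Q (Finset.mem_filter.mp hQ).1
      have h2 := hnot Q' (Finset.mem_filter.mp hQ').1
      rw [← Finset.erase_insert h1, h, Finset.erase_insert h2]
  rw [h1]
  refine Finset.sum_le_sum_of_subset_of_nonneg ?_ ?_
  · intro Q hQ
    obtain ⟨Q', hQ', rfl⟩ := Finset.mem_image.mp hQ
    rw [Finset.mem_filter] at hQ'
    have h1 := hnot Q' hQ'.1
    simp only [Finset.mem_filter, Finset.mem_powerset, Finset.mem_insert_self, and_true]
    refine ⟨?_, ?_⟩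
    · refine Finset.insert_subset hg ((Finset.mem_powerset.mp hQ'.1).trans
        (Finset.erase_subset _ _))
    · rw [Finset.prod_insert h1]
      calc g * ∏ q ∈ Q', q ≤ g * (z / g) := Nat.mul_le_mul_left _ hQ'.2
        _ ≤ z := Nat.mul_div_le z g
  · intro Q hQ _
    simp only [Finset.mem_filter, Finset.mem_powerset] at hQ
    exact hnn Q hQ.1.1

/-- Upper bound sieve for primes `p ≡ -9 (mod m)` with cofactor `(p + 9) / m` free of primes
from a set `G`. -/
theorem card_mul_log_le_of_sieve {m z N : ℕ} (hm : 0 < m) (hz : 1 < z) (G : Finset ℕ)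
    (hG : ∀ g ∈ G, g.Prime ∧ 3 < g ∧ g * g ≤ z ∧ ¬ g ∣ m)
    (hr : ∑ r ∈ m.primeFactors, 1 / (r : ℝ) ≤ 1 / 4) (S : Finset ℕ) (hS : S ⊆ Finset.range N)
    (hSp : ∀ k ∈ S, ∃ p : ℕ, p.Prime ∧ z < p ∧ p + 9 = m * k)
    (hSG : ∀ k ∈ S, ∀ g ∈ G, ¬ g ∣ k) :
    (S.card : ℝ) * (1 / 4 * Real.log z * (1 + ∑ g ∈ G, 1 / (g : ℝ))) ≤
      5 * (N + (z : ℝ) ^ 2 + 1) := by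
  classical
  set P := (Finset.Icc 1 z).filter (fun q => q.Prime ∧ ¬ q ∣ m) with hPdef
  have hmemP : ∀ q, q ∈ P ↔ (1 ≤ q ∧ q ≤ z) ∧ q.Prime ∧ ¬ q ∣ m := by
    intro q; rw [hPdef, Finset.mem_filter, Finset.mem_Icc]
  have hP : ∀ q ∈ P, q.Prime := fun q hq => ((hmemP q).mp hq).2.1
  have hGP : ∀ g ∈ G, g ∈ P := fun g hg => by
    obtain ⟨h1, h2, h3, h4⟩ := hG g hg
    exact (hmemP g).mpr ⟨⟨h1.one_lt.le, le_trans (Nat.le_mul_of_pos_left g h1.pos) h3⟩, h1, h4⟩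
  set w : ℕ → ℕ := fun q => if q ∈ G then 2 else 1 with hw
  set R : ℕ → Finset ℕ := fun q => (Finset.range q).filter
    (fun ρ => ¬ (m * ρ ≡ 9 [MOD q]) ∧ (q ∈ G → ρ ≠ 0)) with hR
  have hwq : ∀ q ∈ P, w q < q := by
    intro q hq
    simp only [hw]
    split_ifs with h
    · have := (hG q h).2.1; omega
    · exact (hP q hq).one_lt
  have hcard : ∀ q ∈ P, (R q).card + w q ≤ q := by
    intro q hq
    obtain ⟨-, hqp, hqm⟩ := (hmemP q).mp hq
    have hcop : Nat.Coprime m q := ((Nat.Prime.coprime_iff_not_dvd hqp).mpr hqm).symm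
    obtain ⟨ρ, hρ, hρ9⟩ : ∃ ρ < q, m * ρ ≡ 9 [MOD q] := by
      obtain ⟨y, -, hy⟩ := Nat.exists_mul_mod_eq_one_of_coprime hcop hqp.one_lt
      refine ⟨(y * 9) % q, Nat.mod_lt _ hqp.pos, ?_⟩
      have h1 : m * y ≡ 1 [MOD q] := by
        rw [Nat.ModEq, hy, Nat.mod_eq_of_lt hqp.one_lt]
      calc m * (y * 9 % q) ≡ m * (y * 9) [MOD q] := (Nat.mod_modEq _ _).mul_left _
        _ = m * y * 9 := by ring
        _ ≡ 1 * 9 [MOD q] := h1.mul_right _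
    have hcompl : (R q).card + ((Finset.range q).filter
      (fun ρ => ¬ (¬ (m * ρ ≡ 9 [MOD q]) ∧ (q ∈ G → ρ ≠ 0)))).card = q := by
      have := Finset.card_filter_add_card_filter_not (s := Finset.range q)
        (fun ρ => ¬ (m * ρ ≡ 9 [MOD q]) ∧ (q ∈ G → ρ ≠ 0))
      rw [Finset.card_range] at this
      exact this
    have hle : w q ≤ ((Finset.range q).filter
      (fun ρ => ¬ (¬ (m * ρ ≡ 9 [MOD q]) ∧ (q ∈ G → ρ ≠ 0)))).card := by
      simp only [hw]
      split_ifs with h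
      · have hρ0 : ρ ≠ 0 := by
          rintro rfl
          have h9 : q ∣ 9 := (Nat.modEq_zero_iff_dvd.mp (by simpa using hρ9.symm))
          have h3 : q ∣ 3 := hqp.dvd_of_dvd_pow (show q ∣ 3 ^ 2 from h9)
          have := Nat.le_of_dvd (by norm_num) h3
          have := (hG q h).2.1
          omega
        rw [← Finset.card_pair hρ0]
        refine Finset.card_le_card fun x hx => ?_
        rw [Finset.mem_insert, Finset.mem_singleton] at hx
        rw [Finset.mem_filter, Finset.mem_range]
        rcases hx with rfl | rfl
        · exact ⟨hρ, fun hh => hh.1 hρ9⟩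
        · exact ⟨hqp.pos, fun hh => hh.2 h rfl⟩
      · rw [Nat.one_le_iff_ne_zero, ← Nat.pos_iff_ne_zero, Finset.card_pos]
        exact ⟨ρ, Finset.mem_filter.mpr ⟨Finset.mem_range.mpr hρ, fun hh => hh.1 hρ9⟩⟩
    omega
  have hSR : ∀ q ∈ P, ∀ n ∈ S, n % q ∈ R q := by
    intro q hq n hn
    obtain ⟨⟨-, hqz⟩, hqp, hqm⟩ := (hmemP q).mp hq
    obtain ⟨p, hp, hzp, hpm⟩ := hSp n hn
    rw [hR, Finset.mem_filter, Finset.mem_range]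
    refine ⟨Nat.mod_lt _ hqp.pos, fun h => ?_, fun hqG h => ?_⟩
    · have h1 : m * n ≡ 9 [MOD q] := ((Nat.mod_modEq n q).mul_left m).symm.trans h
      rw [← hpm] at h1
      have h2 : p ≡ 0 [MOD q] := Nat.ModEq.add_right_cancel' 9 (by simpa using h1)
      have h3 := (Nat.prime_dvd_prime_iff_eq hqp hp).mp (Nat.modEq_zero_iff_dvd.mp h2)
      omega
    · exact hSG n hn q hqG (Nat.dvd_of_mod_eq_zero h)
  have hz0 : (0 : ℝ) < z := by exact_mod_cast (show 0 < z by omega)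
  have hmain := arithmetic_large_sieve P hP w hwq S N hS R
    (fun q _ => Finset.filter_subset _ _) hcard hSR hz0
  refine le_trans (mul_le_mul_of_nonneg_left ?_ (by positivity)) hmain
  simp only [Nat.cast_le]
  set F : Finset ℕ → ℝ := fun Q => ∏ q ∈ Q, 1 / ((q : ℝ) - 1) with hF
  have hFnn : ∀ Q ⊆ P, 0 ≤ F Q := fun Q hQ =>
    Finset.prod_nonneg fun q hq => by
      have : (1 : ℝ) < q := by exact_mod_cast (hP q (hQ hq)).one_lt
      exact div_nonneg zero_le_one (by linarith)
  have hterm : ∀ Q ∈ P.powerset.filter (fun Q => ∏ q ∈ Q, q ≤ z),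
      F Q + ∑ g ∈ G, (if g ∈ Q then F Q else 0) ≤ ∏ q ∈ Q, (w q : ℝ) / ((q : ℝ) - w q) := by
    intro Q hQ
    have hQP := Finset.mem_powerset.mp (Finset.mem_filter.mp hQ).1
    have h1 : F Q * ∏ q ∈ Q, (w q : ℝ) ≤ ∏ q ∈ Q, (w q : ℝ) / ((q : ℝ) - w q) := by
      rw [hF, ← Finset.prod_mul_distrib]
      refine Finset.prod_le_prod (fun q hq => ?_) fun q hq => ?_
      · have : (1 : ℝ) < q := by exact_mod_cast (hP q (hQP hq)).one_lt
        exact mul_nonneg (div_nonneg zero_le_one (by linarith)) (by positivity)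
      · have h2 : (w q : ℝ) < q := by exact_mod_cast hwq q (hQP hq)
        have h3 : (1 : ℝ) ≤ w q := by
          have : 1 ≤ w q := by simp only [hw]; split_ifs <;> norm_num
          exact_mod_cast this
        rw [one_div_mul_eq_div]
        exact div_le_div_of_nonneg_left (by linarith) (by linarith) (by linarith)
    refine le_trans ?_ h1
    rw [← Finset.sum_filter, Finset.sum_const, nsmul_eq_mul]
    have h2 : ∏ q ∈ Q, (w q : ℝ) = 2 ^ (G.filter (· ∈ Q)).card := by
      have : ∏ q ∈ Q, w q = 2 ^ (G.filter (· ∈ Q)).card := by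
        simp only [hw]
        rw [Finset.prod_ite, Finset.prod_const, Finset.prod_const_one, mul_one]
        congr 2
        ext x
        simp [and_comm]
      exact_mod_cast this
    rw [h2]
    have h3 : 1 + ((G.filter (· ∈ Q)).card : ℝ) ≤ 2 ^ (G.filter (· ∈ Q)).card := by
      have := one_add_mul_le_pow (show (-2 : ℝ) ≤ 1 by norm_num) (G.filter (· ∈ Q)).card
      norm_num at this
      exact this
    nlinarith [hFnn Q hQP]
  refine le_trans ?_ (Finset.sum_le_sum hterm)
  rw [Finset.sum_add_distrib, Finset.sum_comm, mul_add, mul_one]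
  have hlogz : 0 ≤ Real.log z := Real.log_natCast_nonneg z
  refine add_le_add ?_ ?_
  · refine le_trans ?_ (half_log_le_sum_prod P z m hm.ne' hP
      (fun q hq hqz hqm => (hmemP q).mpr ⟨⟨hq.one_lt.le, hqz⟩, hq, hqm⟩) (hr.trans (by norm_num)))
    have : Real.log z ≤ Real.log (z + 1) := Real.log_le_log hz0 (by linarith)
    linarith
  · rw [Finset.mul_sum]
    refine Finset.sum_le_sum fun g hg => ?_
    obtain ⟨hgp, hg3, hgz, hgm⟩ := hG g hg
    refine le_trans ?_ (sum_insert_powerset_ge hP (hGP g hg))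
    have hg1 : (1 : ℝ) < g := by exact_mod_cast hgp.one_lt
    have hg5 : (4 : ℝ) ≤ g := by exact_mod_cast hg3
    have hlog := half_log_le_sum_prod (P.erase g) (z / g) (m * g) (Nat.mul_pos hm hgp.pos).ne'
      (fun q hq => hP q (Finset.mem_of_mem_erase hq))
      (fun q hq hqz hqm => by
        refine Finset.mem_erase.mpr ⟨?_, (hmemP q).mpr
            ⟨⟨hq.one_lt.le, hqz.trans (Nat.div_le_self _ _)⟩,
          hq, fun h => hqm (h.mul_right g)⟩⟩
        rintro rfl
        exact hqm (dvd_mul_left _ _))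
      (by
        rw [Nat.primeFactors_mul hm.ne' hgp.ne_zero, hgp.primeFactors]
        rw [Finset.sum_union (Finset.disjoint_singleton_right.mpr
          fun h => hgm (Nat.dvd_of_mem_primeFactors h)), Finset.sum_singleton]
        have : 1 / (g : ℝ) ≤ 1 / 4 := one_div_le_one_div_of_le (by norm_num) hg5
        linarith)
    have hlog2 : 1 / 2 * Real.log z ≤ Real.log (((z / g : ℕ) : ℝ) + 1) := by
      have h1 : (z : ℝ) / g < ((z / g : ℕ) : ℝ) + 1 := by
        rw [← Nat.floor_div_eq_div (K := ℝ)]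
        exact Nat.lt_floor_add_one _
      have h2 : Real.log z ≤ 2 * Real.log ((z : ℝ) / g) := by
        rw [show (2 : ℝ) * Real.log ((z : ℝ) / g) = Real.log (((z : ℝ) / g) ^ 2) by
          rw [Real.log_pow]; norm_num]
        refine Real.log_le_log hz0 ?_
        rw [div_pow, le_div_iff₀ (by positivity), sq, sq]
        have : (g : ℝ) * g ≤ z := by exact_mod_cast hgz
        gcongr
      have h3 := Real.log_le_log (by positivity) h1.le
      linarith
    calc 1 / 4 * Real.log z * (1 / (g : ℝ)) ≤ 1 / 4 * Real.log z * (1 / ((g : ℝ) - 1)) := by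
          have : 1 / (g : ℝ) ≤ 1 / ((g : ℝ) - 1) :=
            one_div_le_one_div_of_le (by linarith) (by linarith)
          gcongr
      _ = 1 / ((g : ℝ) - 1) * (1 / 4 * Real.log z) := by ring
      _ ≤ _ := by
          refine mul_le_mul_of_nonneg_left (le_trans ?_ hlog) (div_nonneg zero_le_one (by linarith))
          linarith

theorem reducedResidues_prime {r : ℕ} (hr : r.Prime) :
    reducedResidues r = (Finset.range r).erase 0 := by
  ext b
  simp only [reducedResidues, Finset.mem_filter, Finset.mem_range, Finset.mem_erase]
  constructor
  · rintro ⟨h1, h2⟩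
    refine ⟨?_, h1⟩
    rintro rfl
    rw [Nat.coprime_zero_left] at h2
    exact hr.one_lt.ne' h2
  · rintro ⟨h1, h2⟩
    exact ⟨h2, Nat.Coprime.symm ((Nat.Prime.coprime_iff_not_dvd hr).mpr
      (Nat.not_dvd_of_pos_of_lt (Nat.pos_of_ne_zero h1) h2))⟩

theorem variance_residues_eq {r : ℕ} (hr : r.Prime) (a : ℕ → ℝ) (N : ℕ) :
    r * ∑ ρ ∈ Finset.range r, (∑ n ∈ Finset.range N with n % r = ρ, a n -
        (∑ n ∈ Finset.range N, a n) / r) ^ 2 =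
      ∑ b ∈ reducedResidues r,
        ‖∑ n ∈ Finset.range N, (a n : ℂ) * addExp (n * ((b : ℝ) / r))‖ ^ 2 := by
  have h := sum_sq_norm_exp_sum_eq (Finset.range N) (fun n => (a n : ℂ)) r hr.pos
  rw [reducedResidues_prime hr]
  have hr0 : (r : ℝ) ≠ 0 := by exact_mod_cast hr.ne_zero
  have h0 := Finset.add_sum_erase (Finset.range r)
    (fun c : ℕ => ‖∑ n ∈ Finset.range N, (a n : ℂ) * addExp (n * ((c : ℝ) / r))‖ ^ 2)
    (Finset.mem_range.mpr hr.pos)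
  have hz : ‖∑ n ∈ Finset.range N, (a n : ℂ) * addExp (n * (((0 : ℕ) : ℝ) / r))‖ ^ 2 =
      (∑ n ∈ Finset.range N, a n) ^ 2 := by
    simp only [Nat.cast_zero, zero_div, mul_zero, addExp_zero, mul_one]
    rw [← Complex.ofReal_sum, Complex.norm_real, Real.norm_eq_abs, sq_abs]
  have hA : ∀ ρ, ‖∑ n ∈ Finset.range N with n % r = ρ, (a n : ℂ)‖ ^ 2 =
      (∑ n ∈ Finset.range N with n % r = ρ, a n) ^ 2 := fun ρ => by
    rw [← Complex.ofReal_sum, Complex.norm_real, Real.norm_eq_abs, sq_abs]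
  simp only [hz] at h0
  rw [h] at h0
  simp only [hA] at h0
  have hS : ∑ ρ ∈ Finset.range r, ∑ n ∈ Finset.range N with n % r = ρ, a n =
      ∑ n ∈ Finset.range N, a n :=
    Finset.sum_fiberwise_of_maps_to (fun n _ => Finset.mem_range.mpr (Nat.mod_lt _ hr.pos)) _
  set S := ∑ n ∈ Finset.range N, a n
  have : ∑ ρ ∈ Finset.range r, (∑ n ∈ Finset.range N with n % r = ρ, a n - S / r) ^ 2 =
      ∑ ρ ∈ Finset.range r, (∑ n ∈ Finset.range N with n % r = ρ, a n) ^ 2 - S ^ 2 / r := by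
    simp_rw [sub_sq]
    rw [Finset.sum_add_distrib, Finset.sum_sub_distrib, ← Finset.sum_mul, ← Finset.mul_sum, hS,
      Finset.sum_const, Finset.card_range, nsmul_eq_mul]
    field_simp
    ring
  rw [this, mul_sub, ← h0]
  field_simp
  ring

theorem sum_variance_residues_le (T : Finset ℕ) {R z : ℝ} (hR : 0 < R)
    (hT : ∀ r ∈ T, r.Prime ∧ R ≤ r ∧ (r : ℝ) ≤ z) (a : ℕ → ℝ) (N : ℕ) (hz : 0 < z) :
    ∑ r ∈ T, ∑ ρ ∈ Finset.range r, (∑ n ∈ Finset.range N with n % r = ρ, a n -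
        (∑ n ∈ Finset.range N, a n) / r) ^ 2 ≤
      5 / R * (N + z ^ 2 + 1) * ∑ n ∈ Finset.range N, a n ^ 2 := by
  have h := large_sieve_farey T (fun D hD => ⟨(hT D hD).1.pos, (hT D hD).2.2⟩) hz
    (fun n => (a n : ℂ)) N
  simp only [Complex.norm_real, Real.norm_eq_abs, sq_abs] at h
  rw [div_mul_eq_mul_div, div_mul_eq_mul_div, le_div_iff₀ hR]
  refine le_trans ?_ h
  rw [mul_comm, Finset.mul_sum]
  refine Finset.sum_le_sum fun r hr => ?_
  rw [← variance_residues_eq (hT r hr).1]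
  exact mul_le_mul_of_nonneg_right (hT r hr).2.1 (Finset.sum_nonneg fun _ _ => sq_nonneg _)

/-- The sum of `α` over the first `N` terms of the progression `a mod u` lying in the class `x`
modulo `r`. -/
noncomputable def resSum (α : ℕ → ℝ) (u a N r : ℕ) (x : ZMod r) : ℝ :=
  ∑ k ∈ Finset.range N, if ((a + u * k : ℕ) : ZMod r) = x then α (a + u * k) else 0

theorem sum_resSum_sub_sq {r u : ℕ} (hr : r.Prime) (hu : ¬ r ∣ u) (α : ℕ → ℝ) (a N : ℕ) (c : ℝ)
    [NeZero r] :
    ∑ x : ZMod r, (resSum α u a N r x - c) ^ 2 =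
      ∑ ρ ∈ Finset.range r, (∑ k ∈ Finset.range N with k % r = ρ, α (a + u * k) - c) ^ 2 := by
  have : Fact r.Prime := ⟨hr⟩
  have hu0 : (u : ZMod r) ≠ 0 := by rwa [Ne, ZMod.natCast_eq_zero_iff]
  have key : ∀ k ρ : ℕ, ((a + u * k : ℕ) : ZMod r) = ((a + u * ρ : ℕ) : ZMod r) ↔
      k % r = ρ % r := by
    intro k ρ
    push_cast
    rw [add_right_inj, mul_right_inj' hu0, ZMod.natCast_eq_natCast_iff']
  symm
  refine Finset.sum_nbij (fun ρ => ((a + u * ρ : ℕ) : ZMod r)) (fun _ _ => Finset.mem_univ _)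
    ?_ ?_ ?_
  · intro k hk ρ hρ h
    have := (key k ρ).mp h
    rwa [Nat.mod_eq_of_lt (Finset.mem_range.mp hk), Nat.mod_eq_of_lt (Finset.mem_range.mp hρ)]
      at this
  · intro x _
    refine ⟨((x - a) * (u : ZMod r)⁻¹).val, Finset.mem_coe.mpr (Finset.mem_range.mpr
      (ZMod.val_lt _)), ?_⟩
    simp only [Nat.cast_add, Nat.cast_mul, ZMod.natCast_val, ZMod.cast_id', id]
    field_simp
    ring
  · intro ρ hρ
    rw [resSum, Finset.sum_filter]
    congr 2
    refine Finset.sum_congr rfl fun k _ => ?_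
    simp only [key, Nat.mod_eq_of_lt (Finset.mem_range.mp hρ)]

/-- The indicator of `x y = c` in `ZMod r` minus its average over the nonzero classes. -/
noncomputable def hypKernel (r : ℕ) (c x y : ZMod r) : ℝ :=
  (if x * y = c then 1 else 0) - (if x * y = 0 then 0 else 1 / ((r : ℝ) - 1))

theorem hypKernel_comm (r : ℕ) (c x y : ZMod r) : hypKernel r c x y = hypKernel r c y x := by
  rw [hypKernel, hypKernel, mul_comm]

theorem sum_hypKernel_mul {r : ℕ} [Fact r.Prime] {c : ZMod r} (hc : c ≠ 0) (B : ZMod r → ℝ)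
    (x : ZMod r) : ∑ y, hypKernel r c x y * B y =
      if x = 0 then 0 else B (c * x⁻¹) - (∑ y with y ≠ 0, B y) / ((r : ℝ) - 1) := by
  split_ifs with hx
  · refine Finset.sum_eq_zero fun y _ => ?_
    simp [hypKernel, hx, hc.symm]
  · simp only [hypKernel, sub_mul, Finset.sum_sub_distrib]
    congr 1
    · rw [Finset.sum_eq_single (c * x⁻¹)]
      · rw [if_pos (by field_simp), one_mul]
      · intro y _ hy
        rw [if_neg, zero_mul]
        rintro rfl
        apply hy
        field_simp
      · simp
    · rw [Finset.sum_filter, Finset.sum_div]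
      refine Finset.sum_congr rfl fun y _ => ?_
      by_cases hy : y = 0
      · simp [hy]
      · simp [hy, hx, div_eq_inv_mul]

theorem card_filter_ne_zero {r : ℕ} [Fact r.Prime] :
    (((Finset.univ : Finset (ZMod r)).filter (· ≠ 0)).card : ℝ) = (r : ℝ) - 1 := by
  rw [Finset.filter_ne', Finset.card_erase_of_mem (Finset.mem_univ _), Finset.card_univ, ZMod.card,
    Nat.cast_sub (Fact.out (p := r.Prime)).one_lt.le, Nat.cast_one]

theorem sum_hypKernel {r : ℕ} [Fact r.Prime] {c : ZMod r} (hc : c ≠ 0) (x : ZMod r) :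
    ∑ y, hypKernel r c x y = 0 := by
  have h := sum_hypKernel_mul hc (fun _ => 1) x
  simp only [mul_one] at h
  rw [h, Finset.sum_const, nsmul_eq_mul, mul_one, card_filter_ne_zero]
  have : (1 : ℝ) < r := by exact_mod_cast (Fact.out (p := r.Prime)).one_lt
  rw [div_self (by linarith)]
  simp

theorem abs_sum_hypKernel_le {r : ℕ} [Fact r.Prime] {c : ZMod r} (hc : c ≠ 0)
    (A B : ZMod r → ℝ) (s t : ℝ) :
    |∑ x, ∑ y, A x * B y * hypKernel r c x y| ≤
      √(∑ x, (A x - s) ^ 2) * √(∑ y, (B y - t) ^ 2) := by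
  have h1 : ∑ x, ∑ y, A x * B y * hypKernel r c x y =
      ∑ x, ∑ y, (A x - s) * (B y - t) * hypKernel r c x y := by
    have e1 : ∑ x, ∑ y, A x * t * hypKernel r c x y = 0 :=
      Finset.sum_eq_zero fun x _ => by rw [← Finset.mul_sum, sum_hypKernel hc, mul_zero]
    have e2 : ∑ x, ∑ y, s * (B y - t) * hypKernel r c x y = 0 := by
      rw [Finset.sum_comm]
      refine Finset.sum_eq_zero fun y _ => ?_
      simp_rw [hypKernel_comm r c _ y]
      rw [← Finset.mul_sum, sum_hypKernel hc, mul_zero]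
    have : ∀ x y, (A x - s) * (B y - t) * hypKernel r c x y = A x * B y * hypKernel r c x y -
        A x * t * hypKernel r c x y - s * (B y - t) * hypKernel r c x y := fun x y => by ring
    simp_rw [this, Finset.sum_sub_distrib, e1, e2, sub_zero]
  rw [h1]
  set A' := fun x => A x - s
  set B' := fun y => B y - t
  set Z := (Finset.univ : Finset (ZMod r)).filter (· ≠ 0)
  set β := (∑ y ∈ Z, B' y) / ((r : ℝ) - 1) with hβ
  have hr1 : (0 : ℝ) < (r : ℝ) - 1 := by
    have : (1 : ℝ) < r := by exact_mod_cast (Fact.out (p := r.Prime)).one_lt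
    linarith
  have h2 : ∑ x, ∑ y, A' x * B' y * hypKernel r c x y = ∑ x ∈ Z, A' x * (B' (c * x⁻¹) - β) := by
    rw [Finset.sum_filter]
    refine Finset.sum_congr rfl fun x _ => ?_
    have : ∀ y, A' x * B' y * hypKernel r c x y = A' x * (hypKernel r c x y * B' y) :=
      fun y => by ring
    simp_rw [this, ← Finset.mul_sum, sum_hypKernel_mul hc B' x]
    by_cases hx : x = 0 <;> simp [hx, β, Z]
  rw [h2]
  refine (Finset.abs_sum_le_sum_abs _ _).trans ?_
  simp_rw [abs_mul]
  refine (Real.sum_mul_le_sqrt_mul_sqrt _ _ _).trans ?_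
  simp_rw [sq_abs]
  refine mul_le_mul (Real.sqrt_le_sqrt ?_) (Real.sqrt_le_sqrt ?_) (Real.sqrt_nonneg _)
    (Real.sqrt_nonneg _)
  · exact Finset.sum_le_sum_of_subset_of_nonneg (Finset.filter_subset _ _)
      fun _ _ _ => sq_nonneg _
  · have h3 : ∑ x ∈ Z, (B' (c * x⁻¹) - β) ^ 2 = ∑ y ∈ Z, (B' y - β) ^ 2 := by
      refine Finset.sum_nbij' (fun x => c * x⁻¹) (fun y => c * y⁻¹) ?_ ?_ ?_ ?_ ?_
      · intro x hx
        simp only [Z, Finset.mem_filter, Finset.mem_univ, true_and] at hx ⊢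
        exact mul_ne_zero hc (inv_ne_zero hx)
      · intro x hx
        simp only [Z, Finset.mem_filter, Finset.mem_univ, true_and] at hx ⊢
        exact mul_ne_zero hc (inv_ne_zero hx)
      · intro x hx
        simp only [Z, Finset.mem_filter, Finset.mem_univ, true_and] at hx
        field_simp
      · intro x hx
        simp only [Z, Finset.mem_filter, Finset.mem_univ, true_and] at hx
        field_simp
      · intro x _
        rfl
    have h4 : ∑ y ∈ Z, (B' y - β) ^ 2 = ∑ y ∈ Z, B' y ^ 2 - ((r : ℝ) - 1) * β ^ 2 := by
      have e3 : ∑ y ∈ Z, B' y = ((r : ℝ) - 1) * β := by rw [hβ]; field_simp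
      simp_rw [sub_sq]
      rw [Finset.sum_add_distrib, Finset.sum_sub_distrib, ← Finset.sum_mul, ← Finset.mul_sum,
        Finset.sum_const, nsmul_eq_mul, card_filter_ne_zero, e3]
      ring
    rw [h3, h4]
    have h5 : ∑ y ∈ Z, B' y ^ 2 ≤ ∑ y, B' y ^ 2 :=
      Finset.sum_le_sum_of_subset_of_nonneg (Finset.filter_subset _ _) fun _ _ _ => sq_nonneg _
    have := mul_nonneg hr1.le (sq_nonneg β)
    linarith

theorem sum_range_mul_eq {M : Type*} [AddCommMonoid M] (f : ℕ → M) (u N : ℕ) :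
    ∑ k ∈ Finset.range (u * N), f k =
      ∑ a ∈ Finset.range u, ∑ k ∈ Finset.range N, f (a + u * k) := by
  induction N with
  | zero => simp
  | succ N ih =>
    rw [Nat.mul_succ, Finset.sum_range_add, ih, ← Finset.sum_add_distrib]
    refine Finset.sum_congr rfl fun a _ => ?_
    rw [Finset.sum_range_succ, add_comm a (u * N)]

/-- Indicator of `n ≡ -9` modulo `u r`, minus its average over the reduced classes modulo `r` lying
in the class `-9` modulo `u`. -/
noncomputable def shiftDisc (u r n : ℕ) : ℝ :=
  if u ∣ n + 9 then (if r ∣ n + 9 then 1 else 0) - (if r ∣ n then 0 else 1 / ((r : ℝ) - 1)) else 0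

theorem shiftDisc_mul_eq {u r k l : ℕ} (h : u ∣ k * l + 9) :
    shiftDisc u r (k * l) = hypKernel r (-9) k l := by
  have e1 : (r ∣ k * l + 9) ↔ ((k : ZMod r) * (l : ZMod r) = -9) := by
    rw [← ZMod.natCast_eq_zero_iff, eq_neg_iff_add_eq_zero]
    push_cast
    rfl
  have e2 : (r ∣ k * l) ↔ ((k : ZMod r) * (l : ZMod r) = 0) := by
    rw [← ZMod.natCast_eq_zero_iff]
    push_cast
    rfl
  rw [shiftDisc, if_pos h, hypKernel]
  simp only [e1, e2]

theorem sum_sum_comm_sum_sum {ι κ M : Type*} [AddCommMonoid M] (s t : Finset ι) (s' t' : Finset κ)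
    (F : ι → ι → κ → κ → M) :
    ∑ k ∈ s, ∑ l ∈ t, ∑ x ∈ s', ∑ y ∈ t', F k l x y =
      ∑ x ∈ s', ∑ y ∈ t', ∑ k ∈ s, ∑ l ∈ t, F k l x y := by
  calc _ = ∑ k ∈ s, ∑ x ∈ s', ∑ l ∈ t, ∑ y ∈ t', F k l x y :=
        Finset.sum_congr rfl fun _ _ => Finset.sum_comm
    _ = ∑ x ∈ s', ∑ k ∈ s, ∑ l ∈ t, ∑ y ∈ t', F k l x y := Finset.sum_comm
    _ = ∑ x ∈ s', ∑ k ∈ s, ∑ y ∈ t', ∑ l ∈ t, F k l x y :=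
        Finset.sum_congr rfl fun _ _ => Finset.sum_congr rfl fun _ _ => Finset.sum_comm
    _ = _ := Finset.sum_congr rfl fun _ _ => Finset.sum_comm

theorem abs_sum_progression_le {u r : ℕ} (hr : r.Prime) (hu : ¬ r ∣ u) (h9 : ¬ r ∣ 9)
    (α β : ℕ → ℝ) {a b : ℕ} (hab : u ∣ a * b + 9) (N₁ N₂ : ℕ) :
    |∑ k ∈ Finset.range N₁, ∑ l ∈ Finset.range N₂, α (a + u * k) * β (b + u * l) *
        shiftDisc u r ((a + u * k) * (b + u * l))| ≤
      √(∑ ρ ∈ Finset.range r, (∑ k ∈ Finset.range N₁ with k % r = ρ, α (a + u * k) -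
        (∑ k ∈ Finset.range N₁, α (a + u * k)) / r) ^ 2) *
      √(∑ ρ ∈ Finset.range r, (∑ k ∈ Finset.range N₂ with k % r = ρ, β (b + u * k) -
        (∑ k ∈ Finset.range N₂, β (b + u * k)) / r) ^ 2) := by
  have hF : Fact r.Prime := ⟨hr⟩
  have hc : (-9 : ZMod r) ≠ 0 := by
    rw [neg_ne_zero]
    intro h
    exact h9 ((ZMod.natCast_eq_zero_iff 9 r).mp (by exact_mod_cast h))
  rw [← sum_resSum_sub_sq hr hu, ← sum_resSum_sub_sq hr hu]
  refine le_trans (le_of_eq ?_) (abs_sum_hypKernel_le hc _ _ _ _)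
  congr 1
  have hdvd : ∀ k l, u ∣ (a + u * k) * (b + u * l) + 9 := by
    intro k l
    have : (a + u * k) * (b + u * l) + 9 = (a * b + 9) + u * (a * l + k * b + u * k * l) := by ring
    rw [this]
    exact dvd_add hab (dvd_mul_right _ _)
  simp_rw [shiftDisc_mul_eq (hdvd _ _), resSum, Finset.sum_mul_sum, Finset.sum_mul]
  have h1 : ∀ (s : ZMod r) (g : ZMod r → ℝ), ∑ x, (if s = x then g x else 0) = g s :=
    fun s g => by simp
  calc _ = ∑ k ∈ Finset.range N₁, ∑ l ∈ Finset.range N₂, ∑ x : ZMod r, ∑ y : ZMod r,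
        (if ((a + u * k : ℕ) : ZMod r) = x then α (a + u * k) else 0) *
        (if ((b + u * l : ℕ) : ZMod r) = y then β (b + u * l) else 0) * hypKernel r (-9) x y := by
        refine Finset.sum_congr rfl fun k _ => Finset.sum_congr rfl fun l _ => ?_
        simp only [ite_mul, mul_ite, zero_mul, mul_zero, h1]
    _ = _ := by
        rw [sum_sum_comm_sum_sum]

theorem shiftDisc_mul_of_not_dvd {u r a b k l : ℕ} (hab : ¬ u ∣ a * b + 9) :
    shiftDisc u r ((a + u * k) * (b + u * l)) = 0 := by
  rw [shiftDisc, if_neg]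
  intro h
  apply hab
  have : (a + u * k) * (b + u * l) + 9 = (a * b + 9) + u * (a * l + k * b + u * k * l) := by ring
  rw [this] at h
  exact (Nat.dvd_add_left (dvd_mul_right _ _)).mp h

theorem modEq_of_dvd_mul_add {u a b b' : ℕ} (hu9 : u.Coprime 9)
    (h : u ∣ a * b + 9) (h' : u ∣ a * b' + 9) : b ≡ b' [MOD u] := by
  have hcop : u.Coprime a := by
    have hd : u.gcd a ∣ 9 := by
      have h1 : u.gcd a ∣ a * b + 9 := (Nat.gcd_dvd_left u a).trans h
      exact (Nat.dvd_add_right ((Nat.gcd_dvd_right u a).mul_right b)).mp h1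
    exact Nat.eq_one_of_dvd_coprimes hu9 (Nat.gcd_dvd_left u a) hd
  have h1 : a * b + 9 ≡ a * b' + 9 [MOD u] :=
    ((Nat.modEq_zero_iff_dvd.mpr h).trans (Nat.modEq_zero_iff_dvd.mpr h').symm)
  exact Nat.ModEq.cancel_left_of_coprime hcop (Nat.ModEq.add_right_cancel' 9 h1)

theorem eq_of_dvd_mul_add {u a b b' : ℕ} (hu9 : u.Coprime 9) (hb : b < u) (hb' : b' < u)
    (h : u ∣ a * b + 9) (h' : u ∣ a * b' + 9) : b = b' :=
  Nat.ModEq.eq_of_lt_of_lt (modEq_of_dvd_mul_add hu9 h h') hb hb'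

theorem bilinear_dispersion_le (T : Finset ℕ) {R z : ℝ} {u : ℕ} (hR : 0 < R) (hz : 0 < z)
    (hu9 : u.Coprime 9)
    (hT : ∀ r ∈ T, (r.Prime ∧ R ≤ r ∧ (r : ℝ) ≤ z) ∧ ¬ r ∣ u ∧ ¬ r ∣ 9)
    (α β : ℕ → ℝ) (N₁ N₂ : ℕ) :
    ∑ r ∈ T, |∑ k ∈ Finset.range (u * N₁), ∑ l ∈ Finset.range (u * N₂),
        α k * β l * shiftDisc u r (k * l)| ≤
      5 / R * √((N₁ + z ^ 2 + 1) * (N₂ + z ^ 2 + 1)) *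
        √((∑ k ∈ Finset.range (u * N₁), α k ^ 2) * ∑ l ∈ Finset.range (u * N₂), β l ^ 2) := by
  set V : (ℕ → ℝ) → ℕ → ℕ → ℕ → ℝ := fun α N r a =>
    ∑ ρ ∈ Finset.range r, (∑ k ∈ Finset.range N with k % r = ρ, α (a + u * k) -
        (∑ k ∈ Finset.range N, α (a + u * k)) / r) ^ 2 with hV
  have hVnn : ∀ α N r a, 0 ≤ V α N r a := fun α N r a => Finset.sum_nonneg fun _ _ => sq_nonneg _
  set P := (Finset.range u ×ˢ Finset.range u).filter fun x => u ∣ x.1 * x.2 + 9 with hP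
  have h1 : ∀ r ∈ T, |∑ k ∈ Finset.range (u * N₁), ∑ l ∈ Finset.range (u * N₂),
        α k * β l * shiftDisc u r (k * l)| ≤ ∑ x ∈ P, √(V α N₁ r x.1) * √(V β N₂ r x.2) := by
    intro r hr
    simp_rw [sum_range_mul_eq]
    have e : ∑ a ∈ Finset.range u, ∑ k ∈ Finset.range N₁, ∑ b ∈ Finset.range u,
        ∑ l ∈ Finset.range N₂, α (a + u * k) * β (b + u * l) *
          shiftDisc u r ((a + u * k) * (b + u * l)) = ∑ x ∈ P, ∑ k ∈ Finset.range N₁,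
        ∑ l ∈ Finset.range N₂, α (x.1 + u * k) * β (x.2 + u * l) *
          shiftDisc u r ((x.1 + u * k) * (x.2 + u * l)) := by
      rw [hP, Finset.sum_filter, Finset.sum_product]
      refine Finset.sum_congr rfl fun a _ => ?_
      rw [Finset.sum_comm]
      refine Finset.sum_congr rfl fun b _ => ?_
      split_ifs with h
      · rfl
      · exact Finset.sum_eq_zero fun k _ => Finset.sum_eq_zero fun l _ => by
          rw [shiftDisc_mul_of_not_dvd h, mul_zero]
    rw [e]
    refine (Finset.abs_sum_le_sum_abs _ _).trans (Finset.sum_le_sum fun x hx => ?_)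
    exact abs_sum_progression_le (hT r hr).1.1 (hT r hr).2.1 (hT r hr).2.2 α β
      (Finset.mem_filter.mp hx).2 N₁ N₂
  refine (Finset.sum_le_sum h1).trans ?_
  rw [← Finset.sum_product']
  refine (Real.sum_sqrt_mul_sqrt_le _ (fun _ => hVnn _ _ _ _) (fun _ => hVnn _ _ _ _)).trans ?_
  have hsum : ∀ (α : ℕ → ℝ) (N : ℕ), ∑ a ∈ Finset.range u, ∑ r ∈ T, V α N r a ≤
      5 / R * (N + z ^ 2 + 1) * ∑ k ∈ Finset.range (u * N), α k ^ 2 := by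
    intro α N
    rw [sum_range_mul_eq, Finset.mul_sum]
    exact Finset.sum_le_sum fun a _ => sum_variance_residues_le T hR (fun r hr => (hT r hr).1)
      (fun k => α (a + u * k)) N hz
  have hA : ∑ x ∈ T ×ˢ P, V α N₁ x.1 x.2.1 ≤ ∑ a ∈ Finset.range u, ∑ r ∈ T, V α N₁ r a := by
    rw [Finset.sum_product, Finset.sum_comm]
    rw [← Finset.sum_image (s := P) (g := Prod.fst) (f := fun a => ∑ r ∈ T, V α N₁ r a)]
    · refine Finset.sum_le_sum_of_subset_of_nonneg ?_ fun _ _ _ =>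
        Finset.sum_nonneg fun _ _ => hVnn _ _ _ _
      intro a ha
      obtain ⟨x, hx, rfl⟩ := Finset.mem_image.mp ha
      exact (Finset.mem_product.mp (Finset.mem_filter.mp hx).1).1
    · rintro ⟨a, b⟩ hx ⟨a', b'⟩ hy (rfl : a = a')
      rw [Finset.mem_coe, hP, Finset.mem_filter, Finset.mem_product, Finset.mem_range,
        Finset.mem_range] at hx hy
      exact Prod.ext rfl (eq_of_dvd_mul_add hu9 hx.1.2 hy.1.2 hx.2 hy.2)
  have hB : ∑ x ∈ T ×ˢ P, V β N₂ x.1 x.2.2 ≤ ∑ b ∈ Finset.range u, ∑ r ∈ T, V β N₂ r b := by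
    rw [Finset.sum_product, Finset.sum_comm]
    rw [← Finset.sum_image (s := P) (g := Prod.snd) (f := fun a => ∑ r ∈ T, V β N₂ r a)]
    · refine Finset.sum_le_sum_of_subset_of_nonneg ?_ fun _ _ _ =>
        Finset.sum_nonneg fun _ _ => hVnn _ _ _ _
      intro a ha
      obtain ⟨x, hx, rfl⟩ := Finset.mem_image.mp ha
      exact (Finset.mem_product.mp (Finset.mem_filter.mp hx).1).2
    · rintro ⟨b, a⟩ hx ⟨b', a'⟩ hy (rfl : a = a')
      rw [Finset.mem_coe, hP, Finset.mem_filter, Finset.mem_product, Finset.mem_range,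
        Finset.mem_range] at hx hy
      refine Prod.ext (eq_of_dvd_mul_add (a := a) hu9 hx.1.1 hy.1.1 ?_ ?_) rfl
      · rw [mul_comm]; exact hx.2
      · rw [mul_comm]; exact hy.2
  have hA' := hA.trans (hsum α N₁)
  have hB' := hB.trans (hsum β N₂)
  have hsA : 0 ≤ ∑ k ∈ Finset.range (u * N₁), α k ^ 2 := Finset.sum_nonneg fun _ _ => sq_nonneg _
  have hsB : 0 ≤ ∑ k ∈ Finset.range (u * N₂), β k ^ 2 := Finset.sum_nonneg fun _ _ => sq_nonneg _
  refine (mul_le_mul (Real.sqrt_le_sqrt hA') (Real.sqrt_le_sqrt hB') (Real.sqrt_nonneg _)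
    (Real.sqrt_nonneg _)).trans (le_of_eq ?_)
  rw [← Real.sqrt_mul (by positivity),
    mul_assoc (5 / R) (√((N₁ + z ^ 2 + 1) * (N₂ + z ^ 2 + 1))), ← Real.sqrt_mul (by positivity),
    show (5 / R * (N₁ + z ^ 2 + 1) * ∑ k ∈ Finset.range (u * N₁), α k ^ 2) *
      (5 / R * (N₂ + z ^ 2 + 1) * ∑ k ∈ Finset.range (u * N₂), β k ^ 2) = (5 / R) ^ 2 *
      ((N₁ + z ^ 2 + 1) * (N₂ + z ^ 2 + 1) * ((∑ k ∈ Finset.range (u * N₁), α k ^ 2) *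
        ∑ l ∈ Finset.range (u * N₂), β l ^ 2)) by ring,
    Real.sqrt_mul (sq_nonneg _), Real.sqrt_sq (by positivity)]

theorem rectangle_dispersion_le (T : Finset ℕ) {R : ℝ} {u U X : ℕ} (hR : 1 ≤ R) (hu : 0 < u)
    (hu9 : u.Coprime 9) (hU : 0 < U)
    (hT : ∀ r ∈ T, (r.Prime ∧ R ≤ r ∧ (r : ℝ) ≤ 4 * R) ∧ ¬ r ∣ u ∧ ¬ r ∣ 9)
    {α β : ℕ → ℝ} {Lg : ℝ} (hα : ∀ k, |α k| ≤ 1) (hβ : ∀ l ≤ X, |β l| ≤ Lg)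
    (A B : Finset ℕ) {x : ℝ} (hA : ∀ k ∈ A, U < k ∧ (k : ℝ) ≤ x)
    (hB : ∀ l ∈ B, U < l ∧ (l : ℝ) * x ≤ X) :
    ∑ r ∈ T, |∑ k ∈ A, ∑ l ∈ B, α k * β l * shiftDisc u r (k * l)| ≤
      Lg * (5 * X / (u * R) + 30 * X / √U + 90 * R * √X) := by
  have hLg : 0 ≤ Lg := (abs_nonneg _).trans (hβ 0 (Nat.zero_le _))
  rcases A.eq_empty_or_nonempty with rfl | ⟨k₀, hk₀⟩
  · simp only [Finset.sum_empty, abs_zero, Finset.sum_const_zero]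
    positivity
  rcases B.eq_empty_or_nonempty with rfl | ⟨l₀, hl₀⟩
  · simp only [Finset.sum_empty, abs_zero, Finset.sum_const_zero]
    positivity
  have hu' : (0 : ℝ) < u := by exact_mod_cast hu
  have hu1 : (1 : ℝ) ≤ u := by exact_mod_cast hu
  have hU' : (0 : ℝ) < U := by exact_mod_cast hU
  have hUx : (U : ℝ) ≤ x := by
    have : (U : ℝ) < k₀ := by exact_mod_cast (hA k₀ hk₀).1
    linarith [(hA k₀ hk₀).2]
  have hx : 0 < x := by linarith
  have hxU : U * x ≤ X := by
    have : (U : ℝ) ≤ l₀ := by exact_mod_cast (hB l₀ hl₀).1.le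
    exact le_trans (by gcongr) (hB l₀ hl₀).2
  have hX : (0 : ℝ) < X := lt_of_lt_of_le (by positivity) hxU
  set N₁ := ⌊x / u⌋₊ + 1 with hN₁
  set N₂ := ⌊X / x / u⌋₊ + 1 with hN₂
  have hlt : ∀ y : ℝ, y < u * ((⌊y / u⌋₊ + 1 : ℕ) : ℝ) := by
    intro y
    have h1 := Nat.lt_floor_add_one (y / u)
    rw [div_lt_iff₀ hu'] at h1
    push_cast
    linarith
  have hAr : A ⊆ Finset.range (u * N₁) := by
    intro k hk
    rw [Finset.mem_range]
    exact_mod_cast lt_of_le_of_lt (hA k hk).2 (hlt x)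
  have hBr : B ⊆ Finset.range (u * N₂) := by
    intro l hl
    rw [Finset.mem_range]
    have h1 : (l : ℝ) ≤ X / x := by rw [le_div_iff₀ hx]; exact (hB l hl).2
    exact_mod_cast lt_of_le_of_lt h1 (hlt (X / x))
  have hmain := bilinear_dispersion_le T (by linarith) (show 0 < 4 * R by linarith) hu9 hT
    (fun k => if k ∈ A then α k else 0) (fun l => if l ∈ B then β l else 0) N₁ N₂
  have hcard : ∀ (S : Finset ℕ) (y : ℝ), (∀ k ∈ S, U < k ∧ (k : ℝ) ≤ y) → 0 ≤ y →
      (S.card : ℝ) ≤ y := by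
    intro S y hS hy
    have h1 : S ⊆ Finset.Ioc 0 ⌊y⌋₊ := fun k hk => Finset.mem_Ioc.mpr
      ⟨lt_of_le_of_lt (Nat.zero_le _) (hS k hk).1, Nat.le_floor (hS k hk).2⟩
    have h2 := Finset.card_le_card h1
    rw [Nat.card_Ioc, Nat.sub_zero] at h2
    exact (Nat.cast_le.mpr h2).trans (Nat.floor_le hy)
  have hsA : ∑ k ∈ Finset.range (u * N₁), (if k ∈ A then α k else 0) ^ 2 ≤ x := by
    have h1 : ∑ k ∈ Finset.range (u * N₁), (if k ∈ A then α k else 0) ^ 2 = ∑ k ∈ A, α k ^ 2 := by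
      simp only [ite_pow, ne_eq, OfNat.ofNat_ne_zero, not_false_eq_true, zero_pow]
      rw [← Finset.sum_filter, Finset.filter_mem_eq_inter, Finset.inter_eq_right.mpr hAr]
    rw [h1]
    refine le_trans ?_ (hcard A x hA hx.le)
    rw [Finset.card_eq_sum_ones]
    push_cast
    exact Finset.sum_le_sum fun k _ => by rw [← sq_abs]; exact pow_le_one₀ (abs_nonneg _) (hα k)
  have hsB : ∑ k ∈ Finset.range (u * N₂), (if k ∈ B then β k else 0) ^ 2 ≤ Lg ^ 2 * (X / x) := by
    have h1 : ∑ k ∈ Finset.range (u * N₂), (if k ∈ B then β k else 0) ^ 2 = ∑ k ∈ B, β k ^ 2 := by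
      simp only [ite_pow, ne_eq, OfNat.ofNat_ne_zero, not_false_eq_true, zero_pow]
      rw [← Finset.sum_filter, Finset.filter_mem_eq_inter, Finset.inter_eq_right.mpr hBr]
    rw [h1]
    have h2 : (B.card : ℝ) ≤ X / x := hcard B _ (fun l hl => ⟨(hB l hl).1, by
      rw [le_div_iff₀ hx]; exact (hB l hl).2⟩) (by positivity)
    refine le_trans ?_ (mul_le_mul_of_nonneg_left h2 (sq_nonneg Lg))
    rw [Finset.card_eq_sum_ones]
    push_cast
    rw [Finset.mul_sum, mul_one]
    refine Finset.sum_le_sum fun l hl => ?_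
    rw [← sq_abs]
    refine pow_le_pow_left₀ (abs_nonneg _) (hβ l ?_) 2
    have h3 := (hB l hl).2
    have h4 : (1 : ℝ) ≤ x := by
      have : (1 : ℝ) ≤ U := by exact_mod_cast hU
      linarith
    have : (l : ℝ) ≤ X := le_trans (le_mul_of_one_le_right (Nat.cast_nonneg _) h4) h3
    exact_mod_cast this
  have e : ∀ r, ∑ k ∈ Finset.range (u * N₁), ∑ l ∈ Finset.range (u * N₂),
      (if k ∈ A then α k else 0) * (if l ∈ B then β l else 0) * shiftDisc u r (k * l) =
      ∑ k ∈ A, ∑ l ∈ B, α k * β l * shiftDisc u r (k * l) := by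
    intro r
    simp only [ite_mul, mul_ite, zero_mul, mul_zero]
    rw [← Finset.sum_subset hAr]
    · refine Finset.sum_congr rfl fun k hk => ?_
      rw [← Finset.sum_subset hBr]
      · exact Finset.sum_congr rfl fun l hl => by rw [if_pos hl, if_pos hk]
      · intro l _ hl
        rw [if_neg hl]
    · intro k _ hk
      exact Finset.sum_eq_zero fun l _ => by split_ifs <;> rfl
  simp only [e] at hmain
  refine hmain.trans ?_
  have hR2 : 1 ≤ R ^ 2 := one_le_pow₀ hR
  have hn1 : (N₁ : ℝ) + (4 * R) ^ 2 + 1 ≤ x / u + 18 * R ^ 2 := by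
    have h1 := Nat.floor_le (show 0 ≤ x / u by positivity)
    rw [hN₁, mul_pow]; push_cast
    linarith
  have hn2 : (N₂ : ℝ) + (4 * R) ^ 2 + 1 ≤ X / x / u + 18 * R ^ 2 := by
    have h1 := Nat.floor_le (show 0 ≤ X / x / u by positivity)
    rw [hN₂, mul_pow]; push_cast
    linarith
  have hq1 : √((N₁ + (4 * R) ^ 2 + 1) * (N₂ + (4 * R) ^ 2 + 1)) ≤
      √X / u + 6 * R * (√X / √U) + 18 * R ^ 2 := by
    rw [Real.sqrt_le_left (by positivity)]
    refine (mul_le_mul hn1 hn2 (by positivity) (by positivity)).trans ?_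
    have hs1 : (√X / u) ^ 2 = X / u ^ 2 := by rw [div_pow, Real.sq_sqrt hX.le]
    have hs2 : (√X / √U) ^ 2 = X / U := by rw [div_pow, Real.sq_sqrt hX.le, Real.sq_sqrt hU'.le]
    have h1 : x / u * (X / x / u) = X / u ^ 2 := by field_simp
    have h2 : x / u ≤ X / U := by
      refine (div_le_self hx.le hu1).trans ?_
      rw [le_div_iff₀ hU']; linarith
    have h3 : X / x / u ≤ X / U :=
      (div_le_self (by positivity) hu1).trans (div_le_div_of_nonneg_left hX.le hU' hUx)
    have p1 : 0 ≤ √X / u := by positivity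
    have p2 : 0 ≤ √X / √U := by positivity
    set s1 := √X / u
    set s2 := √X / √(U : ℝ)
    have h5 : 18 * R ^ 2 * (x / u) ≤ 18 * R ^ 2 * (X / U) := by gcongr
    have h6 : 18 * R ^ 2 * (X / x / u) ≤ 18 * R ^ 2 * (X / U) := by gcongr
    have p3 : 0 ≤ s1 * s2 * R := by positivity
    have p4 : 0 ≤ s1 * R ^ 2 := by positivity
    have p5 : 0 ≤ s2 * R ^ 3 := by positivity
    have e1 : (x / u + 18 * R ^ 2) * (X / x / u + 18 * R ^ 2) = x / u * (X / x / u) +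
      18 * R ^ 2 * (x / u) + 18 * R ^ 2 * (X / x / u) + 324 * R ^ 4 := by ring
    have e2 : (s1 + 6 * R * s2 + 18 * R ^ 2) ^ 2 = s1 ^ 2 + 36 * R ^ 2 * s2 ^ 2 + 324 * R ^ 4 +
      12 * (s1 * s2 * R) + 36 * (s1 * R ^ 2) + 216 * (s2 * R ^ 3) := by ring
    rw [e1, e2, h1, hs1, hs2]
    linarith
  have hq2 : √((∑ k ∈ Finset.range (u * N₁), (if k ∈ A then α k else 0) ^ 2) *
      ∑ k ∈ Finset.range (u * N₂), (if k ∈ B then β k else 0) ^ 2) ≤ Lg * √X := by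
    rw [Real.sqrt_le_left (by positivity)]
    refine (mul_le_mul hsA hsB (Finset.sum_nonneg fun _ _ => sq_nonneg _) hx.le).trans ?_
    rw [mul_pow, Real.sq_sqrt hX.le]
    apply le_of_eq
    field_simp
  calc _ ≤ 5 / R * (√X / u + 6 * R * (√X / √U) + 18 * R ^ 2) * (Lg * √X) := by gcongr
    _ = Lg * (5 * (√X * √X) / (u * R) + 30 * (√X * √X) / √U + 90 * R * √X) := by
        field_simp
        ring
    _ = _ := by rw [Real.mul_self_sqrt hX.le]

theorem sum_abs_shiftDisc_le (T : Finset ℕ) {R : ℝ} {u X n : ℕ} (hR : 1 ≤ R) (hX : 16 ≤ X)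
    (hT : ∀ r ∈ T, r.Prime ∧ R ≤ r ∧ (r : ℝ) ≤ 4 * R) (hn : n ≤ X) :
    ∑ r ∈ T, |shiftDisc u r n| ≤ if u ∣ n + 9 then 12 * Real.log X else 0 := by
  by_cases hun : u ∣ n + 9
  swap
  · rw [if_neg hun]
    exact (Finset.sum_eq_zero fun r _ => by rw [shiftDisc, if_neg hun, abs_zero]).le
  rw [if_pos hun]
  have hX' : (16 : ℝ) ≤ X := by exact_mod_cast hX
  have hlog2 := Real.log_two_gt_d9
  have hLg : 2.7 ≤ Real.log X := by
    have h1 : Real.log 16 ≤ Real.log X := Real.log_le_log (by norm_num) hX'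
    rw [show (16 : ℝ) = 2 ^ 4 by norm_num, Real.log_pow] at h1
    push_cast at h1
    linarith
  have h1 : ∀ r ∈ T, |shiftDisc u r n| ≤ (if r ∣ n + 9 then 1 else 0) + 2 / R := by
    intro r hr
    obtain ⟨hp, hr1, -⟩ := hT r hr
    have hr2 : (2 : ℝ) ≤ r := by exact_mod_cast hp.two_le
    have h3 : 1 / ((r : ℝ) - 1) ≤ 2 / R := by
      rw [div_le_div_iff₀ (by linarith) (by linarith)]
      linarith
    have h4 : 0 ≤ 1 / ((r : ℝ) - 1) := div_nonneg zero_le_one (by linarith)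
    rw [shiftDisc, if_pos hun]
    refine (abs_sub _ _).trans (add_le_add (le_of_eq ?_) ?_)
    · split_ifs <;> simp
    · split_ifs
      · rw [abs_zero]; positivity
      · rwa [abs_of_nonneg h4]
  refine (Finset.sum_le_sum h1).trans ?_
  rw [Finset.sum_add_distrib, Finset.sum_const, nsmul_eq_mul, ← Finset.sum_filter,
    Finset.sum_const, nsmul_eq_mul, mul_one]
  have hcT : (T.card : ℝ) ≤ 4 * R := by
    have h2 : T ⊆ Finset.Ioc 0 ⌊4 * R⌋₊ := fun r hr =>
      Finset.mem_Ioc.mpr ⟨(hT r hr).1.pos, Nat.le_floor (hT r hr).2.2⟩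
    have h3 := Finset.card_le_card h2
    rw [Nat.card_Ioc, Nat.sub_zero] at h3
    exact (Nat.cast_le.mpr h3).trans (Nat.floor_le (by positivity))
  have h5 : (T.card : ℝ) * (2 / R) ≤ 8 := by
    rw [mul_div_assoc', div_le_iff₀ (by linarith)]
    linarith
  set S := T.filter (· ∣ n + 9)
  have h6 : 2 ^ S.card ≤ n + 9 := by
    refine (Finset.pow_card_le_prod S id 2 fun r hr =>
      (hT r (Finset.mem_filter.mp hr).1).1.two_le).trans (Nat.le_of_dvd (by omega) ?_)
    exact Finset.prod_primes_dvd _ (fun r hr => (hT r (Finset.mem_filter.mp hr).1).1.prime)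
      fun r hr => (Finset.mem_filter.mp hr).2
  have h7 : (S.card : ℝ) * Real.log 2 ≤ 2 * Real.log X := by
    have h8 : ((2 ^ S.card : ℕ) : ℝ) ≤ (X : ℝ) ^ 2 := by
      have : 2 ^ S.card ≤ X ^ 2 := h6.trans (by nlinarith)
      exact_mod_cast this
    have h9 := Real.log_le_log (by positivity) h8
    rw [Real.log_pow, Nat.cast_pow, Real.log_pow] at h9
    exact_mod_cast h9
  have h10 : (S.card : ℝ) ≤ 3 * Real.log X := by
    by_contra h
    push Not at h
    nlinarith
  linarith

theorem card_le_of_congruent {S : Finset ℕ} {u : ℕ} (hu : 0 < u) {A B : ℝ} (hAB : A ≤ B)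
    (hS : ∀ l ∈ S, A < l ∧ (l : ℝ) ≤ B) (hcong : ∀ l ∈ S, ∀ l' ∈ S, l ≡ l' [MOD u]) :
    (S.card : ℝ) ≤ (B - A) / u + 1 := by
  have hu' : (0 : ℝ) < u := by exact_mod_cast hu
  have h1 : S.card ≤ (Finset.range (⌊(B - A) / u⌋₊ + 1)).card := by
    refine Finset.card_le_card_of_injOn (fun l => ⌊((l : ℝ) - A) / u⌋₊) ?_ ?_
    · intro l hl
      rw [Finset.mem_coe, Finset.mem_range, Nat.lt_succ_iff]
      have := (hS l hl).2
      exact Nat.floor_mono (by gcongr)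
    · intro l hl l' hl' h
      have key : ∀ a ∈ S, ∀ b ∈ S, ⌊((a : ℝ) - A) / u⌋₊ = ⌊((b : ℝ) - A) / u⌋₊ → ¬ a < b := by
        intro a ha b hb hab hlt
        have h2 : u ∣ b - a := (Nat.modEq_iff_dvd' hlt.le).mp (hcong a ha b hb)
        have h3 : u ≤ b - a := Nat.le_of_dvd (by omega) h2
        have h4 : (a : ℝ) + u ≤ b := by exact_mod_cast (show a + u ≤ b by omega)
        have h5 : ((a : ℝ) - A) / u + 1 ≤ ((b : ℝ) - A) / u := by
          rw [div_add_one hu'.ne']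
          gcongr
          linarith
        have h6 := Nat.floor_le (show 0 ≤ ((a : ℝ) - A) / u from
          div_nonneg (by linarith [(hS a ha).1]) hu'.le)
        have h7 := Nat.lt_floor_add_one (((b : ℝ) - A) / u)
        have h8 := Nat.floor_mono h5
        rw [Nat.floor_add_one (div_nonneg (by linarith [(hS a ha).1]) hu'.le)] at h8
        omega
      have k1 := key l hl l' hl' h
      have k2 := key l' hl' l hl h.symm
      omega
  rw [Finset.card_range] at h1
  refine (Nat.cast_le.mpr h1).trans ?_
  push_cast
  have := Nat.floor_le (show 0 ≤ (B - A) / u from div_nonneg (by linarith) hu'.le)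
  linarith

theorem card_short_interval_le {u k X : ℕ} {J : ℕ} (hJ : 0 < J) (hu : 0 < u) (hu9 : u.Coprime 9)
    (hk : 0 < k) {x : ℝ} (hx : x ≤ k * Real.exp (1 / J)) (hkx : k ≤ x) (S : Finset ℕ) :
    ((S.filter fun l => (k * l ≤ X ∧ (X : ℝ) < l * x) ∧ u ∣ k * l + 9).card : ℝ) ≤
      X / (J * u) * (1 / k) + 1 := by
  have hk' : (0 : ℝ) < k := by exact_mod_cast hk
  have hx0 : 0 < x := lt_of_lt_of_le hk' hkx
  have hu' : (0 : ℝ) < u := by exact_mod_cast hu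
  have hJ' : (0 : ℝ) < J := by exact_mod_cast hJ
  have hle : (X : ℝ) / x ≤ X / k := div_le_div_of_nonneg_left (Nat.cast_nonneg _) hk' hkx
  refine (card_le_of_congruent hu (A := X / x) (B := X / k) hle ?_ ?_).trans ?_
  · intro l hl
    obtain ⟨⟨h1, h2⟩, -⟩ := (Finset.mem_filter.mp hl).2
    rw [div_lt_iff₀ hx0, le_div_iff₀ hk']
    exact ⟨h2, by exact_mod_cast (mul_comm k l ▸ h1)⟩
  · intro l hl l' hl'
    have h1 := (Finset.mem_filter.mp hl).2.2
    have h2 := (Finset.mem_filter.mp hl').2.2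
    exact modEq_of_dvd_mul_add hu9 h1 h2
  · have h1 : 1 - 1 / (J : ℝ) ≤ Real.exp (-(1 / J)) := by
      have := Real.add_one_le_exp (-(1 / (J : ℝ)))
      linarith
    have h2 : (X : ℝ) / k * Real.exp (-(1 / J)) ≤ X / x := by
      rw [Real.exp_neg, ← div_eq_mul_inv, div_div]
      exact div_le_div_of_nonneg_left (Nat.cast_nonneg _) hx0 hx
    have h3 : (X : ℝ) / k * (1 - 1 / J) ≤ X / k * Real.exp (-(1 / J)) := by gcongr
    have h4 : ((X : ℝ) / k - X / x) / u ≤ (X / k * (1 / J)) / u := by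
      gcongr
      linarith
    have h5 : ((X : ℝ) / k * (1 / J)) / u = X / (J * u) * (1 / k) := by field_simp
    linarith

theorem sum_inv_Ioc_le (X : ℕ) (s : Finset ℕ) (hs : ∀ k ∈ s, 0 < k ∧ k ≤ X) :
    ∑ k ∈ s, 1 / (k : ℝ) ≤ 1 + Real.log X := by
  have h1 : s ⊆ Finset.Icc 1 X := fun k hk => Finset.mem_Icc.mpr (hs k hk)
  refine (Finset.sum_le_sum_of_subset_of_nonneg h1 fun _ _ _ => by positivity).trans ?_
  have h2 := harmonic_le_one_add_log X
  rw [harmonic_eq_sum_Icc] at h2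
  push_cast at h2
  simpa only [one_div] using h2

theorem hyperbola_dispersion_le (T : Finset ℕ) {R : ℝ} {u U X J : ℕ} (hR : 1 ≤ R) (hu : 0 < u)
    (hu9 : u.Coprime 9) (hU : 0 < U) (hX : 16 ≤ X) (hJ : 0 < J)
    (hT : ∀ r ∈ T, (r.Prime ∧ R ≤ r ∧ (r : ℝ) ≤ 4 * R) ∧ ¬ r ∣ u ∧ ¬ r ∣ 9)
    {α β : ℕ → ℝ} (hα : ∀ k, |α k| ≤ 1) (hβ : ∀ l ≤ X, |β l| ≤ Real.log X) :
    ∑ r ∈ T, |∑ k ∈ Finset.Ioc U X, ∑ l ∈ Finset.Ioc U X,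
        if k * l ≤ X then α k * β l * shiftDisc u r (k * l) else 0| ≤
      2 * J * Real.log X ^ 2 * (5 * X / (u * R) + 30 * X / √U + 90 * R * √X) +
        12 * Real.log X ^ 2 * (X / (J * u) * (1 + Real.log X) + X / U) := by
  have hX' : (16 : ℝ) ≤ X := by exact_mod_cast hX
  have hJ' : (0 : ℝ) < J := by exact_mod_cast hJ
  have hJ1 : (1 : ℝ) ≤ J := by exact_mod_cast hJ
  have hU' : (0 : ℝ) < U := by exact_mod_cast hU
  set Lg := Real.log X with hLgdef
  have hLg : 1 ≤ Lg := by
    rw [hLgdef, Real.le_log_iff_exp_le (by linarith)]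
    have := Real.exp_one_lt_d9
    linarith
  set I := Finset.Ioc U X with hI
  have hIk : ∀ k ∈ I, U < k ∧ k ≤ X := fun k hk => Finset.mem_Ioc.mp hk
  set j : ℕ → ℕ := fun k => ⌊J * Real.log k⌋₊ with hj
  set y : ℕ → ℝ := fun i => Real.exp ((i + 1) / J) with hy
  have hyk : ∀ k ∈ I, (k : ℝ) ≤ y (j k) ∧ y (j k) ≤ k * Real.exp (1 / J) := by
    intro k hk
    have hk0 : (0 : ℝ) < k := by exact_mod_cast lt_of_le_of_lt (Nat.zero_le _) (hIk k hk).1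
    have hk1 : (1 : ℝ) ≤ k := by exact_mod_cast lt_of_le_of_lt (Nat.zero_le _) (hIk k hk).1
    have hl : 0 ≤ Real.log k := Real.log_nonneg hk1
    have h1 := Nat.floor_le (show 0 ≤ J * Real.log k by positivity)
    have h2 := Nat.lt_floor_add_one (J * Real.log k)
    constructor
    · rw [hy, ← Real.log_le_iff_le_exp hk0, le_div_iff₀ hJ']
      linarith
    · simp only [hy]
      rw [show (k : ℝ) * Real.exp (1 / J) = Real.exp (Real.log k + 1 / J) by
        rw [Real.exp_add, Real.exp_log hk0], Real.exp_le_exp, add_div]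
      gcongr
      rw [div_le_iff₀ hJ']
      linarith
  set M := ⌊J * Lg⌋₊ + 1 with hM
  have hjM : ∀ k ∈ I, j k ∈ Finset.range M := by
    intro k hk
    have hk0 : (0 : ℝ) < k := by exact_mod_cast lt_of_le_of_lt (Nat.zero_le _) (hIk k hk).1
    rw [Finset.mem_range, hM, Nat.lt_succ_iff]
    refine Nat.floor_mono ?_
    have : Real.log k ≤ Lg := Real.log_le_log hk0 (by exact_mod_cast (hIk k hk).2)
    gcongr
  have hMle : (M : ℝ) ≤ 2 * J * Lg := by
    have h1 := Nat.floor_le (show 0 ≤ J * Lg by positivity)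
    have h2 : 1 ≤ J * Lg := one_le_mul_of_one_le_of_one_le hJ1 hLg
    rw [hM]; push_cast; linarith
  set D : ℕ → ℕ → ℝ := fun r i => ∑ k ∈ I with j k = i, ∑ l ∈ I with ((l : ℕ) : ℝ) * y i ≤ X,
    α k * β l * shiftDisc u r (k * l) with hD
  set Q : ℕ → Finset ℕ := fun k => I.filter fun l => k * l ≤ X ∧ (X : ℝ) < l * y (j k) with hQ
  have hsplit : ∀ r, ∑ k ∈ I, ∑ l ∈ I,
      (if k * l ≤ X then α k * β l * shiftDisc u r (k * l) else 0) =
      ∑ i ∈ Finset.range M, D r i + ∑ k ∈ I, ∑ l ∈ Q k, α k * β l * shiftDisc u r (k * l) := by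
    intro r
    have h1 : ∑ i ∈ Finset.range M, D r i = ∑ k ∈ I, ∑ l ∈ I with ((l : ℕ) : ℝ) * y (j k) ≤ X,
        α k * β l * shiftDisc u r (k * l) := by
      rw [← Finset.sum_fiberwise_of_maps_to hjM]
      refine Finset.sum_congr rfl fun i _ => Finset.sum_congr rfl fun k hk => ?_
      rw [(Finset.mem_filter.mp hk).2]
    rw [h1, ← Finset.sum_add_distrib]
    refine Finset.sum_congr rfl fun k hk => ?_
    rw [hQ, Finset.sum_filter, Finset.sum_filter, ← Finset.sum_add_distrib]
    refine Finset.sum_congr rfl fun l _ => ?_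
    by_cases h2 : (l : ℝ) * y (j k) ≤ X
    · have h3 : k * l ≤ X := by
        have h4 : (k : ℝ) * l ≤ X := by
          rw [mul_comm]
          exact le_trans (mul_le_mul_of_nonneg_left (hyk k hk).1 (Nat.cast_nonneg _)) h2
        exact_mod_cast h4
      simp [h2, h3]
    · simp [h2, lt_of_not_ge h2]
  have hmain : ∑ r ∈ T, ∑ i ∈ Finset.range M, |D r i| ≤
      2 * J * Lg ^ 2 * (5 * X / (u * R) + 30 * X / √U + 90 * R * √X) := by
    rw [Finset.sum_comm]
    have h1 : ∀ i ∈ Finset.range M, ∑ r ∈ T, |D r i| ≤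
        Lg * (5 * X / (u * R) + 30 * X / √U + 90 * R * √X) := by
      intro i _
      refine rectangle_dispersion_le T hR hu hu9 hU hT hα hβ _ _ (x := y i) ?_ ?_
      · intro k hk
        obtain ⟨hk1, rfl⟩ := Finset.mem_filter.mp hk
        exact ⟨(hIk k hk1).1, (hyk k hk1).1⟩
      · intro l hl
        obtain ⟨hl1, hl2⟩ := Finset.mem_filter.mp hl
        exact ⟨(hIk l hl1).1, hl2⟩
    refine (Finset.sum_le_sum h1).trans ?_
    rw [Finset.sum_const, Finset.card_range, nsmul_eq_mul]
    calc _ ≤ 2 * J * Lg * (Lg * (5 * X / (u * R) + 30 * X / √U + 90 * R * √X)) := by gcongr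
      _ = _ := by ring
  have hrem : ∑ r ∈ T, ∑ k ∈ I, ∑ l ∈ Q k, |α k * β l * shiftDisc u r (k * l)| ≤
      12 * Lg ^ 2 * (X / (J * u) * (1 + Lg) + X / U) := by
    rw [Finset.sum_comm]
    have h1 : ∀ k ∈ I, ∑ r ∈ T, ∑ l ∈ Q k, |α k * β l * shiftDisc u r (k * l)| ≤
        12 * Lg ^ 2 * (if k * U ≤ X then (X : ℝ) / (J * u) * (1 / (k : ℝ)) + 1 else 0 : ℝ) := by
      intro k hk
      rw [Finset.sum_comm]
      have hk0 : 0 < k := lt_of_le_of_lt (Nat.zero_le _) (hIk k hk).1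
      by_cases hkU : k * U ≤ X
      swap
      · have hQe : Q k = ∅ := by
          rw [hQ, Finset.filter_eq_empty_iff]
          rintro l hl ⟨h2, -⟩
          exact hkU ((Nat.mul_le_mul_left k (hIk l hl).1.le).trans h2)
        rw [hQe, if_neg hkU]
        simp
      rw [if_pos hkU]
      have h2 : ∀ l ∈ Q k, ∑ r ∈ T, |α k * β l * shiftDisc u r (k * l)| ≤
          if u ∣ k * l + 9 then 12 * Lg ^ 2 else 0 := by
        intro l hl
        obtain ⟨hl1, hl2, -⟩ := Finset.mem_filter.mp hl
        have h3 := sum_abs_shiftDisc_le T (u := u) hR hX (fun r hr => (hT r hr).1) hl2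
        simp_rw [abs_mul, ← Finset.mul_sum]
        have h4 : |α k| * |β l| ≤ Lg := by
          calc |α k| * |β l| ≤ 1 * Lg := by
                have := hα k
                have := hβ l (hIk l hl1).2
                gcongr
            _ = Lg := one_mul _
        calc _ ≤ Lg * (if u ∣ k * l + 9 then 12 * Lg else 0) :=
              mul_le_mul h4 h3 (Finset.sum_nonneg fun _ _ => abs_nonneg _) (by linarith)
          _ = _ := by split_ifs <;> ring
      refine (Finset.sum_le_sum h2).trans ?_
      rw [← Finset.sum_filter, Finset.sum_const, nsmul_eq_mul, hQ, Finset.filter_filter, mul_comm]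
      have := card_short_interval_le hJ hu hu9 hk0 (X := X) (hyk k hk).2 (hyk k hk).1 I
      gcongr
    refine (Finset.sum_le_sum h1).trans ?_
    rw [← Finset.mul_sum]
    refine mul_le_mul_of_nonneg_left ?_ (by positivity)
    rw [← Finset.sum_filter, Finset.sum_add_distrib, ← Finset.mul_sum, Finset.sum_const,
      nsmul_eq_mul, mul_one]
    have hsub : ∀ k ∈ I.filter (fun k => k * U ≤ X), 0 < k ∧ k ≤ X / U := fun k hk =>
      ⟨lt_of_le_of_lt (Nat.zero_le _) (hIk k (Finset.mem_filter.mp hk).1).1,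
        (Nat.le_div_iff_mul_le hU).mpr (Finset.mem_filter.mp hk).2⟩
    have h3 : ∑ k ∈ I with k * U ≤ X, 1 / (k : ℝ) ≤ 1 + Lg :=
      sum_inv_Ioc_le X _ fun k hk => ⟨(hsub k hk).1,
        (hsub k hk).2.trans (Nat.div_le_self _ _)⟩
    have h4 : ((I.filter (fun k => k * U ≤ X)).card : ℝ) ≤ X / U := by
      have h5 : I.filter (fun k => k * U ≤ X) ⊆ Finset.Ioc 0 (X / U) := fun k hk =>
        Finset.mem_Ioc.mpr (hsub k hk)
      have h6 := Finset.card_le_card h5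
      rw [Nat.card_Ioc, Nat.sub_zero] at h6
      exact (Nat.cast_le.mpr h6).trans Nat.cast_div_le
    gcongr
  refine le_trans ?_ (add_le_add hmain hrem)
  rw [← Finset.sum_add_distrib]
  refine Finset.sum_le_sum fun r _ => ?_
  rw [hsplit r]
  refine (abs_add_le _ _).trans (add_le_add (Finset.abs_sum_le_sum_abs _ _) ?_)
  refine (Finset.abs_sum_le_sum_abs _ _).trans (Finset.sum_le_sum fun k _ => ?_)
  exact Finset.abs_sum_le_sum_abs _ _

theorem abs_card_modEq_sub_le {m : ℕ} (hm : 0 < m) (v K : ℕ) :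
    |((((Finset.range K).filter fun k => k ≡ v [MOD m]).card : ℕ) : ℝ) - K / m| ≤ 1 := by
  have hm' : (0 : ℝ) < m := by exact_mod_cast hm
  rw [← Nat.count_eq_card_filter_range, Nat.count_modEq_card _ hm]
  have h1 : ((K / m : ℕ) : ℝ) ≤ K / m := Nat.cast_div_le
  have h2 : (K : ℝ) / m < ((K / m : ℕ) : ℝ) + 1 := by
    rw [← Nat.floor_div_eq_div (K := ℝ)]
    exact Nat.lt_floor_add_one _
  rw [abs_le]
  split_ifs <;> constructor <;> push_cast <;> linarith

theorem exists_dvd_mul_add {d m : ℕ} (hm : 0 < m) (h : d.Coprime m) (c : ℕ) :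
    ∃ v : ℕ, m ∣ d * v + c := by
  have : NeZero m := ⟨hm.ne'⟩
  refine ⟨(-(c : ZMod m) * (d : ZMod m)⁻¹).val, ?_⟩
  rw [← ZMod.natCast_eq_zero_iff]
  push_cast
  rw [ZMod.natCast_zmod_val, mul_left_comm, ZMod.coe_mul_inv_eq_one d h]
  ring

theorem dvd_mul_add_iff_modEq {d m v c : ℕ} (h : d.Coprime m) (hv : m ∣ d * v + c) (k : ℕ) :
    m ∣ d * k + c ↔ k ≡ v [MOD m] := by
  have h1 : (m ∣ d * k + c) ↔ d * k + c ≡ d * v + c [MOD m] := by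
    rw [← Nat.modEq_zero_iff_dvd]
    have := (Nat.modEq_zero_iff_dvd).mpr hv
    exact ⟨fun h => h.trans this.symm, fun h => h.trans this⟩
  rw [h1]
  constructor
  · intro h2
    exact Nat.ModEq.cancel_left_of_coprime (h.symm) (Nat.ModEq.add_right_cancel' c h2)
  · intro h2
    exact (h2.mul_left d).add_right c

theorem shiftDisc_eq_zero_of_not_coprime {u r d k : ℕ} (hr : r.Prime) (hu9 : u.Coprime 9)
    (h9 : ¬ r ∣ 9) (h : ¬ d.Coprime (u * r)) : shiftDisc u r (d * k) = 0 := by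
  rw [shiftDisc]
  by_cases h1 : u ∣ d * k + 9
  swap
  · rw [if_neg h1]
  have hdu : d.Coprime u := by
    have h2 : d.gcd u ∣ 9 := by
      rw [← Nat.dvd_add_right ((Nat.gcd_dvd_left d u).mul_right k)]
      exact (Nat.gcd_dvd_right d u).trans h1
    have h3 : d.gcd u ∣ Nat.gcd u 9 := Nat.dvd_gcd (Nat.gcd_dvd_right d u) h2
    rw [hu9] at h3
    exact Nat.dvd_one.mp h3
  have hrd : r ∣ d := by
    by_contra h2
    exact h (Nat.Coprime.mul_right hdu ((hr.coprime_iff_not_dvd.mpr h2).symm))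
  have h3 : r ∣ d * k := hrd.mul_right k
  rw [if_pos h1, if_neg (fun h4 => h9 ((Nat.dvd_add_right h3).mp h4)), if_pos h3, sub_zero]

theorem abs_sum_range_shiftDisc_le {u r d : ℕ} (hr : r.Prime) (hu : 0 < u) (hur : ¬ r ∣ u)
    (hu9 : u.Coprime 9) (h9 : ¬ r ∣ 9) (K : ℕ) :
    |∑ k ∈ Finset.range K, shiftDisc u r (d * k)| ≤ 3 := by
  by_cases h : d.Coprime (u * r)
  swap
  · rw [Finset.sum_eq_zero fun k _ => shiftDisc_eq_zero_of_not_coprime hr hu9 h9 h]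
    norm_num
  have hcop : u.Coprime r := ((hr.coprime_iff_not_dvd.mpr hur).symm)
  have hdu : d.Coprime u := h.coprime_mul_right_right
  have hdr : d.Coprime r := h.coprime_mul_left_right
  obtain ⟨v, hv⟩ := exists_dvd_mul_add (Nat.mul_pos hu hr.pos) h 9
  have hvu : u ∣ d * v + 9 := (Dvd.intro _ rfl).trans hv
  obtain ⟨w, hw1, hw2⟩ := Nat.chineseRemainder hcop v 0
  have hr1 : (1 : ℝ) ≤ (r : ℝ) - 1 := by
    have : (2 : ℝ) ≤ r := by exact_mod_cast hr.two_le
    linarith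
  have key : ∀ k, shiftDisc u r (d * k) = (if k ≡ v [MOD u * r] then (1 : ℝ) else 0) -
      ((if k ≡ v [MOD u] then (1 : ℝ) else 0) - (if k ≡ w [MOD u * r] then 1 else 0)) *
        (1 / ((r : ℝ) - 1)) := by
    intro k
    have e1 : (u ∣ d * k + 9) ↔ k ≡ v [MOD u] := dvd_mul_add_iff_modEq hdu hvu k
    have e2 : (u * r ∣ d * k + 9) ↔ k ≡ v [MOD u * r] := dvd_mul_add_iff_modEq h hv k
    have e3 : (u * r ∣ d * k + 9) ↔ u ∣ d * k + 9 ∧ r ∣ d * k + 9 :=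
      ⟨fun h => ⟨(Dvd.intro _ rfl).trans h, (Dvd.intro_left _ rfl).trans h⟩,
        fun h => hcop.mul_dvd_of_dvd_of_dvd h.1 h.2⟩
    have e4 : (k ≡ w [MOD u * r]) ↔ k ≡ v [MOD u] ∧ r ∣ d * k := by
      rw [← Nat.modEq_and_modEq_iff_modEq_mul hcop, hdr.symm.dvd_mul_left, ← Nat.modEq_zero_iff_dvd]
      exact ⟨fun h => ⟨h.1.trans hw1, h.2.trans hw2⟩, fun h => ⟨h.1.trans hw1.symm,
        h.2.trans hw2.symm⟩⟩
    simp only [shiftDisc, ← e2, e3, e4, ← e1]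
    by_cases h1 : u ∣ d * k + 9
    · by_cases h2 : r ∣ d * k <;> simp [h1, h2]
    · simp [h1]
  simp_rw [key]
  rw [Finset.sum_sub_distrib, ← Finset.sum_mul, Finset.sum_sub_distrib, Finset.sum_boole,
    Finset.sum_boole, Finset.sum_boole]
  have b1 := abs_card_modEq_sub_le (Nat.mul_pos hu hr.pos) v K
  have b2 := abs_card_modEq_sub_le hu v K
  have b3 := abs_card_modEq_sub_le (Nat.mul_pos hu hr.pos) w K
  set A := ((((Finset.range K).filter fun k => k ≡ v [MOD u * r]).card : ℕ) : ℝ)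
  set B := ((((Finset.range K).filter fun k => k ≡ v [MOD u]).card : ℕ) : ℝ)
  set C := ((((Finset.range K).filter fun k => k ≡ w [MOD u * r]).card : ℕ) : ℝ)
  have hu' : (0 : ℝ) < u := by exact_mod_cast hu
  have hr' : (0 : ℝ) < r := by linarith
  have e : A - (B - C) * (1 / ((r : ℝ) - 1)) = (A - K / ((u * r : ℕ) : ℝ)) -
      ((B - K / u) - (C - K / ((u * r : ℕ) : ℝ))) * (1 / ((r : ℝ) - 1)) := by
    push_cast
    field_simp
    ring
  rw [e]
  have hle : 1 / ((r : ℝ) - 1) ≤ 1 := by rw [div_le_one (by linarith)]; exact hr1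
  calc _ ≤ |A - K / ((u * r : ℕ) : ℝ)| +
        |((B - K / u) - (C - K / ((u * r : ℕ) : ℝ))) * (1 / ((r : ℝ) - 1))| := abs_sub _ _
    _ ≤ 1 + 2 * 1 := by
        rw [abs_mul, abs_of_nonneg (show 0 ≤ 1 / ((r : ℝ) - 1) by positivity)]
        have := abs_sub (B - K / u) (C - K / ((u * r : ℕ) : ℝ))
        gcongr
        linarith
    _ = 3 := by norm_num

theorem abs_sum_mul_le_of_monotone {f h : ℕ → ℝ} {B G : ℝ} (hf : Monotone f) (hf0 : 0 ≤ f 0)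
    (n : ℕ) (hG : f (n - 1) ≤ G) (hB : ∀ k, |∑ i ∈ Finset.range k, h i| ≤ B) :
    |∑ i ∈ Finset.range n, f i * h i| ≤ 2 * B * G := by
  have hB0 : 0 ≤ B := (abs_nonneg _).trans (hB 0)
  have := Finset.sum_range_by_parts f h n
  simp only [smul_eq_mul] at this
  rw [this]
  have h1 : |f (n - 1) * ∑ i ∈ Finset.range n, h i| ≤ f (n - 1) * B := by
    rw [abs_mul, abs_of_nonneg (hf0.trans (hf (Nat.zero_le _)))]
    exact mul_le_mul_of_nonneg_left (hB n) (hf0.trans (hf (Nat.zero_le _)))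
  have h2 : |∑ i ∈ Finset.range (n - 1), (f (i + 1) - f i) * ∑ i ∈ Finset.range (i + 1), h i| ≤
      f (n - 1) * B := by
    refine (Finset.abs_sum_le_sum_abs _ _).trans ?_
    calc _ ≤ ∑ i ∈ Finset.range (n - 1), (f (i + 1) - f i) * B := by
          refine Finset.sum_le_sum fun i _ => ?_
          have h3 : 0 ≤ f (i + 1) - f i := sub_nonneg.mpr (hf (Nat.le_succ i))
          rw [abs_mul, abs_of_nonneg h3]
          exact mul_le_mul_of_nonneg_left (hB _) h3
      _ = (f (n - 1) - f 0) * B := by rw [← Finset.sum_mul, Finset.sum_range_sub]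
      _ ≤ f (n - 1) * B := by gcongr; linarith
  calc _ ≤ _ := abs_sub _ _
    _ ≤ f (n - 1) * B + f (n - 1) * B := add_le_add h1 h2
    _ = 2 * B * f (n - 1) := by ring
    _ ≤ _ := by gcongr

theorem sum_mul_apply_mul_eq (f g : ArithmeticFunction ℝ) (s : ℕ → ℝ) (N : ℕ) :
    ∑ n ∈ Finset.Ioc 0 N, (f * g) n * s n = ∑ a ∈ Finset.Ioc 0 N, ∑ b ∈ Finset.Ioc 0 N,
      if a * b ≤ N then f a * g b * s (a * b) else 0 := by
  simp only [ArithmeticFunction.mul_apply, Finset.sum_mul]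
  trans ∑ n ∈ Finset.Ioc 0 N, ∑ x ∈ Finset.Ioc 0 N ×ˢ Finset.Ioc 0 N with x.1 * x.2 = n,
    f x.1 * g x.2 * s (x.1 * x.2)
  · refine Finset.sum_congr rfl fun n hn => ?_
    simp only [Finset.mem_Ioc] at hn
    rw [Nat.divisorsAntidiagonal_eq_prod_filter_of_le hn.1.ne' hn.2]
    refine Finset.sum_congr rfl fun x hx => ?_
    rw [(Finset.mem_filter.mp hx).2]
  · simp_rw [Finset.sum_filter]
    rw [Finset.sum_comm, Finset.sum_product]
    refine Finset.sum_congr rfl fun a ha => Finset.sum_congr rfl fun b hb => ?_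
    have h1 : 0 < a * b := Nat.mul_pos (Finset.mem_Ioc.mp ha).1 (Finset.mem_Ioc.mp hb).1
    simp [h1]

theorem abs_sum_convolution_shiftDisc_le {u r X D : ℕ} (hr : r.Prime) (hu : 0 < u) (hur : ¬ r ∣ u)
    (hu9 : u.Coprime 9) (h9 : ¬ r ∣ 9) (c g : ArithmeticFunction ℝ) {g₀ : ℕ → ℝ} {C G : ℝ}
    (hC : 0 ≤ C) (hG : 0 ≤ G) (hc : ∀ d ≤ X, |c d| ≤ C) (hcD : ∀ d, D < d → c d = 0)
    (hg : ∀ n, 0 < n → g n = g₀ n) (hg₀ : Monotone g₀) (hg0 : 0 ≤ g₀ 0)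
    (hgX : ∀ n ≤ X, g₀ n ≤ G) :
    |∑ n ∈ Finset.Ioc 0 X, (c * g) n * shiftDisc u r n| ≤ D * (6 * C * G) := by
  rw [sum_mul_apply_mul_eq]
  have hs0 : shiftDisc u r 0 = 0 := by
    rw [shiftDisc]
    simp [h9]
  have h1 : ∀ d ∈ Finset.Ioc 0 X, |∑ k ∈ Finset.Ioc 0 X,
      if d * k ≤ X then c d * g k * shiftDisc u r (d * k) else 0| ≤
      if d ∈ Finset.Ioc 0 D then 6 * C * G else 0 := by
    intro d hd
    obtain ⟨hd0, hdX⟩ := Finset.mem_Ioc.mp hd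
    split_ifs with hdD
    swap
    · have hcd : c d = 0 := hcD d (by
        by_contra h
        exact hdD (Finset.mem_Ioc.mpr ⟨hd0, not_lt.mp h⟩))
      simp [hcd]
    have h2 : ∑ k ∈ Finset.Ioc 0 X, (if d * k ≤ X then c d * g k * shiftDisc u r (d * k) else 0) =
        c d * ∑ k ∈ Finset.range (X / d + 1), g₀ k * shiftDisc u r (d * k) := by
      rw [← Finset.sum_filter, Finset.mul_sum]
      have h3 : Finset.range (X / d + 1) = insert 0 ((Finset.Ioc 0 X).filter (d * · ≤ X)) := by
        ext k
        simp only [Finset.mem_range, Nat.lt_succ_iff, Finset.mem_insert, Finset.mem_filter,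
          Finset.mem_Ioc, Nat.le_div_iff_mul_le hd0]
        constructor
        · intro h
          rcases Nat.eq_zero_or_pos k with h4 | h4
          · exact Or.inl h4
          · exact Or.inr ⟨⟨h4, (Nat.le_mul_of_pos_right k hd0).trans h⟩, by rwa [mul_comm]⟩
        · rintro (rfl | h)
          · simp
          · rw [mul_comm]; exact h.2
      rw [h3, Finset.sum_insert (by simp), Nat.mul_zero, hs0]
      simp only [mul_zero, zero_add]
      refine Finset.sum_congr rfl fun k hk => ?_
      rw [hg k (Finset.mem_Ioc.mp (Finset.mem_filter.mp hk).1).1, mul_assoc]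
    rw [h2, abs_mul]
    have h5 := abs_sum_mul_le_of_monotone hg₀ hg0 (X / d + 1) (G := G) (B := 3)
      (h := fun k => shiftDisc u r (d * k))
      (hgX _ (by rw [Nat.add_sub_cancel]; exact Nat.div_le_self _ _))
      (fun K => abs_sum_range_shiftDisc_le hr hu hur hu9 h9 K)
    calc _ ≤ C * (2 * 3 * G) := mul_le_mul (hc d hdX) h5 (abs_nonneg _) hC
      _ = _ := by ring
  refine (Finset.abs_sum_le_sum_abs _ _).trans ((Finset.sum_le_sum h1).trans ?_)
  rw [← Finset.sum_filter, Finset.sum_const, nsmul_eq_mul]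
  have h6 : ((Finset.Ioc 0 X).filter (· ∈ Finset.Ioc 0 D)).card ≤ D := by
    calc _ ≤ (Finset.Ioc 0 D).card := Finset.card_le_card fun x hx => (Finset.mem_filter.mp hx).2
      _ = D := by simp
  gcongr

open ArithmeticFunction in
/-- The restriction of an arithmetic function to the integers not exceeding `U`. -/
noncomputable def truncate (f : ArithmeticFunction ℝ) (U : ℕ) : ArithmeticFunction ℝ :=
  ⟨fun n => if n ≤ U then f n else 0, by simp⟩

theorem truncate_apply (f : ArithmeticFunction ℝ) (U n : ℕ) :
    truncate f U n = if n ≤ U then f n else 0 := rfl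

theorem arithmeticFunction_sub_apply (f g : ArithmeticFunction ℝ) (n : ℕ) :
    (f - g) n = f n - g n := by
  rw [eq_sub_iff_add_eq, ← ArithmeticFunction.add_apply, sub_add_cancel]

theorem sub_truncate_apply (f : ArithmeticFunction ℝ) (U n : ℕ) :
    (f - truncate f U) n = if n ≤ U then 0 else f n := by
  rw [arithmeticFunction_sub_apply, truncate_apply]
  split_ifs <;> simp

open ArithmeticFunction in
theorem vaughan_identity (U : ℕ) :
    vonMangoldt = truncate vonMangoldt U + truncate ((moebius : ArithmeticFunction ℤ) :
        ArithmeticFunction ℝ) U * log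
      - truncate ((moebius : ArithmeticFunction ℤ) : ArithmeticFunction ℝ) U *
          truncate vonMangoldt U * ((zeta : ArithmeticFunction ℕ) : ArithmeticFunction ℝ)
      + (((moebius : ArithmeticFunction ℤ) : ArithmeticFunction ℝ) -
          truncate ((moebius : ArithmeticFunction ℤ) : ArithmeticFunction ℝ) U) *
        ((vonMangoldt - truncate vonMangoldt U) *
          ((zeta : ArithmeticFunction ℕ) : ArithmeticFunction ℝ)) := by
  have h1 : vonMangoldt * ((zeta : ArithmeticFunction ℕ) : ArithmeticFunction ℝ) = log :=
    vonMangoldt_mul_zeta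
  have h2 : ((moebius : ArithmeticFunction ℤ) : ArithmeticFunction ℝ) * log = vonMangoldt :=
    moebius_mul_log_eq_vonMangoldt
  have h3 : ((moebius : ArithmeticFunction ℤ) : ArithmeticFunction ℝ) *
      ((zeta : ArithmeticFunction ℕ) : ArithmeticFunction ℝ) = 1 := coe_moebius_mul_coe_zeta
  set m := ((moebius : ArithmeticFunction ℤ) : ArithmeticFunction ℝ)
  set z := ((zeta : ArithmeticFunction ℕ) : ArithmeticFunction ℝ)
  set L := truncate vonMangoldt U
  set t := truncate m U
  linear_combination (-1 : ArithmeticFunction ℝ) * h2 - (m - t) * h1 + L * h3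

open ArithmeticFunction in
theorem abs_mul_zeta_le_log {f : ArithmeticFunction ℝ} (hf : ∀ n, |f n| ≤ vonMangoldt n) (n : ℕ) :
    |(f * ((zeta : ArithmeticFunction ℕ) : ArithmeticFunction ℝ)) n| ≤ Real.log n := by
  rw [← vonMangoldt_sum, coe_mul_zeta_apply]
  exact (Finset.abs_sum_le_sum_abs _ _).trans (Finset.sum_le_sum fun i _ => hf i)

open ArithmeticFunction in
theorem abs_mul_le_log {f g : ArithmeticFunction ℝ} (hg : ∀ n, |g n| ≤ 1)
    (hf : ∀ n, |f n| ≤ vonMangoldt n) (n : ℕ) : |(g * f) n| ≤ Real.log n := by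
  rw [mul_apply, ← vonMangoldt_sum]
  refine (Finset.abs_sum_le_sum_abs _ _).trans ?_
  rw [← Nat.sum_divisorsAntidiagonal' (fun _ i => vonMangoldt i)]
  refine Finset.sum_le_sum fun x _ => ?_
  rw [abs_mul]
  calc _ ≤ 1 * vonMangoldt x.2 := mul_le_mul (hg _) (hf _) (abs_nonneg _) zero_le_one
    _ = _ := one_mul _

theorem abs_shiftDisc_le {u r n : ℕ} (hr : r.Prime) : |shiftDisc u r n| ≤ 1 := by
  have hr1 : (1 : ℝ) ≤ (r : ℝ) - 1 := by
    have : (2 : ℝ) ≤ r := by exact_mod_cast hr.two_le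
    linarith
  have hle : 1 / ((r : ℝ) - 1) ≤ 1 := by rw [div_le_one (by linarith)]; exact hr1
  have h0 : 0 ≤ 1 / ((r : ℝ) - 1) := by positivity
  rw [shiftDisc, abs_le]
  split_ifs <;> constructor <;> linarith

open ArithmeticFunction in
theorem sum_abs_vonMangoldt_shiftDisc_le (T : Finset ℕ) {R : ℝ} {u U X J : ℕ} (hR : 1 ≤ R)
    (hu : 0 < u) (hu9 : u.Coprime 9) (hU : 0 < U) (hX : 16 ≤ X) (hJ : 0 < J)
    (hT : ∀ r ∈ T, (r.Prime ∧ R ≤ r ∧ (r : ℝ) ≤ 4 * R) ∧ ¬ r ∣ u ∧ ¬ r ∣ 9) :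
    ∑ r ∈ T, |∑ n ∈ Finset.Ioc 0 X, vonMangoldt n * shiftDisc u r n| ≤
      4 * R * (13 * U ^ 2 * Real.log X) +
      (2 * J * Real.log X ^ 2 * (5 * X / (u * R) + 30 * X / √U + 90 * R * √X) +
        12 * Real.log X ^ 2 * (X / (J * u) * (1 + Real.log X) + X / U)) := by
  set m : ArithmeticFunction ℝ := ((moebius : ArithmeticFunction ℤ) : ArithmeticFunction ℝ) with hm
  set z : ArithmeticFunction ℝ := ((zeta : ArithmeticFunction ℕ) : ArithmeticFunction ℝ) with hz
  set α := m - truncate m U with hα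
  set β := (vonMangoldt - truncate vonMangoldt U) * z with hβ
  have hX0 : (0 : ℝ) < X := by exact_mod_cast (show 0 < X by omega)
  have hU1 : (1 : ℝ) ≤ U := by exact_mod_cast hU
  have hL0 : 0 ≤ Real.log X := Real.log_natCast_nonneg _
  have hlogle : ∀ l ≤ X, Real.log l ≤ Real.log X := by
    intro l hl
    rcases Nat.eq_zero_or_pos l with rfl | h
    · simpa using hL0
    · exact Real.log_le_log (by exact_mod_cast h) (by exact_mod_cast hl)
  have hm1 : ∀ n, |m n| ≤ 1 := by
    intro n
    rw [hm, intCoe_apply]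
    exact_mod_cast abs_moebius_le_one
  have ht1 : ∀ n, |truncate m U n| ≤ 1 := by
    intro n
    rw [truncate_apply]
    split_ifs
    · exact hm1 n
    · simp
  have hα1 : ∀ n, |α n| ≤ 1 := by
    intro n
    rw [hα, sub_truncate_apply]
    split_ifs
    · simp
    · exact hm1 n
  have hΛ : ∀ n, |truncate vonMangoldt U n| ≤ vonMangoldt n := by
    intro n
    rw [truncate_apply]
    split_ifs
    · rw [abs_of_nonneg vonMangoldt_nonneg]
    · simp
  have hΛ' : ∀ n, |(vonMangoldt - truncate vonMangoldt U) n| ≤ vonMangoldt n := by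
    intro n
    rw [sub_truncate_apply]
    split_ifs
    · simp
    · rw [abs_of_nonneg vonMangoldt_nonneg]
  have hβ1 : ∀ l ≤ X, |β l| ≤ Real.log X := fun l hl =>
    (abs_mul_zeta_le_log hΛ' l).trans (hlogle l hl)
  have hα0 : ∀ n ≤ U, α n = 0 := fun n hn => by rw [hα, sub_truncate_apply, if_pos hn]
  have hβ0 : ∀ n ≤ U, β n = 0 := by
    intro n hn
    rw [hβ, hz, coe_mul_zeta_apply]
    refine Finset.sum_eq_zero fun i hi => ?_
    rw [sub_truncate_apply, if_pos]
    exact (Nat.divisor_le hi).trans hn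
  have hdecomp : ∀ r ∈ T, |∑ n ∈ Finset.Ioc 0 X, vonMangoldt n * shiftDisc u r n| ≤
      13 * U ^ 2 * Real.log X + |∑ k ∈ Finset.Ioc U X, ∑ l ∈ Finset.Ioc U X,
        if k * l ≤ X then α k * β l * shiftDisc u r (k * l) else 0| := by
    intro r hr
    obtain ⟨⟨hrp, -, -⟩, hur, h9⟩ := hT r hr
    have e0 : ∀ n, (vonMangoldt n : ℝ) = truncate vonMangoldt U n + (truncate m U * log) n -
        (truncate m U * truncate vonMangoldt U * z) n + (α * β) n := by
      intro n
      have := congrArg (fun f : ArithmeticFunction ℝ => f n) (vaughan_identity U)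
      simpa only [ArithmeticFunction.add_apply, arithmeticFunction_sub_apply] using this
    have e1 : ∑ n ∈ Finset.Ioc 0 X, vonMangoldt n * shiftDisc u r n =
        ∑ n ∈ Finset.Ioc 0 X, truncate vonMangoldt U n * shiftDisc u r n +
        ∑ n ∈ Finset.Ioc 0 X, (truncate m U * log) n * shiftDisc u r n -
        ∑ n ∈ Finset.Ioc 0 X, (truncate m U * truncate vonMangoldt U * z) n * shiftDisc u r n +
        ∑ n ∈ Finset.Ioc 0 X, (α * β) n * shiftDisc u r n := by
      rw [← Finset.sum_add_distrib, ← Finset.sum_sub_distrib, ← Finset.sum_add_distrib]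
      refine Finset.sum_congr rfl fun n _ => ?_
      rw [e0 n]
      ring
    have b1 : |∑ n ∈ Finset.Ioc 0 X, truncate vonMangoldt U n * shiftDisc u r n| ≤
        U * Real.log X := by
      have h1 : ∀ n ∈ Finset.Ioc 0 X, |truncate vonMangoldt U n * shiftDisc u r n| ≤
          if n ∈ Finset.Ioc 0 U then Real.log X else 0 := by
        intro n hn
        obtain ⟨hn0, hnX⟩ := Finset.mem_Ioc.mp hn
        rw [abs_mul]
        split_ifs with h
        · calc _ ≤ Real.log X * 1 := mul_le_mul ((hΛ n).trans (vonMangoldt_le_log.trans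
                (hlogle n hnX))) (abs_shiftDisc_le hrp) (abs_nonneg _) hL0
            _ = _ := mul_one _
        · rw [truncate_apply, if_neg (fun h2 => h (Finset.mem_Ioc.mpr ⟨hn0, h2⟩))]
          simp
      refine (Finset.abs_sum_le_sum_abs _ _).trans ((Finset.sum_le_sum h1).trans ?_)
      rw [← Finset.sum_filter, Finset.sum_const, nsmul_eq_mul]
      have h6 : ((Finset.Ioc 0 X).filter (· ∈ Finset.Ioc 0 U)).card ≤ U := by
        calc _ ≤ (Finset.Ioc 0 U).card :=
              Finset.card_le_card fun x hx => (Finset.mem_filter.mp hx).2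
          _ = U := by simp
      gcongr
    have b2 : |∑ n ∈ Finset.Ioc 0 X, (truncate m U * log) n * shiftDisc u r n| ≤
        U * (6 * 1 * Real.log X) := by
      refine abs_sum_convolution_shiftDisc_le hrp hu hur hu9 h9 _ _ (g₀ := fun n => Real.log n)
        zero_le_one hL0 (fun d _ => ht1 d) (fun d hd => ?_) (fun n _ => log_apply) ?_ (by simp)
        hlogle
      · rw [truncate_apply, if_neg (not_le.mpr hd)]
      · intro a b hab
        rcases Nat.eq_zero_or_pos a with rfl | h
        · simpa using Real.log_natCast_nonneg b
        · exact Real.log_le_log (by exact_mod_cast h) (by exact_mod_cast hab)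
    have b3 : |∑ n ∈ Finset.Ioc 0 X, (truncate m U * truncate vonMangoldt U * z) n *
        shiftDisc u r n| ≤ ((U * U : ℕ) : ℝ) * (6 * Real.log X * 1) := by
      refine abs_sum_convolution_shiftDisc_le hrp hu hur hu9 h9 _ _ (g₀ := fun _ => 1)
        hL0 zero_le_one (fun d hd => (abs_mul_le_log ht1 hΛ d).trans (hlogle d hd))
        (fun d hd => ?_) (fun n hn => ?_) (fun _ _ _ => le_rfl) zero_le_one (fun _ _ => le_rfl)
      · rw [mul_apply]
        refine Finset.sum_eq_zero fun x hx => ?_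
        obtain ⟨hx1, -⟩ := Nat.mem_divisorsAntidiagonal.mp hx
        rw [truncate_apply, truncate_apply]
        by_cases h1 : x.1 ≤ U
        · by_cases h2 : x.2 ≤ U
          · exact absurd (Nat.mul_le_mul h1 h2) (by omega)
          · rw [if_neg h2, mul_zero]
        · rw [if_neg h1, zero_mul]
      · rw [hz, natCoe_apply, zeta_apply_ne hn.ne']
        simp
    have e2 : ∑ n ∈ Finset.Ioc 0 X, (α * β) n * shiftDisc u r n =
        ∑ k ∈ Finset.Ioc U X, ∑ l ∈ Finset.Ioc U X,
        if k * l ≤ X then α k * β l * shiftDisc u r (k * l) else 0 := by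
      rw [sum_mul_apply_mul_eq]
      have hsub : Finset.Ioc U X ⊆ Finset.Ioc 0 X := Finset.Ioc_subset_Ioc_left (Nat.zero_le _)
      rw [← Finset.sum_subset hsub]
      · refine Finset.sum_congr rfl fun k _ => ?_
        rw [← Finset.sum_subset hsub]
        intro l hl hl'
        rw [hβ0 l]
        · simp
        · by_contra h
          exact hl' (Finset.mem_Ioc.mpr ⟨not_le.mp h, (Finset.mem_Ioc.mp hl).2⟩)
      · intro k hk hk'
        refine Finset.sum_eq_zero fun l _ => ?_
        rw [hα0 k]
        · simp
        · by_contra h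
          exact hk' (Finset.mem_Ioc.mpr ⟨not_le.mp h, (Finset.mem_Ioc.mp hk).2⟩)
    rw [e1, e2]
    have hUU : (U : ℝ) ≤ U ^ 2 := by nlinarith
    have hUL : (U : ℝ) * Real.log X ≤ U ^ 2 * Real.log X := by gcongr
    push_cast at b3
    refine (abs_add_le _ _).trans (add_le_add ?_ le_rfl)
    refine (abs_sub _ _).trans ?_
    refine (add_le_add (abs_add_le _ _) le_rfl).trans ?_
    nlinarith
  refine (Finset.sum_le_sum hdecomp).trans ?_
  rw [Finset.sum_add_distrib]
  refine add_le_add ?_ (hyperbola_dispersion_le T hR hu hu9 hU hX hJ hT hα1 hβ1)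
  rw [Finset.sum_const, nsmul_eq_mul]
  have hcard : (T.card : ℝ) ≤ 4 * R := by
    have h1 : T ⊆ Finset.Ioc 0 ⌊4 * R⌋₊ := fun r hr => Finset.mem_Ioc.mpr
      ⟨(hT r hr).1.1.pos, Nat.le_floor (hT r hr).1.2.2⟩
    have h2 := Finset.card_le_card h1
    rw [Nat.card_Ioc, Nat.sub_zero] at h2
    exact (Nat.cast_le.mpr h2).trans (Nat.floor_le (by linarith))
  gcongr

/-- The Chebyshev function of `n ≤ X` in the residue class `-9` modulo `u`. -/
noncomputable def psiShift (X u : ℕ) : ℝ :=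
  ∑ n ∈ Finset.Ioc 0 X, if u ∣ n + 9 then ArithmeticFunction.vonMangoldt n else 0

/-- The error term in `le_sum_psiShift_mul`. -/
noncomputable def bvError (X u U J : ℕ) (R : ℝ) : ℝ :=
  56 * R * U ^ 2 * Real.log X +
    (2 * J * Real.log X ^ 2 * (5 * X / (u * R) + 30 * X / √U + 90 * R * √X) +
      12 * Real.log X ^ 2 * (X / (J * u) * (1 + Real.log X) + X / U))

theorem psiShift_nonneg (X u : ℕ) : 0 ≤ psiShift X u :=
  Finset.sum_nonneg fun n _ => by
    split_ifs
    · exact ArithmeticFunction.vonMangoldt_nonneg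
    · exact le_rfl

theorem sum_vonMangoldt_of_dvd_le {r : ℕ} (hr : r.Prime) (X : ℕ) :
    ∑ n ∈ Finset.Ioc 0 X with r ∣ n, ArithmeticFunction.vonMangoldt n ≤ Real.log X := by
  rcases Nat.eq_zero_or_pos X with rfl | hX
  · simp
  have h1 : ∑ n ∈ Finset.Ioc 0 X with r ∣ n, ArithmeticFunction.vonMangoldt n ≤
      ∑ k ∈ Finset.Icc 1 (Nat.log r X), ArithmeticFunction.vonMangoldt (r ^ k) := by
    rw [← Finset.sum_image (f := fun n => ArithmeticFunction.vonMangoldt n) (g := fun k => r ^ k)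
      (fun a _ b _ h => Nat.pow_right_injective hr.two_le h)]
    rw [← Finset.sum_filter_ne_zero]
    refine Finset.sum_le_sum_of_subset_of_nonneg ?_
      fun _ _ _ => ArithmeticFunction.vonMangoldt_nonneg
    intro n hn
    obtain ⟨hn1, hn2⟩ := Finset.mem_filter.mp hn
    obtain ⟨hn3, hrn⟩ := Finset.mem_filter.mp hn1
    obtain ⟨p, k, hp, hk, rfl⟩ := (isPrimePow_nat_iff n).mp
      (ArithmeticFunction.vonMangoldt_ne_zero_iff.mp hn2)
    have hrp : r = p := (Nat.prime_dvd_prime_iff_eq hr hp).mp (hr.dvd_of_dvd_pow hrn)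
    subst hrp
    exact Finset.mem_image.mpr ⟨k, Finset.mem_Icc.mpr ⟨hk,
      Nat.le_log_of_pow_le hr.one_lt (Finset.mem_Ioc.mp hn3).2⟩, rfl⟩
  refine h1.trans ?_
  rw [Finset.sum_congr rfl fun k hk => (ArithmeticFunction.vonMangoldt_apply_pow
    (show k ≠ 0 by have := (Finset.mem_Icc.mp hk).1; omega)).trans
    (ArithmeticFunction.vonMangoldt_apply_prime hr)]
  rw [Finset.sum_const, Nat.card_Icc, Nat.add_sub_cancel, nsmul_eq_mul, ← Real.log_pow]
  refine Real.log_le_log (pow_pos (by exact_mod_cast hr.pos) _) ?_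
  exact_mod_cast Nat.pow_log_le_self r hX.ne'

theorem le_psiShift_mul {X u r : ℕ} (hr : r.Prime) (hur : ¬ r ∣ u) :
    psiShift X u * (1 / r) - Real.log X -
      |∑ n ∈ Finset.Ioc 0 X, ArithmeticFunction.vonMangoldt n * shiftDisc u r n| ≤
      psiShift X (u * r) := by
  have hcop : u.Coprime r := ((hr.coprime_iff_not_dvd.mpr hur).symm)
  have hr1 : (1 : ℝ) ≤ (r : ℝ) - 1 := by
    have : (2 : ℝ) ≤ r := by exact_mod_cast hr.two_le
    linarith
  have hX' : 0 ≤ Real.log X := Real.log_natCast_nonneg _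
  set W : ℝ := ∑ n ∈ Finset.Ioc 0 X with r ∣ n,
    if u ∣ n + 9 then ArithmeticFunction.vonMangoldt n else 0 with hW
  have hWle : W ≤ Real.log X := by
    refine le_trans ?_ (sum_vonMangoldt_of_dvd_le hr X)
    refine Finset.sum_le_sum fun n _ => ?_
    split_ifs
    · exact le_rfl
    · exact ArithmeticFunction.vonMangoldt_nonneg
  have key : ∑ n ∈ Finset.Ioc 0 X, ArithmeticFunction.vonMangoldt n * shiftDisc u r n =
      psiShift X (u * r) - (psiShift X u - W) * (1 / ((r : ℝ) - 1)) := by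
    rw [hW, Finset.sum_filter, psiShift, psiShift, ← Finset.sum_sub_distrib, Finset.sum_mul,
      ← Finset.sum_sub_distrib]
    refine Finset.sum_congr rfl fun n _ => ?_
    have e3 : (u * r ∣ n + 9) ↔ u ∣ n + 9 ∧ r ∣ n + 9 :=
      ⟨fun h => ⟨(Dvd.intro _ rfl).trans h, (Dvd.intro_left _ rfl).trans h⟩,
        fun h => hcop.mul_dvd_of_dvd_of_dvd h.1 h.2⟩
    simp only [shiftDisc, e3]
    by_cases h1 : u ∣ n + 9
    · by_cases h2 : r ∣ n <;> by_cases h3 : r ∣ n + 9 <;> simp [h1, h2, h3] <;> ring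
    · simp [h1]
  have h1 := (abs_le.mp (le_refl |∑ n ∈ Finset.Ioc 0 X,
    ArithmeticFunction.vonMangoldt n * shiftDisc u r n|)).1
  set Y := |∑ n ∈ Finset.Ioc 0 X, ArithmeticFunction.vonMangoldt n * shiftDisc u r n|
  rw [key] at h1
  have hle : 1 / ((r : ℝ) - 1) ≤ 1 := by rw [div_le_one (by linarith)]; exact hr1
  have hinv : 0 ≤ 1 / ((r : ℝ) - 1) := by positivity
  have h2 : W * (1 / ((r : ℝ) - 1)) ≤ Real.log X := by
    calc _ ≤ Real.log X * 1 := mul_le_mul hWle hle hinv hX'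
      _ = _ := mul_one _
  have h3 : psiShift X u * (1 / r) ≤ psiShift X u * (1 / ((r : ℝ) - 1)) := by
    have := psiShift_nonneg X u
    have : 1 / (r : ℝ) ≤ 1 / ((r : ℝ) - 1) := one_div_le_one_div_of_le (by linarith) (by linarith)
    gcongr
  linarith [sub_mul (psiShift X u) W (1 / ((r : ℝ) - 1))]

theorem le_sum_psiShift_mul (T : Finset ℕ) {R : ℝ} {u U X J : ℕ} (hR : 1 ≤ R)
    (hu : 0 < u) (hu9 : u.Coprime 9) (hU : 0 < U) (hX : 16 ≤ X) (hJ : 0 < J)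
    (hT : ∀ r ∈ T, (r.Prime ∧ R ≤ r ∧ (r : ℝ) ≤ 4 * R) ∧ ¬ r ∣ u ∧ ¬ r ∣ 9) :
    psiShift X u * ∑ r ∈ T, 1 / (r : ℝ) - bvError X u U J R ≤ ∑ r ∈ T, psiShift X (u * r) := by
  have h1 := sum_abs_vonMangoldt_shiftDisc_le T hR hu hu9 hU hX hJ hT
  have h2 := Finset.sum_le_sum fun r hr =>
    le_psiShift_mul (X := X) (hT r hr).1.1 (hT r hr).2.1
  rw [Finset.sum_sub_distrib, Finset.sum_sub_distrib, ← Finset.mul_sum, Finset.sum_const,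
    nsmul_eq_mul] at h2
  have hcard : (T.card : ℝ) ≤ 4 * R := by
    have h1 : T ⊆ Finset.Ioc 0 ⌊4 * R⌋₊ := fun r hr => Finset.mem_Ioc.mpr
      ⟨(hT r hr).1.1.pos, Nat.le_floor (hT r hr).1.2.2⟩
    have h2 := Finset.card_le_card h1
    rw [Nat.card_Ioc, Nat.sub_zero] at h2
    exact (Nat.cast_le.mpr h2).trans (Nat.floor_le (by linarith))
  have hX' : 0 ≤ Real.log X := Real.log_natCast_nonneg _
  have hU1 : (1 : ℝ) ≤ U := by exact_mod_cast hU
  have h3 : (T.card : ℝ) * Real.log X ≤ 4 * R * (U ^ 2 * Real.log X) := by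
    have : Real.log X ≤ U ^ 2 * Real.log X := le_mul_of_one_le_left hX' (one_le_pow₀ hU1)
    gcongr
  rw [bvError]
  linarith

/-- The primes in `[4 ^ a, 4 ^ b)`. -/
def primeRange (a b : ℕ) : Finset ℕ := (Finset.Ico (4 ^ a) (4 ^ b)).filter Nat.Prime

theorem mem_primeRange {a b r : ℕ} : r ∈ primeRange a b ↔ (4 ^ a ≤ r ∧ r < 4 ^ b) ∧ r.Prime := by
  rw [primeRange, Finset.mem_filter, Finset.mem_Ico]

theorem sum_primeRange {a b : ℕ} (hab : a ≤ b) (f : ℕ → ℝ) :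
    ∑ r ∈ primeRange a b, f r = ∑ k ∈ Finset.Ico a b, ∑ r ∈ primeRange k (k + 1), f r := by
  induction b, hab using Nat.le_induction with
  | base => simp [primeRange]
  | succ b hab ih =>
    rw [Finset.sum_Ico_succ_top hab, ← ih, ← Finset.sum_union]
    · congr 1
      ext r
      rw [Finset.mem_union, mem_primeRange, mem_primeRange, mem_primeRange]
      have h1 : 4 ^ a ≤ 4 ^ b := Nat.pow_le_pow_right (by norm_num) hab
      have h2 : 4 ^ b ≤ 4 ^ (b + 1) := Nat.pow_le_pow_right (by norm_num) (Nat.le_succ b)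
      constructor
      · rintro ⟨⟨h3, h4⟩, h5⟩
        rcases lt_or_ge r (4 ^ b) with h6 | h6
        · exact Or.inl ⟨⟨h3, h6⟩, h5⟩
        · exact Or.inr ⟨⟨h6, h4⟩, h5⟩
      · rintro (⟨⟨h3, h4⟩, h5⟩ | ⟨⟨h3, h4⟩, h5⟩)
        · exact ⟨⟨h3, by omega⟩, h5⟩
        · exact ⟨⟨by omega, h4⟩, h5⟩
    · rw [Finset.disjoint_left]
      intro r h1 h2
      rw [mem_primeRange] at h1 h2
      omega

theorem log_four_eq : Real.log 4 = 2 * Real.log 2 := by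
  rw [show (4 : ℝ) = 2 ^ 2 by norm_num, Real.log_pow]
  push_cast
  rfl

theorem sum_inv_primeRange_succ_le {k : ℕ} (hk : 1 ≤ k) :
    ∑ r ∈ primeRange k (k + 1), 1 / (r : ℝ) ≤ 4 / k := by
  have hk' : (0 : ℝ) < k := by exact_mod_cast hk
  have hl4 : 0 < Real.log 4 := Real.log_pos (by norm_num)
  have h1 : ∀ r ∈ primeRange k (k + 1), 1 / (r : ℝ) ≤
      Real.log r * (1 / (k * Real.log 4 * 4 ^ k)) := by
    intro r hr
    rw [mem_primeRange] at hr
    have h2 : (4 : ℝ) ^ k ≤ r := by exact_mod_cast hr.1.1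
    have h3 : k * Real.log 4 ≤ Real.log r := by
      rw [← Real.log_pow]
      exact Real.log_le_log (by positivity) h2
    have h4 : (0 : ℝ) < 4 ^ k := by positivity
    rw [mul_one_div, div_le_div_iff₀ (by linarith) (by positivity), one_mul]
    exact mul_le_mul h3 h2 h4.le ((by positivity : (0 : ℝ) ≤ k * Real.log 4).trans h3)
  refine (Finset.sum_le_sum h1).trans ?_
  rw [← Finset.sum_mul]
  have h5 : ∑ r ∈ primeRange k (k + 1), Real.log r ≤ Real.log 4 * 4 ^ (k + 1) := by
    refine le_trans ?_ (Chebyshev.theta_le_log4_mul_x (show (0 : ℝ) ≤ 4 ^ (k + 1) by positivity))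
    rw [Chebyshev.theta, show ((4 : ℝ) ^ (k + 1)) = ((4 ^ (k + 1) : ℕ) : ℝ) by push_cast; rfl,
      Nat.floor_natCast]
    refine Finset.sum_le_sum_of_subset_of_nonneg ?_ fun r _ _ => Real.log_natCast_nonneg r
    intro r hr
    rw [mem_primeRange] at hr
    exact Finset.mem_filter.mpr ⟨Finset.mem_Ioc.mpr ⟨hr.2.pos, hr.1.2.le⟩, hr.2⟩
  calc _ ≤ Real.log 4 * 4 ^ (k + 1) * (1 / (k * Real.log 4 * 4 ^ k)) := by gcongr
    _ = 4 / k := by rw [pow_succ]; field_simp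

theorem le_sum_inv_primeRange_succ {k : ℕ} (hk : 8 ≤ k) :
    1 / (8 * ((k : ℝ) + 1)) ≤ ∑ r ∈ primeRange k (k + 1), 1 / (r : ℝ) := by
  have hl2 : 0 < Real.log 2 := Real.log_pos (by norm_num)
  have hpow : ∀ m : ℕ, 8 ≤ m → 8 * (m + 1) + 1 ≤ 2 ^ m := by
    intro m hm
    induction m, hm using Nat.le_induction with
    | base => norm_num
    | succ m hm ih => rw [pow_succ]; omega
  have hp : 8 * ((k : ℝ) + 1) + 1 ≤ 2 ^ k := by exact_mod_cast hpow k hk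
  have h4 : (4 : ℝ) ^ k = 2 ^ k * 2 ^ k := by rw [← mul_pow]; norm_num
  have hk0 : (0 : ℝ) ≤ k := Nat.cast_nonneg k
  have hupper := Chebyshev.theta_le_log4_mul_x (show (0 : ℝ) ≤ ((4 ^ k : ℕ) : ℝ) by positivity)
  have hlower := Chebyshev.theta_ge (4 ^ (k + 1))
  have hlog1 : Real.log (((4 ^ (k + 1) : ℕ) : ℝ) + 1) ≤ (k + 2) * (2 * Real.log 2) := by
    rw [← log_four_eq, show ((k : ℝ) + 2) = ((k + 2 : ℕ) : ℝ) by push_cast; rfl, ← Real.log_pow]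
    refine Real.log_le_log (by positivity) ?_
    push_cast
    have : (1 : ℝ) ≤ 4 ^ k := one_le_pow₀ (by norm_num)
    rw [pow_succ, pow_add]
    linarith
  have hlog2 : Real.log ((4 ^ (k + 1) : ℕ) : ℝ) = (k + 1) * (2 * Real.log 2) := by
    push_cast
    rw [Real.log_pow, log_four_eq]
    push_cast
    rfl
  have hsqrt : √((4 ^ (k + 1) : ℕ) : ℝ) = 2 * 2 ^ k := by
    rw [Real.sqrt_eq_iff_mul_self_eq (by positivity) (by positivity)]
    push_cast
    rw [pow_succ, h4]
    ring
  rw [hlog2, hsqrt] at hlower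
  have hdiff : Chebyshev.theta ((4 ^ (k + 1) : ℕ) : ℝ) - Chebyshev.theta ((4 ^ k : ℕ) : ℝ) ≤
      ∑ r ∈ primeRange k (k + 1), Real.log r := by
    rw [Chebyshev.theta, Chebyshev.theta, Nat.floor_natCast, Nat.floor_natCast,
      sub_le_iff_le_add, ← Finset.sum_union]
    · refine Finset.sum_le_sum_of_subset_of_nonneg ?_ fun r _ _ => Real.log_natCast_nonneg r
      intro r hr
      obtain ⟨h1, h2⟩ := Finset.mem_filter.mp hr
      rw [Finset.mem_Ioc] at h1
      rw [Finset.mem_union, mem_primeRange]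
      by_cases h3 : r ≤ 4 ^ k
      · exact Or.inr (Finset.mem_filter.mpr ⟨Finset.mem_Ioc.mpr ⟨h1.1, h3⟩, h2⟩)
      · refine Or.inl ⟨⟨by omega, lt_of_le_of_ne h1.2 ?_⟩, h2⟩
        rintro rfl
        exact absurd h2 (Nat.Prime.not_prime_pow (by omega))
    · rw [Finset.disjoint_left]
      intro r h1 h2
      rw [mem_primeRange] at h1
      have h3 := (Finset.mem_Ioc.mp (Finset.mem_filter.mp h2).1).2
      have h5 : r = 4 ^ k := by omega
      rw [h5] at h1
      exact absurd h1.2 (Nat.Prime.not_prime_pow (by omega))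
  have hmain : Real.log 2 * 4 ^ k ≤ ∑ r ∈ primeRange k (k + 1), Real.log r := by
    refine le_trans ?_ hdiff
    rw [log_four_eq] at hupper
    push_cast at hupper hlower hlog1 ⊢
    have e1 : (2 * ((k : ℝ) + 2) + 8 * 2 ^ k * (k + 1)) ≤ 4 ^ k := by
      rw [h4]
      have : (0 : ℝ) < 2 ^ k := by positivity
      nlinarith
    have e2 := mul_le_mul_of_nonneg_left e1 hl2.le
    have e3 : (4 : ℝ) ^ (k + 1) = 4 * 4 ^ k := by rw [pow_succ]; ring
    rw [e3] at hlower hlog1 ⊢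
    nlinarith
  have h1 : ∀ r ∈ primeRange k (k + 1), Real.log r ≤
      1 / (r : ℝ) * ((k + 1) * (2 * Real.log 2) * (4 * 4 ^ k)) := by
    intro r hr
    rw [mem_primeRange] at hr
    have h2 : (r : ℝ) ≤ ((4 ^ (k + 1) : ℕ) : ℝ) := by exact_mod_cast hr.1.2.le
    have h3 : (0 : ℝ) < r := by exact_mod_cast hr.2.pos
    have h5 := Real.log_le_log h3 h2
    rw [hlog2] at h5
    push_cast at h2
    rw [pow_succ] at h2
    rw [one_div, inv_mul_eq_div, le_div_iff₀ h3]
    exact mul_le_mul h5 (by linarith) h3.le (by positivity)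
  have h2 := hmain.trans (Finset.sum_le_sum h1)
  rw [← Finset.sum_mul] at h2
  rw [div_le_iff₀ (by positivity)]
  have h5 : (0 : ℝ) < Real.log 2 * 4 ^ k := by positivity
  refine le_of_mul_le_mul_right ?_ h5
  rw [one_mul]
  refine h2.trans (le_of_eq ?_)
  ring

theorem le_sum_inv_primeRange {z : ℕ} (hz : 8 ≤ z) (s : ℕ) :
    (s : ℝ) / 16 ≤ ∑ r ∈ primeRange z (z * 2 ^ s), 1 / (r : ℝ) := by
  rw [sum_primeRange (Nat.le_mul_of_pos_right z (by positivity))]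
  induction s with
  | zero => simp
  | succ s ih =>
    have h1 : z * 2 ^ s ≤ z * 2 ^ (s + 1) := by gcongr <;> omega
    rw [← Finset.sum_Ico_consecutive _ (Nat.le_mul_of_pos_right z (by positivity)) h1]
    have h2 : (1 : ℝ) / 16 ≤ ∑ k ∈ Finset.Ico (z * 2 ^ s) (z * 2 ^ (s + 1)),
        ∑ r ∈ primeRange k (k + 1), 1 / (r : ℝ) := by
      have h3 : ∀ k ∈ Finset.Ico (z * 2 ^ s) (z * 2 ^ (s + 1)),
          1 / (8 * (((z * 2 ^ (s + 1) : ℕ) : ℝ))) ≤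
          ∑ r ∈ primeRange k (k + 1), 1 / (r : ℝ) := by
        intro k hk
        obtain ⟨h4, h5⟩ := Finset.mem_Ico.mp hk
        have h6 : z ≤ z * 2 ^ s := Nat.le_mul_of_pos_right z (by positivity)
        refine le_trans ?_ (le_sum_inv_primeRange_succ (show 8 ≤ k by omega))
        have h7 : (k : ℝ) + 1 ≤ ((z * 2 ^ (s + 1) : ℕ) : ℝ) := by exact_mod_cast h5
        exact one_div_le_one_div_of_le (by positivity) (by linarith)
      refine le_trans ?_ (Finset.sum_le_sum h3)
      rw [Finset.sum_const, Nat.card_Ico, nsmul_eq_mul,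
        show z * 2 ^ (s + 1) - z * 2 ^ s = z * 2 ^ s by rw [pow_succ]; ring_nf; omega]
      have hz' : (0 : ℝ) < z := by exact_mod_cast (show 0 < z by omega)
      push_cast
      rw [pow_succ]
      apply le_of_eq
      field_simp
      norm_num
    push_cast
    linarith

theorem sum_inv_primeRange_le {z : ℕ} (hz : 1 ≤ z) (s : ℕ) :
    ∑ r ∈ primeRange z (z * 2 ^ s), 1 / (r : ℝ) ≤ 4 * s := by
  rw [sum_primeRange (Nat.le_mul_of_pos_right z (by positivity))]
  induction s with
  | zero => simp
  | succ s ih =>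
    have h1 : z * 2 ^ s ≤ z * 2 ^ (s + 1) := by gcongr <;> omega
    rw [← Finset.sum_Ico_consecutive _ (Nat.le_mul_of_pos_right z (by positivity)) h1]
    have h2 : ∑ k ∈ Finset.Ico (z * 2 ^ s) (z * 2 ^ (s + 1)),
        ∑ r ∈ primeRange k (k + 1), 1 / (r : ℝ) ≤ 4 := by
      have hpos : 0 < z * 2 ^ s := by positivity
      have h3 : ∀ k ∈ Finset.Ico (z * 2 ^ s) (z * 2 ^ (s + 1)),
          ∑ r ∈ primeRange k (k + 1), 1 / (r : ℝ) ≤ 4 / ((z * 2 ^ s : ℕ) : ℝ) := by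
        intro k hk
        obtain ⟨h4, h5⟩ := Finset.mem_Ico.mp hk
        refine (sum_inv_primeRange_succ_le (by omega)).trans ?_
        have : (0 : ℝ) < ((z * 2 ^ s : ℕ) : ℝ) := by exact_mod_cast hpos
        exact div_le_div_of_nonneg_left (by norm_num) this (by exact_mod_cast h4)
      refine (Finset.sum_le_sum h3).trans ?_
      rw [Finset.sum_const, Nat.card_Ico, nsmul_eq_mul,
        show z * 2 ^ (s + 1) - z * 2 ^ s = z * 2 ^ s by rw [pow_succ]; ring_nf; omega]
      have : (0 : ℝ) < ((z * 2 ^ s : ℕ) : ℝ) := by exact_mod_cast hpos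
      rw [mul_div_cancel₀]
      exact this.ne'
    push_cast
    linarith

theorem sum_inv_primes_le_of_lt_four_mul {a : ℕ} (ha : 1 ≤ a) (S : Finset ℕ)
    (hS : ∀ r ∈ S, r.Prime ∧ 4 ^ a ≤ r) (hS4 : ∀ r ∈ S, ∀ r' ∈ S, r' < 4 * r) :
    ∑ r ∈ S, 1 / (r : ℝ) ≤ 8 / a := by
  rcases S.eq_empty_or_nonempty with rfl | hne
  · simpa using (by positivity : (0 : ℝ) ≤ 8 / a)
  set r₀ := S.min' hne
  have hr₀ : r₀ ∈ S := S.min'_mem hne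
  set k := Nat.log 4 r₀
  have hk0 : 4 ^ k ≤ r₀ := Nat.pow_log_le_self 4 (hS r₀ hr₀).1.ne_zero
  have hk1 : r₀ < 4 ^ (k + 1) := Nat.lt_pow_succ_log_self (by norm_num) r₀
  have hak : a ≤ k := Nat.le_log_of_pow_le (by norm_num) (hS r₀ hr₀).2
  have hsub : S ⊆ primeRange k (k + 2) := by
    intro r hr
    have h1 := S.min'_le r hr
    have h2 := hS4 r₀ hr₀ r hr
    rw [mem_primeRange, pow_succ]
    exact ⟨⟨hk0.trans h1, by omega⟩, (hS r hr).1⟩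
  refine (Finset.sum_le_sum_of_subset_of_nonneg hsub fun _ _ _ => by positivity).trans ?_
  rw [sum_primeRange (by omega), Finset.sum_Ico_succ_top (by omega),
    Finset.sum_Ico_succ_top (by omega), Finset.Ico_self, Finset.sum_empty, zero_add]
  have ha' : (0 : ℝ) < a := by exact_mod_cast ha
  have h1 := sum_inv_primeRange_succ_le (k := k) (by omega)
  have h2 := sum_inv_primeRange_succ_le (k := k + 1) (by omega)
  have h3 : (4 : ℝ) / k ≤ 4 / a :=
    div_le_div_of_nonneg_left (by norm_num) ha' (by exact_mod_cast hak)
  have h4 : (4 : ℝ) / ((k + 1 : ℕ) : ℝ) ≤ 4 / a :=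
    div_le_div_of_nonneg_left (by norm_num) ha' (by exact_mod_cast (show a ≤ k + 1 by omega))
  have h5 : (8 : ℝ) / a = 4 / a + 4 / a := by ring
  linarith

/-- The products of one prime from each of the intervals `[4 ^ x.1, 4 ^ x.2)`, `x ∈ l`. -/
def primeProducts : List (ℕ × ℕ) → Finset ℕ
  | [] => {1}
  | x :: l => (primeRange x.1 x.2 ×ˢ primeProducts l).image fun y => y.1 * y.2

/-- The product over `x ∈ l` of the sums of `1 / r` over the primes `r ∈ [4 ^ x.1, 4 ^ x.2)`. -/
noncomputable def primeMass (l : List (ℕ × ℕ)) : ℝ :=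
  (l.map fun x => ∑ r ∈ primeRange x.1 x.2, 1 / (r : ℝ)).prod

/-- The intervals of `l` are pairwise disjoint. -/
def DisjointRanges (l : List (ℕ × ℕ)) : Prop :=
  l.Pairwise fun x y => Disjoint (primeRange x.1 x.2) (primeRange y.1 y.2)

theorem primeMass_nil : primeMass [] = 1 := rfl

theorem primeMass_cons (x : ℕ × ℕ) (l : List (ℕ × ℕ)) :
    primeMass (x :: l) = (∑ r ∈ primeRange x.1 x.2, 1 / (r : ℝ)) * primeMass l := rfl

theorem primeMass_nonneg (l : List (ℕ × ℕ)) : 0 ≤ primeMass l :=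
  List.prod_nonneg fun a ha => by
    obtain ⟨x, -, rfl⟩ := List.mem_map.mp ha
    exact Finset.sum_nonneg fun _ _ => by positivity

theorem mem_primeProducts_cons {x : ℕ × ℕ} {l : List (ℕ × ℕ)} {u : ℕ} :
    u ∈ primeProducts (x :: l) ↔
      ∃ r ∈ primeRange x.1 x.2, ∃ v ∈ primeProducts l, r * v = u := by
  simp only [primeProducts, Finset.mem_image, Finset.mem_product, Prod.exists]
  constructor
  · rintro ⟨r, v, ⟨hr, hv⟩, rfl⟩
    exact ⟨r, hr, v, hv, rfl⟩
  · rintro ⟨r, hr, v, hv, rfl⟩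
    exact ⟨r, v, ⟨hr, hv⟩, rfl⟩

theorem exists_mul_of_mem_primeProducts_append {l₁ l₂ : List (ℕ × ℕ)} {u : ℕ}
    (hu : u ∈ primeProducts (l₁ ++ l₂)) :
    ∃ w ∈ primeProducts l₁, ∃ v ∈ primeProducts l₂, w * v = u := by
  induction l₁ generalizing u with
  | nil => exact ⟨1, by simp [primeProducts], u, hu, one_mul u⟩
  | cons x l ih =>
    obtain ⟨r, hr, v, hv, rfl⟩ := mem_primeProducts_cons.mp hu
    obtain ⟨w, hw, v', hv', rfl⟩ := ih hv
    exact ⟨r * w, mem_primeProducts_cons.mpr ⟨r, hr, w, hw, rfl⟩, v', hv', mul_assoc _ _ _⟩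

theorem pos_of_mem_primeProducts {l : List (ℕ × ℕ)} {u : ℕ} (hu : u ∈ primeProducts l) :
    0 < u := by
  induction l generalizing u with
  | nil =>
    rw [Finset.mem_singleton.mp hu]
    exact one_pos
  | cons x l ih =>
    obtain ⟨r, hr, v, hv, rfl⟩ := mem_primeProducts_cons.mp hu
    exact Nat.mul_pos (mem_primeRange.mp hr).2.pos (ih hv)

theorem le_of_mem_primeProducts {l : List (ℕ × ℕ)} {u : ℕ} (hu : u ∈ primeProducts l) :
    u ≤ 4 ^ (l.map Prod.snd).sum := by
  induction l generalizing u with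
  | nil =>
    rw [Finset.mem_singleton.mp hu]
    simp
  | cons x l ih =>
    obtain ⟨r, hr, v, hv, rfl⟩ := mem_primeProducts_cons.mp hu
    rw [List.map_cons, List.sum_cons, pow_add]
    exact Nat.mul_le_mul (mem_primeRange.mp hr).1.2.le (ih hv)

theorem exists_mem_primeRange_of_dvd {l : List (ℕ × ℕ)} {u q : ℕ} (hu : u ∈ primeProducts l)
    (hq : q.Prime) (hqu : q ∣ u) : ∃ x ∈ l, q ∈ primeRange x.1 x.2 := by
  induction l generalizing u with
  | nil =>
    rw [Finset.mem_singleton.mp hu] at hqu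
    exact absurd (Nat.dvd_one.mp hqu) hq.ne_one
  | cons x l ih =>
    obtain ⟨r, hr, v, hv, rfl⟩ := mem_primeProducts_cons.mp hu
    rcases hq.dvd_mul.mp hqu with h | h
    · rw [(Nat.prime_dvd_prime_iff_eq hq (mem_primeRange.mp hr).2).mp h]
      exact ⟨x, List.mem_cons_self, hr⟩
    · obtain ⟨y, hy, h⟩ := ih hv h
      exact ⟨y, List.mem_cons_of_mem _ hy, h⟩

theorem le_of_prime_dvd_of_mem_primeProducts {l : List (ℕ × ℕ)} {u q A : ℕ}
    (hA : ∀ x ∈ l, A ≤ x.1) (hu : u ∈ primeProducts l) (hq : q.Prime) (hqu : q ∣ u) :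
    4 ^ A ≤ q := by
  obtain ⟨x, hx, h⟩ := exists_mem_primeRange_of_dvd hu hq hqu
  exact (Nat.pow_le_pow_right (by norm_num) (hA x hx)).trans (mem_primeRange.mp h).1.1

theorem not_dvd_of_mem_primeRange {x : ℕ × ℕ} {l : List (ℕ × ℕ)} (hl : DisjointRanges (x :: l))
    {r u : ℕ} (hr : r ∈ primeRange x.1 x.2) (hu : u ∈ primeProducts l) : ¬ r ∣ u := by
  intro h
  obtain ⟨y, hy, hry⟩ := exists_mem_primeRange_of_dvd hu (mem_primeRange.mp hr).2 h
  exact Finset.disjoint_left.mp ((List.pairwise_cons.mp hl).1 y hy) hr hry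

theorem sum_primeProducts_cons {x : ℕ × ℕ} {l : List (ℕ × ℕ)} (hl : DisjointRanges (x :: l))
    (f : ℕ → ℝ) :
    ∑ u ∈ primeProducts (x :: l), f u =
      ∑ u ∈ primeProducts l, ∑ r ∈ primeRange x.1 x.2, f (r * u) := by
  rw [primeProducts, Finset.sum_image, Finset.sum_product_right]
  rintro ⟨r, u⟩ h ⟨r', u'⟩ h' heq
  obtain ⟨hr, hu⟩ := Finset.mem_product.mp h
  obtain ⟨hr', hu'⟩ := Finset.mem_product.mp h'
  dsimp only at hr hu hr' hu' heq
  have hp := (mem_primeRange.mp hr).2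
  have h1 : r = r' := by
    rcases hp.dvd_mul.mp (Dvd.intro _ heq) with h2 | h2
    · exact (Nat.prime_dvd_prime_iff_eq hp (mem_primeRange.mp hr').2).mp h2
    · exact absurd h2 (not_dvd_of_mem_primeRange hl hr hu')
  subst h1
  rw [Nat.eq_of_mul_eq_mul_left hp.pos heq]

theorem sum_inv_primeProducts {l : List (ℕ × ℕ)} (hl : DisjointRanges l) :
    ∑ u ∈ primeProducts l, 1 / (u : ℝ) = primeMass l := by
  induction l with
  | nil => simp [primeProducts, primeMass]
  | cons x l ih =>
    rw [sum_primeProducts_cons hl, primeMass_cons, ← ih (List.pairwise_cons.mp hl).2,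
      Finset.sum_mul_sum, Finset.sum_comm]
    refine Finset.sum_congr rfl fun r _ => Finset.sum_congr rfl fun u _ => ?_
    push_cast
    rw [one_div_mul_one_div]

/-- `X` lies in `[16 ^ N, 16 ^ (N + 1))` and `4 ^ ℓ` is of the order of `N`. -/
structure IsScale (X N ℓ : ℕ) : Prop where
  one_le : 1 ≤ ℓ
  mul_le : 100 * ℓ ≤ N
  succ_le : 4 * (N + 1) ≤ 4 ^ ℓ
  le_pow : 4 ^ ℓ ≤ 16 * (N + 1)
  pow_le : 16 ^ N ≤ X
  lt_pow : X < 16 ^ (N + 1)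

theorem IsScale.log_le {X N ℓ : ℕ} (h : IsScale X N ℓ) : Real.log X ≤ 4 * (N + 1) := by
  have h0 : 0 < X := lt_of_lt_of_le (by positivity) h.pow_le
  have h1 : Real.log X ≤ Real.log (16 ^ (N + 1)) :=
    Real.log_le_log (by exact_mod_cast h0) (by exact_mod_cast h.lt_pow.le)
  rw [Real.log_pow, show (16 : ℝ) = 2 ^ 4 by norm_num, Real.log_pow] at h1
  have h2 := Real.log_two_lt_d9
  push_cast at h1
  nlinarith [Nat.cast_nonneg (α := ℝ) N]

theorem IsScale.log_le_pow {X N ℓ : ℕ} (h : IsScale X N ℓ) : Real.log X ≤ 4 ^ ℓ := by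
  have h1 : (4 : ℝ) * (N + 1) ≤ 4 ^ ℓ := by exact_mod_cast h.succ_le
  exact h.log_le.trans h1

theorem IsScale.le_sqrt {X N ℓ : ℕ} (h : IsScale X N ℓ) : (4 : ℝ) ^ N ≤ √X := by
  refine Real.le_sqrt_of_sq_le ?_
  rw [← pow_mul, mul_comm, pow_mul]
  norm_num
  exact_mod_cast h.pow_le

theorem bvError_le {X N ℓ u k : ℕ} (h : IsScale X N ℓ) (hu : 0 < u) (hu' : u ≤ 4 ^ (N / 50))
    (hk : 16 * ℓ ≤ k) (hku : 4 ^ k * u * 4 ^ (16 * ℓ) ≤ 4 ^ (N + 1)) :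
    bvError X u (4 ^ (2 * (N / 5))) (4 ^ (10 * ℓ)) (4 ^ k : ℕ) ≤
      882 / (4 : ℝ) ^ (4 * ℓ) * (X / u) := by
  obtain ⟨E, hE⟩ : ∃ E : ℝ, E = 4 ^ ℓ := ⟨_, rfl⟩
  have hEpow : ∀ j : ℕ, (4 : ℝ) ^ (j * ℓ) = E ^ j := fun j => by
    rw [mul_comm, pow_mul, ← hE]
  have hE4 : 4 ≤ E := by
    rw [hE]
    calc (4 : ℝ) = 4 ^ 1 := by norm_num
      _ ≤ 4 ^ ℓ := pow_le_pow_right₀ (by norm_num) h.one_le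
  have hL : Real.log X ≤ E := hE ▸ h.log_le_pow
  have hL0 : 0 ≤ Real.log X := Real.log_natCast_nonneg _
  obtain ⟨V, hV⟩ : ∃ V : ℝ, V = 4 ^ (N / 5) := ⟨_, rfl⟩
  obtain ⟨F, hF⟩ : ∃ F : ℝ, F = 4 ^ N := ⟨_, rfl⟩
  have hF0 : 0 < F := by rw [hF]; positivity
  have hE0 : 0 < E := by linarith
  have hV0 : 0 < V := by rw [hV]; positivity
  have hu0 : (0 : ℝ) < u := by exact_mod_cast hu
  obtain ⟨R, hR⟩ : ∃ R : ℝ, R = 4 ^ k := ⟨_, rfl⟩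
  have hR0 : 0 < R := by rw [hR]; positivity
  have hRE : E ^ 16 ≤ R := by
    rw [hR, ← hEpow]
    exact pow_le_pow_right₀ (by norm_num) hk
  have hRu : R * u * E ^ 16 ≤ 4 * F := by
    rw [hR, ← hEpow, hF, ← pow_succ']
    exact_mod_cast hku
  have huV : u * E ^ 16 ≤ V := by
    have : (u : ℝ) ≤ 4 ^ (N / 50) := by exact_mod_cast hu'
    calc u * E ^ 16 ≤ 4 ^ (N / 50) * 4 ^ (16 * ℓ) := by
          rw [hEpow]; exact mul_le_mul_of_nonneg_right this (by positivity)
      _ ≤ V := by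
          rw [← pow_add, hV]
          refine pow_le_pow_right₀ (by norm_num) ?_
          have := h.mul_le
          omega
  have hVF : V ^ 4 * E ^ 10 ≤ F := by
    rw [hV, ← pow_mul, ← hEpow, ← pow_add, hF]
    refine pow_le_pow_right₀ (by norm_num) ?_
    have := h.mul_le
    omega
  have hS := h.le_sqrt
  rw [← hF] at hS
  have hS0 : 0 < √(X : ℝ) := hF0.trans_le hS
  have hX : (X : ℝ) = √X * √X := (Real.mul_self_sqrt (Nat.cast_nonneg X)).symm
  have hX0 : (0 : ℝ) < X := by rw [hX]; positivity
  have hXF : F * F ≤ X := by rw [hX]; exact mul_self_le_mul_self hF0.le hS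
  have hU : ((4 ^ (2 * (N / 5)) : ℕ) : ℝ) = V ^ 2 := by
    push_cast
    rw [hV, ← pow_mul, mul_comm]
  have hsU : √(V ^ 2) = V := Real.sqrt_sq hV0.le
  have hJ : ((4 ^ (10 * ℓ) : ℕ) : ℝ) = E ^ 10 := by push_cast; exact hEpow 10
  have hRc : ((4 ^ k : ℕ) : ℝ) = R := by push_cast; exact hR.symm
  rw [bvError, hU, hJ, hsU, hRc, hEpow]
  set L := Real.log X
  set Q : ℝ := X / (E ^ 4 * u) with hQ
  have hE1 : 1 ≤ E := by linarith
  have hmono : ∀ {i j : ℕ}, i ≤ j → E ^ i ≤ E ^ j := fun hij => pow_le_pow_right₀ hE1 hij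
  have hL2 : L ^ 2 ≤ E ^ 2 := pow_le_pow_left₀ hL0 hL 2
  have hL2' : (0 : ℝ) ≤ L ^ 2 := by positivity
  have t1 : 56 * R * (V ^ 2) ^ 2 * L ≤ 56 * Q := by
    have e1 : R * u ≤ F := by
      have : 4 * (R * u) ≤ R * u * E ^ 16 := by
        have : (4 : ℝ) ≤ E ^ 16 := hE4.trans (by simpa using hmono (show 1 ≤ 16 by norm_num))
        nlinarith [mul_pos hR0 hu0]
      linarith
    have e2 : R * V ^ 4 * L * (E ^ 4 * u) ≤ X := by
      calc R * V ^ 4 * L * (E ^ 4 * u) ≤ R * V ^ 4 * E * (E ^ 4 * u) := by gcongr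
        _ = (R * u) * (V ^ 4 * E ^ 5) := by ring
        _ ≤ F * (V ^ 4 * E ^ 10) := by
            gcongr; norm_num
        _ ≤ F * F := by gcongr
        _ ≤ X := hXF
    have := (le_div_iff₀ (by positivity)).mpr e2
    rw [hQ]
    linarith [this, show 56 * R * (V ^ 2) ^ 2 * L = 56 * (R * V ^ 4 * L) by ring]
  have t2 : E ^ 10 * L ^ 2 * (5 * X / (u * R)) ≤ 5 * Q := by
    rw [hQ, mul_div_assoc', mul_div_assoc', div_le_div_iff₀ (by positivity) (by positivity)]
    calc E ^ 10 * L ^ 2 * (5 * X) * (E ^ 4 * u) ≤ E ^ 10 * E ^ 2 * (5 * X) * (E ^ 4 * u) := by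
          gcongr
      _ = 5 * X * u * E ^ 16 := by ring
      _ ≤ 5 * X * u * R := by gcongr
      _ = _ := by ring
  have t3 : E ^ 10 * L ^ 2 * (30 * X / V) ≤ 30 * Q := by
    rw [hQ, mul_div_assoc', mul_div_assoc', div_le_div_iff₀ (by positivity) (by positivity)]
    calc E ^ 10 * L ^ 2 * (30 * X) * (E ^ 4 * u) ≤ E ^ 10 * E ^ 2 * (30 * X) * (E ^ 4 * u) := by
          gcongr
      _ = 30 * X * (u * E ^ 16) := by ring
      _ ≤ 30 * X * V := by gcongr
  have t4 : E ^ 10 * L ^ 2 * (90 * R * √X) ≤ 360 * Q := by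
    rw [hQ, mul_div_assoc', le_div_iff₀ (by positivity)]
    calc E ^ 10 * L ^ 2 * (90 * R * √X) * (E ^ 4 * u)
        ≤ E ^ 10 * E ^ 2 * (90 * R * √X) * (E ^ 4 * u) := by gcongr
      _ = 90 * √X * (R * u * E ^ 16) := by ring
      _ ≤ 90 * √X * (4 * F) := by gcongr
      _ ≤ 90 * √X * (4 * √X) := by gcongr
      _ = 360 * X := by rw [show 90 * √(X : ℝ) * (4 * √X) = 360 * (√X * √X) by ring, ← hX]
  have t5 : L ^ 2 * (X / (E ^ 10 * u) * (1 + L)) ≤ 2 * Q := by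
    rw [hQ, mul_div_assoc', div_mul_eq_mul_div, mul_div_assoc',
      div_le_div_iff₀ (by positivity) (by positivity)]
    calc L ^ 2 * (X * (1 + L)) * (E ^ 4 * u) ≤ E ^ 2 * (X * (E + E)) * (E ^ 4 * u) := by
          gcongr
      _ = 2 * X * u * E ^ 7 := by ring
      _ ≤ 2 * X * u * E ^ 10 := by
          gcongr; norm_num
      _ = _ := by ring
  have t6 : L ^ 2 * (X / V ^ 2) ≤ Q := by
    rw [hQ, mul_div_assoc', div_le_div_iff₀ (by positivity) (by positivity)]
    have hV1 : 1 ≤ V := by rw [hV]; exact one_le_pow₀ (by norm_num)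
    calc L ^ 2 * X * (E ^ 4 * u) ≤ E ^ 2 * X * (E ^ 4 * u) := by gcongr
      _ = X * (u * E ^ 6) := by ring
      _ ≤ X * (u * E ^ 16) := by
          gcongr; norm_num
      _ ≤ X * V := by gcongr
      _ ≤ X * V ^ 2 := by
          gcongr
          exact le_self_pow₀ hV1 two_ne_zero
  have hfin : 882 / E ^ 4 * (X / u) = 882 * Q := by
    rw [hQ]
    field_simp
  rw [hfin]
  linarith

theorem le_sum_psiShift_primeRange {X N ℓ u k : ℕ} (h : IsScale X N ℓ) (hu : 0 < u)
    (hu' : u ≤ 4 ^ (N / 50)) (hk : 16 * ℓ ≤ k) (hku : 4 ^ k * u * 4 ^ (16 * ℓ) ≤ 4 ^ (N + 1))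
    (hu9 : u.Coprime 9) (hr : ∀ r ∈ primeRange k (k + 1), ¬ r ∣ u) :
    psiShift X u * ∑ r ∈ primeRange k (k + 1), 1 / (r : ℝ) -
      882 / (4 : ℝ) ^ (4 * ℓ) * (X / u) ≤ ∑ r ∈ primeRange k (k + 1), psiShift X (r * u) := by
  have hk2 : 2 ≤ k := by have := h.one_le; omega
  have h16 : 16 ≤ X := by
    refine le_trans ?_ h.pow_le
    calc 16 = 16 ^ 1 := by norm_num
      _ ≤ 16 ^ N := Nat.pow_le_pow_right (by norm_num)
          (by have := h.one_le; have := h.mul_le; omega)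
  have h1 := le_sum_psiShift_mul (primeRange k (k + 1)) (R := ((4 ^ k : ℕ) : ℝ)) (u := u)
    (U := 4 ^ (2 * (N / 5))) (X := X) (J := 4 ^ (10 * ℓ))
        (by exact_mod_cast Nat.one_le_pow k 4 (by norm_num)) hu hu9
    (by positivity) h16 (by positivity) (fun r hrm => by
      have h2 := mem_primeRange.mp hrm
      refine ⟨⟨h2.2, by exact_mod_cast h2.1.1, ?_⟩, hr r hrm, fun h9 => ?_⟩
      · have := h2.1.2.le
        rw [pow_succ'] at this
        exact_mod_cast this
      · have h3 := Nat.le_of_dvd (by norm_num) h9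
        have h4 : 4 ^ 2 ≤ 4 ^ k := Nat.pow_le_pow_right (by norm_num) hk2
        omega)
  have h2 := bvError_le h hu hu' hk hku
  simp only [mul_comm u] at h1
  linarith

theorem psiShift_one (X : ℕ) : psiShift X 1 = Chebyshev.psi X := by
  rw [psiShift, Chebyshev.psi, Nat.floor_natCast]
  exact Finset.sum_congr rfl fun n _ => if_pos (one_dvd _)

theorem inv_le_sum_inv_primeRange {a b : ℕ} (ha : 8 ≤ a) (hab : a < b) :
    1 / (8 * (b : ℝ)) ≤ ∑ r ∈ primeRange a b, 1 / (r : ℝ) := by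
  rw [sum_primeRange hab.le]
  have h1 := Finset.single_le_sum
    (f := fun k => ∑ r ∈ primeRange k (k + 1), 1 / (r : ℝ)) (s := Finset.Ico a b)
    (fun k _ => Finset.sum_nonneg fun r _ => by positivity) (Finset.mem_Ico.mpr ⟨le_rfl, hab⟩)
  refine le_trans ?_ ((le_sum_inv_primeRange_succ ha).trans h1)
  have : (a : ℝ) + 1 ≤ b := by exact_mod_cast hab
  exact one_div_le_one_div_of_le (by positivity) (by linarith)

theorem coprime_nine_of_mem_primeProducts {l : List (ℕ × ℕ)} (hl : ∀ x ∈ l, 1 ≤ x.1) {u : ℕ}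
    (hu : u ∈ primeProducts l) : u.Coprime 9 := by
  rw [show 9 = 3 ^ 2 by norm_num]
  refine Nat.Coprime.pow_right _ (Nat.Coprime.symm ?_)
  refine (Nat.Prime.coprime_iff_not_dvd Nat.prime_three).mpr fun h => ?_
  have := le_of_prime_dvd_of_mem_primeProducts hl hu Nat.prime_three h
  omega

theorem le_sum_psiShift_primeProducts {X N ℓ : ℕ} (h : IsScale X N ℓ) (l : List (ℕ × ℕ))
    (hl : DisjointRanges l) (hl' : ∀ x ∈ l, 16 * ℓ ≤ x.1 ∧ x.1 < x.2 ∧ x.2 ≤ 2 ^ ℓ)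
    (hs : (l.map Prod.snd).sum ≤ N / 50) :
    primeMass l * (Chebyshev.psi X - l.length * (7056 / (4 : ℝ) ^ (3 * ℓ)) * X) ≤
      ∑ u ∈ primeProducts l, psiShift X u := by
  induction l with
  | nil => simp [primeMass_nil, primeProducts, psiShift_one]
  | cons x l ih =>
    have hl2 := (List.pairwise_cons.mp hl).2
    rw [List.map_cons, List.sum_cons] at hs
    have ih' := ih hl2 (fun y hy => hl' y (List.mem_cons_of_mem _ hy)) (by omega)
    obtain ⟨hx1, hx2, hx3⟩ := hl' x List.mem_cons_self
    have hℓ := h.one_le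
    have hN := h.mul_le
    set m := ∑ r ∈ primeRange x.1 x.2, 1 / (r : ℝ) with hm
    have hm0 : 0 ≤ m := Finset.sum_nonneg fun r _ => by positivity
    have hstep : ∀ u ∈ primeProducts l, m * psiShift X u -
        7056 / (4 : ℝ) ^ (3 * ℓ) * X * m * (1 / u) ≤
        ∑ r ∈ primeRange x.1 x.2, psiShift X (r * u) := by
      intro u hu
      have hu0 := pos_of_mem_primeProducts hu
      have hul : u ≤ 4 ^ (N / 50) := (le_of_mem_primeProducts hu).trans
        (Nat.pow_le_pow_right (by norm_num) (by omega))
      have h1 : ∀ k ∈ Finset.Ico x.1 x.2,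
          psiShift X u * ∑ r ∈ primeRange k (k + 1), 1 / (r : ℝ) -
          882 / (4 : ℝ) ^ (4 * ℓ) * (X / u) ≤
          ∑ r ∈ primeRange k (k + 1), psiShift X (r * u) := by
        intro k hk
        obtain ⟨hk1, hk2⟩ := Finset.mem_Ico.mp hk
        refine le_sum_psiShift_primeRange h hu0 hul (hx1.trans hk1) ?_
          (coprime_nine_of_mem_primeProducts (fun y hy =>
            le_trans (by omega) (hl' y (List.mem_cons_of_mem _ hy)).1) hu) ?_
        · calc 4 ^ k * u * 4 ^ (16 * ℓ) ≤ 4 ^ k * 4 ^ (N / 50) * 4 ^ (16 * ℓ) := by gcongr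
            _ = 4 ^ (k + N / 50 + 16 * ℓ) := by rw [pow_add, pow_add]
            _ ≤ 4 ^ (N + 1) := Nat.pow_le_pow_right (by norm_num) (by omega)
        · intro r hr
          refine not_dvd_of_mem_primeRange hl ?_ hu
          rw [mem_primeRange] at hr ⊢
          exact ⟨⟨(Nat.pow_le_pow_right (by norm_num) hk1).trans hr.1.1,
            hr.1.2.trans_le (Nat.pow_le_pow_right (by norm_num) hk2)⟩, hr.2⟩
      have h2 := Finset.sum_le_sum h1
      rw [Finset.sum_sub_distrib, ← Finset.mul_sum, ← sum_primeRange hx2.le,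
        ← sum_primeRange hx2.le, Finset.sum_const, Nat.card_Ico, nsmul_eq_mul] at h2
      refine le_trans ?_ h2
      rw [mul_comm m]
      refine sub_le_sub_left ?_ _
      have h3 : ((x.2 - x.1 : ℕ) : ℝ) ≤ 8 * 4 ^ ℓ * m := by
        have h4 := inv_le_sum_inv_primeRange (show 8 ≤ x.1 by omega) hx2
        have h5 : (0 : ℝ) < x.2 := by exact_mod_cast (by omega : 0 < x.2)
        have h6 : (x.2 : ℝ) ≤ 2 ^ ℓ := by exact_mod_cast hx3
        have h7 : (x.2 : ℝ) ^ 2 ≤ 4 ^ ℓ := by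
          calc (x.2 : ℝ) ^ 2 ≤ (2 ^ ℓ) ^ 2 := pow_le_pow_left₀ h5.le h6 2
            _ = 4 ^ ℓ := by rw [← pow_mul, mul_comm, pow_mul]; norm_num
        calc ((x.2 - x.1 : ℕ) : ℝ) ≤ x.2 := by exact_mod_cast Nat.sub_le _ _
          _ = 8 * (x.2 : ℝ) ^ 2 * (1 / (8 * (x.2 : ℝ))) := by field_simp
          _ ≤ 8 * 4 ^ ℓ * m := by gcongr
      calc ((x.2 - x.1 : ℕ) : ℝ) * (882 / 4 ^ (4 * ℓ) * (X / u))
          ≤ 8 * 4 ^ ℓ * m * (882 / 4 ^ (4 * ℓ) * (X / u)) := by gcongr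
        _ = 7056 / (4 : ℝ) ^ (3 * ℓ) * X * m * (1 / u) := by
          rw [show 4 * ℓ = ℓ + 3 * ℓ by ring, pow_add]
          field_simp
          ring
    have h2 := Finset.sum_le_sum hstep
    rw [← sum_primeProducts_cons hl, Finset.sum_sub_distrib, ← Finset.mul_sum, ← Finset.mul_sum,
      sum_inv_primeProducts hl2] at h2
    refine le_trans ?_ h2
    rw [primeMass_cons, List.length_cons, ← hm]
    push_cast
    have h3 := mul_le_mul_of_nonneg_left ih' hm0
    linarith

/-- The pairs `(u, e)` with `u ∈ primeProducts l` and `e` a prime such that `e * u` is about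
`4 ^ N`. -/
def modPairs (l : List (ℕ × ℕ)) (N : ℕ) : Finset (Σ _ : ℕ, ℕ) :=
  (primeProducts l).sigma fun u => primeRange (N - Nat.log 4 u) (N - Nat.log 4 u + 1)

theorem log_four_le_of_mem_primeProducts {l : List (ℕ × ℕ)} {M u : ℕ}
    (hs : (l.map Prod.snd).sum ≤ M) (hu : u ∈ primeProducts l) : Nat.log 4 u ≤ M := by
  have h1 := (le_of_mem_primeProducts hu).trans (Nat.pow_le_pow_right (by norm_num) hs)
  calc Nat.log 4 u ≤ Nat.log 4 (4 ^ M) := Nat.log_mono_right h1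
    _ = M := Nat.log_pow (by norm_num) M

theorem modPairs_bounds {l : List (ℕ × ℕ)} {N M : ℕ} (hs : (l.map Prod.snd).sum ≤ M)
    (hM : M ≤ N) {y : Σ _ : ℕ, ℕ} (hy : y ∈ modPairs l N) :
    y.2.Prime ∧ 4 ^ (N - M) ≤ y.2 ∧ 4 ^ N ≤ y.2 * y.1 ∧ y.2 * y.1 < 4 ^ (N + 2) := by
  obtain ⟨hu, he⟩ := Finset.mem_sigma.mp hy
  have hlog := log_four_le_of_mem_primeProducts hs hu
  have h0 := pos_of_mem_primeProducts hu
  obtain ⟨⟨he1, he2⟩, he3⟩ := mem_primeRange.mp he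
  have h1 := Nat.pow_log_le_self 4 h0.ne'
  have h2 := Nat.lt_pow_succ_log_self (show 1 < 4 by norm_num) y.1
  refine ⟨he3, (Nat.pow_le_pow_right (by norm_num) (by omega)).trans he1, ?_, ?_⟩
  · calc 4 ^ N = 4 ^ (N - Nat.log 4 y.1) * 4 ^ Nat.log 4 y.1 := by
          rw [← pow_add, Nat.sub_add_cancel (by omega)]
      _ ≤ y.2 * y.1 := Nat.mul_le_mul he1 h1
  · calc y.2 * y.1 < 4 ^ (N - Nat.log 4 y.1 + 1) * 4 ^ (Nat.log 4 y.1 + 1) :=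
          Nat.mul_lt_mul'' he2 h2
      _ = 4 ^ (N + 2) := by
          rw [← pow_add]
          congr 1
          omega

theorem sum_inv_modPairs_le {l : List (ℕ × ℕ)} (hl : DisjointRanges l) {N M : ℕ}
    (hs : (l.map Prod.snd).sum ≤ M) (hM : M < N) :
    ∑ y ∈ modPairs l N, 1 / ((y.2 : ℝ) * y.1) ≤ 4 / (N - M : ℕ) * primeMass l := by
  rw [modPairs, Finset.sum_sigma, ← sum_inv_primeProducts hl, Finset.mul_sum]
  refine Finset.sum_le_sum fun u hu => ?_
  have hlog := log_four_le_of_mem_primeProducts hs hu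
  have h1 : ∀ e : ℕ, 1 / ((e : ℝ) * u) = 1 / (e : ℝ) * (1 / u) := fun e =>
    (one_div_mul_one_div _ _).symm
  simp only [h1, ← Finset.sum_mul]
  refine mul_le_mul_of_nonneg_right ?_ (by positivity)
  refine (sum_inv_primeRange_succ_le (by omega)).trans ?_
  exact div_le_div_of_nonneg_left (by norm_num) (by exact_mod_cast (by omega : 0 < N - M))
    (by exact_mod_cast (by omega : N - M ≤ N - Nat.log 4 u))

theorem IsScale.le_psi {X N ℓ : ℕ} (h : IsScale X N ℓ) :
    3 / 5 * (X : ℝ) ≤ Chebyshev.psi X := by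
  have h1 := Chebyshev.psi_ge X
  have hN : 100 ≤ N := by have := h.one_le; have := h.mul_le; omega
  have h2 : Real.log (X + 1) ≤ 4 * (N + 1) := by
    have h3 : Real.log ((X : ℝ) + 1) ≤ Real.log (16 ^ (N + 1)) :=
      Real.log_le_log (by positivity) (by exact_mod_cast h.lt_pow)
    rw [Real.log_pow, show (16 : ℝ) = 2 ^ 4 by norm_num, Real.log_pow] at h3
    have h4 := Real.log_two_lt_d9
    push_cast at h3
    nlinarith [Nat.cast_nonneg (α := ℝ) N]
  have h3 : 60 * (N + 1) ≤ X := by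
    refine le_trans ?_ h.pow_le
    have h4 : N + 1 ≤ 4 ^ N := Nat.lt_pow_self (by norm_num)
    have h5 : 4 ^ 3 ≤ 4 ^ N := Nat.pow_le_pow_right (by norm_num) (by omega)
    calc 60 * (N + 1) ≤ 4 ^ N * 4 ^ N := Nat.mul_le_mul (by omega) h4
      _ = 16 ^ N := by rw [← mul_pow]; norm_num
  have h4 : (60 : ℝ) * (N + 1) ≤ X := by exact_mod_cast h3
  have h5 := Real.log_two_gt_d9
  nlinarith

theorem le_sum_psiShift_modPairs {X N ℓ : ℕ} (h : IsScale X N ℓ) (l : List (ℕ × ℕ))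
    (hl : DisjointRanges l)
    (hl' : ∀ x ∈ l, 16 * ℓ ≤ x.1 ∧ x.1 < x.2 ∧ x.2 ≤ 2 ^ ℓ)
    (hs : (l.map Prod.snd).sum ≤ N / 50) (hlen : l.length < 4 ^ ℓ) (hℓ : 5 ≤ ℓ) :
    X / (16 * ((N : ℝ) + 1)) * primeMass l ≤
      ∑ y ∈ modPairs l (N - 16 * ℓ), psiShift X (y.2 * y.1) := by
  have hN := h.mul_le
  have hN0 : (0 : ℝ) ≤ N := Nat.cast_nonneg N
  have hX0 : (0 : ℝ) ≤ X := Nat.cast_nonneg X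
  have hm0 := primeMass_nonneg l
  have h1 : ∀ u ∈ primeProducts l, psiShift X u * (1 / (8 * ((N : ℝ) + 1))) -
      882 / (4 : ℝ) ^ (4 * ℓ) * X * (1 / u) ≤
      ∑ e ∈ primeRange (N - 16 * ℓ - Nat.log 4 u) (N - 16 * ℓ - Nat.log 4 u + 1),
        psiShift X (e * u) := by
    intro u hu
    have hu0 := pos_of_mem_primeProducts hu
    have hlog := log_four_le_of_mem_primeProducts hs hu
    have h2 := Nat.lt_pow_succ_log_self (show 1 < 4 by norm_num) u
    refine le_trans ?_ (le_sum_psiShift_primeRange h hu0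
      ((le_of_mem_primeProducts hu).trans (Nat.pow_le_pow_right (by norm_num) hs))
      (by omega) ?_ (coprime_nine_of_mem_primeProducts (fun y hy =>
            le_trans (by omega) (hl' y hy).1) hu) ?_)
    · rw [mul_one_div (X : ℝ) u |>.symm, ← mul_assoc]
      refine sub_le_sub_right (mul_le_mul_of_nonneg_left ?_ (psiShift_nonneg _ _)) _
      refine le_trans ?_ (le_sum_inv_primeRange_succ (by omega))
      have : ((N - 16 * ℓ - Nat.log 4 u : ℕ) : ℝ) ≤ N := by
        exact_mod_cast (by omega : N - 16 * ℓ - Nat.log 4 u ≤ N)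
      exact one_div_le_one_div_of_le (by positivity) (by linarith)
    · calc 4 ^ (N - 16 * ℓ - Nat.log 4 u) * u * 4 ^ (16 * ℓ)
          ≤ 4 ^ (N - 16 * ℓ - Nat.log 4 u) * 4 ^ (Nat.log 4 u + 1) * 4 ^ (16 * ℓ) := by gcongr
        _ = 4 ^ (N + 1) := by
          rw [← pow_add, ← pow_add]
          congr 1
          omega
    · intro r hr hru
      obtain ⟨x, hx, hrx⟩ :=
        exists_mem_primeRange_of_dvd hu (mem_primeRange.mp hr).2 hru
      have h3 := (mem_primeRange.mp hrx).1.2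
      have h4 := (mem_primeRange.mp hr).1.1
      have h5 : 4 ^ x.2 ≤ 4 ^ (N / 50) := Nat.pow_le_pow_right (by norm_num)
        ((List.single_le_sum (by simp) _ (List.mem_map_of_mem hx)).trans hs)
      have h6 : 4 ^ (N / 50) ≤ 4 ^ (N - 16 * ℓ - Nat.log 4 u) :=
        Nat.pow_le_pow_right (by norm_num) (by omega)
      omega
  have h2 := Finset.sum_le_sum h1
  rw [Finset.sum_sub_distrib, ← Finset.sum_mul, ← Finset.mul_sum, sum_inv_primeProducts hl] at h2
  rw [modPairs, Finset.sum_sigma]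
  refine le_trans ?_ h2
  have h3 := le_sum_psiShift_primeProducts h l hl hl' hs
  have h4 := h.le_psi
  have h5 : ((l.length : ℝ) + 1) * (7056 / (4 : ℝ) ^ (3 * ℓ)) ≤ 1 / 100 := by
    have h6 : (l.length : ℝ) + 1 ≤ 4 ^ ℓ := by exact_mod_cast hlen
    have h7 : (4 : ℝ) ^ 10 ≤ 4 ^ (2 * ℓ) := pow_le_pow_right₀ (by norm_num) (by omega)
    rw [mul_div_assoc', div_le_iff₀ (by positivity), show 3 * ℓ = 2 * ℓ + ℓ by ring, pow_add]
    nlinarith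
  have h6 : 882 / (4 : ℝ) ^ (4 * ℓ) * (8 * (N + 1)) ≤ 7056 / (4 : ℝ) ^ (3 * ℓ) := by
    have h7 : (4 : ℝ) * (N + 1) ≤ 4 ^ ℓ := by exact_mod_cast h.succ_le
    rw [show 4 * ℓ = ℓ + 3 * ℓ by ring, pow_add, div_mul_eq_mul_div, div_le_div_iff₀
        (by positivity) (by positivity), ← mul_assoc (7056 : ℝ)]
    refine mul_le_mul_of_nonneg_right ?_ (by positivity)
    linarith
  have h7 : primeMass l * (1 / 2 * X) ≤ (∑ u ∈ primeProducts l, psiShift X u) -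
      882 / (4 : ℝ) ^ (4 * ℓ) * (8 * (N + 1)) * X * primeMass l := by
    have e1 := mul_le_mul_of_nonneg_right h6 (mul_nonneg hX0 hm0)
    have e2 := mul_le_mul_of_nonneg_right h5 (mul_nonneg hX0 hm0)
    have e3 := mul_le_mul_of_nonneg_right h4 hm0
    have e4 := mul_nonneg hX0 hm0
    linarith
  have h8 := mul_le_mul_of_nonneg_right h7 (by positivity : 0 ≤ 1 / (8 * ((N : ℝ) + 1)))
  refine le_of_eq_of_le ?_ (h8.trans (le_of_eq ?_))
  · field_simp
    ring
  · field_simp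

/-- The product over `x ∈ l` of `1` plus the sum of `1 / r` over the primes
`r ∈ [4 ^ x.1, 4 ^ x.2)`. -/
noncomputable def onePrimeMass (l : List (ℕ × ℕ)) : ℝ :=
  (l.map fun x => 1 + ∑ r ∈ primeRange x.1 x.2, 1 / (r : ℝ)).prod

theorem onePrimeMass_cons (x : ℕ × ℕ) (l : List (ℕ × ℕ)) :
    onePrimeMass (x :: l) =
      (1 + ∑ r ∈ primeRange x.1 x.2, 1 / (r : ℝ)) * onePrimeMass l := rfl

theorem one_le_one_add_sum_primeRange (x : ℕ × ℕ) :
    1 ≤ 1 + ∑ r ∈ primeRange x.1 x.2, 1 / (r : ℝ) :=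
  le_add_of_nonneg_right (Finset.sum_nonneg fun _ _ => by positivity)

theorem one_le_onePrimeMass (l : List (ℕ × ℕ)) : 1 ≤ onePrimeMass l := by
  induction l with
  | nil => exact le_rfl
  | cons x l ih =>
    rw [onePrimeMass_cons]
    exact one_le_mul_of_one_le_of_one_le (one_le_one_add_sum_primeRange x) ih

theorem gcd_mul_of_mem_primeRange {x : ℕ × ℕ} {l : List (ℕ × ℕ)} (hl : DisjointRanges (x :: l))
    {r r' u u' : ℕ} (hr : r ∈ primeRange x.1 x.2) (hr' : r' ∈ primeRange x.1 x.2)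
    (hu : u ∈ primeProducts l) (hu' : u' ∈ primeProducts l) :
    Nat.gcd (r * u) (r' * u') = if r' = r then r * Nat.gcd u u' else Nat.gcd u u' := by
  have hp := (mem_primeRange.mp hr).2
  have hp' := (mem_primeRange.mp hr').2
  split_ifs with h
  · rw [h, Nat.gcd_mul_left]
  · have h1 : Nat.Coprime r (r' * u') :=
      Nat.Coprime.mul_right ((Nat.coprime_primes hp hp').mpr (Ne.symm h))
        ((hp.coprime_iff_not_dvd).mpr (not_dvd_of_mem_primeRange hl hr hu'))
    have h2 : Nat.Coprime r' u :=
      (hp'.coprime_iff_not_dvd).mpr (not_dvd_of_mem_primeRange hl hr' hu)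
    rw [Nat.Coprime.gcd_mul_left_cancel u h1, Nat.Coprime.gcd_mul_left_cancel_right u' h2]

theorem sum_gcd_div_le {l : List (ℕ × ℕ)} (hl : DisjointRanges l) {u : ℕ}
    (hu : u ∈ primeProducts l) :
    ∑ u' ∈ primeProducts l, (Nat.gcd u u' : ℝ) / u' ≤ onePrimeMass l := by
  induction l generalizing u with
  | nil =>
    rw [Finset.mem_singleton.mp hu]
    simp [primeProducts, onePrimeMass]
  | cons x l ih =>
    obtain ⟨r, hr, v, hv, rfl⟩ := mem_primeProducts_cons.mp hu
    have hr0 : (r : ℝ) ≠ 0 := by exact_mod_cast (mem_primeRange.mp hr).2.ne_zero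
    rw [sum_primeProducts_cons hl, onePrimeMass_cons]
    have ih' := ih (List.pairwise_cons.mp hl).2 hv
    refine le_trans ?_ (mul_le_mul_of_nonneg_left ih'
      (zero_le_one.trans (one_le_one_add_sum_primeRange x)))
    rw [Finset.mul_sum]
    refine Finset.sum_le_sum fun u' hu' => ?_
    rw [add_mul, one_mul, Finset.sum_mul, ← Finset.add_sum_erase _ _ hr]
    refine add_le_add (le_of_eq ?_) ((Finset.sum_le_sum fun r' hr' => le_of_eq ?_).trans
      (Finset.sum_le_sum_of_subset_of_nonneg (Finset.erase_subset _ _)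
        fun r' _ _ => by positivity))
    · rw [gcd_mul_of_mem_primeRange hl hr hr hv hu', if_pos rfl]
      push_cast
      rw [mul_div_mul_left _ _ hr0]
    · obtain ⟨h1, h2⟩ := Finset.mem_erase.mp hr'
      rw [gcd_mul_of_mem_primeRange hl hr h2 hv hu', if_neg h1]
      push_cast
      rw [one_div_mul_eq_div, div_div, mul_comm (u' : ℝ)]

theorem sum_gcd_div_window_cons_le {x : ℕ × ℕ} {l : List (ℕ × ℕ)}
    (hl : DisjointRanges (x :: l)) {a r v : ℕ} (ha : 1 ≤ a) (hax : a ≤ x.1)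
    (hr : r ∈ primeRange x.1 x.2) (hv : v ∈ primeProducts l) (Y : ℝ) :
    ∑ u' ∈ primeProducts (x :: l), (if Y ≤ u' ∧ u' < 4 * Y then
        (Nat.gcd (r * v) u' : ℝ) / u' else 0) ≤
      ∑ u' ∈ primeProducts l, (if Y / r ≤ u' ∧ u' < 4 * (Y / r) then
        (Nat.gcd v u' : ℝ) / u' else 0) + 8 / a * onePrimeMass l := by
  have hr0 : (0 : ℝ) < r := by exact_mod_cast (mem_primeRange.mp hr).2.pos
  have hl2 := (List.pairwise_cons.mp hl).2
  rw [sum_primeProducts_cons hl]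
  refine le_trans ?_ (add_le_add_right (mul_le_mul_of_nonneg_left (sum_gcd_div_le hl2 hv)
    (by positivity : (0 : ℝ) ≤ 8 / a)) _)
  rw [Finset.mul_sum, ← Finset.sum_add_distrib]
  refine Finset.sum_le_sum fun u' hu' => ?_
  have hu0 : (0 : ℝ) < u' := by exact_mod_cast pos_of_mem_primeProducts hu'
  rw [← Finset.add_sum_erase _ _ hr]
  refine add_le_add (le_of_eq ?_) ?_
  · have h1 : (Y ≤ ((r * u' : ℕ) : ℝ) ∧ ((r * u' : ℕ) : ℝ) < 4 * Y) ↔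
        (Y / r ≤ u' ∧ (u' : ℝ) < 4 * (Y / r)) := by
      rw [div_le_iff₀' hr0, mul_div_assoc', lt_div_iff₀' hr0]
      push_cast
      rfl
    simp only [h1]
    rw [gcd_mul_of_mem_primeRange hl hr hr hv hu', if_pos rfl]
    push_cast
    rw [mul_div_mul_left _ _ hr0.ne']
  · set S := ((primeRange x.1 x.2).erase r).filter
      fun r' => Y ≤ ((r' * u' : ℕ) : ℝ) ∧ ((r' * u' : ℕ) : ℝ) < 4 * Y with hS
    have h1 : ∑ r' ∈ S, 1 / (r' : ℝ) ≤ 8 / a := by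
      refine sum_inv_primes_le_of_lt_four_mul ha S (fun r' hr' => ?_) fun r' hr' r'' hr'' => ?_
      · have h2 := mem_primeRange.mp (Finset.mem_of_mem_erase (Finset.mem_filter.mp hr').1)
        exact ⟨h2.2, (Nat.pow_le_pow_right (by norm_num) hax).trans h2.1.1⟩
      · have h2 := (Finset.mem_filter.mp hr').2.1
        have h3 := (Finset.mem_filter.mp hr'').2.2
        push_cast at h2 h3
        have h4 : (r'' : ℝ) * u' < 4 * r' * u' := by linarith
        exact_mod_cast lt_of_mul_lt_mul_right h4 hu0.le
    rw [← Finset.sum_filter, ← hS]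
    refine le_trans (le_of_eq ?_) (mul_le_mul_of_nonneg_right h1
      (by positivity : 0 ≤ (Nat.gcd v u' : ℝ) / u'))
    rw [Finset.sum_mul]
    refine Finset.sum_congr rfl fun r' hr' => ?_
    obtain ⟨h2, h3⟩ := Finset.mem_erase.mp (Finset.mem_filter.mp hr').1
    rw [gcd_mul_of_mem_primeRange hl hr h3 hv hu', if_neg h2]
    push_cast
    rw [one_div_mul_eq_div, div_div, mul_comm (u' : ℝ)]

theorem sum_gcd_div_window_le {l₁ l₂ : List (ℕ × ℕ)} (hl : DisjointRanges (l₁ ++ l₂)) {a u : ℕ}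
    (ha : 1 ≤ a) (hal : ∀ x ∈ l₁, a ≤ x.1) (hu : u ∈ primeProducts (l₁ ++ l₂)) (Y : ℝ) :
    ∑ u' ∈ primeProducts (l₁ ++ l₂), (if Y ≤ u' ∧ u' < 4 * Y then
        (Nat.gcd u u' : ℝ) / u' else 0) ≤
      onePrimeMass l₂ + l₁.length * (8 / a * onePrimeMass (l₁ ++ l₂)) := by
  induction l₁ generalizing u Y with
  | nil =>
    rw [List.nil_append] at hl hu ⊢
    rw [List.length_nil, Nat.cast_zero, zero_mul, add_zero]
    refine (Finset.sum_le_sum fun u' _ => ?_).trans (sum_gcd_div_le hl hu)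
    split_ifs
    · exact le_rfl
    · positivity
  | cons x l ih =>
    rw [List.cons_append] at hl hu ⊢
    obtain ⟨r, hr, v, hv, rfl⟩ := mem_primeProducts_cons.mp hu
    have h1 := sum_gcd_div_window_cons_le hl ha (hal x List.mem_cons_self) hr hv Y
    have h2 := ih (List.pairwise_cons.mp hl).2
      (fun y hy => hal y (List.mem_cons_of_mem _ hy)) hv (Y / r)
    have h3 : onePrimeMass (l ++ l₂) ≤ onePrimeMass (x :: (l ++ l₂)) := by
      rw [onePrimeMass_cons]
      exact le_mul_of_one_le_left (zero_le_one.trans (one_le_onePrimeMass _))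
        (one_le_one_add_sum_primeRange x)
    have h4 := mul_le_mul_of_nonneg_left h3 (by positivity : (0 : ℝ) ≤ 8 / a)
    have h5 := mul_le_mul_of_nonneg_left h4 (Nat.cast_nonneg (α := ℝ) l.length)
    rw [List.length_cons]
    push_cast
    linarith

/-- Pairs of intervals `[4 ^ a, 4 ^ (a + 1))` with `a = A + 2 * i` and
`a = A + 2 * i + 2 ^ (i + 1) + 1`, for `i < t`. -/
def pairList (A : ℕ) : ℕ → List (ℕ × ℕ)
  | 0 => []
  | t + 1 => (A + 2 * t + 2 ^ (t + 1) + 1, A + 2 * t + 2 ^ (t + 1) + 2) ::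
      (A + 2 * t, A + 2 * t + 1) :: pairList A t

theorem mem_pairList {A t : ℕ} {x : ℕ × ℕ} (hx : x ∈ pairList A t) :
    x.2 = x.1 + 1 ∧ ∃ i < t, x.1 = A + 2 * i ∨ x.1 = A + 2 * i + 2 ^ (i + 1) + 1 := by
  induction t with
  | zero => simp [pairList] at hx
  | succ t ih =>
    rw [pairList, List.mem_cons, List.mem_cons] at hx
    rcases hx with rfl | rfl | hx
    · exact ⟨rfl, t, Nat.lt_succ_self t, Or.inr rfl⟩
    · exact ⟨rfl, t, Nat.lt_succ_self t, Or.inl rfl⟩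
    · obtain ⟨h1, i, h2, h3⟩ := ih hx
      exact ⟨h1, i, by omega, h3⟩

theorem length_pairList (A t : ℕ) : (pairList A t).length = 2 * t := by
  induction t with
  | zero => rfl
  | succ t ih =>
    rw [pairList, List.length_cons, List.length_cons, ih]
    ring

theorem disjoint_primeRange_of_le {a b c d : ℕ} (h : b ≤ c) :
    Disjoint (primeRange a b) (primeRange c d) := by
  rw [Finset.disjoint_left]
  intro r h1 h2
  have h3 := (mem_primeRange.mp h1).1.2
  have h4 := (mem_primeRange.mp h2).1.1
  have h5 : 4 ^ b ≤ 4 ^ c := Nat.pow_le_pow_right (by norm_num) h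
  omega

theorem disjoint_primeRange_of_ne {a b : ℕ} (h : a ≠ b) :
    Disjoint (primeRange a (a + 1)) (primeRange b (b + 1)) := by
  rcases Nat.lt_or_gt_of_ne h with h | h
  · exact disjoint_primeRange_of_le h
  · exact (disjoint_primeRange_of_le h).symm

theorem disjointRanges_pairList (A t : ℕ) : DisjointRanges (pairList A t) := by
  induction t with
  | zero => exact List.Pairwise.nil
  | succ t ih =>
    have hpow : ∀ i < t, 2 ^ (i + 1) < 2 ^ (t + 1) := fun i hi =>
      Nat.pow_lt_pow_right (by norm_num) (by omega)
    rw [pairList]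
    refine List.Pairwise.cons ?_ (List.Pairwise.cons ?_ ih)
    · intro x hx
      rcases List.mem_cons.mp hx with rfl | hx
      · refine disjoint_primeRange_of_ne ?_
        omega
      · obtain ⟨h1, i, hi, h2⟩ := mem_pairList hx
        dsimp only
        rw [h1]
        refine disjoint_primeRange_of_ne ?_
        have := hpow i hi
        omega
    · intro x hx
      obtain ⟨h1, i, hi, h2⟩ := mem_pairList hx
      dsimp only
      rw [h1]
      refine disjoint_primeRange_of_ne ?_
      have := pow_succ 2 i
      omega

/-- There is a product of some of the primes making up `v` within a factor `256` of any target in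
the range from `ρ₀` to `ρ₁`. -/
theorem exists_mul_le_of_mem_primeProducts_pairList {A t v : ℕ}
    (hv : v ∈ primeProducts (pairList A t)) :
    ∃ ρ₀ ρ₁ : ℕ, ρ₀ * ρ₁ = v ∧ ρ₀ ≤ 4 ^ (∑ i ∈ Finset.range t, (A + 2 * i) + t) ∧
      4 ^ (∑ i ∈ Finset.range t, (A + 2 * i + 2 ^ (i + 1) + 1)) ≤ ρ₁ ∧
      4 ^ (2 ^ (t + 1)) * ρ₀ ≤ 16 * ρ₁ ∧
      ∀ P Y : ℕ, P * ρ₀ ≤ Y → Y ≤ 256 * (P * ρ₁) →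
        ∃ d, d ∣ v ∧ P * d ≤ Y ∧ Y ≤ 256 * (P * d) := by
  induction t generalizing v with
  | zero =>
    rw [pairList, primeProducts, Finset.mem_singleton] at hv
    subst hv
    exact ⟨1, 1, by norm_num, by simp, by simp, by norm_num,
      fun P Y h1 h2 => ⟨1, one_dvd _, h1, h2⟩⟩
  | succ t ih =>
    rw [pairList] at hv
    obtain ⟨r', hr', v', hv', rfl⟩ := mem_primeProducts_cons.mp hv
    obtain ⟨r, hr, w, hw, rfl⟩ := mem_primeProducts_cons.mp hv'
    obtain ⟨ρ₀, ρ₁, h1, h2, h3, h4, h5⟩ := ih hw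
    obtain ⟨⟨hr1, hr2⟩, -⟩ := mem_primeRange.mp hr
    obtain ⟨⟨hr3, hr4⟩, -⟩ := mem_primeRange.mp hr'
    dsimp only at hr1 hr2 hr3 hr4
    have hkey : r' * ρ₀ ≤ 256 * (r * ρ₁) := by
      calc r' * ρ₀ ≤ 4 ^ (A + 2 * t + 2 ^ (t + 1) + 2) * ρ₀ := Nat.mul_le_mul_right _ hr4.le
        _ = 16 * 4 ^ (A + 2 * t) * (4 ^ (2 ^ (t + 1)) * ρ₀) := by
            rw [pow_add, pow_add 4 (A + 2 * t)]
            ring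
        _ ≤ 16 * r * (16 * ρ₁) := Nat.mul_le_mul (Nat.mul_le_mul_left _ hr1) h4
        _ = 256 * (r * ρ₁) := by ring
    refine ⟨r * ρ₀, r' * ρ₁, by rw [← h1]; ring, ?_, ?_, ?_, fun P Y hY1 hY2 => ?_⟩
    · rw [Finset.sum_range_succ]
      calc r * ρ₀ ≤ 4 ^ (A + 2 * t + 1) * 4 ^ (∑ i ∈ Finset.range t, (A + 2 * i) + t) :=
            Nat.mul_le_mul hr2.le h2
        _ = _ := by rw [← pow_add]; congr 1; ring
    · rw [Finset.sum_range_succ, pow_add, mul_comm]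
      exact Nat.mul_le_mul hr3 h3
    · calc 4 ^ (2 ^ (t + 1 + 1)) * (r * ρ₀)
          ≤ 4 ^ (2 ^ (t + 1 + 1)) * (4 ^ (A + 2 * t + 1) * ρ₀) := by gcongr
        _ = 4 ^ (A + 2 * t + 2 ^ (t + 1) + 1) * (4 ^ (2 ^ (t + 1)) * ρ₀) := by
            rw [← mul_assoc, ← mul_assoc, ← pow_add, ← pow_add]
            congr 2
            rw [pow_succ 2 (t + 1)]
            ring
        _ ≤ r' * (16 * ρ₁) := Nat.mul_le_mul hr3 h4
        _ = 16 * (r' * ρ₁) := by ring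
    · rcases le_or_gt (P * (r' * ρ₀)) Y with h | h
      · obtain ⟨d, hd1, hd2, hd3⟩ := h5 (P * r') Y (by rwa [mul_assoc]) (by rwa [mul_assoc])
        exact ⟨r' * d, Nat.mul_dvd_mul_left _ (hd1.mul_left r), by rwa [← mul_assoc],
          by rwa [← mul_assoc P]⟩
      · obtain ⟨d, hd1, hd2, hd3⟩ := h5 (P * r) Y (by rwa [mul_assoc]) (by
          calc Y ≤ P * (r' * ρ₀) := h.le
            _ ≤ P * (256 * (r * ρ₁)) := Nat.mul_le_mul_left _ hkey
            _ = 256 * (P * r * ρ₁) := by ring)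
        exact ⟨r * d, (Nat.mul_dvd_mul_left _ hd1).mul_left r', by rwa [← mul_assoc],
          by rwa [← mul_assoc P]⟩

theorem sum_range_pairList_eq (A t : ℕ) :
    ∑ i ∈ Finset.range t, (A + 2 * i + 2 ^ (i + 1) + 1) + 2 =
      ∑ i ∈ Finset.range t, (A + 2 * i) + 2 ^ (t + 1) + t := by
  induction t with
  | zero => simp
  | succ t ih =>
    rw [Finset.sum_range_succ, Finset.sum_range_succ, pow_succ 2 (t + 1)]
    omega

theorem sum_range_add_two_mul_le (A t : ℕ) :
    ∑ i ∈ Finset.range t, (A + 2 * i) ≤ t * (A + 2 * t) := by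
  refine (Finset.sum_le_card_nsmul _ _ (A + 2 * t) fun i hi => ?_).trans ?_
  · have := Finset.mem_range.mp hi
    omega
  · rw [Finset.card_range, smul_eq_mul]

theorem exists_dvd_mul_near {l : List (ℕ × ℕ)} {A t N D u e g z : ℕ}
    (hu : u ∈ primeProducts (l ++ pairList A t)) (hDN : D ≤ N)
    (hz : z + 4 = D + ∑ i ∈ Finset.range t, (A + 2 * i) + t)
    (he1 : 4 ^ (N - D) ≤ e * u) (he2 : e * u < 4 ^ (N - D + 2))
    (hg1 : 4 ^ z ≤ g) (hg2 : g < 4 ^ (z + 2 ^ (t + 1))) :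
    ∃ a, a ∣ g * (e * u) ∧ a ≤ 4 ^ N ∧ 4 ^ N ≤ 256 * a := by
  obtain ⟨w, -, v, hv, rfl⟩ := exists_mul_of_mem_primeProducts_append hu
  obtain ⟨ρ₀, ρ₁, h1, h2, h3, -, h5⟩ := exists_mul_le_of_mem_primeProducts_pairList hv
  have hv0 := pos_of_mem_primeProducts hv
  have hρ₀ : 0 < ρ₀ := Nat.pos_of_mul_pos_right (h1 ▸ hv0)
  have hρ₁ : 0 < ρ₁ := Nat.pos_of_mul_pos_left (h1 ▸ hv0)
  have hS := sum_range_pairList_eq A t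
  obtain ⟨d, hd1, hd2, hd3⟩ := h5 (g * (e * w)) (4 ^ N) (by
    refine Nat.le_of_mul_le_mul_right ?_ hρ₁
    calc g * (e * w) * ρ₀ * ρ₁ = g * (e * (w * v)) := by rw [← h1]; ring
      _ ≤ 4 ^ (z + 2 ^ (t + 1)) * 4 ^ (N - D + 2) := Nat.mul_le_mul hg2.le he2.le
      _ = 4 ^ N * 4 ^ (∑ i ∈ Finset.range t, (A + 2 * i + 2 ^ (i + 1) + 1)) := by
          rw [← pow_add, ← pow_add]
          congr 1
          omega
      _ ≤ 4 ^ N * ρ₁ := Nat.mul_le_mul_left _ h3) (by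
    refine Nat.le_of_mul_le_mul_right ?_ hρ₀
    calc 4 ^ N * ρ₀ ≤ 4 ^ N * 4 ^ (∑ i ∈ Finset.range t, (A + 2 * i) + t) :=
          Nat.mul_le_mul_left _ h2
      _ = 256 * (4 ^ z * 4 ^ (N - D)) := by
          rw [show 256 = 4 ^ 4 by norm_num, ← pow_add, ← pow_add, ← pow_add]
          congr 1
          omega
      _ ≤ 256 * (g * (e * (w * v))) := Nat.mul_le_mul_left _ (Nat.mul_le_mul hg1 he1)
      _ = 256 * (g * (e * w) * ρ₁) * ρ₀ := by rw [← h1]; ring)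
  refine ⟨g * (e * w) * d, ?_, hd2, hd3⟩
  calc g * (e * w) * d ∣ g * (e * w) * v := Nat.mul_dvd_mul_left _ hd1
    _ = g * (e * (w * v)) := by ring

theorem sum_inv_primeFactors_le {M B a : ℕ} (hM0 : M ≠ 0) (hM : M ≤ 2 ^ B)
    (hMp : ∀ r : ℕ, r.Prime → r ∣ M → a ≤ r) (ha : 0 < a) :
    ∑ r ∈ M.primeFactors, 1 / (r : ℝ) ≤ B / a := by
  have h1 : M.primeFactors.card ≤ B := by
    refine (Nat.pow_le_pow_iff_right (show 1 < 2 by norm_num)).mp (le_trans ?_ hM)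
    refine le_trans ?_ (Nat.le_of_dvd (Nat.pos_of_ne_zero hM0) (Nat.prod_primeFactors_dvd M))
    exact Finset.pow_card_le_prod _ _ _ fun r hr => (Nat.prime_of_mem_primeFactors hr).two_le
  have h2 : ∀ r ∈ M.primeFactors, 1 / (r : ℝ) ≤ 1 / a := fun r hr =>
    one_div_le_one_div_of_le (by exact_mod_cast ha) (by
      exact_mod_cast hMp r (Nat.prime_of_mem_primeFactors hr) (Nat.dvd_of_mem_primeFactors hr))
  refine (Finset.sum_le_card_nsmul _ _ _ h2).trans ?_
  rw [nsmul_eq_mul, mul_one_div]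
  have : (M.primeFactors.card : ℝ) ≤ B := by exact_mod_cast h1
  gcongr

theorem IsScale.sum_inv_primeFactors_le {X N ℓ M : ℕ} (h : IsScale X N ℓ) (hM0 : M ≠ 0)
    (hM : M ≤ 4 ^ (2 * N)) (hMp : ∀ r : ℕ, r.Prime → r ∣ M → 4 ^ (16 * ℓ) ≤ r) :
    ∑ r ∈ M.primeFactors, 1 / (r : ℝ) ≤ 1 / 4 := by
  have h1 : M ≤ 2 ^ (4 * N) := by
    refine hM.trans (le_of_eq ?_)
    rw [show 4 = 2 ^ 2 by norm_num, ← pow_mul]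
    congr 1
    ring
  refine (_root_.sum_inv_primeFactors_le hM0 h1 hMp (by positivity)).trans ?_
  rw [div_le_div_iff₀ (by positivity) (by norm_num)]
  have h2 : 4 * N * 4 ≤ 4 ^ (16 * ℓ) := by
    calc 4 * N * 4 ≤ 4 ^ ℓ * 4 ^ ℓ := by
          have h3 := h.succ_le
          have h4 : 4 ^ 1 ≤ 4 ^ ℓ := Nat.pow_le_pow_right (by norm_num) h.one_le
          exact Nat.mul_le_mul (by omega) (by omega)
      _ = 4 ^ (2 * ℓ) := by rw [← pow_add]; congr 1; ring
      _ ≤ 4 ^ (16 * ℓ) := Nat.pow_le_pow_right (by norm_num) (by omega)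
  rw [one_mul]
  exact_mod_cast h2

theorem IsScale.card_primes_mul_le {X N ℓ M X' : ℕ} (h : IsScale X N ℓ) (hM0 : 0 < M)
    (hM : M ≤ 4 ^ (N + N / 4)) (hMp : ∀ r : ℕ, r.Prime → r ∣ M → 4 ^ (16 * ℓ) ≤ r)
    (hX' : 4 ^ (2 * N) ≤ 4 ^ 11 * X') (G : Finset ℕ)
    (hG : ∀ g ∈ G, g.Prime ∧ 3 < g ∧ g * g ≤ 4 ^ (N / 8) ∧ ¬ g ∣ M) (T : Finset ℕ)
    (hT : ∀ p ∈ T, p.Prime ∧ 4 ^ (N / 8) < p ∧ p ≤ X' ∧ M ∣ p + 9)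
    (hTG : ∀ p ∈ T, ∀ g ∈ G, ¬ g ∣ (p + 9) / M) :
    (T.card : ℝ) * ((N + 1) * (1 + ∑ g ∈ G, 1 / (g : ℝ))) ≤ 400 * (X' / M) := by
  have hN : 100 ≤ N := by have := h.one_le; have := h.mul_le; omega
  have hz : 1 < 4 ^ (N / 8) := Nat.one_lt_pow (by omega) (by norm_num)
  have hinj : Set.InjOn (fun p => (p + 9) / M) T := by
    intro p hp p' hp' heq
    have h1 := Nat.mul_div_cancel' (hT p hp).2.2.2
    have h2 := Nat.mul_div_cancel' (hT p' hp').2.2.2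
    dsimp only at heq
    rw [heq] at h1
    omega
  have h1 := card_mul_log_le_of_sieve (m := M) (z := 4 ^ (N / 8)) (N := (X' + 9) / M + 1) hM0 hz
    G hG (h.sum_inv_primeFactors_le hM0.ne' (hM.trans
      (Nat.pow_le_pow_right (by norm_num) (by omega))) hMp)
    (T.image fun p => (p + 9) / M) (by
      intro k hk
      obtain ⟨p, hp, rfl⟩ := Finset.mem_image.mp hk
      rw [Finset.mem_range, Nat.lt_succ_iff]
      exact Nat.div_le_div_right (Nat.add_le_add_right (hT p hp).2.2.1 9)) (by
      intro k hk
      obtain ⟨p, hp, rfl⟩ := Finset.mem_image.mp hk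
      exact ⟨p, (hT p hp).1, (hT p hp).2.1, (Nat.mul_div_cancel' (hT p hp).2.2.2).symm⟩) (by
      intro k hk
      obtain ⟨p, hp, rfl⟩ := Finset.mem_image.mp hk
      exact hTG p hp)
  rw [Finset.card_image_of_injOn hinj] at h1
  set K : ℝ := 1 + ∑ g ∈ G, 1 / (g : ℝ) with hK
  have hK0 : 0 ≤ K := add_nonneg zero_le_one (Finset.sum_nonneg fun _ _ => by positivity)
  have hlog : ((N : ℝ) + 1) / 10 ≤ Real.log ((4 ^ (N / 8) : ℕ) : ℝ) := by
    push_cast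
    rw [Real.log_pow, log_four_eq]
    have h2 := Real.log_two_gt_d9
    have h3 : N ≤ 8 * (N / 8) + 7 := by omega
    have h4 : (N : ℝ) ≤ 8 * (N / 8 : ℕ) + 7 := by exact_mod_cast h3
    have h5 : (100 : ℝ) ≤ N := by exact_mod_cast hN
    nlinarith
  have hMr : (0 : ℝ) < M := by exact_mod_cast hM0
  have h2 : (((X' + 9) / M + 1 : ℕ) : ℝ) ≤ X' / M + 10 := by
    push_cast
    have h3 : (((X' + 9) / M : ℕ) : ℝ) ≤ ((X' + 9 : ℕ) : ℝ) / M := Nat.cast_div_le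
    have h4 : (9 : ℝ) / M ≤ 9 := div_le_self (by norm_num) (by exact_mod_cast hM0)
    push_cast at h3
    rw [add_div] at h3
    linarith
  have h3 : ((4 ^ (N / 8) : ℕ) : ℝ) ^ 2 + 11 ≤ X' / M := by
    rw [le_div_iff₀ hMr]
    have h4 : 4 ^ (2 * (N / 8)) + 11 ≤ 4 ^ (N / 4 + 2) := by
      have h5 : 4 ^ (2 * (N / 8)) ≤ 4 ^ (N / 4) := Nat.pow_le_pow_right (by norm_num) (by omega)
      have h6 : 1 ≤ 4 ^ (N / 4) := Nat.one_le_pow _ _ (by norm_num)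
      rw [pow_add]
      omega
    have h5 : 4 ^ 11 * ((4 ^ (2 * (N / 8)) + 11) * M) ≤ 4 ^ 11 * X' := by
      refine le_trans ?_ hX'
      calc 4 ^ 11 * ((4 ^ (2 * (N / 8)) + 11) * M)
          ≤ 4 ^ 11 * (4 ^ (N / 4 + 2) * 4 ^ (N + N / 4)) := by gcongr
        _ = 4 ^ (11 + (N / 4 + 2 + (N + N / 4))) := by rw [← pow_add, ← pow_add]
        _ ≤ 4 ^ (2 * N) := Nat.pow_le_pow_right (by norm_num) (by omega)
    have h6 := Nat.le_of_mul_le_mul_left h5 (by positivity)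
    have h7 : ((4 ^ (N / 8)) ^ 2 + 11) * M ≤ X' := by rwa [← pow_mul, mul_comm (N / 8)]
    exact_mod_cast h7
  have h4 : (T.card : ℝ) * (1 / 4 * ((N + 1) / 10) * K) ≤
      T.card * (1 / 4 * Real.log ((4 ^ (N / 8) : ℕ) : ℝ) * K) := by gcongr
  push_cast at h1 h2 h3 h4
  linarith

/-- The primes `p ≤ X`, not much smaller than `X`, for which `m ∣ p + 9` and `(p + 9) / m` has a
prime factor in `[4 ^ z, 4 ^ w)`. -/
def goodPrimes (X z w m : ℕ) : Finset ℕ :=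
  {p ∈ Finset.Ioc (X / 4 ^ 11) X | p.Prime ∧ m ∣ p + 9 ∧ ∃ g ∈ primeRange z w, g ∣ (p + 9) / m}

theorem mem_goodPrimes {X z w m p : ℕ} : p ∈ goodPrimes X z w m ↔
    (X / 4 ^ 11 < p ∧ p ≤ X) ∧ p.Prime ∧ m ∣ p + 9 ∧
      ∃ g ∈ primeRange z w, g ∣ (p + 9) / m := by
  rw [goodPrimes, Finset.mem_filter, Finset.mem_Ioc]

theorem psiShift_le_card_mul_log (X Y m : ℕ) :
    psiShift X m ≤ ({p ∈ Finset.Ioc 0 X | p.Prime ∧ Y < p ∧ m ∣ p + 9} : Finset ℕ).card *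
      Real.log X + (Chebyshev.psi X - Chebyshev.theta X) + Y * Real.log X := by
  classical
  have hlog : ∀ p ∈ Finset.Ioc 0 X, Real.log p ≤ Real.log X := fun p hp => by
    obtain ⟨h1, h2⟩ := Finset.mem_Ioc.mp hp
    exact Real.log_le_log (by exact_mod_cast h1) (by exact_mod_cast h2)
  have hlX : 0 ≤ Real.log X := Real.log_natCast_nonneg X
  have h1 : Chebyshev.psi X - Chebyshev.theta X =
      ∑ n ∈ Finset.Ioc 0 X, if n.Prime then 0 else ArithmeticFunction.vonMangoldt n := by
    rw [Chebyshev.psi_sub_theta_eq_sum_not_prime, Nat.floor_natCast, Finset.sum_filter]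
    refine Finset.sum_congr rfl fun n _ => ?_
    by_cases hn : n.Prime <;> simp [hn]
  have h2 : (({p ∈ Finset.Ioc 0 X | p.Prime ∧ Y < p ∧ m ∣ p + 9} : Finset ℕ).card : ℝ) *
      Real.log X = ∑ n ∈ Finset.Ioc 0 X, if n.Prime ∧ Y < n ∧ m ∣ n + 9 then Real.log X else 0 := by
    rw [← Finset.sum_filter, Finset.sum_const, nsmul_eq_mul]
  have h3 : ∑ n ∈ Finset.Ioc 0 X, (if n ≤ Y then Real.log X else 0) ≤ Y * Real.log X := by
    rw [← Finset.sum_filter, Finset.sum_const, nsmul_eq_mul]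
    refine mul_le_mul_of_nonneg_right ?_ hlX
    have : ({n ∈ Finset.Ioc 0 X | n ≤ Y} : Finset ℕ) ⊆ Finset.Ioc 0 Y := fun n hn => by
      obtain ⟨h4, h5⟩ := Finset.mem_filter.mp hn
      exact Finset.mem_Ioc.mpr ⟨(Finset.mem_Ioc.mp h4).1, h5⟩
    have := Finset.card_le_card this
    rw [Nat.card_Ioc] at this
    exact_mod_cast this
  rw [h1, h2]
  refine le_trans ?_ (add_le_add_right h3 _)
  rw [psiShift, ← Finset.sum_add_distrib, ← Finset.sum_add_distrib]
  refine Finset.sum_le_sum fun n hn => ?_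
  have h4 := hlog n hn
  have h5 : 0 ≤ ArithmeticFunction.vonMangoldt n := ArithmeticFunction.vonMangoldt_nonneg
  by_cases hp : n.Prime
  · rw [ArithmeticFunction.vonMangoldt_apply_prime hp]
    by_cases hm : m ∣ n + 9 <;> by_cases hY : n ≤ Y
    · simp [hp, hm, hY, not_lt.mpr hY, h4]
    · simp [hp, hm, hY, not_le.mp hY, h4]
    · simp [hp, hm, hY, not_lt.mpr hY, hlX]
    · simp [hp, hm, hY]
  · have h6 : 0 ≤ if n ≤ Y then Real.log X else 0 := by positivity
    by_cases hm : m ∣ n + 9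
    · simp [hp, hm, h6]
    · simp only [hm, hp, if_false, false_and]
      linarith

theorem IsScale.psiShift_le {X N ℓ m z w q : ℕ} (h : IsScale X N ℓ) (hm0 : 0 < m)
    (hm : m ≤ 4 ^ (N - 16 * ℓ + 2)) (hmp : ∀ r : ℕ, r.Prime → r ∣ m → 4 ^ (16 * ℓ) ≤ r)
    (hz : 8 ≤ z) (hzw : z * 2 ^ q ≤ w) (hq : 2 ^ 26 ≤ q) (hw : 2 * w ≤ N / 8) :
    psiShift X m ≤ 4 * (N + 1) * (goodPrimes X z w m).card + X / (200 * m) := by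
  classical
  have hℓ := h.one_le
  have hN := h.mul_le
  have hX0 : 0 < X := lt_of_lt_of_le (by positivity) h.pow_le
  have hX0' : (0 : ℝ) < X := by exact_mod_cast hX0
  have hm0' : (0 : ℝ) < m := by exact_mod_cast hm0
  set P : Finset ℕ := {p ∈ Finset.Ioc 0 X | p.Prime ∧ 4 ^ (N / 8) < p ∧ m ∣ p + 9} with hP
  have hPmem : ∀ p ∈ P, p.Prime ∧ 4 ^ (N / 8) < p ∧ p ≤ X ∧ m ∣ p + 9 := fun p hp => by
    obtain ⟨h1, h2, h3, h4⟩ := Finset.mem_filter.mp hp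
    exact ⟨h2, h3, (Finset.mem_Ioc.mp h1).2, h4⟩
  have hmN : m ≤ 4 ^ (N + N / 4) := hm.trans (Nat.pow_le_pow_right (by norm_num) (by omega))
  have h16 : 4 ^ (2 * N) ≤ X := by
    rw [pow_mul]
    exact h.pow_le
  set S : Finset ℕ := {p ∈ P | p ≤ X / 4 ^ 11}
  set G : Finset ℕ := primeRange z w \ m.primeFactors with hG
  set B : Finset ℕ := {p ∈ P | ∀ g ∈ primeRange z w, ¬ g ∣ (p + 9) / m}
  have hS : (S.card : ℝ) * ((N + 1) * (1 + ∑ g ∈ (∅ : Finset ℕ), 1 / (g : ℝ))) ≤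
      400 * ((X / 4 ^ 11 : ℕ) / m) := by
    refine h.card_primes_mul_le hm0 hmN hmp ?_ ∅ (by simp) S (fun p hp => ?_) (by simp)
    · have h1 : 4 ^ 11 ∣ 4 ^ (2 * N) := pow_dvd_pow 4 (by omega)
      calc 4 ^ (2 * N) = 4 ^ 11 * (4 ^ (2 * N) / 4 ^ 11) := (Nat.mul_div_cancel' h1).symm
        _ ≤ 4 ^ 11 * (X / 4 ^ 11) := Nat.mul_le_mul_left _ (Nat.div_le_div_right h16)
    · obtain ⟨h1, h2⟩ := Finset.mem_filter.mp hp
      obtain ⟨h3, h4, -, h5⟩ := hPmem p h1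
      exact ⟨h3, h4, h2, h5⟩
  have hB : (B.card : ℝ) * ((N + 1) * (1 + ∑ g ∈ G, 1 / (g : ℝ))) ≤ 400 * (X / m) := by
    refine h.card_primes_mul_le hm0 hmN hmp (h16.trans (Nat.le_mul_of_pos_left _ (by positivity)))
      G (fun g hg => ?_) B (fun p hp => hPmem p (Finset.mem_filter.mp hp).1)
      fun p hp g hg => (Finset.mem_filter.mp hp).2 g (Finset.mem_sdiff.mp hg).1
    obtain ⟨h1, h2⟩ := Finset.mem_sdiff.mp hg
    obtain ⟨⟨h3, h4⟩, h5⟩ := mem_primeRange.mp h1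
    refine ⟨h5, ?_, ?_, fun h6 => h2 (Nat.mem_primeFactors.mpr ⟨h5, h6, hm0.ne'⟩)⟩
    · have : 4 ^ 1 ≤ 4 ^ z := Nat.pow_le_pow_right (by norm_num) (by omega)
      omega
    · calc g * g ≤ 4 ^ w * 4 ^ w := Nat.mul_le_mul h4.le h4.le
        _ = 4 ^ (2 * w) := by rw [← pow_add, two_mul]
        _ ≤ 4 ^ (N / 8) := Nat.pow_le_pow_right (by norm_num) hw
  have hGsum : (4 : ℝ) ^ 11 ≤ 1 + ∑ g ∈ G, 1 / (g : ℝ) := by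
    have h1 := le_sum_inv_primeRange hz q
    have h2 : ∑ g ∈ primeRange z (z * 2 ^ q), 1 / (g : ℝ) ≤
        ∑ g ∈ primeRange z w, 1 / (g : ℝ) := by
      refine Finset.sum_le_sum_of_subset_of_nonneg (fun g hg => ?_) fun _ _ _ => by positivity
      obtain ⟨⟨h3, h4⟩, h5⟩ := mem_primeRange.mp hg
      exact mem_primeRange.mpr
        ⟨⟨h3, h4.trans_le (Nat.pow_le_pow_right (by norm_num) hzw)⟩, h5⟩
    have h3 := h.sum_inv_primeFactors_le hm0.ne' (hmN.trans
      (Nat.pow_le_pow_right (by norm_num) (by omega))) hmp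
    have h4 : ∑ g ∈ primeRange z w, 1 / (g : ℝ) ≤
        ∑ g ∈ G, 1 / (g : ℝ) + ∑ g ∈ m.primeFactors, 1 / (g : ℝ) := by
      rw [← Finset.sum_inter_add_sum_sdiff (primeRange z w) m.primeFactors, add_comm]
      exact add_le_add_right (Finset.sum_le_sum_of_subset_of_nonneg Finset.inter_subset_right
        fun _ _ _ => by positivity) _
    have h5 : ((2 ^ 26 : ℕ) : ℝ) ≤ q := by exact_mod_cast hq
    push_cast at h5
    linarith
  have hcard : P.card ≤ (goodPrimes X z w m).card + S.card + B.card := by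
    refine (Finset.card_le_card (t := goodPrimes X z w m ∪ S ∪ B) fun p hp => ?_).trans
      ((Finset.card_union_le _ _).trans (Nat.add_le_add_right (Finset.card_union_le _ _) _))
    obtain ⟨h1, h2, h3, h4⟩ := hPmem p hp
    by_cases h5 : p ≤ X / 4 ^ 11
    · exact Finset.mem_union_left _ (Finset.mem_union_right _ (Finset.mem_filter.mpr ⟨hp, h5⟩))
    by_cases h6 : ∃ g ∈ primeRange z w, g ∣ (p + 9) / m
    · exact Finset.mem_union_left _ (Finset.mem_union_left _
        (mem_goodPrimes.mpr ⟨⟨not_le.mp h5, h3⟩, h1, h4, h6⟩))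
    · push Not at h6
      exact Finset.mem_union_right _ (Finset.mem_filter.mpr ⟨hp, h6⟩)
  have hcard' : (P.card : ℝ) ≤ (goodPrimes X z w m).card + S.card + B.card := by
    exact_mod_cast hcard
  have hlog := h.log_le
  have hN1 : (0 : ℝ) < N + 1 := by positivity
  have hS' : (S.card : ℝ) * (N + 1) * 4 ^ 11 ≤ 400 * (X / m) := by
    simp only [Finset.sum_empty, add_zero, mul_one] at hS
    have h1 : ((X / 4 ^ 11 : ℕ) : ℝ) ≤ X / (4 ^ 11 : ℕ) := Nat.cast_div_le
    have h2 : ((X / 4 ^ 11 : ℕ) : ℝ) / m ≤ X / (4 ^ 11 : ℕ) / m := by gcongr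
    have h3 : (X : ℝ) / (4 ^ 11 : ℕ) / m = X / m / 4 ^ 11 := by
      rw [div_right_comm, Nat.cast_pow, Nat.cast_ofNat]
    rw [h3, le_div_iff₀ (by positivity)] at h2
    nlinarith
  have hB' : (B.card : ℝ) * (N + 1) * 4 ^ 11 ≤ 400 * (X / m) := by
    refine le_trans ?_ hB
    rw [mul_assoc]
    gcongr
  have herr : (36 : ℝ) * 4 ^ N * (N + 1) ≤ X / m / 256 := by
    rw [le_div_iff₀ (by norm_num), le_div_iff₀ hm0']
    have h1 : 36 * 4 ^ N * (N + 1) * 256 * m ≤ X := by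
      refine le_trans ?_ h16
      have h2 : 36 * 16 * 256 * (N + 1) ≤ 4 ^ (16 * ℓ) := by
        have h3 := h.succ_le
        calc 36 * 16 * 256 * (N + 1) ≤ 4 ^ 15 * 4 ^ ℓ := by omega
          _ = 4 ^ (15 + ℓ) := (pow_add _ _ _).symm
          _ ≤ 4 ^ (16 * ℓ) := Nat.pow_le_pow_right (by norm_num) (by omega)
      calc 36 * 4 ^ N * (N + 1) * 256 * m
          ≤ 36 * 4 ^ N * (N + 1) * 256 * 4 ^ (N - 16 * ℓ + 2) := Nat.mul_le_mul_left _ hm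
        _ = 36 * 16 * 256 * (N + 1) * 4 ^ (N + (N - 16 * ℓ)) := by
          rw [pow_add, pow_add]
          ring
        _ ≤ 4 ^ (16 * ℓ) * 4 ^ (N + (N - 16 * ℓ)) := Nat.mul_le_mul_right _ h2
        _ = 4 ^ (2 * N) := by
          rw [← pow_add]
          congr 1
          omega
    exact_mod_cast h1
  have hpsi : Chebyshev.psi X - Chebyshev.theta X ≤ 32 * 4 ^ N * (N + 1) := by
    refine (Chebyshev.psi_sub_theta_le (x := (X : ℝ)) (by exact_mod_cast hX0)).trans ?_
    have h1 : √(X : ℝ) ≤ 4 ^ (N + 1) := by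
      refine Real.sqrt_le_iff.mpr ⟨by positivity, ?_⟩
      rw [← pow_mul, mul_comm, pow_mul]
      norm_num
      exact_mod_cast h.lt_pow.le
    calc 2 * √(X : ℝ) * Real.log X ≤ 2 * 4 ^ (N + 1) * (4 * (N + 1)) := by
          gcongr
      _ = 32 * 4 ^ N * (N + 1) := by rw [pow_succ]; ring
  have hY : (((4 ^ (N / 8) : ℕ) : ℝ)) * Real.log X ≤ 4 * 4 ^ N * (N + 1) := by
    have h1 : ((4 ^ (N / 8) : ℕ) : ℝ) ≤ 4 ^ N := by
      exact_mod_cast Nat.pow_le_pow_right (n := 4) (by norm_num) (Nat.div_le_self N 8)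
    calc ((4 ^ (N / 8) : ℕ) : ℝ) * Real.log X ≤ 4 ^ N * (4 * (N + 1)) := by gcongr
      _ = 4 * 4 ^ N * (N + 1) := by ring
  have h1 := psiShift_le_card_mul_log X (4 ^ (N / 8)) m
  have h2 : (P.card : ℝ) * Real.log X ≤
      ((goodPrimes X z w m).card + S.card + B.card) * (4 * (N + 1)) := by gcongr
  have h3 : (X : ℝ) / (200 * m) = X / m / 200 := by rw [mul_comm, div_div]
  have h4 : 0 < (X : ℝ) / m := by positivity
  rw [h3]
  nlinarith

theorem sq_sum_card_le_of_card_image_le {ι : Type*} [DecidableEq ι] (Y : Finset ι)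
    (G : ι → Finset ℕ) (e : ι → ℕ) (k : ℕ)
    (hk : ∀ p, ({y ∈ Y | p ∈ G y}.image e).card ≤ k) :
    (∑ y ∈ Y, (G y).card) ^ 2 ≤
      (Y.biUnion G).card * (k * ∑ y ∈ Y, ∑ y' ∈ Y with e y' = e y, (G y ∩ G y').card) := by
  set U := Y.biUnion G
  have hU : ∀ y ∈ Y, G y ⊆ U := fun y hy => Finset.subset_biUnion_of_mem G hy
  have h1 : ∑ y ∈ Y, (G y).card = ∑ p ∈ U, ({y ∈ Y | p ∈ G y} : Finset ι).card := by
    simp only [Finset.card_filter]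
    rw [Finset.sum_comm]
    refine Finset.sum_congr rfl fun y hy => ?_
    rw [← Finset.card_filter, Finset.filter_mem_eq_inter, Finset.inter_eq_right.mpr (hU y hy)]
  have h2 : ∀ p, ({y ∈ Y | p ∈ G y} : Finset ι).card ^ 2 ≤
      k * ∑ y ∈ Y, ∑ y' ∈ Y with e y' = e y, if p ∈ G y ∩ G y' then 1 else 0 := by
    intro p
    set Z : Finset ι := {y ∈ Y | p ∈ G y} with hZ
    have h3 : Z.card = ∑ b ∈ Z.image e, ({y ∈ Z | e y = b} : Finset ι).card :=
      Finset.card_eq_sum_card_image e Z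
    have h4 : ∑ b ∈ Z.image e, ({y ∈ Z | e y = b} : Finset ι).card ^ 2 =
        ∑ y ∈ Z, ({y' ∈ Z | e y' = e y} : Finset ι).card := by
      rw [Finset.sum_comp (fun b => ({y' ∈ Z | e y' = b} : Finset ι).card) e]
      exact Finset.sum_congr rfl fun b _ => by rw [smul_eq_mul, sq]
    have h5 : ∑ y ∈ Z, ({y' ∈ Z | e y' = e y} : Finset ι).card =
        ∑ y ∈ Y, ∑ y' ∈ Y with e y' = e y, if p ∈ G y ∩ G y' then 1 else 0 := by
      rw [hZ, Finset.sum_filter]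
      refine Finset.sum_congr rfl fun y _ => ?_
      split_ifs with h6
      · rw [Finset.card_filter, Finset.sum_filter, Finset.sum_filter]
        refine Finset.sum_congr rfl fun y' _ => ?_
        by_cases h7 : p ∈ G y' <;> simp [h6, h7]
      · simp [h6]
    calc Z.card ^ 2 ≤ (Z.image e).card *
          ∑ b ∈ Z.image e, ({y ∈ Z | e y = b} : Finset ι).card ^ 2 := by
          rw [h3]
          exact sq_sum_le_card_mul_sum_sq
      _ ≤ k * ∑ b ∈ Z.image e, ({y ∈ Z | e y = b} : Finset ι).card ^ 2 :=
          Nat.mul_le_mul_right _ (hk p)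
      _ = _ := by rw [h4, h5]
  rw [h1]
  refine sq_sum_le_card_mul_sum_sq.trans (Nat.mul_le_mul_left _ ?_)
  refine (Finset.sum_le_sum fun p _ => h2 p).trans (le_of_eq ?_)
  rw [← Finset.mul_sum, Finset.sum_comm]
  congr 1
  refine Finset.sum_congr rfl fun y hy => ?_
  rw [Finset.sum_comm]
  refine Finset.sum_congr rfl fun y' _ => ?_
  rw [← Finset.card_filter, Finset.filter_mem_eq_inter, Finset.inter_eq_right.mpr]
  exact Finset.inter_subset_left.trans (hU y hy)

theorem card_le_two_of_primes_dvd {n K : ℕ} (hn0 : n ≠ 0) (hn : n < 4 ^ (3 * K)) (E : Finset ℕ)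
    (hE : ∀ e ∈ E, e.Prime ∧ 4 ^ K ≤ e ∧ e ∣ n) : E.card ≤ 2 := by
  by_contra! h
  have h1 : ∏ e ∈ E, e ∣ n := Finset.prod_primes_dvd n (fun e he => (hE e he).1.prime)
    fun e he => (hE e he).2.2
  have h2 : (4 ^ K) ^ E.card ≤ ∏ e ∈ E, e := Finset.pow_card_le_prod _ _ _ fun e he => (hE e he).2.1
  have h3 := h2.trans (Nat.le_of_dvd (Nat.pos_of_ne_zero hn0) h1)
  rw [← pow_mul] at h3
  have h4 : 4 ^ (3 * K) ≤ 4 ^ (K * E.card) := Nat.pow_le_pow_right (by norm_num) (by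
    rw [mul_comm 3]
    exact Nat.mul_le_mul_left _ h)
  omega

theorem IsScale.card_inter_goodPrimes_le {X N ℓ z w u u' e : ℕ} (h : IsScale X N ℓ)
    (hu : 0 < u) (hu' : 0 < u') (he : 0 < e) (hM : e * u * u' ≤ 4 ^ (N + N / 4))
    (hp : ∀ r : ℕ, r.Prime → r ∣ e * u * u' → 4 ^ (16 * ℓ) ≤ r) :
    ((goodPrimes X z w (e * u) ∩ goodPrimes X z w (e * u')).card : ℝ) * (N + 1) ≤
      400 * X * (1 / ((e : ℝ) * u) * ((Nat.gcd u u' : ℝ) / u')) := by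
  have hℓ := h.one_le
  have hN := h.mul_le
  have hdvd : e * Nat.lcm u u' ∣ e * u * u' := by
    rw [mul_assoc]
    exact mul_dvd_mul_left e (Nat.lcm_dvd_mul u u')
  have hlcm : 0 < Nat.lcm u u' := Nat.lcm_pos hu hu'
  have h16 : 4 ^ (2 * N) ≤ X := by
    rw [pow_mul]
    exact h.pow_le
  have h1 := h.card_primes_mul_le (M := e * Nat.lcm u u') (X' := X) (by positivity)
    ((Nat.le_of_dvd (by positivity) hdvd).trans hM) (fun r hr hd => hp r hr (hd.trans hdvd))
    (h16.trans (Nat.le_mul_of_pos_left _ (by positivity))) ∅ (by simp)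
    (goodPrimes X z w (e * u) ∩ goodPrimes X z w (e * u')) (fun p hp => ?_) (by simp)
  · simp only [Finset.sum_empty, add_zero, mul_one] at h1
    refine h1.trans (le_of_eq ?_)
    have h2 : ((Nat.gcd u u' : ℕ) : ℝ) * (Nat.lcm u u' : ℕ) = u * u' := by
      exact_mod_cast Nat.gcd_mul_lcm u u'
    have h3 : (0 : ℝ) < u := by exact_mod_cast hu
    have h4 : (0 : ℝ) < u' := by exact_mod_cast hu'
    have h5 : (0 : ℝ) < e := by exact_mod_cast he
    have h6 : (0 : ℝ) < (Nat.lcm u u' : ℕ) := by exact_mod_cast hlcm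
    push_cast
    field_simp
    linear_combination -(X : ℝ) * h2
  · obtain ⟨h2, h3⟩ := Finset.mem_inter.mp hp
    obtain ⟨⟨h4, h5⟩, h6, h7, -⟩ := mem_goodPrimes.mp h2
    obtain ⟨-, -, h8, -⟩ := mem_goodPrimes.mp h3
    refine ⟨h6, lt_of_le_of_lt ?_ h4, h5, ?_⟩
    · rw [Nat.le_div_iff_mul_le (by positivity)]
      refine le_trans ?_ h16
      rw [← pow_add]
      exact Nat.pow_le_pow_right (by norm_num) (by omega)
    · rw [← Nat.lcm_mul_left]
      exact Nat.lcm_dvd h7 h8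

theorem IsScale.sum_card_inter_goodPrimes_le {X N ℓ z w : ℕ} (h : IsScale X N ℓ)
    {l : List (ℕ × ℕ)} (hl' : ∀ x ∈ l, 16 * ℓ ≤ x.1) (hs : (l.map Prod.snd).sum ≤ N / 50)
    (hW : ∀ u ∈ primeProducts l, ∀ Y : ℝ, ∑ u' ∈ primeProducts l, (if Y ≤ u' ∧ u' < 4 * Y then
        (Nat.gcd u u' : ℝ) / u' else 0) ≤ 3)
    {y : Σ _ : ℕ, ℕ} (hy : y ∈ modPairs l (N - 16 * ℓ)) :
    (∑ y' ∈ modPairs l (N - 16 * ℓ) with y'.2 = y.2,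
      ((goodPrimes X z w (y.2 * y.1) ∩ goodPrimes X z w (y'.2 * y'.1)).card : ℝ)) * (N + 1) ≤
      1200 * X * (1 / ((y.2 : ℝ) * y.1)) := by
  have hN := h.mul_le
  have hℓ := h.one_le
  obtain ⟨u, e⟩ := y
  obtain ⟨hu, he⟩ := Finset.mem_sigma.mp hy
  obtain ⟨hep, heK, -, hm⟩ := modPairs_bounds hs (by omega) hy
  dsimp only at hu he hep heK hm ⊢
  have hu0 := pos_of_mem_primeProducts hu
  have hrange : ∀ {v : ℕ}, v ∈ primeProducts l →
      e ∈ primeRange (N - 16 * ℓ - Nat.log 4 v) (N - 16 * ℓ - Nat.log 4 v + 1) →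
      N - 16 * ℓ - Nat.log 4 v = Nat.log 4 e := fun {v} hv hev => by
    obtain ⟨⟨h1, h2⟩, -⟩ := mem_primeRange.mp hev
    exact (Nat.log_eq_of_pow_le_of_lt_pow h1 h2).symm
  have hterm : ∀ u' ∈ primeProducts l, (∑ e' ∈ primeRange (N - 16 * ℓ - Nat.log 4 u')
      (N - 16 * ℓ - Nat.log 4 u' + 1), if e' = e then
        ((goodPrimes X z w (e * u) ∩ goodPrimes X z w (e' * u')).card : ℝ) else 0) * (N + 1) ≤
      400 * X * (1 / ((e : ℝ) * u)) * (if (4 : ℝ) ^ Nat.log 4 u ≤ u' ∧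
        u' < 4 * (4 : ℝ) ^ Nat.log 4 u then (Nat.gcd u u' : ℝ) / u' else 0) := by
    intro u' hu'
    have hu0' := pos_of_mem_primeProducts hu'
    rw [Finset.sum_ite_eq']
    by_cases he' : e ∈ primeRange (N - 16 * ℓ - Nat.log 4 u') (N - 16 * ℓ - Nat.log 4 u' + 1)
    · have h1 := log_four_le_of_mem_primeProducts hs hu
      have h2 := log_four_le_of_mem_primeProducts hs hu'
      have h3 := hrange hu he
      have h4 := hrange hu' he'
      have h5 : Nat.log 4 u' = Nat.log 4 u := by omega
      have h6 : (4 : ℝ) ^ Nat.log 4 u ≤ u' ∧ u' < 4 * (4 : ℝ) ^ Nat.log 4 u := by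
        rw [← h5, ← pow_succ']
        exact ⟨by exact_mod_cast Nat.pow_log_le_self 4 hu0'.ne',
          by exact_mod_cast Nat.lt_pow_succ_log_self (by norm_num) u'⟩
      rw [if_pos he', if_pos h6, mul_assoc (400 * (X : ℝ))]
      refine h.card_inter_goodPrimes_le hu0 hu0' hep.pos ?_ fun r hr hd => ?_
      · calc e * u * u' ≤ 4 ^ (N - 16 * ℓ + 2) * 4 ^ (N / 50) :=
              Nat.mul_le_mul hm.le ((le_of_mem_primeProducts hu').trans
                (Nat.pow_le_pow_right (by norm_num) hs))
          _ = 4 ^ (N - 16 * ℓ + 2 + N / 50) := (pow_add _ _ _).symm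
          _ ≤ 4 ^ (N + N / 4) := Nat.pow_le_pow_right (by norm_num) (by omega)
      · rcases (Nat.Prime.dvd_mul hr).mp hd with hd | hd
        · rcases (Nat.Prime.dvd_mul hr).mp hd with hd | hd
          · rw [(Nat.prime_dvd_prime_iff_eq hr hep).mp hd]
            exact (Nat.pow_le_pow_right (by norm_num) (by omega)).trans heK
          · exact le_of_prime_dvd_of_mem_primeProducts hl' hu hr hd
        · exact le_of_prime_dvd_of_mem_primeProducts hl' hu' hr hd
    · rw [if_neg he', zero_mul]
      positivity
  have h1 := Finset.sum_le_sum hterm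
  rw [← Finset.sum_mul, ← Finset.mul_sum] at h1
  rw [Finset.sum_filter, modPairs, Finset.sum_sigma]
  refine h1.trans ?_
  have h2 := mul_le_mul_of_nonneg_left (hW u hu (4 ^ Nat.log 4 u))
    (by positivity : 0 ≤ 400 * (X : ℝ) * (1 / ((e : ℝ) * u)))
  linarith

theorem IsScale.le_card_biUnion_goodPrimes {X N ℓ z w q : ℕ} (h : IsScale X N ℓ)
    {l : List (ℕ × ℕ)} (hl : DisjointRanges l)
    (hl' : ∀ x ∈ l, 16 * ℓ ≤ x.1 ∧ x.1 < x.2 ∧ x.2 ≤ 2 ^ ℓ)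
    (hs : (l.map Prod.snd).sum ≤ N / 50) (hlen : l.length < 4 ^ ℓ) (hℓ : 5 ≤ ℓ)
    (hz : 8 ≤ z) (hzw : z * 2 ^ q ≤ w) (hq : 2 ^ 26 ≤ q) (hw : 2 * w ≤ N / 8)
    (hW : ∀ u ∈ primeProducts l, ∀ Y : ℝ, ∑ u' ∈ primeProducts l, (if Y ≤ u' ∧ u' < 4 * Y then
        (Nat.gcd u u' : ℝ) / u' else 0) ≤ 3) (hmass : 1 ≤ primeMass l) :
    (X : ℝ) ≤ 2 * 10 ^ 9 * (N + 1) ^ 2 *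
      ((modPairs l (N - 16 * ℓ)).biUnion fun y => goodPrimes X z w (y.2 * y.1)).card := by
  have hN := h.mul_le
  have hN0 : (0 : ℝ) < N + 1 := by positivity
  have hX0 : 0 < X := lt_of_lt_of_le (by positivity) h.pow_le
  have hX0' : (0 : ℝ) < X := by exact_mod_cast hX0
  set Y := modPairs l (N - 16 * ℓ) with hY
  set S : ℝ := primeMass l
  set H : ℝ := ∑ y ∈ Y, 1 / ((y.2 : ℝ) * y.1) with hH
  set G : (Σ _ : ℕ, ℕ) → Finset ℕ := fun y => goodPrimes X z w (y.2 * y.1) with hG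
  have hHle : H * (N + 1) ≤ 8 * S := by
    have h1 := sum_inv_modPairs_le hl (N := N - 16 * ℓ) hs (by omega)
    have h2 : 4 / ((N - 16 * ℓ - N / 50 : ℕ) : ℝ) ≤ 8 / (N + 1) := by
      have h3 : N + 1 ≤ 2 * (N - 16 * ℓ - N / 50) := by omega
      have h4 : ((N + 1 : ℕ) : ℝ) ≤ (2 * (N - 16 * ℓ - N / 50) : ℕ) := by exact_mod_cast h3
      rw [Nat.cast_mul] at h4
      push_cast at h4
      have h5 : 0 < N - 16 * ℓ - N / 50 := by omega
      rw [div_le_div_iff₀ (by exact_mod_cast h5) hN0]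
      linarith
    have h3 := h1.trans (mul_le_mul_of_nonneg_right h2 (zero_le_one.trans hmass))
    rwa [div_mul_eq_mul_div, le_div_iff₀ hN0] at h3
  have hfirst : X * S ≤ 256 * (N + 1) ^ 2 * ∑ y ∈ Y, ((G y).card : ℝ) := by
    have h1 := le_sum_psiShift_modPairs h l hl hl' hs hlen hℓ
    have h2 : ∑ y ∈ Y, psiShift X (y.2 * y.1) ≤
        ∑ y ∈ Y, (4 * (N + 1) * ((G y).card : ℝ) + X / 200 * (1 / ((y.2 : ℝ) * y.1))) := by
      refine Finset.sum_le_sum fun y hy => ?_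
      obtain ⟨hep, heK, h3, h4⟩ := modPairs_bounds hs (by omega) hy
      have hu := (Finset.mem_sigma.mp hy).1
      have h5 := h.psiShift_le (m := y.2 * y.1) (lt_of_lt_of_le (by positivity) h3) h4.le
        (fun r hr hd => ?_) hz hzw hq hw
      · rw [div_mul_div_comm, mul_one]
        exact_mod_cast h5
      · rcases (Nat.Prime.dvd_mul hr).mp hd with hd | hd
        · rw [(Nat.prime_dvd_prime_iff_eq hr hep).mp hd]
          exact (Nat.pow_le_pow_right (by norm_num) (by omega)).trans heK
        · exact le_of_prime_dvd_of_mem_primeProducts (fun x hx => (hl' x hx).1) hu hr hd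
    rw [Finset.sum_add_distrib, ← Finset.mul_sum, ← Finset.mul_sum, ← hH] at h2
    have h3 := h1.trans h2
    rw [div_mul_eq_mul_div, div_le_iff₀ (by positivity)] at h3
    have h4 := mul_le_mul_of_nonneg_left hHle hX0'.le
    nlinarith
  have hsecond : ∑ y ∈ Y, ∑ y' ∈ Y with y'.2 = y.2, ((G y ∩ G y').card : ℝ) * (N + 1) ≤
      1200 * X * H := by
    rw [hH, Finset.mul_sum]
    refine Finset.sum_le_sum fun y hy => ?_
    rw [← Finset.sum_mul]
    exact h.sum_card_inter_goodPrimes_le (fun x hx => (hl' x hx).1) hs hW hy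
  have hcs := sq_sum_card_le_of_card_image_le Y G (fun y => y.2) 2 fun p => by
    rcases Finset.eq_empty_or_nonempty ({y ∈ Y | p ∈ G y} : Finset (Σ _ : ℕ, ℕ)) with h0 | ⟨y, hy⟩
    · rw [h0]
      simp
    have hp := (mem_goodPrimes.mp (Finset.mem_filter.mp hy).2).1.2
    refine card_le_two_of_primes_dvd (n := p + 9) (K := N - 16 * ℓ - N / 50) (by omega) ?_ _ ?_
    · have h1 := h.lt_pow
      calc p + 9 < 16 ^ (N + 1) * 16 := by
            have : 16 ≤ 16 ^ (N + 1) := Nat.le_self_pow (by omega) 16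
            omega
        _ = 4 ^ (2 * (N + 2)) := by
            rw [← pow_succ, pow_mul]
            norm_num
        _ ≤ _ := Nat.pow_le_pow_right (by norm_num) (by omega)
    · intro e he
      obtain ⟨y, hy, rfl⟩ := Finset.mem_image.mp he
      obtain ⟨h1, h2⟩ := Finset.mem_filter.mp hy
      obtain ⟨h3, h4, -, -⟩ := modPairs_bounds hs (by omega) h1
      exact ⟨h3, h4, (dvd_mul_right _ _).trans (mem_goodPrimes.mp h2).2.2.1⟩
  set C : ℝ := ((Y.biUnion G).card : ℝ) with hC
  have hcs' : (∑ y ∈ Y, ((G y).card : ℝ)) ^ 2 ≤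
      C * (2 * ∑ y ∈ Y, ∑ y' ∈ Y with y'.2 = y.2, ((G y ∩ G y').card : ℝ)) := by
    rw [hC]
    exact_mod_cast hcs
  simp only [← Finset.sum_mul] at hsecond
  set D : ℝ := ∑ y ∈ Y, ∑ y' ∈ Y with y'.2 = y.2, ((G y ∩ G y').card : ℝ)
  have hC0 : 0 ≤ C := Nat.cast_nonneg _
  have hD : D * (N + 1) ^ 2 ≤ 9600 * X * S := by
    have h1 := mul_le_mul_of_nonneg_right hsecond hN0.le
    have h2 := mul_le_mul_of_nonneg_left hHle (by positivity : 0 ≤ 1200 * (X : ℝ))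
    linarith
  have h1 : (X * S) ^ 2 ≤ (256 * (N + 1) ^ 2 * ∑ y ∈ Y, ((G y).card : ℝ)) ^ 2 :=
    pow_le_pow_left₀ (by positivity) hfirst 2
  have h2 : (256 * (N + 1) ^ 2 * ∑ y ∈ Y, ((G y).card : ℝ)) ^ 2 ≤
      256 ^ 2 * (N + 1) ^ 2 * (C * (2 * (9600 * X * S))) := by
    calc (256 * (N + 1) ^ 2 * ∑ y ∈ Y, ((G y).card : ℝ)) ^ 2
        = 256 ^ 2 * ((N : ℝ) + 1) ^ 4 * (∑ y ∈ Y, ((G y).card : ℝ)) ^ 2 := by ring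
      _ ≤ 256 ^ 2 * ((N : ℝ) + 1) ^ 4 * (C * (2 * D)) := by gcongr
      _ = 256 ^ 2 * ((N : ℝ) + 1) ^ 2 * (C * (2 * (D * (N + 1) ^ 2))) := by ring
      _ ≤ _ := by gcongr
  have hXS : 0 < X * S := mul_pos hX0' (zero_lt_one.trans_le hmass)
  have h3 : X * S ≤ 256 ^ 2 * (N + 1) ^ 2 * (C * (2 * 9600)) := by
    refine le_of_mul_le_mul_right ?_ hXS
    linarith
  have h4 : (X : ℝ) ≤ X * S := le_mul_of_one_le_right hX0'.le hmass
  have h5 : 0 ≤ ((N : ℝ) + 1) ^ 2 * C := by positivity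
  linarith

theorem IsScale.exists_cycHeight_gt {X N ℓ A t z w p : ℕ} (h : IsScale X N ℓ)
    {l : List (ℕ × ℕ)} (hs : ((l ++ pairList A t).map Prod.snd).sum ≤ N / 50)
    (hz : z + 4 = 16 * ℓ + ∑ i ∈ Finset.range t, (A + 2 * i) + t) (hw : w ≤ z + 2 ^ (t + 1))
    (hp : p ∈ (modPairs (l ++ pairList A t) (N - 16 * ℓ)).biUnion
      fun y => goodPrimes X z w (y.2 * y.1)) :
    p ≤ X ∧ p.Prime ∧ ∃ q r : ℕ, q.Prime ∧ r.Prime ∧ p < q ∧ q < r ∧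
      2 * (p : ℝ) / 3 - 2 ^ 30 * √(p : ℝ) < cycHeight (p * q * r) := by
  have hN := h.mul_le
  have hℓ := h.one_le
  obtain ⟨y, hy, hpy⟩ := Finset.mem_biUnion.mp hp
  obtain ⟨⟨hXp, hpX⟩, hpp, hm, g, hg, hgd⟩ := mem_goodPrimes.mp hpy
  obtain ⟨-, -, hm1, hm2⟩ := modPairs_bounds hs (by omega) hy
  obtain ⟨⟨hg1, hg2⟩, -⟩ := mem_primeRange.mp hg
  obtain ⟨a, had, ha1, ha2⟩ := exists_dvd_mul_near (Finset.mem_sigma.mp hy).1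
    (by omega : 16 * ℓ ≤ N) hz hm1 hm2 hg1
    (hg2.trans_le (Nat.pow_le_pow_right (by norm_num) hw))
  have hgm : g * (y.2 * y.1) ∣ p + 9 := by
    rw [← Nat.div_mul_cancel hm]
    exact Nat.mul_dvd_mul_right hgd _
  obtain ⟨b, hb⟩ := had.trans hgm
  have h16 : 4 ^ (2 * N) ≤ X := by
    rw [pow_mul]
    exact h.pow_le
  have hp2N : 4 ^ (2 * N) ≤ 4 ^ 11 * p := by
    have h1 : X < 4 ^ 11 * (X / 4 ^ 11 + 1) := Nat.lt_mul_div_succ X (by positivity)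
    exact (h16.trans h1.le).trans (Nat.mul_le_mul_left _ hXp)
  have hpN : 4 ^ (N + 7) < p := by
    refine lt_of_le_of_lt ?_ hXp
    rw [Nat.le_div_iff_mul_le (by positivity), ← pow_add]
    exact (Nat.pow_le_pow_right (by norm_num) (by omega)).trans h16
  have hbE : b ≤ 4 ^ (N + 7) := by
    have h1 : 4 ^ N * b ≤ 4 ^ N * 4 ^ (N + 7) := by
      have h2 := h.lt_pow
      calc 4 ^ N * b ≤ 256 * a * b := Nat.mul_le_mul_right b ha2
        _ = 256 * (p + 9) := by rw [hb, mul_assoc]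
        _ ≤ 256 * (4 * 16 ^ (N + 1)) := by
          have : 16 ≤ 16 ^ (N + 1) := Nat.le_self_pow (by omega) 16
          omega
        _ = 4 ^ (2 * N + 7) := by
          rw [pow_add 4 (2 * N), pow_mul, pow_succ 16 N]
          norm_num
          ring
        _ = 4 ^ N * 4 ^ (N + 7) := by
          rw [← pow_add]
          congr 1
          ring
    exact Nat.le_of_mul_le_mul_left h1 (by positivity)
  have h9 : 9 < p := lt_of_le_of_lt (by
    calc 9 ≤ 4 ^ 7 := by norm_num
      _ ≤ 4 ^ (N + 7) := Nat.pow_le_pow_right (by norm_num) (by omega)) hpN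
  obtain ⟨q, r, hq, hr, hpq, hqr, hH⟩ := exists_cycHeight_ge_of_mul_eq hpp h9 hb.symm
    (ha1.trans (Nat.pow_le_pow_right (by norm_num) (by omega))) hbE hpN
  refine ⟨hpX, hpp, q, r, hq, hr, hpq, hqr, lt_of_lt_of_le ?_ hH⟩
  have h1 : (1 : ℝ) ≤ √(p : ℝ) := Real.one_le_sqrt.mpr (by exact_mod_cast hpp.one_le)
  have h2 : (4 : ℝ) ^ N ≤ 2 ^ 11 * √(p : ℝ) := by
    refine (sq_le_sq₀ (by positivity) (by positivity)).mp ?_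
    rw [mul_pow, Real.sq_sqrt (Nat.cast_nonneg p), ← pow_mul, ← pow_mul, mul_comm N]
    have h3 : (4 : ℝ) ^ (2 * N) ≤ 4 ^ 11 * p := by exact_mod_cast hp2N
    norm_num at h3 ⊢
    exact h3
  push_cast
  rw [pow_add]
  linarith

theorem primeMass_append (l₁ l₂ : List (ℕ × ℕ)) :
    primeMass (l₁ ++ l₂) = primeMass l₁ * primeMass l₂ := by
  rw [primeMass, List.map_append, List.prod_append, primeMass, primeMass]

theorem onePrimeMass_append (l₁ l₂ : List (ℕ × ℕ)) :
    onePrimeMass (l₁ ++ l₂) = onePrimeMass l₁ * onePrimeMass l₂ := by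
  rw [onePrimeMass, List.map_append, List.prod_append, onePrimeMass, onePrimeMass]

theorem pow_length_le_primeMass {l : List (ℕ × ℕ)} {c : ℝ} (hc : 0 ≤ c)
    (h : ∀ x ∈ l, c ≤ ∑ r ∈ primeRange x.1 x.2, 1 / (r : ℝ)) : c ^ l.length ≤ primeMass l := by
  induction l with
  | nil => simp [primeMass]
  | cons x l ih =>
    rw [primeMass_cons, List.length_cons, pow_succ']
    have h1 := h x (List.mem_cons_self ..)
    exact mul_le_mul h1 (ih fun y hy => h y (List.mem_cons_of_mem _ hy)) (by positivity)
      (hc.trans h1)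

theorem onePrimeMass_le_pow_length {l : List (ℕ × ℕ)} {c : ℝ}
    (h : ∀ x ∈ l, 1 + ∑ r ∈ primeRange x.1 x.2, 1 / (r : ℝ) ≤ c) :
    onePrimeMass l ≤ c ^ l.length := by
  induction l with
  | nil => simp [onePrimeMass]
  | cons x l ih =>
    rw [onePrimeMass_cons, List.length_cons, pow_succ']
    have h1 := h x (List.mem_cons_self ..)
    exact mul_le_mul h1 (ih fun y hy => h y (List.mem_cons_of_mem _ hy))
      (zero_le_one.trans (one_le_onePrimeMass l))
      ((zero_le_one.trans (one_le_one_add_sum_primeRange x)).trans h1)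

/-- The consecutive intervals `[κ, κ * 2 ^ s)` with `κ = 2 ^ (a + j * s)`, for `j < J`. -/
def fillerList (a s J : ℕ) : List (ℕ × ℕ) :=
  (List.range J).map fun j => (2 ^ (a + j * s), 2 ^ (a + j * s) * 2 ^ s)

theorem length_fillerList (a s J : ℕ) : (fillerList a s J).length = J := by
  rw [fillerList, List.length_map, List.length_range]

theorem mem_fillerList {a s J : ℕ} {x : ℕ × ℕ} (hx : x ∈ fillerList a s J) :
    x.2 = x.1 * 2 ^ s ∧ 2 ^ a ≤ x.1 ∧ x.2 ≤ 2 ^ (a + J * s) := by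
  obtain ⟨j, hj, rfl⟩ := List.mem_map.mp hx
  refine ⟨rfl, Nat.pow_le_pow_right (by norm_num) (by omega), ?_⟩
  dsimp only
  rw [← pow_add]
  refine Nat.pow_le_pow_right (by norm_num) ?_
  have h1 : (j + 1) * s ≤ J * s := Nat.mul_le_mul_right _ (List.mem_range.mp hj)
  linarith

theorem disjointRanges_fillerList (a s J : ℕ) : DisjointRanges (fillerList a s J) := by
  refine List.pairwise_map.mpr (List.Pairwise.imp (fun {j j'} h => ?_) List.pairwise_lt_range)
  refine disjoint_primeRange_of_le ?_
  dsimp only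
  rw [← pow_add]
  refine Nat.pow_le_pow_right (by norm_num) ?_
  have h1 : (j + 1) * s ≤ j' * s := Nat.mul_le_mul_right _ h
  linarith

theorem two_pow_le_primeMass_fillerList {a k J : ℕ} (ha : 3 ≤ a) :
    (2 : ℝ) ^ (k * J) ≤ primeMass (fillerList a (2 ^ (k + 4)) J) := by
  have h := pow_length_le_primeMass (l := fillerList a (2 ^ (k + 4)) J) (c := 2 ^ k)
    (by positivity) fun x hx => ?_
  · rwa [length_fillerList, ← pow_mul] at h
  · obtain ⟨h1, h2, -⟩ := mem_fillerList hx
    have h3 : 8 ≤ x.1 := by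
      have : 2 ^ 3 ≤ 2 ^ a := Nat.pow_le_pow_right (by norm_num) ha
      omega
    have h4 := le_sum_inv_primeRange h3 (2 ^ (k + 4))
    rw [← h1, pow_add] at h4
    push_cast at h4
    linarith

theorem onePrimeMass_fillerList_le (a k J : ℕ) :
    onePrimeMass (fillerList a (2 ^ (k + 4)) J) ≤ 2 ^ ((k + 7) * J) := by
  have h := onePrimeMass_le_pow_length (l := fillerList a (2 ^ (k + 4)) J) (c := 2 ^ (k + 7))
    fun x hx => ?_
  · rwa [length_fillerList, ← pow_mul] at h
  · obtain ⟨h1, h2, -⟩ := mem_fillerList hx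
    have h3 : 1 ≤ x.1 := (Nat.one_le_two_pow).trans h2
    have h4 := sum_inv_primeRange_le h3 (2 ^ (k + 4))
    have h5 : (1 : ℝ) ≤ 2 ^ k := one_le_pow₀ (by norm_num)
    rw [← h1, pow_add] at h4
    rw [pow_add]
    push_cast at h4
    linarith

theorem le_of_mem_pairList {A t : ℕ} {x : ℕ × ℕ} (hx : x ∈ pairList A t) :
    A ≤ x.1 ∧ x.2 = x.1 + 1 ∧ x.2 ≤ A + 2 * t + 2 ^ t := by
  obtain ⟨h1, i, h2, h3⟩ := mem_pairList hx
  have h4 : 2 ^ (i + 1) ≤ 2 ^ t := Nat.pow_le_pow_right (by norm_num) h2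
  generalize 2 ^ (i + 1) = P at h3 h4
  omega

theorem le_primeMass_pairList {A t B : ℕ} (hA : 8 ≤ A) (hB : ∀ x ∈ pairList A t, x.2 ≤ 2 ^ B) :
    (1 / 2 : ℝ) ^ ((B + 3) * (2 * t)) ≤ primeMass (pairList A t) := by
  have h := pow_length_le_primeMass (l := pairList A t) (c := (1 / 2) ^ (B + 3))
    (by positivity) fun x hx => ?_
  · rwa [length_pairList, ← pow_mul] at h
  · obtain ⟨h3, h1, -⟩ := le_of_mem_pairList hx
    refine le_trans ?_ (inv_le_sum_inv_primeRange (by omega) (by omega))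
    rw [one_div_pow]
    refine one_div_le_one_div_of_le ?_ ?_
    · have : 0 < x.2 := by omega
      positivity
    · have h4 : (x.2 : ℝ) ≤ 2 ^ B := by exact_mod_cast hB x hx
      rw [pow_add]
      linarith

theorem onePrimeMass_pairList_le {A t : ℕ} (hA : 0 < A) (hAt : 16 * t ≤ A) :
    onePrimeMass (pairList A t) ≤ 2 := by
  have hA' : (0 : ℝ) < A := by exact_mod_cast hA
  have h := onePrimeMass_le_pow_length (l := pairList A t) (c := Real.exp (4 / A)) fun x hx => ?_
  · rw [length_pairList, ← Real.exp_nat_mul] at h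
    refine h.trans ?_
    rw [← Real.le_log_iff_exp_le (by norm_num)]
    have h1 := Real.log_two_gt_d9
    have h2 : ((16 * t : ℕ) : ℝ) ≤ A := by exact_mod_cast hAt
    rw [mul_div_assoc', div_le_iff₀ hA']
    push_cast at h2 ⊢
    nlinarith
  · obtain ⟨h3, h1, -⟩ := le_of_mem_pairList hx
    have h4 := sum_inv_primeRange_succ_le (k := x.1) (by omega)
    have h5 : (4 : ℝ) / x.1 ≤ 4 / A := by gcongr
    have h6 := Real.add_one_le_exp (4 / (A : ℝ))
    rw [h1]
    linarith

theorem two_pow_mul_le_of_two_pow_lt {t b ℓ : ℕ} (hb : 20 ≤ b) (ht1 : 32 * b ≤ t)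
    (ht2 : t < 32 * (b + 1)) (hA : 2 ^ t < 2 * (16 * ℓ) ^ 2) :
    24 * t ^ 2 + 12 * t * 2 ^ ((t + 10) / 6 + 4) ≤ ℓ := by
  have ht : t ≤ 2 ^ (b + 5) := by
    have h1 : b + 1 ≤ 2 ^ b := Nat.lt_two_pow_self
    rw [pow_add]
    omega
  have h1 : 2 ^ (7 * b + 21) < ℓ := by
    refine lt_of_pow_lt_pow_left₀ 2 (Nat.zero_le ℓ) ?_
    have h2 : 512 * (2 ^ (7 * b + 21)) ^ 2 ≤ 2 ^ t := by
      calc 512 * (2 ^ (7 * b + 21)) ^ 2 = 2 ^ 9 * 2 ^ ((7 * b + 21) * 2) := by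
            rw [← pow_mul, show 512 = 2 ^ 9 by norm_num]
        _ = 2 ^ (9 + (7 * b + 21) * 2) := (pow_add _ _ _).symm
        _ ≤ 2 ^ t := Nat.pow_le_pow_right (by norm_num) (by omega)
    rw [mul_pow] at hA
    omega
  have h2 : 24 * t ^ 2 ≤ 2 ^ (7 * b + 20) := by
    calc 24 * t ^ 2 ≤ 2 ^ 5 * (2 ^ (b + 5)) ^ 2 :=
          Nat.mul_le_mul (by norm_num) (Nat.pow_le_pow_left ht 2)
      _ = 2 ^ (5 + (b + 5) * 2) := by rw [← pow_mul, ← pow_add]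
      _ ≤ _ := Nat.pow_le_pow_right (by norm_num) (by omega)
  have h3 : 12 * t * 2 ^ ((t + 10) / 6 + 4) ≤ 2 ^ (7 * b + 20) := by
    calc 12 * t * 2 ^ ((t + 10) / 6 + 4) ≤ 2 ^ 4 * 2 ^ (b + 5) * 2 ^ ((t + 10) / 6 + 4) :=
          Nat.mul_le_mul_right _ (Nat.mul_le_mul (by norm_num) ht)
      _ = 2 ^ (4 + (b + 5) + ((t + 10) / 6 + 4)) := by rw [← pow_add, ← pow_add]
      _ ≤ _ := Nat.pow_le_pow_right (by norm_num) (by omega)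
  rw [pow_succ] at h1
  omega

theorem mul_two_pow_le_of_two_pow_lt {t b q A : ℕ} (hb : 20 ≤ b) (hq : q ≤ b) (ht1 : 32 * b ≤ t)
    (ht2 : t < 32 * (b + 1)) (hA : 2 ^ t < 2 * A ^ 2) : 16 * t * 2 ^ q ≤ A := by
  have ht : t ≤ 2 ^ (b + 5) := by
    have h1 : b + 1 ≤ 2 ^ b := Nat.lt_two_pow_self
    rw [pow_add]
    omega
  have h1 : 2 ^ (2 * b + 9) < A := by
    refine lt_of_pow_lt_pow_left₀ 2 (Nat.zero_le A) ?_
    have h2 : 2 * (2 ^ (2 * b + 9)) ^ 2 ≤ 2 ^ t := by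
      rw [← pow_mul, ← pow_succ']
      exact Nat.pow_le_pow_right (by norm_num) (by omega)
    omega
  calc 16 * t * 2 ^ q ≤ 2 ^ 4 * 2 ^ (b + 5) * 2 ^ b :=
        Nat.mul_le_mul (Nat.mul_le_mul (by norm_num) ht) (Nat.pow_le_pow_right (by norm_num) hq)
    _ = 2 ^ (2 * b + 9) := by
        rw [← pow_add, ← pow_add]
        congr 1
        ring
    _ ≤ A := h1.le

/-- The list of intervals used to build the divisors of `p + 9`. -/
def intervalList (A t : ℕ) : List (ℕ × ℕ) :=
  fillerList (24 * t ^ 2) (2 ^ ((t + 10) / 6 + 4)) (12 * t) ++ pairList A t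

theorem length_intervalList (A t : ℕ) : (intervalList A t).length = 14 * t := by
  rw [intervalList, List.length_append, length_fillerList, length_pairList]
  ring

theorem add_one_le_mul_sq {t : ℕ} (ht : 640 ≤ t) : t + 1 ≤ 24 * t ^ 2 := by
  rw [sq]
  nlinarith

theorem add_le_two_pow_of_sq_le {A t : ℕ} (hA : A ^ 2 ≤ 2 ^ t) (hAt : 16 * t ≤ A)
    (ht : 640 ≤ t) : A + 2 * t + 2 ^ t ≤ 2 ^ (t + 1) := by
  have h1 : 2 * A ≤ A ^ 2 := by
    rw [sq]
    exact Nat.mul_le_mul_right _ (by omega)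
  rw [pow_succ]
  omega

theorem disjointRanges_intervalList {A t : ℕ} (hA : A ^ 2 ≤ 2 ^ t) (hAt : 16 * t ≤ A)
    (ht : 640 ≤ t) : DisjointRanges (intervalList A t) := by
  refine List.pairwise_append.mpr
    ⟨disjointRanges_fillerList _ _ _, disjointRanges_pairList A t, fun x hx y hy => ?_⟩
  refine (disjoint_primeRange_of_le ?_).symm
  exact (((le_of_mem_pairList hy).2.2.trans (add_le_two_pow_of_sq_le hA hAt ht)).trans
    (Nat.pow_le_pow_right (by norm_num) (add_one_le_mul_sq ht))).trans
    (mem_fillerList hx).2.1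

theorem bounds_of_mem_intervalList {A t ℓ : ℕ} (hA : A ^ 2 ≤ 2 ^ t) (hAt : 16 * t ≤ A)
    (ht : 640 ≤ t) (hℓ : 24 * t ^ 2 + 12 * t * 2 ^ ((t + 10) / 6 + 4) ≤ ℓ) {x : ℕ × ℕ}
    (hx : x ∈ intervalList A t) : A ≤ x.1 ∧ x.1 < x.2 ∧ x.2 ≤ 2 ^ ℓ := by
  have h1 := add_le_two_pow_of_sq_le hA hAt ht
  have h2 := add_one_le_mul_sq ht
  have h3 : 2 ^ (t + 1) ≤ 2 ^ (24 * t ^ 2) := Nat.pow_le_pow_right (by norm_num) h2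
  rcases List.mem_append.mp hx with hx | hx
  · obtain ⟨h4, h5, h6⟩ := mem_fillerList hx
    have h7 : 2 ^ 1 ≤ 2 ^ (2 ^ ((t + 10) / 6 + 4)) :=
      Nat.pow_le_pow_right (by norm_num) Nat.one_le_two_pow
    refine ⟨by omega, ?_, h6.trans (Nat.pow_le_pow_right (by norm_num) hℓ)⟩
    rw [h4]
    exact lt_mul_of_one_lt_right (by omega) (by omega)
  · obtain ⟨h4, h5, h6⟩ := le_of_mem_pairList hx
    have h7 : 2 ^ (24 * t ^ 2) ≤ 2 ^ ℓ := Nat.pow_le_pow_right (by norm_num) (by omega)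
    omega

theorem one_le_primeMass_intervalList {A t : ℕ} (hA : A ^ 2 ≤ 2 ^ t) (hAt : 16 * t ≤ A)
    (ht : 640 ≤ t) : 1 ≤ primeMass (intervalList A t) := by
  rw [intervalList, primeMass_append]
  have h1 := two_pow_le_primeMass_fillerList (a := 24 * t ^ 2) (k := (t + 10) / 6) (J := 12 * t)
    (by have := add_one_le_mul_sq ht; omega)
  have h2 := le_primeMass_pairList (A := A) (t := t) (B := t + 1) (by omega) fun x hx =>
    (le_of_mem_pairList hx).2.2.trans (add_le_two_pow_of_sq_le hA hAt ht)
  refine le_trans ?_ (mul_le_mul h1 h2 (by positivity) (le_trans (by positivity) h1))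
  rw [one_div_pow, mul_one_div, one_le_div (by positivity)]
  refine pow_le_pow_right₀ (by norm_num) ?_
  have h3 : t + 1 + 3 ≤ (t + 10) / 6 * 6 := by omega
  calc (t + 1 + 3) * (2 * t) ≤ (t + 10) / 6 * 6 * (2 * t) := Nat.mul_le_mul_right _ h3
    _ = (t + 10) / 6 * (12 * t) := by ring

theorem sum_gcd_div_intervalList_le {A t : ℕ} (hA : A ^ 2 ≤ 2 ^ t) (hAt : 16 * t ≤ A)
    (ht : 640 ≤ t) {u : ℕ} (hu : u ∈ primeProducts (intervalList A t)) (Y : ℝ) :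
    ∑ u' ∈ primeProducts (intervalList A t), (if Y ≤ u' ∧ u' < 4 * Y then
      (Nat.gcd u u' : ℝ) / u' else 0) ≤ 3 := by
  have h1 := sum_gcd_div_window_le (disjointRanges_intervalList hA hAt ht)
    (a := 2 ^ (24 * t ^ 2)) Nat.one_le_two_pow (fun x hx => (mem_fillerList hx).2.1) hu Y
  rw [onePrimeMass_append, length_fillerList] at h1
  have h2 := onePrimeMass_pairList_le (A := A) (t := t) (by omega) hAt
  have h3 := onePrimeMass_fillerList_le (24 * t ^ 2) ((t + 10) / 6) (12 * t)
  have h4 : 0 ≤ onePrimeMass (pairList A t) := zero_le_one.trans (one_le_onePrimeMass _)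
  have h5 := mul_le_mul h3 h2 h4 (by positivity)
  have h6 : 192 * t * 2 ^ (((t + 10) / 6 + 7) * (12 * t)) ≤ 2 ^ (24 * t ^ 2) := by
    have e1 : (t + 10) / 6 * 6 ≤ t + 10 := Nat.div_mul_le_self _ _
    have e2 : ((t + 10) / 6 + 7) * (12 * t) ≤ 2 * t ^ 2 + 104 * t := by
      calc ((t + 10) / 6 + 7) * (12 * t) = (t + 10) / 6 * 6 * (2 * t) + 84 * t := by ring
        _ ≤ (t + 10) * (2 * t) + 84 * t := Nat.add_le_add_right (Nat.mul_le_mul_right _ e1) _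
        _ = _ := by ring
    have e3 : t < 2 ^ t := Nat.lt_two_pow_self
    calc 192 * t * 2 ^ (((t + 10) / 6 + 7) * (12 * t))
        ≤ 2 ^ 8 * 2 ^ t * 2 ^ (2 * t ^ 2 + 104 * t) :=
          Nat.mul_le_mul (by omega) (Nat.pow_le_pow_right (by norm_num) e2)
      _ = 2 ^ (8 + t + (2 * t ^ 2 + 104 * t)) := by rw [← pow_add, ← pow_add]
      _ ≤ _ := Nat.pow_le_pow_right (by norm_num) (by nlinarith)
  have h7 : (192 : ℝ) * t * 2 ^ (((t + 10) / 6 + 7) * (12 * t)) ≤ 2 ^ (24 * t ^ 2) := by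
    exact_mod_cast h6
  have h8 : ((12 * t : ℕ) : ℝ) * (8 / (2 ^ (24 * t ^ 2) : ℕ) *
      (onePrimeMass (fillerList (24 * t ^ 2) (2 ^ ((t + 10) / 6 + 4)) (12 * t)) *
        onePrimeMass (pairList A t))) ≤ 1 := by
    calc _ ≤ ((12 * t : ℕ) : ℝ) * (8 / (2 ^ (24 * t ^ 2) : ℕ) *
          (2 ^ (((t + 10) / 6 + 7) * (12 * t)) * 2)) := by gcongr
      _ = 192 * t * 2 ^ (((t + 10) / 6 + 7) * (12 * t)) / 2 ^ (24 * t ^ 2) := by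
          rw [Nat.cast_mul, Nat.cast_pow, Nat.cast_ofNat, Nat.cast_ofNat]
          ring
      _ ≤ 1 := (div_le_one (by positivity)).mpr h7
  rw [intervalList] at hu ⊢
  linarith

theorem exists_isScale (L : ℕ) :
    ∃ X₁ : ℕ, ∀ X : ℕ, X₁ ≤ X → ∃ N ℓ : ℕ, IsScale X N ℓ ∧ L ≤ ℓ := by
  refine ⟨16 ^ 4 ^ (L + 8), fun X hX => ?_⟩
  have hX0 : X ≠ 0 := (lt_of_lt_of_le (by positivity) hX).ne'
  have hN : 4 ^ (L + 8) ≤ Nat.log 16 X := Nat.le_log_of_pow_le (by norm_num) hX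
  set N := Nat.log 16 X with hNdef
  have h1 : N + 1 ≤ 4 ^ Nat.clog 4 (N + 1) := Nat.le_pow_clog (by norm_num) _
  have h2 : 4 ^ (Nat.clog 4 (N + 1)).pred < N + 1 := Nat.pow_pred_clog_lt_self (by norm_num)
    (by have : 0 < 4 ^ (L + 8) := by positivity
        omega)
  set c := Nat.clog 4 (N + 1) with hc
  have h3 : L + 8 < c := (Nat.pow_lt_pow_iff_right (show 1 < 4 by norm_num)).mp (by omega)
  have h4 : 4 ^ c = 4 * 4 ^ c.pred := by
    rw [← pow_succ', ← Nat.succ_eq_add_one, Nat.succ_pred (by omega)]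
  have h5 : 100 * (c + 1) ≤ N := by
    have h6 : c.pred - 5 < 4 ^ (c.pred - 5) := Nat.lt_pow_self (by norm_num)
    have h7 : 4 ^ c.pred = 4 ^ (c.pred - 5) * 4 ^ 5 := by
      rw [← pow_add]
      congr 1
      rw [Nat.pred_eq_sub_one]
      omega
    rw [Nat.pred_eq_sub_one] at *
    omega
  refine ⟨N, c + 1, ⟨by omega, h5, ?_, ?_, Nat.pow_log_le_self 16 hX0,
    Nat.lt_pow_succ_log_self (by norm_num) X⟩, by omega⟩
  · rw [pow_succ]
    omega
  · rw [pow_succ]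
    omega

theorem exists_two_pow_near_sq {L q : ℕ} (hL : 2 ^ (32 * (q + 20)) ≤ L) :
    ∃ t b : ℕ, (16 * L) ^ 2 ≤ 2 ^ t ∧ 2 ^ t < 2 * (16 * L) ^ 2 ∧ 20 ≤ b ∧ q ≤ b ∧
      32 * b ≤ t ∧ t < 32 * (b + 1) := by
  have hL0 : 0 < L := lt_of_lt_of_le (by positivity) hL
  have h1 : (16 * L) ^ 2 ≤ 2 ^ Nat.clog 2 ((16 * L) ^ 2) := Nat.le_pow_clog (by norm_num) _
  have hA : L < (16 * L) ^ 2 := by nlinarith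
  have h2 : 2 ^ (Nat.clog 2 ((16 * L) ^ 2)).pred < (16 * L) ^ 2 :=
    Nat.pow_pred_clog_lt_self (by norm_num) (by omega)
  set t := Nat.clog 2 ((16 * L) ^ 2)
  have h3 : 32 * (q + 20) < t := (Nat.pow_lt_pow_iff_right (show 1 < 2 by norm_num)).mp (by omega)
  refine ⟨t, t / 32, h1, ?_, by omega, by omega, by omega, by omega⟩
  have h4 : 2 ^ t = 2 * 2 ^ t.pred := by
    rw [← pow_succ', ← Nat.succ_eq_add_one, Nat.succ_pred (by omega)]
  omega

theorem IsScale.le_card_primes {X N ℓ q : ℕ} (h : IsScale X N ℓ) (hq : 2 ^ 26 ≤ q)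
    (hℓ : 2 ^ (32 * (q + 20)) ≤ ℓ) :
    ∃ S : Finset ℕ, (X : ℝ) ≤ 2 * 10 ^ 9 * (N + 1) ^ 2 * S.card ∧
      ∀ p ∈ S, p ≤ X ∧ p.Prime ∧ ∃ q r : ℕ, q.Prime ∧ r.Prime ∧ p < q ∧ q < r ∧
        2 * (p : ℝ) / 3 - 2 ^ 30 * √(p : ℝ) < cycHeight (p * q * r) := by
  obtain ⟨t, b, hA1, hA2, hb, hqb, ht1, ht2⟩ := exists_two_pow_near_sq hℓ
  have hpow := h.le_pow
  have hexp := two_pow_mul_le_of_two_pow_lt hb ht1 ht2 hA2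
  have hAq := mul_two_pow_le_of_two_pow_lt hb hqb ht1 ht2 hA2
  have ht : 640 ≤ t := by omega
  have hq1 : 1 ≤ 2 ^ q := Nat.one_le_two_pow
  have hAt : 16 * t ≤ 16 * ℓ := (Nat.le_mul_of_pos_right _ hq1).trans hAq
  have hsum := sum_range_add_two_mul_le (A := 16 * ℓ) (t := t)
  obtain ⟨z, hz⟩ : ∃ z, z + 4 = 16 * ℓ + ∑ i ∈ Finset.range t, (16 * ℓ + 2 * i) + t :=
    ⟨16 * ℓ + ∑ i ∈ Finset.range t, (16 * ℓ + 2 * i) + t - 4, by omega⟩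
  have hℓt : 24 * t ^ 2 ≤ ℓ := by omega
  have htt : 640 * t ≤ t ^ 2 := by
    rw [sq]
    exact Nat.mul_le_mul_right _ ht
  have hzA : z ≤ 4 * (t * (16 * ℓ)) := by nlinarith
  have hzq : z * 2 ^ q ≤ 2 ^ (t + 1) := by
    calc z * 2 ^ q ≤ 4 * (t * (16 * ℓ)) * 2 ^ q := Nat.mul_le_mul_right _ hzA
      _ ≤ 16 * t * 2 ^ q * (16 * ℓ) := by nlinarith
      _ ≤ 16 * ℓ * (16 * ℓ) := Nat.mul_le_mul_right _ hAq
      _ = (16 * ℓ) ^ 2 := (sq _).symm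
      _ ≤ 2 ^ (t + 1) := hA1.trans (Nat.pow_le_pow_right (by norm_num) (by omega))
  have hz' : z ≤ 2 ^ (t + 1) := (Nat.le_mul_of_pos_right _ hq1).trans hzq
  have hw : 2 * (z + 2 ^ (t + 1)) ≤ N / 8 := by
    have h1 : 2 ^ (t + 1) * 2 ^ 10 ≤ 4 ^ ℓ := by
      rw [← pow_add, show 4 = 2 ^ 2 by norm_num, ← pow_mul]
      exact Nat.pow_le_pow_right (by norm_num) (by omega)
    omega
  have hbounds : ∀ x ∈ intervalList (16 * ℓ) t, 16 * ℓ ≤ x.1 ∧ x.1 < x.2 ∧ x.2 ≤ 2 ^ ℓ :=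
    fun x hx => bounds_of_mem_intervalList hA1 hAt ht hexp hx
  have h2ℓ : ℓ < 2 ^ ℓ := Nat.lt_two_pow_self
  have h4ℓ : 4 ^ ℓ = 2 ^ ℓ * 2 ^ ℓ := by
    rw [← mul_pow, show 2 * 2 = 4 by norm_num]
  have hs : ((intervalList (16 * ℓ) t).map Prod.snd).sum ≤ N / 50 := by
    have h1 := List.sum_le_card_nsmul ((intervalList (16 * ℓ) t).map Prod.snd) (2 ^ ℓ) (by
      intro n hn
      obtain ⟨x, hx, rfl⟩ := List.mem_map.mp hn
      exact (hbounds x hx).2.2)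
    rw [List.length_map, length_intervalList, smul_eq_mul] at h1
    refine h1.trans ?_
    have h2 : 15360 * t * 2 ^ ℓ ≤ 2 ^ ℓ * 2 ^ ℓ := Nat.mul_le_mul_right _ (by omega)
    have h3 : 1 ≤ t * 2 ^ ℓ := Nat.mul_pos (by omega) (by positivity)
    rw [Nat.le_div_iff_mul_le (by norm_num), mul_assoc 14 t]
    rw [mul_assoc] at h2
    omega
  have hlen : (intervalList (16 * ℓ) t).length < 4 ^ ℓ := by
    rw [length_intervalList]
    have : 2 ^ ℓ ≤ 4 ^ ℓ := Nat.pow_le_pow_left (by norm_num) ℓ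
    omega
  refine ⟨_, h.le_card_biUnion_goodPrimes (disjointRanges_intervalList hA1 hAt ht) hbounds hs hlen
    (by omega) (by omega) (hzq.trans (Nat.le_add_left _ _)) hq hw
    (fun u hu Y => sum_gcd_div_intervalList_le hA1 hAt ht hu Y)
    (one_le_primeMass_intervalList hA1 hAt ht), fun p hp => ?_⟩
  exact h.exists_cycHeight_gt hs hz le_rfl hp

theorem stmt_18 :
    ∃ c₇ c₈ : ℝ, 0 < c₇ ∧ 0 < c₈ ∧ ∃ X₀ : ℝ, ∀ X : ℝ, X₀ ≤ X →
      c₇ * X / (Real.log X) ^ 2 ≤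
        (({pp : ℕ | (pp : ℝ) ≤ X ∧ pp.Prime ∧ ∃ q r : ℕ, q.Prime ∧ r.Prime ∧
          pp < q ∧ q < r ∧
          2 * (pp : ℝ) / 3 - c₈ * Real.sqrt pp < (cycHeight (pp * q * r) : ℝ)}).ncard : ℝ) := by
  obtain ⟨q, hq⟩ : ∃ q : ℕ, 2 ^ 26 ≤ q := ⟨_, le_rfl⟩
  obtain ⟨X₁, hX₁⟩ := exists_isScale (2 ^ (32 * (q + 20)))
  refine ⟨1 / (4 * 10 ^ 9), 2 ^ 30, by positivity, by positivity, X₁ + 1, fun X hX => ?_⟩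
  have hX0 : 1 ≤ X := le_trans (by linarith [Nat.cast_nonneg (α := ℝ) X₁]) hX
  obtain ⟨N, ℓ, h, hℓ⟩ := hX₁ ⌊X⌋₊ (Nat.le_floor (by linarith))
  obtain ⟨S, hS, hSp⟩ := h.le_card_primes hq hℓ
  have hfl : (⌊X⌋₊ : ℝ) ≤ X := Nat.floor_le (by linarith)
  have hX2 : X ≤ 2 * ⌊X⌋₊ := by
    have h1 := Nat.lt_floor_add_one X
    have h2 : (1 : ℝ) ≤ ⌊X⌋₊ := by exact_mod_cast Nat.one_le_floor_iff X |>.mpr hX0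
    linarith
  have hlog : (N : ℝ) + 1 ≤ Real.log X := by
    have h1 : Real.log (16 ^ N) ≤ Real.log X := Real.log_le_log (by positivity)
      (le_trans (by exact_mod_cast h.pow_le) hfl)
    rw [Real.log_pow, show (16 : ℝ) = 2 ^ 4 by norm_num, Real.log_pow] at h1
    have h2 := Real.log_two_gt_d9
    have h3 : 1 ≤ N := by have := h.one_le; have := h.mul_le; omega
    have h4 : (1 : ℝ) ≤ N := by exact_mod_cast h3
    push_cast at h1
    nlinarith
  have hcard : (S.card : ℝ) ≤ (({pp : ℕ | (pp : ℝ) ≤ X ∧ pp.Prime ∧ ∃ q r : ℕ, q.Prime ∧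
      r.Prime ∧ pp < q ∧ q < r ∧
      2 * (pp : ℝ) / 3 - 2 ^ 30 * Real.sqrt pp < (cycHeight (pp * q * r) : ℝ)}).ncard : ℝ) := by
    rw [← Set.ncard_coe_finset]
    refine Nat.cast_le.mpr (Set.ncard_le_ncard (fun p hp => ?_) ?_)
    · obtain ⟨h1, h2⟩ := hSp p hp
      exact ⟨le_trans (by exact_mod_cast h1) hfl, h2⟩
    · exact (Set.finite_Iic ⌊X⌋₊).subset fun p hp => Nat.le_floor hp.1
  refine le_trans ?_ hcard
  have hN0 : (0 : ℝ) < N + 1 := by positivity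
  rw [div_le_iff₀ (pow_pos (hN0.trans_le hlog) 2)]
  have h1 : ((N : ℝ) + 1) ^ 2 * S.card ≤ Real.log X ^ 2 * S.card := by gcongr
  linarith
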